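/- Let M ⊂ ℝ^N be a compact 2-dimensional smooth submanifold without boundary, and let g : M → M be a diffeomorphism of class C^{1+ε} for some ε > 0 (g and g⁻¹ are C¹ and the differential x ↦ D_xg is ε-Hölder) with positive topological entropy h(g) > 0. Let Γ be a very ample family of C¹ curves on M. Then for every real number λ with 1 ≤ λ < exp(h(g)) there exist a curve γ ∈ Γ and a constant C > 0 such that length(gⁿ ∘ γ) ≥ C·λⁿ for all n ∈ ℕ. In particular, sup_{γ ∈ Γ} liminf_{n→∞} (1/n)·log length(gⁿ ∘ γ) ≥ h(g). -/

import Mathlib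

open Set
open scoped NNReal ENNReal

noncomputable section

/-- The set of vectors tangent to `M ⊆ ℝ^N` at `x`: velocities at time `0` of
differentiable curves traced on `M` through `x`. -/
def TangentAt {N : ℕ} (M : Set (EuclideanSpace ℝ (Fin N))) (x : EuclideanSpace ℝ (Fin N)) :
    Set (EuclideanSpace ℝ (Fin N)) :=
  {v | ∃ c : ℝ → EuclideanSpace ℝ (Fin N), (∀ t, c t ∈ M) ∧ c 0 = x ∧ HasDerivAt c v 0}

/-- `M ⊆ ℝ^N` is a `d`-dimensional smooth (C^∞) embedded submanifold without boundary:
every point of `M` has a smooth parametrization by an open set of `ℝ^d`, with everywhere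
injective differential, which is a homeomorphism onto a relatively open neighborhood in `M`. -/
def IsSmoothSubmanifold {N : ℕ} (d : ℕ) (M : Set (EuclideanSpace ℝ (Fin N))) : Prop :=
  ∀ x ∈ M, ∃ (U : Set (EuclideanSpace ℝ (Fin d))) (V : Set (EuclideanSpace ℝ (Fin N)))
    (φ : EuclideanSpace ℝ (Fin d) → EuclideanSpace ℝ (Fin N))
    (ψ : EuclideanSpace ℝ (Fin N) → EuclideanSpace ℝ (Fin d)),
      IsOpen U ∧ IsOpen V ∧ x ∈ V ∧ ContDiffOn ℝ (⊤ : ℕ∞) φ U ∧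
      (∀ u ∈ U, Function.Injective (fderivWithin ℝ φ U u)) ∧
      Set.BijOn φ U (M ∩ V) ∧ ContinuousOn ψ (M ∩ V) ∧ ∀ u ∈ U, ψ (φ u) = u

/-- A family `Γ` of `C¹` curves on the surface `M` is *very ample* if for every point `P ∈ M`
and every direction `𝒟 ⊆ T_P M` (spanned by a nonzero tangent vector `v`), some curve of `Γ`
passes through `P` regularly with tangent direction `𝒟`. -/
def IsVeryAmpleFamily {N : ℕ} (M : Set (EuclideanSpace ℝ (Fin N)))
    (Γ : Set (ℝ → EuclideanSpace ℝ (Fin N))) : Prop :=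
  (∀ γ ∈ Γ, (∀ t ∈ Icc (0 : ℝ) 1, γ t ∈ M) ∧ ContDiffOn ℝ 1 γ (Icc (0 : ℝ) 1)) ∧
  ∀ P ∈ M, ∀ v ∈ TangentAt M P, v ≠ 0 →
    ∃ γ ∈ Γ, ∃ t₀ ∈ Icc (0 : ℝ) 1, γ t₀ = P ∧
      derivWithin γ (Icc (0 : ℝ) 1) t₀ ≠ 0 ∧
      ∃ c : ℝ, derivWithin γ (Icc (0 : ℝ) 1) t₀ = c • v

/-- A normalized box: a set with an unstable coordinate `V`, of absolute value at most one on the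
set, and a stable coordinate `U`. -/
structure Tube (E : Type*) [TopologicalSpace E] where
  /-- the underlying set -/
  D : Set E
  /-- the stable coordinate -/
  U : E → ℝ
  /-- the unstable coordinate -/
  V : E → ℝ
  cont : Continuous V
  le_one : ∀ y ∈ D, |V y| ≤ 1

/-- The box with the unstable coordinate reversed. -/
def Tube.flip {E : Type*} [TopologicalSpace E] (τ : Tube E) : Tube E where
  D := τ.D
  U := τ.U
  V := fun y => -τ.V y
  cont := τ.cont.neg
  le_one := fun y hy => by rw [abs_neg]; exact τ.le_one y hy

/-- The map `f` sends the box `τ` across the box `τ'`, expanding the unstable cone by `c > 1`. -/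
structure Link {E : Type*} [TopologicalSpace E] (f : E → E) (c : ℝ) (τ τ' : Tube E) : Prop where
  mem : ∀ y ∈ τ.D, |τ'.V (f y)| ≤ 1 → f y ∈ τ'.D
  right : ∀ y ∈ τ.D, τ.V y = 1 → 1 ≤ τ'.V (f y)
  left : ∀ y ∈ τ.D, τ.V y = -1 → τ'.V (f y) ≤ -1
  cone : ∀ y ∈ τ.D, ∀ z ∈ τ.D, |τ.U y - τ.U z| ≤ τ.V y - τ.V z →
    |τ'.U (f y) - τ'.U (f z)| ≤ τ'.V (f y) - τ'.V (f z) ∧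
      c * (τ.V y - τ.V z) ≤ τ'.V (f y) - τ'.V (f z)

theorem Link.flip {E : Type*} [TopologicalSpace E] {f : E → E} {c : ℝ} {τ τ' : Tube E}
    (h : Link f c τ τ') : Link f c τ.flip τ'.flip where
  mem y hy h1 := h.mem y hy (by simpa [Tube.flip] using h1)
  right y hy h1 := by
    have := h.left y hy (by simp only [Tube.flip] at h1; linarith)
    simp only [Tube.flip]; linarith
  left y hy h1 := by
    have := h.right y hy (by simp only [Tube.flip] at h1; linarith)
    simp only [Tube.flip]; linarith
  cone y hy z hz h1 := by
    simp only [Tube.flip] at h1 ⊢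
    have := h.cone z hz y hy (by rw [abs_sub_comm]; linarith)
    rw [abs_sub_comm]
    exact ⟨by linarith [this.1], by linarith [this.2]⟩

/-- The arc `c` on `[p,q]` crosses the box from the left side to the right side. -/
structure Spans {E : Type*} [TopologicalSpace E] (τ : Tube E) (c : ℝ → E) (p q : ℝ) : Prop where
  le : p ≤ q
  cont : ContinuousOn c (Icc p q)
  mem : ∀ t ∈ Icc p q, c t ∈ τ.D
  left : τ.V (c p) = -1
  right : τ.V (c q) = 1

theorem exists_subinterval_crossing {φ : ℝ → ℝ} {p q : ℝ} (hpq : p ≤ q)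
    (hφ : ContinuousOn φ (Icc p q)) (hp : φ p ≤ -1) (hq : 1 ≤ φ q) :
    ∃ p' q', p ≤ p' ∧ p' ≤ q' ∧ q' ≤ q ∧ φ p' = -1 ∧ φ q' = 1 ∧
      ∀ t ∈ Icc p' q', |φ t| ≤ 1 := by
  obtain ⟨a, ha, hamax⟩ : ∃ a ∈ Icc p q ∩ φ ⁻¹' Iic (-1), ∀ x ∈ Icc p q ∩ φ ⁻¹' Iic (-1), x ≤ a := by
    have hcl : IsCompact (Icc p q ∩ φ ⁻¹' Iic (-1)) :=
      isCompact_Icc.of_isClosed_subset (hφ.preimage_isClosed_of_isClosed isClosed_Icc isClosed_Iic)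
        inter_subset_left
    exact hcl.exists_isGreatest ⟨p, ⟨le_rfl, hpq⟩, hp⟩
  have hφ2 : ContinuousOn φ (Icc a q) := hφ.mono (Icc_subset_Icc ha.1.1 le_rfl)
  obtain ⟨b, hb, hbmin⟩ : ∃ b ∈ Icc a q ∩ φ ⁻¹' Ici 1, ∀ x ∈ Icc a q ∩ φ ⁻¹' Ici 1, b ≤ x := by
    have hcl : IsCompact (Icc a q ∩ φ ⁻¹' Ici 1) :=
      isCompact_Icc.of_isClosed_subset (hφ2.preimage_isClosed_of_isClosed isClosed_Icc isClosed_Ici)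
        inter_subset_left
    exact hcl.exists_isLeast ⟨q, ⟨ha.1.2, le_rfl⟩, hq⟩
  have hfa : φ a ≤ -1 := ha.2
  have hfb : 1 ≤ φ b := hb.2
  have hlow : ∀ t ∈ Icc a b, -1 ≤ φ t := by
    intro t ht
    by_contra! hlt
    have htq : t ≤ q := ht.2.trans hb.1.2
    obtain ⟨s, hs, hs1⟩ := intermediate_value_Icc htq
      (hφ2.mono (Icc_subset_Icc ht.1 le_rfl)) (show (-1 : ℝ) ∈ Icc (φ t) (φ q) from ⟨hlt.le, by linarith⟩)
    have : s ≤ a := hamax s ⟨⟨ha.1.1.trans (ht.1.trans hs.1), hs.2⟩, hs1.le⟩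
    have : s = t := le_antisymm (this.trans ht.1) hs.1
    subst this; linarith
  have hup : ∀ t ∈ Icc a b, φ t ≤ 1 := by
    intro t ht
    by_contra! hlt
    obtain ⟨s, hs, hs1⟩ := intermediate_value_Icc ht.1
      (hφ2.mono (Icc_subset_Icc le_rfl (ht.2.trans hb.1.2)))
      (show (1 : ℝ) ∈ Icc (φ a) (φ t) from ⟨by linarith, hlt.le⟩)
    have : b ≤ s := hbmin s ⟨⟨hs.1, hs.2.trans (ht.2.trans hb.1.2)⟩, hs1.ge⟩
    have : s = t := le_antisymm hs.2 (ht.2.trans this)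
    subst this; linarith
  refine ⟨a, b, ha.1.1, hb.1.1, hb.1.2, le_antisymm hfa (hlow a ⟨le_rfl, hb.1.1⟩),
    le_antisymm (hup b ⟨hb.1.1, le_rfl⟩) hfb, fun t ht => abs_le.2 ⟨hlow t ht, hup t ht⟩⟩

section chains
variable {E : Type*} [TopologicalSpace E] {f : E → E} {c : ℝ}

theorem Spans.link {τ τ' : Tube E} (hf : Continuous f) (hl : Link f c τ τ') {γ : ℝ → E} {p q : ℝ}
    (h : Spans τ γ p q) : ∃ p' q', p ≤ p' ∧ q' ≤ q ∧ Spans τ' (fun t => f (γ t)) p' q' := by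
  have hc : ContinuousOn (fun t => f (γ t)) (Icc p q) := hf.comp_continuousOn h.cont
  obtain ⟨p', q', h1, h2, h3, h4, h5, h6⟩ := exists_subinterval_crossing h.le
    (τ'.cont.comp_continuousOn hc) (hl.left _ (h.mem p ⟨le_rfl, h.le⟩) h.left)
    (hl.right _ (h.mem q ⟨h.le, le_rfl⟩) h.right)
  have hsub : Icc p' q' ⊆ Icc p q := Icc_subset_Icc h1 h3
  exact ⟨p', q', h1, h3, h2, hc.mono hsub, fun t ht => hl.mem _ (h.mem t (hsub ht)) (h6 t ht), h4, h5⟩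

theorem Spans.chain {τ : ℕ → Tube E} {l : ℕ} (hf : Continuous f)
    (hl : ∀ i < l, Link f c (τ i) (τ (i + 1))) {γ : ℝ → E} {p q : ℝ} (h : Spans (τ 0) γ p q) :
    ∃ p' q', p ≤ p' ∧ q' ≤ q ∧ Spans (τ l) (fun t => f^[l] (γ t)) p' q' ∧
      ∀ t ∈ Icc p' q', ∀ k ≤ l, f^[k] (γ t) ∈ (τ k).D := by
  induction l with
  | zero => exact ⟨p, q, le_rfl, le_rfl, h, fun t ht k hk => by
      obtain rfl : k = 0 := by omega
      exact h.mem t ht⟩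
  | succ l ih =>
    obtain ⟨p1, q1, h1, h2, h3, h4⟩ := ih fun i hi => hl i (by omega)
    obtain ⟨p2, q2, h5, h6, h7⟩ := h3.link hf (hl l (by omega))
    refine ⟨p2, q2, h1.trans h5, h6.trans h2, ?_, ?_⟩
    · simpa only [Function.iterate_succ_apply'] using h7
    · intro t ht k hk
      rcases Nat.lt_or_ge k (l + 1) with hk' | hk'
      · exact h4 t (Icc_subset_Icc h5 h6 ht) k (by omega)
      · obtain rfl : k = l + 1 := by omega
        rw [Function.iterate_succ_apply']
        exact h7.mem t ht

end chains

theorem sum_eVariationOn_le_of_pairwiseDisjoint {F ι : Type*} [PseudoEMetricSpace F] (γ : ℝ → F)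
    (S : Finset ι) (p q : ι → ℝ) (a b : ℝ) (hle : ∀ j ∈ S, p j ≤ q j) (ha : ∀ j ∈ S, a ≤ p j)
    (hb : ∀ j ∈ S, q j ≤ b)
    (hd : ∀ i ∈ S, ∀ j ∈ S, i ≠ j → Disjoint (Icc (p i) (q i)) (Icc (p j) (q j))) :
    ∑ j ∈ S, eVariationOn γ (Icc (p j) (q j)) ≤ eVariationOn γ (Icc a b) := by
  classical
  induction S using Finset.strongInduction generalizing b with
  | H S ih =>
    rcases S.eq_empty_or_nonempty with rfl | hS
    · simp
    obtain ⟨m, hm, hmax⟩ := S.exists_max_image q hS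
    rw [← Finset.add_sum_erase S _ hm, add_comm]
    have hlt : ∀ j ∈ S.erase m, q j ≤ p m := by
      intro j hj
      have hj' := Finset.mem_erase.1 hj
      by_contra! hcon
      have h1 : max (p j) (p m) ∈ Icc (p j) (q j) :=
        ⟨le_max_left _ _, max_le (hle j hj'.2) hcon.le⟩
      exact Set.disjoint_left.1 (hd j hj'.2 m hm hj'.1) h1
        ⟨le_max_right _ _, max_le ((hle j hj'.2).trans (hmax j hj'.2)) (hle m hm)⟩
    have h1 := ih (S.erase m) (Finset.erase_ssubset hm) (p m)
      (fun j hj => hle j (Finset.mem_of_mem_erase hj)) (fun j hj => ha j (Finset.mem_of_mem_erase hj))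
      hlt (fun i hi j hj => hd i (Finset.mem_of_mem_erase hi) j (Finset.mem_of_mem_erase hj))
    calc _ ≤ eVariationOn γ (Icc a (p m)) + eVariationOn γ (Icc (p m) (q m)) := by gcongr
      _ ≤ eVariationOn γ (Icc a (p m) ∪ Icc (p m) (q m)) :=
          eVariationOn.add_le_union γ fun x hx y hy => hx.2.trans hy.1
      _ ≤ _ := eVariationOn.mono γ (union_subset
          (Icc_subset_Icc le_rfl ((hle m hm).trans (hb m hm))) (Icc_subset_Icc (ha m hm) (hb m hm)))

/-- A finite family of chains of boxes of length `l`, starting and ending with the same box,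
such that no orbit follows two of them. -/
structure Horseshoe {E : Type*} [TopologicalSpace E] (f : E → E) (c : ℝ) (base : Tube E) (l : ℕ)
    {ι : Type*} (J : Finset ι) (τ : ι → ℕ → Tube E) : Prop where
  cont : Continuous f
  one_lt : 1 < c
  pos : 0 < l
  start : ∀ j ∈ J, τ j 0 = base
  finish : ∀ j ∈ J, τ j l = base
  link : ∀ j ∈ J, ∀ i < l, Link f c (τ j i) (τ j (i + 1))
  excl : ∀ i ∈ J, ∀ j ∈ J, ∀ y, (∀ k ≤ l, f^[k] y ∈ (τ i k).D) → (∀ k ≤ l, f^[k] y ∈ (τ j k).D) →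
    i = j

theorem Horseshoe.flip {E : Type*} [TopologicalSpace E] {f : E → E} {c : ℝ} {base : Tube E} {l : ℕ}
    {ι : Type*} {J : Finset ι} {τ : ι → ℕ → Tube E} (h : Horseshoe f c base l J τ) :
    Horseshoe f c base.flip l J (fun j i => (τ j i).flip) where
  cont := h.cont
  one_lt := h.one_lt
  pos := h.pos
  start j hj := by rw [h.start j hj]
  finish j hj := by rw [h.finish j hj]
  link j hj i hi := (h.link j hj i hi).flip
  excl := h.excl

section horseshoe
variable {E : Type*} [PseudoEMetricSpace E] {f : E → E} {c : ℝ} {base : Tube E} {l : ℕ}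
    {ι : Type*} {J : Finset ι} {τ : ι → ℕ → Tube E}

theorem Horseshoe.strip (h : Horseshoe f c base l J τ) {γ : ℝ → E} {p q : ℝ}
    (hs : Spans base γ p q) (j : ι) (hj : j ∈ J) :
    ∃ p' q', p ≤ p' ∧ q' ≤ q ∧ Spans base (fun t => f^[l] (γ t)) p' q' ∧
      ∀ t ∈ Icc p' q', ∀ k ≤ l, f^[k] (γ t) ∈ (τ j k).D := by
  have := Spans.chain h.cont (h.link j hj) (γ := γ) (p := p) (q := q) (by rw [h.start j hj]; exact hs)
  rwa [h.finish j hj] at this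

theorem Horseshoe.le_eVariationOn (h : Horseshoe f c base l J τ) {d : ℝ≥0∞}
    (hd : ∀ y z, base.V y = -1 → base.V z = 1 → d ≤ edist y z) (k : ℕ) {γ : ℝ → E} {p q : ℝ}
    (hs : Spans base γ p q) :
    (J.card : ℝ≥0∞) ^ k * d ≤ eVariationOn (fun t => f^[k * l] (γ t)) (Icc p q) := by
  induction k generalizing γ p q with
  | zero =>
    simp only [pow_zero, one_mul, zero_mul, Function.iterate_zero, id]
    exact (hd _ _ hs.left hs.right).trans
      (eVariationOn.edist_le γ (left_mem_Icc.2 hs.le) (right_mem_Icc.2 hs.le))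
  | succ k ih =>
    choose! P Q h1 h2 h3 h4 using fun j hj => h.strip hs j hj
    calc (J.card : ℝ≥0∞) ^ (k + 1) * d = ∑ j ∈ J, (J.card : ℝ≥0∞) ^ k * d := by
          rw [Finset.sum_const, nsmul_eq_mul]; ring
      _ ≤ ∑ j ∈ J, eVariationOn (fun t => f^[(k + 1) * l] (γ t)) (Icc (P j) (Q j)) := by
          refine Finset.sum_le_sum fun j hj => ?_
          have := ih (h3 j hj)
          simpa only [add_mul, one_mul, Function.iterate_add_apply] using this
      _ ≤ _ := by
          refine sum_eVariationOn_le_of_pairwiseDisjoint _ J P Q p q (fun j hj => (h3 j hj).le) h1 h2 ?_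
          intro i hi j hj hij
          refine Set.disjoint_left.2 fun t ht ht' => hij ?_
          exact h.excl i hi j hj (γ t) (h4 i hi t ht) (h4 j hj t ht')

/-- The orbit of `y` leaves the chain `τ` through its left side. -/
def ExitsLeft {E : Type*} [TopologicalSpace E] (f : E → E) (l : ℕ) (τ : ℕ → Tube E) (y : E) : Prop :=
  ∃ i < l, (∀ k ≤ i, f^[k] y ∈ (τ k).D) ∧ (τ (i + 1)).V (f^[i + 1] y) < -1

/-- The orbit of `y` leaves the chain `τ` through its right side. -/
def ExitsRight {E : Type*} [TopologicalSpace E] (f : E → E) (l : ℕ) (τ : ℕ → Tube E) (y : E) : Prop :=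
  ∃ i < l, (∀ k ≤ i, f^[k] y ∈ (τ k).D) ∧ 1 < (τ (i + 1)).V (f^[i + 1] y)

theorem follows_or_exits {τ : ℕ → Tube E} {l : ℕ} (hl : ∀ i < l, Link f c (τ i) (τ (i + 1))) {y : E}
    (hy : y ∈ (τ 0).D) :
    (∀ k ≤ l, f^[k] y ∈ (τ k).D) ∨ ExitsLeft f l τ y ∨ ExitsRight f l τ y := by
  induction l with
  | zero => left; intro k hk; obtain rfl : k = 0 := by omega
            exact hy
  | succ l ih =>
    rcases ih fun i hi => hl i (by omega) with h | h | h
    · by_cases hV : |(τ (l + 1)).V (f^[l + 1] y)| ≤ 1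
      · left
        intro k hk
        rcases Nat.lt_or_ge k (l + 1) with hk' | hk'
        · exact h k (by omega)
        · obtain rfl : k = l + 1 := by omega
          rw [Function.iterate_succ_apply'] at hV ⊢
          exact (hl l (by omega)).mem _ (h l le_rfl) hV
      · right
        rw [not_le, lt_abs] at hV
        rcases hV with hV | hV
        · exact Or.inr ⟨l, by omega, h, hV⟩
        · exact Or.inl ⟨l, by omega, h, by linarith⟩
    · obtain ⟨i, hi, hh⟩ := h
      exact Or.inr (Or.inl ⟨i, by omega, hh⟩)
    · obtain ⟨i, hi, hh⟩ := h
      exact Or.inr (Or.inr ⟨i, by omega, hh⟩)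

theorem cone_iterate {τ : ℕ → Tube E} {l : ℕ} (hl : ∀ i < l, Link f c (τ i) (τ (i + 1))) {y z : E}
    (h : |(τ 0).U y - (τ 0).U z| ≤ (τ 0).V y - (τ 0).V z) {i : ℕ} (hi : i ≤ l)
    (hy : ∀ k < i, f^[k] y ∈ (τ k).D) (hz : ∀ k < i, f^[k] z ∈ (τ k).D) :
    |(τ i).U (f^[i] y) - (τ i).U (f^[i] z)| ≤ (τ i).V (f^[i] y) - (τ i).V (f^[i] z) := by
  induction i with
  | zero => exact h
  | succ i ih =>
    have := ih (by omega) (fun k hk => hy k (by omega)) (fun k hk => hz k (by omega))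
    simp only [Function.iterate_succ_apply']
    exact ((hl i (by omega)).cone _ (hy i (by omega)) _ (hz i (by omega)) this).1

/-- An arc crossing the box within the unstable cone. -/
structure ConeSpans {E : Type*} [TopologicalSpace E] (τ : Tube E) (c : ℝ → E) (p q : ℝ) : Prop
    extends Spans τ c p q where
  cone : ∀ s ∈ Icc p q, ∀ t ∈ Icc p q, s ≤ t → |τ.U (c t) - τ.U (c s)| ≤ τ.V (c t) - τ.V (c s)

theorem Horseshoe.exists_middle_strip (h : Horseshoe f c base l J τ) (hJ : 3 ≤ J.card)
    {γ : ℝ → E} {p q : ℝ} (hs : ConeSpans base γ p q) :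
    ∃ p' q', p < p' ∧ q' < q ∧ ConeSpans base (fun t => f^[l] (γ t)) p' q' ∧
      ∃ j ∈ J, ∃ a ∈ J, ∃ b ∈ J, ∀ t ∈ Icc p' q', (∀ k ≤ l, f^[k] (γ t) ∈ (τ j k).D) ∧
        ExitsLeft f l (τ a) (γ t) ∧ ExitsRight f l (τ b) (γ t) := by
  classical
  choose! P Q h1 h2 h3 h4 using fun j hj => h.strip hs.toSpans j hj
  have hord : ∀ i ∈ J, ∀ j ∈ J, i ≠ j → P i ≤ P j → Q i < P j := by
    intro i hi j hj hij hP
    by_contra! hcon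
    exact hij (h.excl i hi j hj (γ (P j)) (h4 i hi _ ⟨hP, hcon⟩) (h4 j hj _ ⟨le_rfl, (h3 j hj).le⟩))
  obtain ⟨b, hb, hbmin⟩ := J.exists_min_image P (Finset.card_pos.1 (by omega))
  have hcb : (J.erase b).card = J.card - 1 := Finset.card_erase_of_mem hb
  obtain ⟨a, ha, hamax⟩ := (J.erase b).exists_max_image P (Finset.card_pos.1 (by omega))
  have hca : ((J.erase b).erase a).card = (J.erase b).card - 1 := Finset.card_erase_of_mem ha
  obtain ⟨j, hj⟩ := Finset.card_pos.1 (show 0 < ((J.erase b).erase a).card by omega)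
  simp only [Finset.mem_erase] at ha hj
  have hbj : Q b < P j := hord b hb j hj.2.2 (Ne.symm hj.2.1) (hbmin j hj.2.2)
  have hja : Q j < P a := hord j hj.2.2 a ha.2 hj.1
    (hamax j (by simp only [Finset.mem_erase]; exact hj.2))
  have hjJ := hj.2.2
  have sub : ∀ i ∈ J, ∀ t ∈ Icc (P i) (Q i), t ∈ Icc p q :=
    fun i hi t ht => Icc_subset_Icc (h1 i hi) (h2 i hi) ht
  refine ⟨P j, Q j, lt_of_le_of_lt ((h1 b hb).trans (h3 b hb).le) hbj,
    lt_of_lt_of_le hja ((h3 a ha.2).le.trans (h2 a ha.2)), ⟨h3 j hjJ, ?_⟩, j, hjJ, a, ha.2, b, hb, ?_⟩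
  · intro s hs' t ht hst
    have := cone_iterate (h.link j hjJ) (y := γ t) (z := γ s)
      (by rw [h.start j hjJ]; exact hs.cone s (sub j hjJ s hs') t (sub j hjJ t ht) hst) le_rfl
      (fun k hk => h4 j hjJ t ht k hk.le) (fun k hk => h4 j hjJ s hs' k hk.le)
    rwa [h.finish j hjJ] at this
  · intro t ht
    refine ⟨h4 j hjJ t ht, ?_, ?_⟩
    · have hPa : P a ∈ Icc (P a) (Q a) := ⟨le_rfl, (h3 a ha.2).le⟩
      rcases follows_or_exits (h.link a ha.2) (y := γ t)
        (by rw [h.start a ha.2]; exact hs.mem t (sub j hjJ t ht)) with hh | hh | hh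
      · exact absurd (h.excl j hjJ a ha.2 (γ t) (h4 j hjJ t ht) hh) hj.1
      · exact hh
      · obtain ⟨i, hi, hD, hV⟩ := hh
        have h5 := h4 a ha.2 (P a) hPa
        have := cone_iterate (h.link a ha.2) (y := γ (P a)) (z := γ t) (i := i + 1)
          (by rw [h.start a ha.2]; exact hs.cone t (sub j hjJ t ht) _ (sub a ha.2 _ hPa)
                (ht.2.trans hja.le)) hi (fun k hk => h5 k (by omega)) (fun k hk => hD k (by omega))
        have h6 := (abs_nonneg _).trans this
        have h7 := (abs_le.1 ((τ a (i + 1)).le_one _ (h5 (i + 1) hi))).2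
        linarith
    · have hQb : Q b ∈ Icc (P b) (Q b) := ⟨(h3 b hb).le, le_rfl⟩
      rcases follows_or_exits (h.link b hb) (y := γ t)
        (by rw [h.start b hb]; exact hs.mem t (sub j hjJ t ht)) with hh | hh | hh
      · exact absurd (h.excl j hjJ b hb (γ t) (h4 j hjJ t ht) hh) hj.2.1
      · obtain ⟨i, hi, hD, hV⟩ := hh
        have h5 := h4 b hb (Q b) hQb
        have := cone_iterate (h.link b hb) (y := γ t) (z := γ (Q b)) (i := i + 1)
          (by rw [h.start b hb]; exact hs.cone _ (sub b hb _ hQb) t (sub j hjJ t ht)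
                (hbj.le.trans ht.1)) hi (fun k hk => hD k (by omega)) (fun k hk => h5 k (by omega))
        have h6 := (abs_nonneg _).trans this
        have h7 := (abs_le.1 ((τ b (i + 1)).le_one _ (h5 (i + 1) hi))).1
        linarith
      · exact hh

/-- A point whose orbit follows chains forever, and which at each return leaves some chain
through the left and some other chain through the right. -/
def IsMiddle (f : E → E) (l : ℕ) (J : Finset ι) (τ : ι → ℕ → Tube E) (y : E) : Prop :=
  ∀ n : ℕ, ∃ j ∈ J, ∃ a ∈ J, ∃ b ∈ J, (∀ k ≤ l, f^[k] (f^[n * l] y) ∈ (τ j k).D) ∧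
    ExitsLeft f l (τ a) (f^[n * l] y) ∧ ExitsRight f l (τ b) (f^[n * l] y)

theorem Horseshoe.exists_isMiddle (h : Horseshoe f c base l J τ) (hJ : 3 ≤ J.card)
    {γ : ℝ → E} {p q : ℝ} (hs : ConeSpans base γ p q) :
    ∃ t ∈ Ioo p q, IsMiddle f l J τ (γ t) := by
  let X := {I : ℕ × ℝ × ℝ // ConeSpans base (fun t => f^[I.1 * l] (γ t)) I.2.1 I.2.2}
  have step : ∀ I : X, ∃ I' : X, I'.1.1 = I.1.1 + 1 ∧ I.1.2.1 < I'.1.2.1 ∧ I'.1.2.2 < I.1.2.2 ∧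
      ∃ j ∈ J, ∃ a ∈ J, ∃ b ∈ J, ∀ t ∈ Icc I'.1.2.1 I'.1.2.2,
        (∀ k ≤ l, f^[k] (f^[I.1.1 * l] (γ t)) ∈ (τ j k).D) ∧
        ExitsLeft f l (τ a) (f^[I.1.1 * l] (γ t)) ∧ ExitsRight f l (τ b) (f^[I.1.1 * l] (γ t)) := by
    rintro ⟨⟨n, p, q⟩, hI⟩
    obtain ⟨p', q', h1, h2, h3, h4⟩ := h.exists_middle_strip hJ hI
    refine ⟨⟨⟨n + 1, p', q'⟩, ?_⟩, rfl, h1, h2, h4⟩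
    have : ∀ t, f^[(n + 1) * l] (γ t) = f^[l] (f^[n * l] (γ t)) := fun t => by
      rw [← Function.iterate_add_apply]; congr 1; ring
    simpa only [this] using h3
  choose F hF1 hF2 hF3 hF4 using step
  let I : ℕ → X := fun n => F^[n] ⟨⟨0, p, q⟩, by simpa using hs⟩
  have hI : ∀ n, I (n + 1) = F (I n) := fun n => Function.iterate_succ_apply' F n _
  have hI1 : ∀ n, (I n).1.1 = n := by
    intro n
    induction n with
    | zero => rfl
    | succ n ih => rw [hI, hF1, ih]
  obtain ⟨t, ht⟩ := IsCompact.nonempty_iInter_of_sequence_nonempty_isCompact_isClosed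
    (fun n => Icc (I n).1.2.1 (I n).1.2.2)
    (fun n => by rw [hI]; exact Icc_subset_Icc (hF2 _).le (hF3 _).le)
    (fun n => nonempty_Icc.2 (I n).2.le) isCompact_Icc (fun n => isClosed_Icc)
  rw [mem_iInter] at ht
  refine ⟨t, ?_, fun n => ?_⟩
  · have h1 := ht 1
    rw [hI] at h1
    exact ⟨(hF2 (I 0)).trans_le h1.1, h1.2.trans_lt (hF3 (I 0))⟩
  · obtain ⟨j, hj, a, ha, b, hb, hh⟩ := hF4 (I n)
    have := hh t (by rw [← hI]; exact ht (n + 1))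
    rw [hI1] at this
    exact ⟨j, hj, a, ha, b, hb, this⟩

/-- An arc in the box issued from `P` on the right, either reaching the right side or having
extension at least `d`. -/
structure HalfArc (τ : Tube E) (d : ℝ) (γ : ℝ → E) (p q : ℝ) : Prop where
  le : p ≤ q
  cont : ContinuousOn γ (Icc p q)
  mem : ∀ t ∈ Icc p q, γ t ∈ τ.D
  cone : ∀ t ∈ Icc p q, |τ.U (γ t) - τ.U (γ p)| ≤ τ.V (γ t) - τ.V (γ p)
  reach : τ.V (γ q) = 1 ∨ d ≤ τ.V (γ q) - τ.V (γ p)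

theorem exists_first_eq_one {φ : ℝ → ℝ} {p q : ℝ} (hpq : p ≤ q)
    (hφ : ContinuousOn φ (Icc p q)) (hp : φ p ≤ 1) (hq : 1 ≤ φ q) :
    ∃ q' ∈ Icc p q, φ q' = 1 ∧ ∀ t ∈ Icc p q', φ t ≤ 1 := by
  obtain ⟨b, hb, hbmin⟩ : ∃ b ∈ Icc p q ∩ φ ⁻¹' Ici 1, ∀ x ∈ Icc p q ∩ φ ⁻¹' Ici 1, b ≤ x := by
    have hcl : IsCompact (Icc p q ∩ φ ⁻¹' Ici 1) :=
      isCompact_Icc.of_isClosed_subset (hφ.preimage_isClosed_of_isClosed isClosed_Icc isClosed_Ici)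
        inter_subset_left
    exact hcl.exists_isLeast ⟨q, ⟨hpq, le_rfl⟩, hq⟩
  have hup : ∀ t ∈ Icc p b, φ t ≤ 1 := by
    intro t ht
    by_contra! hlt
    obtain ⟨s, hs, hs1⟩ := intermediate_value_Icc ht.1
      (hφ.mono (Icc_subset_Icc le_rfl (ht.2.trans hb.1.2)))
      (show (1 : ℝ) ∈ Icc (φ p) (φ t) from ⟨by linarith, hlt.le⟩)
    have : b ≤ s := hbmin s ⟨⟨hs.1, hs.2.trans (ht.2.trans hb.1.2)⟩, hs1.ge⟩
    have : s = t := le_antisymm hs.2 (ht.2.trans this)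
    subst this; linarith
  exact ⟨b, hb.1, le_antisymm (hup b ⟨hb.1.1, le_rfl⟩) hb.2, hup⟩

theorem HalfArc.link {τ τ' : Tube E} (hf : Continuous f) (hc : 0 ≤ c) (hl : Link f c τ τ') {d : ℝ}
    {γ : ℝ → E} {p q : ℝ} (h : HalfArc τ d γ p q) (hP : f (γ p) ∈ τ'.D) :
    ∃ q' ≤ q, HalfArc τ' (c * d) (fun t => f (γ t)) p q' := by
  have hcont : ContinuousOn (fun t => f (γ t)) (Icc p q) := hf.comp_continuousOn h.cont
  have hp : p ∈ Icc p q := ⟨le_rfl, h.le⟩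
  have hq : q ∈ Icc p q := ⟨h.le, le_rfl⟩
  have hP1 := abs_le.1 (τ'.le_one _ hP)
  have key := fun t ht => hl.cone _ (h.mem t ht) _ (h.mem p hp) (h.cone t ht)
  have hlow : ∀ t ∈ Icc p q, -1 ≤ τ'.V (f (γ t)) := fun t ht => by
    have := (abs_nonneg _).trans (key t ht).1; linarith
  by_cases h1 : 1 ≤ τ'.V (f (γ q))
  · obtain ⟨q', hq', h2, h3⟩ := exists_first_eq_one h.le (τ'.cont.comp_continuousOn hcont) hP1.2 h1
    have hsub : Icc p q' ⊆ Icc p q := Icc_subset_Icc le_rfl hq'.2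
    exact ⟨q', hq'.2, hq'.1, hcont.mono hsub, fun t ht => hl.mem _ (h.mem t (hsub ht))
      (abs_le.2 ⟨hlow t (hsub ht), h3 t ht⟩), fun t ht => (key t (hsub ht)).1, Or.inl h2⟩
  · have hd : d ≤ τ.V (γ q) - τ.V (γ p) := by
      rcases h.reach with h2 | h2
      · exact absurd (hl.right _ (h.mem q hq) h2) h1
      · exact h2
    by_cases hex : ∃ s ∈ Icc p q, 1 ≤ τ'.V (f (γ s))
    · obtain ⟨s, hs, hs1⟩ := hex
      obtain ⟨q', hq', h2, h3⟩ := exists_first_eq_one hs.1 ((τ'.cont.comp_continuousOn hcont).mono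
        (Icc_subset_Icc le_rfl hs.2)) hP1.2 hs1
      have hsub : Icc p q' ⊆ Icc p q := Icc_subset_Icc le_rfl (hq'.2.trans hs.2)
      exact ⟨q', hq'.2.trans hs.2, hq'.1, hcont.mono hsub, fun t ht => hl.mem _ (h.mem t (hsub ht))
        (abs_le.2 ⟨hlow t (hsub ht), h3 t ht⟩), fun t ht => (key t (hsub ht)).1, Or.inl h2⟩
    · push Not at hex
      refine ⟨q, le_rfl, h.le, hcont, fun t ht => hl.mem _ (h.mem t ht)
        (abs_le.2 ⟨hlow t ht, (hex t ht).le⟩), fun t ht => (key t ht).1, Or.inr ?_⟩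
      exact (mul_le_mul_of_nonneg_left hd hc).trans (key q hq).2

theorem HalfArc.chain {τ : ℕ → Tube E} {l : ℕ} (hf : Continuous f) (hc : 0 ≤ c)
    (hl : ∀ i < l, Link f c (τ i) (τ (i + 1))) {d : ℝ} {γ : ℝ → E} {p q : ℝ}
    (h : HalfArc (τ 0) d γ p q) (hP : ∀ k ≤ l, f^[k] (γ p) ∈ (τ k).D) :
    ∃ q' ≤ q, HalfArc (τ l) (c ^ l * d) (fun t => f^[l] (γ t)) p q' := by
  induction l with
  | zero => exact ⟨q, le_rfl, by simpa using h⟩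
  | succ l ih =>
    obtain ⟨q1, h1, h2⟩ := ih (fun i hi => hl i (by omega)) fun k hk => hP k (by omega)
    obtain ⟨q2, h3, h4⟩ := h2.link hf hc (hl l (by omega))
      (by have := hP (l + 1) le_rfl; rwa [Function.iterate_succ_apply'] at this)
    refine ⟨q2, h3.trans h1, ?_⟩
    simpa only [Function.iterate_succ_apply', pow_succ', mul_assoc] using h4

theorem HalfArc.reach_of_lt {τ : Tube E} {d : ℝ} {γ : ℝ → E} {p q : ℝ} (h : HalfArc τ d γ p q)
    (hd : 2 < d) : τ.V (γ q) = 1 := by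
  rcases h.reach with h1 | h1
  · exact h1
  · have h2 := abs_le.1 (τ.le_one _ (h.mem p ⟨le_rfl, h.le⟩))
    have h3 := abs_le.1 (τ.le_one _ (h.mem q ⟨h.le, le_rfl⟩))
    linarith

/-- A half arc reaching the right side, issued from a point leaving a chain through the left,
contains an arc crossing the last box of the chain. -/
theorem HalfArc.exists_spans {τ : ℕ → Tube E} {l : ℕ} (hf : Continuous f) (hc : 1 < c)
    (hl : ∀ i < l, Link f c (τ i) (τ (i + 1))) {γ : ℝ → E} {p q : ℝ}
    (h : HalfArc (τ 0) 3 γ p q) (hP : ExitsLeft f l τ (γ p)) :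
    ∃ p' q', p ≤ p' ∧ q' ≤ q ∧ Spans (τ l) (fun t => f^[l] (γ t)) p' q' := by
  obtain ⟨i, hi, hD, hV⟩ := hP
  obtain ⟨q1, hq1, h1⟩ := HalfArc.chain hf (by linarith) (fun k hk => hl k (by omega)) h hD
  have hr := h1.reach_of_lt (by have := one_le_pow₀ (n := i) hc.le; linarith)
  have hcont : ContinuousOn (fun t => f (f^[i] (γ t))) (Icc p q1) := hf.comp_continuousOn h1.cont
  obtain ⟨p2, q2, h2, h3, h4, h5, h6, h7⟩ := exists_subinterval_crossing h1.le
    ((τ (i + 1)).cont.comp_continuousOn hcont)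
    (by rw [Function.iterate_succ_apply'] at hV; exact hV.le)
    ((hl i hi).right _ (h1.mem q1 ⟨h1.le, le_rfl⟩) hr)
  have hsub : Icc p2 q2 ⊆ Icc p q1 := Icc_subset_Icc h2 h4
  have hsp : Spans (τ (i + 1)) (fun t => f^[i + 1] (γ t)) p2 q2 := by
    simp only [Function.iterate_succ_apply']
    exact ⟨h3, hcont.mono hsub, fun t ht => (hl i hi).mem _ (h1.mem t (hsub ht)) (h7 t ht), h5, h6⟩
  obtain ⟨p3, q3, h8, h9, h10, -⟩ := Spans.chain (τ := fun k => τ (i + 1 + k)) (l := l - (i + 1)) hf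
    (fun k hk => hl (i + 1 + k) (by omega)) hsp
  refine ⟨p3, q3, h2.trans h8, h9.trans (h4.trans hq1), ?_⟩
  have e : i + 1 + (l - (i + 1)) = l := by omega
  simp only [e, ← Function.iterate_add_apply] at h10
  rw [show l - (i + 1) + (i + 1) = l by omega] at h10
  exact h10

theorem Horseshoe.halfArc_returns (h : Horseshoe f c base l J τ) {d : ℝ} {γ : ℝ → E} {p q : ℝ}
    (ha : HalfArc base d γ p q) (hP : IsMiddle f l J τ (γ p)) (n : ℕ) :
    ∃ q' ≤ q, HalfArc base (c ^ (n * l) * d) (fun t => f^[n * l] (γ t)) p q' := by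
  induction n with
  | zero => exact ⟨q, le_rfl, by simpa using ha⟩
  | succ n ih =>
    obtain ⟨q1, h1, h2⟩ := ih
    obtain ⟨j, hj, a, ha, b, hb, h3, -, -⟩ := hP n
    obtain ⟨q2, h4, h5⟩ := HalfArc.chain (τ := τ j) h.cont (by linarith [h.one_lt]) (h.link j hj)
      (by rw [h.start j hj]; exact h2) h3
    refine ⟨q2, h4.trans h1, ?_⟩
    rw [h.finish j hj] at h5
    have e : (n + 1) * l = l + n * l := by ring
    simpa only [e, Function.iterate_add_apply, pow_add, mul_assoc] using h5

theorem Horseshoe.halfArc_growth (h : Horseshoe f c base l J τ) {δ : ℝ≥0∞}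
    (hδ : ∀ y z, base.V y = -1 → base.V z = 1 → δ ≤ edist y z) {d : ℝ} (hd : 0 < d) {γ : ℝ → E}
    {p q : ℝ} (ha : HalfArc base d γ p q) (hP : IsMiddle f l J τ (γ p)) :
    ∃ n₀ : ℕ, ∀ k : ℕ,
      (J.card : ℝ≥0∞) ^ k * δ ≤ eVariationOn (fun t => f^[(n₀ + k) * l] (γ t)) (Icc p q) := by
  obtain ⟨n, hn⟩ := pow_unbounded_of_one_lt (3 / d) h.one_lt
  obtain ⟨q1, h1, h2⟩ := h.halfArc_returns ha hP n
  obtain ⟨-, -, a, ha', -, -, -, h4, -⟩ := hP n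
  have h5 : HalfArc base 3 (fun t => f^[n * l] (γ t)) p q1 :=
    ⟨h2.le, h2.cont, h2.mem, h2.cone, h2.reach.imp id fun hh => le_trans (by
      have h6 : c ^ n ≤ c ^ (n * l) := pow_le_pow_right₀ h.one_lt.le (Nat.le_mul_of_pos_right n h.pos)
      have h7 : 3 / d ≤ c ^ (n * l) := hn.le.trans h6
      rwa [div_le_iff₀ hd] at h7) hh⟩
  obtain ⟨p2, q2, h6, h7, h8⟩ := HalfArc.exists_spans (τ := τ a) h.cont h.one_lt (h.link a ha')
    (by rw [h.start a ha']; exact h5) h4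
  rw [h.finish a ha'] at h8
  refine ⟨n + 1, fun k => ?_⟩
  refine (h.le_eVariationOn hδ k h8).trans ?_
  have : ∀ t, f^[(n + 1 + k) * l] (γ t) = f^[k * l] (f^[l] (f^[n * l] (γ t))) := fun t => by
    simp only [← Function.iterate_add_apply]; congr 1; ring
  simp only [this]
  exact eVariationOn.mono _ (Icc_subset_Icc h6 (h7.trans h1))

theorem IsMiddle.flip {y : E} (h : IsMiddle f l J τ y) :
    IsMiddle f l J (fun j i => (τ j i).flip) y := by
  intro n
  obtain ⟨j, hj, a, ha, b, hb, h1, ⟨i, hi, h2, h3⟩, ⟨i', hi', h4, h5⟩⟩ := h n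
  refine ⟨j, hj, b, hb, a, ha, h1, ⟨i', hi', h4, ?_⟩, ⟨i, hi, h2, ?_⟩⟩
  · simp only [Tube.flip]; linarith
  · simp only [Tube.flip]; linarith

end horseshoe

set_option maxHeartbeats 4000000 in
/-- Logarithmic widths of a chain of boxes along an orbit segment of length `l`, where `p` is the
width in the contracted direction and `q` the width in the expanded direction: the contraction
and expansion rates are `a` and `b`, and the widths return to their initial values. -/
theorem exists_log_widths {l : ℕ} {a b D : ℕ → ℝ} {χ κ A C α : ℝ} (hκ : 0 < κ) (hχ : 0 < χ)
    (hC : 0 ≤ C) (hα0 : 0 < α) (hα : α ≤ 1)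
    (hκχ : κ + 2 * (4 * κ * A / χ) ≤ α * χ / 2) (hχA : χ ≤ A) (hl : C ≤ (χ - κ) * l)
    (hDa : ∀ i, -D i ≤ a i) (hDb : ∀ i, -D i ≤ b i) (hD0 : ∀ i, 0 ≤ D i)
    (haA : ∀ i, a i ≤ A) (hbA : ∀ i, b i ≤ A)
    (hb : ∀ j ≤ l, χ * j ≤ ∑ i ∈ Finset.range j, b i)
    (ha : ∀ j ≤ l, χ * (l - j) - C ≤ ∑ i ∈ Finset.range l, a i - ∑ i ∈ Finset.range j, a i)
    (hD1 : ∀ j ≤ l, ∑ i ∈ Finset.range j, D i ≤ κ * j)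
    (hD2 : ∀ j ≤ l, ∑ i ∈ Finset.range l, D i - ∑ i ∈ Finset.range j, D i ≤ κ * (l - j) + κ) :
    ∃ p q : ℕ → ℝ, p 0 = 0 ∧ q 0 = -C ∧ p l = 0 ∧ q l = -C ∧
      (∀ i < l, p i - b i + κ / 2 ≤ p (i + 1)) ∧ (∀ i < l, q (i + 1) ≤ q i + a i - κ / 2) ∧
      (∀ i < l, α * max (p i) (q i) + κ * min (i : ℝ) (l - i) +
        (max (p i) (q i) - min (p (i + 1)) (q (i + 1))) ≤ 4 * C + 4 * A) ∧
      (∀ i ≤ l, α * max (p i) (q i) + κ * min (i : ℝ) (l - i) ≤ 4 * C + 4 * A) ∧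
      ∀ i ≤ l, max (p i) (q i) ≤ 2 * C + κ := by
  set PA : ℕ → ℝ := fun j => ∑ i ∈ Finset.range j, a i with hPA
  set PB : ℕ → ℝ := fun j => ∑ i ∈ Finset.range j, b i with hPB
  set PD : ℕ → ℝ := fun j => ∑ i ∈ Finset.range j, D i with hPD
  have sPA : ∀ j, PA (j + 1) = PA j + a j := fun j => Finset.sum_range_succ _ _
  have sPB : ∀ j, PB (j + 1) = PB j + b j := fun j => Finset.sum_range_succ _ _
  have sPD : ∀ j, PD (j + 1) = PD j + D j := fun j => Finset.sum_range_succ _ _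
  have zPA : PA 0 = 0 := by simp [hPA]
  have zPB : PB 0 = 0 := by simp [hPB]
  have zPD : PD 0 = 0 := by simp [hPD]
  set Kp := 4 * κ * A / χ with hKp
  have hA : 0 < A := hχ.trans_le hχA
  have hKpχ : Kp * χ = 4 * κ * A := by rw [hKp]; field_simp
  have hKp4 : 4 * κ ≤ Kp := by rw [hKp, le_div_iff₀ hχ]; linarith [mul_le_mul_of_nonneg_left hχA hκ.le]
  have hαχ : α * χ ≤ χ := mul_le_of_le_one_left hχ.le hα
  have h9 : 9 * κ ≤ χ / 2 := by linarith
  have hmonoD : ∀ i j, i ≤ j → PD i ≤ PD j := by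
    intro i j hij
    induction j, hij using Nat.le_induction with
    | base => rfl
    | succ j _ ih => rw [sPD]; linarith [hD0 j]
  have hPBD : ∀ i j, i ≤ j → PB i - PB j ≤ PD j - PD i := by
    intro i j hij
    induction j, hij using Nat.le_induction with
    | base => simp
    | succ j _ ih => rw [sPD, sPB]; linarith [hDb j]
  have hPAD : ∀ i j, i ≤ j → PA i - PA j ≤ PD j - PD i := by
    intro i j hij
    induction j, hij using Nat.le_induction with
    | base => simp
    | succ j _ ih => rw [sPD, sPA]; linarith [hDa j]
  have hPBA : ∀ i, PB i ≤ A * i := by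
    intro i
    induction i with
    | zero => simp [zPB]
    | succ i ih => rw [sPB]; push_cast; linarith [hbA i]
  have hPAA : ∀ i j, i ≤ j → PA j - PA i ≤ A * (j - i) := by
    intro i j hij
    induction j, hij using Nat.le_induction with
    | base => simp
    | succ j _ ih => rw [sPA]; push_cast; linarith [haA j]
  -- the forward loss `ω`
  let ω : ℕ → ℝ := fun i => Nat.rec C (fun i x => max (x - a i + κ) 0) i
  have ω0 : ω 0 = C := rfl
  have ωs : ∀ i, ω (i + 1) = max (ω i - a i + κ) 0 := fun i => rfl
  have ωpos : ∀ i, 0 ≤ ω i := fun i => by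
    cases i with
    | zero => exact hC
    | succ i => rw [ωs]; exact le_max_right _ _
  have ωrep : ∀ i, ω i = C - (PA i - κ * i) ∨ ∃ j ≤ i, ω i = (PA j - κ * j) - (PA i - κ * i) := by
    intro i
    induction i with
    | zero => left; simp [ω0, zPA]
    | succ i ih =>
      rw [ωs, sPA]
      rcases max_choice (ω i - a i + κ) 0 with h | h
      · rw [h]
        rcases ih with h' | ⟨j, hj, h'⟩
        · left; rw [h']; push_cast; ring
        · right; exact ⟨j, by omega, by rw [h']; push_cast; ring⟩
      · right; exact ⟨i + 1, le_rfl, by rw [h, sPA]; ring⟩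
  -- the backward loss `σ`
  let s : ℕ → ℝ := fun k => Nat.rec 0 (fun k x => max (x - b (l - k - 1) + κ) 0) k
  have s0 : s 0 = 0 := rfl
  have ss : ∀ k, s (k + 1) = max (s k - b (l - k - 1) + κ) 0 := fun k => rfl
  let σ : ℕ → ℝ := fun i => s (l - i)
  have σl : σ l = 0 := by simp [σ, s0]
  have σs : ∀ i < l, σ i = max (σ (i + 1) - b i + κ) 0 := by
    intro i hi
    have h1 : l - i = (l - (i + 1)) + 1 := by omega
    have h2 : l - (l - (i + 1)) - 1 = i := by omega
    simp only [σ]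
    rw [h1, ss, h2]
  have spos : ∀ k, 0 ≤ s k := fun k => by
    cases k with
    | zero => exact s0.ge
    | succ k => rw [ss]; exact le_max_right _ _
  have σpos : ∀ i, 0 ≤ σ i := fun i => spos _
  have σrep : ∀ k ≤ l, ∃ j, l - k ≤ j ∧ j ≤ l ∧
      σ (l - k) = (PB (l - k) - κ * (l - k : ℕ)) - (PB j - κ * j) := by
    intro k hk
    induction k with
    | zero => exact ⟨l, by omega, le_rfl, by simp [σl]⟩
    | succ k ih =>
      obtain ⟨j, hj1, hj2, hj⟩ := ih (by omega)
      have h1 : l - k = l - (k + 1) + 1 := by omega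
      rw [σs _ (by omega : l - (k + 1) < l)]
      rw [h1, sPB] at hj
      rcases max_choice (σ (l - (k + 1) + 1) - b (l - (k + 1)) + κ) 0 with h | h
      · refine ⟨j, by omega, hj2, ?_⟩
        rw [h, hj]; push_cast; ring
      · exact ⟨l - (k + 1), le_rfl, by omega, by rw [h]; ring⟩
  have σrep' : ∀ i ≤ l, ∃ j, i ≤ j ∧ j ≤ l ∧ σ i = (PB i - κ * i) - (PB j - κ * j) := by
    intro i hi
    have := σrep (l - i) (by omega)
    rwa [show l - (l - i) = i by omega] at this
  have σle1 : ∀ i ≤ l, σ i ≤ Kp * i := by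
    intro i hi
    obtain ⟨j, h1, h2, h3⟩ := σrep' i hi
    have h4 := hb j h2
    have h5 := hPBA i
    have h6 := σpos i
    have hj0 : (0 : ℝ) ≤ j := Nat.cast_nonneg _
    have hi0 : (0 : ℝ) ≤ i := Nat.cast_nonneg _
    have h7 : χ * j ≤ 2 * A * i := by
      change χ * j ≤ PB j at h4
      linarith [mul_nonneg (by linarith : 0 ≤ χ / 2 - κ) hj0, mul_nonneg hκ.le hi0]
    have h8 : σ i ≤ 2 * κ * j := by
      have := hPBD i j h1
      have := hD1 j h2
      have : 0 ≤ PD i := by rw [← zPD]; exact hmonoD 0 i (by omega)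
      change PD j ≤ κ * j at *
      linarith [mul_nonneg hκ.le hi0]
    have : χ * σ i ≤ χ * (Kp * i) := by
      linarith [mul_le_mul_of_nonneg_left h8 hχ.le,
        mul_le_mul_of_nonneg_left h7 (by linarith : 0 ≤ 2 * κ), congrArg (fun z => z * (i : ℝ)) hKpχ]
    exact le_of_mul_le_mul_left this hχ
  have σle2 : ∀ i ≤ l, σ i ≤ Kp * (l - i) + κ := by
    intro i hi
    obtain ⟨j, h1, h2, h3⟩ := σrep' i hi
    have := hPBD i j h1
    have := hmonoD j l h2
    have h4 := hD2 i hi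
    change PD l - PD i ≤ _ at h4
    have h5 : (i : ℝ) ≤ l := Nat.cast_le.2 hi
    have h6 : (j : ℝ) ≤ l := Nat.cast_le.2 h2
    linarith [mul_nonneg (by linarith : 0 ≤ Kp - 2 * κ) (sub_nonneg.2 h5),
      mul_nonneg hκ.le (sub_nonneg.2 h6)]
  have key1 : ∀ i ≤ l, ∀ j ≤ i, (PA j - κ * j) - (PA i - κ * i) ≤ Kp * i := by
    intro i hi j hj
    have := hPAD j i hj
    have h4 := hD1 i hi
    have : 0 ≤ PD j := by rw [← zPD]; exact hmonoD 0 j (by omega)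
    change PD i ≤ _ at h4
    have hj0 : (0 : ℝ) ≤ j := Nat.cast_nonneg _
    have hi0 : (0 : ℝ) ≤ i := Nat.cast_nonneg _
    linarith [mul_nonneg (by linarith : 0 ≤ Kp - 2 * κ) hi0, mul_nonneg hκ.le hj0]
  have key2 : ∀ i ≤ l, ∀ j ≤ i, (PA j - κ * j) - (PA i - κ * i) ≤ Kp * (l - i) + C + κ := by
    intro i hi j hj
    have hil : (i : ℝ) ≤ l := Nat.cast_le.2 hi
    have hji : (j : ℝ) ≤ i := Nat.cast_le.2 hj
    have hKp0 : 0 ≤ Kp := by linarith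
    rcases le_total ((PA j - κ * j) - (PA i - κ * i)) 0 with h0 | h0
    · have : 0 ≤ Kp * (l - i) := mul_nonneg hKp0 (by linarith)
      linarith
    have h1 := ha j (hj.trans hi)
    change _ ≤ PA l - PA j at h1
    have h2 := hPAA i l hi
    have h3 : χ * (l - j) ≤ 2 * A * (l - i) + 2 * C := by
      linarith [mul_nonneg hκ.le (sub_nonneg.2 hil),
        mul_nonneg (by linarith : 0 ≤ χ / 2 - κ) (sub_nonneg.2 (hji.trans hil))]
    have h4 := hPAD j i hj
    have h5 := hmonoD i l hi
    have h6 := hD2 j (hj.trans hi)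
    change PD l - PD j ≤ _ at h6
    have h7 : (PA j - κ * j) - (PA i - κ * i) ≤ 2 * κ * (l - j) + κ := by
      linarith [mul_nonneg hκ.le (sub_nonneg.2 hil)]
    have h8 : χ * ((PA j - κ * j) - (PA i - κ * i)) ≤ χ * (Kp * (l - i) + C + κ) := by
      have h10 : χ * ((PA j - κ * j) - (PA i - κ * i)) ≤ 2 * κ * (χ * (l - j)) + χ * κ := by
        linarith [mul_le_mul_of_nonneg_left h7 hχ.le]
      have h11 : 2 * κ * (χ * (l - j)) ≤ 2 * κ * (2 * A * (l - i) + 2 * C) :=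
        mul_le_mul_of_nonneg_left h3 (by linarith)
      have h12 : χ * (Kp * (l - i)) = 4 * κ * A * (l - i) := by rw [← hKpχ]; ring
      have h13 : 4 * κ * C ≤ χ * C := mul_le_mul_of_nonneg_right (by linarith) hC
      linarith
    exact le_of_mul_le_mul_left h8 hχ
  have ωle1 : ∀ i ≤ l, ω i ≤ Kp * i + C := by
    intro i hi
    rcases ωrep i with h | ⟨j, hj, h⟩
    · have := key1 i hi 0 (by omega)
      rw [zPA] at this; push_cast at this; linarith
    · have := key1 i hi j hj
      linarith
  have ωle2 : ∀ i ≤ l, ω i ≤ Kp * (l - i) + 2 * C + κ := by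
    intro i hi
    rcases ωrep i with h | ⟨j, hj, h⟩
    · have := key2 i hi 0 (by omega)
      rw [zPA] at this; push_cast at this; linarith
    · have := key2 i hi j hj
      linarith
  -- the widths
  let X : ℕ → ℝ := fun i => -(PB i - κ / 2 * i) + σ i
  let Y : ℕ → ℝ := fun i => -(PA l - PA i - κ / 2 * (l - i)) + ω i - C
  let m : ℕ → ℝ := fun i => max (X i) (Y i)
  have hKp0 : 0 ≤ Kp := by linarith
  have mle : ∀ i ≤ l, m i ≤ -(χ / 2) * min (i : ℝ) (l - i) + 2 * C + κ := by
    intro i hi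
    have hi0 : (0 : ℝ) ≤ i := Nat.cast_nonneg _
    have hil : (0 : ℝ) ≤ l - i := sub_nonneg.2 (Nat.cast_le.2 hi)
    have m1 := min_le_left (i : ℝ) (l - i)
    have m2 := min_le_right (i : ℝ) (l - i)
    refine max_le ?_ ?_
    · have h1 := hb i hi
      change _ ≤ PB i at h1
      have h2 := σle1 i hi
      have : X i ≤ -(χ / 2) * i := by
        simp only [X]; linarith [mul_nonneg (by linarith : 0 ≤ χ / 2 - κ / 2 - Kp) hi0]
      linarith [mul_le_mul_of_nonneg_left m1 (by linarith : 0 ≤ χ / 2)]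
    · have h1 := ha i hi
      change _ ≤ PA l - PA i at h1
      have h2 := ωle2 i hi
      have : Y i ≤ -(χ / 2) * (l - i) + 2 * C + κ := by
        simp only [Y]; linarith [mul_nonneg (by linarith : 0 ≤ χ / 2 - κ / 2 - Kp) hil]
      linarith [mul_le_mul_of_nonneg_left m2 (by linarith : 0 ≤ χ / 2)]
  have Xs : ∀ i < l, X (i + 1) ≤ X i - κ / 2 := by
    intro i hi
    have := (le_max_left _ _).trans (σs i hi).ge
    simp only [X]; rw [sPB]; push_cast; linarith
  have σs' : ∀ i < l, σ (i + 1) - b i + κ ≤ σ i := fun i hi => (le_max_left _ _).trans (σs i hi).ge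
  have ωs' : ∀ i, ω i - a i + κ ≤ ω (i + 1) := fun i => (le_max_left _ _).trans (ωs i).ge
  have Ys : ∀ i, Y i + κ / 2 ≤ Y (i + 1) := by
    intro i
    have := ωs' i
    simp only [Y]; rw [sPA]; push_cast; linarith
  let p₀ : ℕ → ℝ := fun i => m i - σ i
  let q : ℕ → ℝ := fun i => m i - ω i
  have W1 : ∀ i < l, p₀ i - b i + κ / 2 ≤ p₀ (i + 1) := by
    intro i hi
    simp only [p₀, m]
    rcases max_choice (X i) (Y i) with h | h
    · rw [h]
      have h1 : X (i + 1) ≤ max (X (i + 1)) (Y (i + 1)) := le_max_left _ _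
      have h2 : X (i + 1) = X i - b i + κ / 2 + (σ (i + 1) - σ i) := by
        simp only [X]; rw [sPB]; push_cast; ring
      linarith
    · rw [h]
      have : Y (i + 1) ≤ max (X (i + 1)) (Y (i + 1)) := le_max_right _ _
      linarith [Ys i, σs' i hi]
  have W2 : ∀ i < l, q (i + 1) ≤ q i + a i - κ / 2 := by
    intro i hi
    simp only [q, m]
    rcases max_choice (X (i + 1)) (Y (i + 1)) with h | h
    · rw [h]
      have : X i ≤ max (X i) (Y i) := le_max_left _ _
      linarith [Xs i hi, ωs' i]
    · rw [h]
      have : Y i ≤ max (X i) (Y i) := le_max_right _ _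
      simp only [Y] at this ⊢; rw [sPA]; push_cast; linarith
  have l0 : (0 : ℝ) ≤ l := Nat.cast_nonneg _
  have hl' : C ≤ (χ - κ / 2) * l := by linarith [mul_nonneg hκ.le l0]
  have σ0 : σ 0 = 0 := le_antisymm (by simpa using σle1 0 (by omega)) (σpos 0)
  have hm0 : m 0 = 0 := by
    have h1 := ha 0 (by omega)
    change _ ≤ PA l - PA 0 at h1
    simp only [m, X, Y, σ0, ω0, zPB, zPA] at h1 ⊢
    push_cast at h1 ⊢
    rw [max_eq_left]
    · ring
    · linarith
  have hp0 : p₀ 0 = 0 := by simp only [p₀, hm0, σ0]; ring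
  have hq0 : q 0 = -C := by simp only [q, hm0, ω0]; ring
  have ωl : ω l ≤ C := by
    rcases ωrep l with h | ⟨j, hj, h⟩
    · have h1 := ha 0 (by omega)
      change _ ≤ PA l - PA 0 at h1
      rw [zPA] at h1; push_cast at h1; linarith
    · have h1 := ha j hj
      change _ ≤ PA l - PA j at h1
      have : (j : ℝ) ≤ l := Nat.cast_le.2 hj
      linarith [mul_nonneg (by linarith : 0 ≤ χ - κ) (sub_nonneg.2 this)]
  have hXl : X l ≤ -C := by
    have h1 := hb l le_rfl
    change _ ≤ PB l at h1
    simp only [X, σl]; linarith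
  have hYl : Y l = ω l - C := by simp only [Y]; ring
  have hpl : p₀ l ≤ 0 := by
    simp only [p₀, σl, m, hYl]
    have := max_le (hXl.trans (by linarith : -C ≤ 0)) (by linarith : ω l - C ≤ 0)
    linarith
  have hql : q l = -C := by
    simp only [q, m, hYl]
    rw [max_eq_right]
    · ring
    · linarith [ωpos l]
  set p : ℕ → ℝ := fun i => if i = l then 0 else p₀ i with hp
  have pge : ∀ i, p₀ i ≤ p i := fun i => by
    simp only [hp]; split_ifs with h
    · rw [h]; exact hpl
    · rfl
  have plt : ∀ i < l, p i = p₀ i := fun i hi => by simp [hp, hi.ne]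
  have pl : p l = 0 := by simp [hp]
  have qle : ∀ i, q i ≤ m i := fun i => by simp only [q]; linarith [ωpos i]
  have ple : ∀ i < l, p i ≤ m i := fun i hi => by rw [plt i hi]; simp only [p₀]; linarith [σpos i]
  have mxle : ∀ i < l, max (p i) (q i) ≤ m i := fun i hi => max_le (ple i hi) (qle i)
  have minnn : ∀ i ≤ l, 0 ≤ min (i : ℝ) (l - i) := fun i hi =>
    le_min (Nat.cast_nonneg _) (sub_nonneg.2 (Nat.cast_le.2 hi))
  have hKpA : Kp ≤ A / 4 := by linarith
  have hlast : max (p l) (q l) = 0 := by rw [pl, hql]; exact max_eq_left (by linarith)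
  have hminl : min (l : ℝ) (l - l) = 0 := by rw [sub_self]; exact min_eq_right l0
  have mα : ∀ i ≤ l, α * m i + (κ + 2 * Kp) * min (i : ℝ) (l - i) ≤ 2 * C + κ := by
    intro i hi
    have h1 := mul_le_mul_of_nonneg_left (mle i hi) hα0.le
    have h2 := mul_le_mul_of_nonneg_right hκχ (minnn i hi)
    linarith [mul_le_mul_of_nonneg_right hα (by linarith : 0 ≤ 2 * C + κ)]
  refine ⟨p, q, ?_, hq0, pl, hql, ?_, W2, ?_, ?_, ?_⟩
  · rcases Nat.eq_zero_or_pos l with h | h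
    · have := pl; rwa [h] at this
    · rw [plt 0 h, hp0]
  · intro i hi
    rw [plt i hi]
    exact (W1 i hi).trans (pge _)
  · intro i hi
    have hmn := minnn i hi.le
    have hp1 : p₀ i - A ≤ p₀ (i + 1) := by linarith [W1 i hi, hbA i]
    have hq1 : p₀ i - A - ω (i + 1) ≤ q (i + 1) := by
      have : p₀ (i + 1) ≤ m (i + 1) := by simp only [p₀]; linarith [σpos (i + 1)]
      simp only [q]; linarith
    have hmin : m i - σ i - A - ω (i + 1) ≤ min (p (i + 1)) (q (i + 1)) := by
      refine le_min ?_ hq1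
      have := pge (i + 1)
      have : m i - σ i = p₀ i := rfl
      linarith [ωpos (i + 1)]
    have hσ : σ i ≤ Kp * min (i : ℝ) (l - i) + κ := by
      rcases min_choice (i : ℝ) (l - i) with h | h
      · rw [h]; linarith [σle1 i hi.le]
      · rw [h]; exact σle2 i hi.le
    have hω : ω (i + 1) ≤ Kp * min (i : ℝ) (l - i) + 2 * C + κ + Kp := by
      rcases min_choice (i : ℝ) (l - i) with h | h
      · rw [h]; have := ωle1 (i + 1) hi; push_cast at this; linarith
      · rw [h]; have := ωle2 (i + 1) hi; push_cast at this; linarith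
    have hM := mxle i hi
    have h1 := mul_le_mul_of_nonneg_left hM hα0.le
    have h2 := mα i hi.le
    linarith
  · intro i hi
    rcases hi.lt_or_eq with h | h
    · have h1 := mul_le_mul_of_nonneg_left (mxle i h) hα0.le
      have h2 := mα i hi
      have h3 := mul_nonneg hKp0 (minnn i hi)
      linarith
    · rw [h, hlast, hminl]; linarith
  · intro i hi
    rcases hi.lt_or_eq with h | h
    · have h1 := mle i hi
      have h3 := mul_nonneg hχ.le (minnn i hi)
      have h2 := mxle i h
      linarith
    · rw [h, hlast]; linarith

/-- All partial sums of `c` from time `i` on, up to time `L`, grow at rate at least `χ`. -/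
def FwdGood (c : ℕ → ℝ) (χ : ℝ) (L i : ℕ) : Prop :=
  ∀ j, i ≤ j → j ≤ L → χ * (j - i) ≤ ∑ k ∈ Finset.Ico i j, c k

/-- All partial sums of `c` ending with the step `i` have rate at least `χ`. -/
def BwdGood (c : ℕ → ℝ) (χ : ℝ) (i : ℕ) : Prop :=
  ∀ j ≤ i, χ * (i + 1 - j) ≤ ∑ k ∈ Finset.Ico j (i + 1), c k

open Classical in
theorem sum_not_fwdGood_le (c : ℕ → ℝ) (χ : ℝ) (L s : ℕ) (hs : s ≤ L) :
    ∑ i ∈ Finset.Ico s L with ¬FwdGood c χ L i, (c i - χ) ≤ 0 := by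
  induction hn : L - s using Nat.strong_induction_on generalizing s with
  | _ n ih =>
    rcases hs.eq_or_lt with rfl | hs
    · simp
    by_cases hg : FwdGood c χ L s
    · have h1 : (Finset.Ico s L).filter (fun i => ¬FwdGood c χ L i) =
          (Finset.Ico (s + 1) L).filter (fun i => ¬FwdGood c χ L i) := by
        rw [← Finset.insert_Ico_add_one_left_eq_Ico hs, Finset.filter_insert, if_neg (not_not.2 hg)]
      rw [h1]
      exact ih _ (by omega) (s + 1) hs rfl
    · have hex : ∃ j, s ≤ j ∧ j ≤ L ∧ ∑ k ∈ Finset.Ico s j, c k < χ * (j - s) := by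
        simpa [FwdGood] using hg
      obtain ⟨h1, h2, h3⟩ := Nat.find_spec hex
      set t := Nat.find hex with ht
      have hst : s < t := by
        rcases h1.eq_or_lt with h | h
        · rw [← h] at h3; simp at h3
        · exact h
      have hbad : ∀ i ∈ Finset.Ico s t, ¬FwdGood c χ L i := by
        intro i hi hgi
        rw [Finset.mem_Ico] at hi
        have h4 := hgi t hi.2.le h2
        have h5 : χ * (i - s) ≤ ∑ k ∈ Finset.Ico s i, c k := by
          by_contra! hcon
          exact Nat.find_min hex hi.2 ⟨hi.1, hi.2.le.trans h2, hcon⟩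
        have h6 := Finset.sum_Ico_consecutive c hi.1 hi.2.le
        linarith
      rw [← Finset.Ico_union_Ico_eq_Ico h1 h2, Finset.filter_union, Finset.sum_union
        ((Finset.Ico_disjoint_Ico_consecutive s t L).mono (Finset.filter_subset _ _)
          (Finset.filter_subset _ _)), Finset.filter_true_of_mem hbad]
      have h7 := ih _ (by omega) t h2 rfl
      have h8 : ∑ i ∈ Finset.Ico s t, (c i - χ) < 0 := by
        rw [Finset.sum_sub_distrib, Finset.sum_const, Nat.card_Ico, nsmul_eq_mul, Nat.cast_sub h1]
        linarith
      linarith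

open Classical in
theorem sum_not_bwdGood_le (c : ℕ → ℝ) (χ : ℝ) (L : ℕ) :
    ∑ i ∈ Finset.range L with ¬BwdGood c χ i, (c i - χ) ≤ 0 := by
  induction L using Nat.strong_induction_on with
  | _ L ih =>
    rcases Nat.eq_zero_or_pos L with rfl | hL
    · simp
    obtain ⟨l, rfl⟩ : ∃ l, L = l + 1 := ⟨L - 1, by omega⟩
    by_cases hg : BwdGood c χ l
    · rw [Finset.range_add_one, Finset.filter_insert, if_neg (not_not.2 hg)]
      exact ih l (by omega)
    · have hex : ∃ k, k ≤ l ∧ ∑ i ∈ Finset.Ico (l - k) (l + 1), c i < χ * (k + 1) := by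
        have : ∃ j, j ≤ l ∧ ∑ i ∈ Finset.Ico j (l + 1), c i < χ * (l + 1 - j) := by
          simpa [BwdGood] using hg
        obtain ⟨j, h1, h2⟩ := this
        refine ⟨l - j, by omega, ?_⟩
        rw [show l - (l - j) = j by omega, Nat.cast_sub h1]
        linarith
      obtain ⟨h1, h2⟩ := Nat.find_spec hex
      set k := Nat.find hex with hk
      set t := l - k with ht
      have hbad : ∀ i ∈ Finset.Ico t (l + 1), ¬BwdGood c χ i := by
        intro i hi hgi
        rw [Finset.mem_Ico] at hi
        have h4 := hgi t hi.1
        have h5 : χ * (l - i) ≤ ∑ k ∈ Finset.Ico (i + 1) (l + 1), c k := by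
          rcases (Nat.lt_succ_iff.1 hi.2).eq_or_lt with rfl | hil
          · simp
          by_contra! hcon
          refine Nat.find_min hex (m := l - (i + 1)) (by omega) ⟨by omega, ?_⟩
          rw [show l - (l - (i + 1)) = i + 1 by omega, Nat.cast_sub hil]
          push_cast
          linarith
        have h6 := Finset.sum_Ico_consecutive c (show t ≤ i + 1 by omega) (show i + 1 ≤ l + 1 by omega)
        have h7 : (t : ℝ) = l - k := by rw [ht, Nat.cast_sub h1]
        rw [h7] at h4
        linarith
      rw [Finset.range_eq_Ico, ← Finset.Ico_union_Ico_eq_Ico (Nat.zero_le t) (show t ≤ l + 1 by omega),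
        Finset.filter_union, Finset.sum_union
        ((Finset.Ico_disjoint_Ico_consecutive 0 t (l + 1)).mono (Finset.filter_subset _ _)
          (Finset.filter_subset _ _)), Finset.filter_true_of_mem hbad, ← Finset.range_eq_Ico]
      have h7 := ih t (by omega)
      have h8 : ∑ i ∈ Finset.Ico t (l + 1), (c i - χ) < 0 := by
        rw [Finset.sum_sub_distrib, Finset.sum_const, Nat.card_Ico, nsmul_eq_mul,
          show l + 1 - t = k + 1 by omega]
        push_cast; linarith
      linarith

open Classical in
/-- The set of steps which are good in both directions. -/
def goodSteps (c : ℕ → ℝ) (χ : ℝ) (L : ℕ) : Finset ℕ :=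
  {i ∈ Finset.range L | FwdGood c χ L i ∧ BwdGood c χ i}

theorem sum_not_goodSteps_le (N D : ℕ → ℝ) {χ K : ℝ} (hχ : 0 ≤ χ) (hK : 0 ≤ K) (L : ℕ)
    (hN : ∀ i, 0 ≤ N i) (hD : ∀ i, 0 ≤ D i) :
    ∑ i ∈ Finset.range L \ goodSteps (fun i => N i - K * D i) χ L, N i ≤
      2 * χ * L + 2 * K * ∑ i ∈ Finset.range L, D i := by
  classical
  set c : ℕ → ℝ := fun i => N i - K * D i with hc
  have bound : ∀ S ⊆ Finset.range L, ∑ i ∈ S, (c i - χ) ≤ 0 →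
      ∑ i ∈ S, N i ≤ χ * L + K * ∑ i ∈ Finset.range L, D i := by
    intro S hS h
    have h1 : ∑ i ∈ S, N i = ∑ i ∈ S, (c i - χ) + K * ∑ i ∈ S, D i + χ * S.card := by
      simp only [hc, Finset.sum_sub_distrib, Finset.mul_sum, Finset.sum_const, nsmul_eq_mul]; ring
    have h2 : ∑ i ∈ S, D i ≤ ∑ i ∈ Finset.range L, D i :=
      Finset.sum_le_sum_of_subset_of_nonneg hS fun i _ _ => hD i
    have h3 : (S.card : ℝ) ≤ L := by
      have := Finset.card_le_card hS
      rw [Finset.card_range] at this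
      exact_mod_cast this
    have h4 := mul_le_mul_of_nonneg_left h2 hK
    have h5 := mul_le_mul_of_nonneg_left h3 hχ
    linarith
  have h1 := bound ((Finset.range L).filter fun i => ¬FwdGood c χ L i) (Finset.filter_subset _ _)
    (by have := sum_not_fwdGood_le c χ L 0 (Nat.zero_le _); rwa [← Finset.range_eq_Ico] at this)
  have h2 := bound ((Finset.range L).filter fun i => ¬BwdGood c χ i) (Finset.filter_subset _ _)
    (sum_not_bwdGood_le c χ L)
  have h3 : ∑ i ∈ Finset.range L \ goodSteps c χ L, N i ≤
      ∑ i ∈ (Finset.range L).filter (fun i => ¬FwdGood c χ L i) ∪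
        (Finset.range L).filter (fun i => ¬BwdGood c χ i), N i := by
    refine Finset.sum_le_sum_of_subset_of_nonneg ?_ fun i _ _ => hN i
    intro i hi
    simp only [goodSteps, Finset.mem_sdiff, Finset.mem_filter, Finset.mem_union] at hi ⊢
    tauto
  have h4 := Finset.sum_union_inter (s₁ := (Finset.range L).filter (fun i => ¬FwdGood c χ L i))
    (s₂ := (Finset.range L).filter (fun i => ¬BwdGood c χ i)) (f := N)
  have h5 : 0 ≤ ∑ i ∈ (Finset.range L).filter (fun i => ¬FwdGood c χ L i) ∩
        (Finset.range L).filter (fun i => ¬BwdGood c χ i), N i := Finset.sum_nonneg fun i _ => hN i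
  linarith

/-- All orbit segments of length `n` starting in `B` stay pairwise `δ`-close. -/
def SmallSet {X : Type*} [PseudoMetricSpace X] (g : X → X) (δ : ℝ) (n : ℕ) (B : Set X) : Prop :=
  ∀ x ∈ B, ∀ y ∈ B, ∀ i ≤ n, dist (g^[i] x) (g^[i] y) ≤ δ

/-- `S` is covered by at most `b` sets that are small along orbit segments of length `n`. -/
def Cov {X : Type*} [PseudoMetricSpace X] (g : X → X) (δ : ℝ) (n : ℕ) (S : Set X) (b : ℝ) : Prop :=
  ∃ 𝒞 : Finset (Set X), (𝒞.card : ℝ) ≤ b ∧ (∀ B ∈ 𝒞, SmallSet g δ n B) ∧ ∀ x ∈ S, ∃ B ∈ 𝒞, x ∈ B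

section Cov

variable {X : Type*} [PseudoMetricSpace X] {g g' : X → X} {δ : ℝ} {n m k : ℕ} {S S' M : Set X}
  {b b' : ℝ}

theorem Cov.mono (h : Cov g δ n S b) (hS : S' ⊆ S) (hb : b ≤ b') : Cov g δ n S' b' := by
  obtain ⟨C, h1, h2, h3⟩ := h
  exact ⟨C, h1.trans hb, h2, fun x hx => h3 x (hS hx)⟩

theorem Cov.of_le (h : Cov g δ n S b) (hm : m ≤ n) : Cov g δ m S b := by
  obtain ⟨C, h1, h2, h3⟩ := h
  exact ⟨C, h1, fun B hB x hx y hy i hi => h2 B hB x hx y hy i (hi.trans hm), h3⟩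

theorem cov_empty (hb : 0 ≤ b) : Cov g δ n (∅ : Set X) b :=
  ⟨∅, by simpa using hb, by simp, by simp⟩

theorem Cov.union (h : Cov g δ n S b) (h' : Cov g δ n S' b') : Cov g δ n (S ∪ S') (b + b') := by
  classical
  obtain ⟨C, h1, h2, h3⟩ := h
  obtain ⟨C', h1', h2', h3'⟩ := h'
  refine ⟨C ∪ C', ?_, ?_, ?_⟩
  · have : ((C ∪ C').card : ℝ) ≤ C.card + C'.card := by exact_mod_cast Finset.card_union_le C C'
    linarith
  · intro B hB
    rcases Finset.mem_union.1 hB with hB | hB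
    exacts [h2 B hB, h2' B hB]
  · rintro x (hx | hx)
    · obtain ⟨B, hB, hxB⟩ := h3 x hx
      exact ⟨B, Finset.mem_union_left _ hB, hxB⟩
    · obtain ⟨B, hB, hxB⟩ := h3' x hx
      exact ⟨B, Finset.mem_union_right _ hB, hxB⟩

theorem cov_biUnion {ι : Type*} (I : Finset ι) (S : ι → Set X) (b : ι → ℝ)
    (h : ∀ i ∈ I, Cov g δ n (S i) (b i)) : Cov g δ n (⋃ i ∈ I, S i) (∑ i ∈ I, b i) := by
  classical
  induction I using Finset.induction_on with
  | empty => simpa using cov_empty le_rfl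
  | insert a I ha ih =>
    rw [Finset.sum_insert ha, Finset.set_biUnion_insert]
    exact (h a (Finset.mem_insert_self _ _)).union
      (ih fun i hi => h i (Finset.mem_insert_of_mem hi))

/-- Covering a set by pieces indexed by a finite set, with a uniform bound. -/
theorem cov_of_forall_piece {ι : Type*} (I : Finset ι) (P : ι → Set X)
    (hS : ∀ x ∈ S, ∃ i ∈ I, x ∈ P i) (h : ∀ i ∈ I, Cov g δ n (S ∩ P i) b) :
    Cov g δ n S (I.card * b) := by
  have := cov_biUnion I (fun i => S ∩ P i) (fun _ => b) h
  rw [Finset.sum_const, nsmul_eq_mul] at this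
  refine this.mono (fun x hx => ?_) le_rfl
  obtain ⟨i, hi, hxi⟩ := hS x hx
  simp only [mem_iUnion]
  exact ⟨i, hi, hx, hxi⟩

theorem Cov.mul (h : Cov g δ n S b) (h' : Cov g δ m (g^[k] '' S) b') (hk : k ≤ n + 1) :
    Cov g δ (k + m) S (b * b') := by
  classical
  obtain ⟨C, h1, h2, h3⟩ := h
  obtain ⟨C', h1', h2', h3'⟩ := h'
  refine ⟨(C ×ˢ C').image fun p => p.1 ∩ (g^[k]) ⁻¹' p.2, ?_, ?_, ?_⟩
  · have : (((C ×ˢ C').image fun p => p.1 ∩ (g^[k]) ⁻¹' p.2).card : ℝ) ≤ C.card * C'.card := by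
      exact_mod_cast Finset.card_image_le.trans (Finset.card_product _ _).le
    exact this.trans (mul_le_mul h1 h1' (Nat.cast_nonneg _) ((Nat.cast_nonneg _).trans h1))
  · intro B hB
    obtain ⟨⟨B1, B2⟩, hp, rfl⟩ := Finset.mem_image.1 hB
    obtain ⟨hp1, hp2⟩ := Finset.mem_product.1 hp
    rintro x ⟨hx1, hx2⟩ y ⟨hy1, hy2⟩ i hi
    rcases lt_or_ge i k with hik | hik
    · exact h2 B1 hp1 x hx1 y hy1 i (by omega)
    · obtain ⟨j, rfl⟩ := Nat.exists_eq_add_of_le hik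
      rw [add_comm k j, Function.iterate_add_apply, Function.iterate_add_apply]
      exact h2' B2 hp2 _ hx2 _ hy2 j (by omega)
  · intro x hx
    obtain ⟨B, hB, hxB⟩ := h3 x hx
    obtain ⟨B', hB', hxB'⟩ := h3' _ (mem_image_of_mem _ hx)
    exact ⟨_, Finset.mem_image.2 ⟨(B, B'), Finset.mem_product.2 ⟨hB, hB'⟩, rfl⟩, hxB, hxB'⟩

theorem cov_pow {Y : ℝ} (hY : Cov g δ 0 M Y) (hg : MapsTo g M M) (n : ℕ) :
    Cov g δ n M (Y ^ (n + 1)) := by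
  induction n with
  | zero => simpa using hY
  | succ n ih =>
    have := hY.mul (k := 1) (ih.mono (S' := g^[1] '' M) (by simpa using hg.image_subset) le_rfl)
      (by omega)
    rwa [← pow_succ', add_comm 1 n] at this

/-- Coverings for the inverse map, read backwards. -/
theorem Cov.reverse (hg : MapsTo g M M) (hinv : ∀ x ∈ M, g' (g x) = x) (hS : S ⊆ M)
    (h : Cov g' δ n (g^[n] '' S) b) : Cov g δ n S b := by
  classical
  have key : ∀ x ∈ M, ∀ i ≤ n, g^[i] x = g'^[n - i] (g^[n] x) := by
    intro x hx i hi
    have aux : ∀ k, ∀ y ∈ M, g'^[k] (g^[k] y) = y := by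
      intro k
      induction k with
      | zero => intro y _; rfl
      | succ k ih =>
        intro y hy
        rw [Function.iterate_succ_apply' g, Function.iterate_succ_apply,
          hinv _ (hg.iterate k hy), ih y hy]
    have : g^[n] x = g^[n - i] (g^[i] x) := by
      rw [← Function.iterate_add_apply]; congr 2; omega
    rw [this, aux _ _ (hg.iterate i hx)]
  obtain ⟨C, h1, h2, h3⟩ := h
  refine ⟨C.image fun B => (g^[n]) ⁻¹' B ∩ M, ?_, ?_, ?_⟩
  · exact le_trans (by exact_mod_cast Finset.card_image_le) h1
  · intro B hB
    obtain ⟨B', hB', rfl⟩ := Finset.mem_image.1 hB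
    rintro x ⟨hx, hxM⟩ y ⟨hy, hyM⟩ i hi
    rw [key x hxM i hi, key y hyM i hi]
    exact h2 B' hB' _ hx _ hy _ (Nat.sub_le _ _)
  · intro x hx
    obtain ⟨B, hB, hxB⟩ := h3 _ (mem_image_of_mem _ hx)
    exact ⟨_, Finset.mem_image.2 ⟨B, hB, rfl⟩, hxB, hS hx⟩

/-- A set without small coverings contains many separated points. -/
theorem exists_separated_of_not_cov (hδ : 0 ≤ δ) (hb : ¬ Cov g δ n S b) :
    ∃ F : Finset X, (F : Set X) ⊆ S ∧ b < F.card ∧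
      ∀ x ∈ F, ∀ y ∈ F, x ≠ y → ∃ i ≤ n, δ / 2 < dist (g^[i] x) (g^[i] y) := by
  classical
  by_contra! hcon
  let P : ℕ → Prop := fun k => ∃ F : Finset X, (F : Set X) ⊆ S ∧ F.card = k ∧
      ∀ x ∈ F, ∀ y ∈ F, x ≠ y → ∃ i ≤ n, δ / 2 < dist (g^[i] x) (g^[i] y)
  have hbd : ∀ k, P k → k ≤ ⌊b⌋₊ := by
    rintro k ⟨F, hF, rfl, hsep⟩
    by_contra hlt
    obtain ⟨x, hx, y, hy, hne, hxy⟩ := hcon F hF (Nat.lt_of_floor_lt (not_le.1 hlt))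
    obtain ⟨i, hi, hd⟩ := hsep x hx y hy hne
    exact absurd (hxy i hi) (not_le.2 hd)
  have h0 : P 0 := ⟨∅, by simp, by simp, by simp⟩
  have hmax := Nat.findGreatest_spec (P := P) (Nat.zero_le ⌊b⌋₊) h0
  set K := Nat.findGreatest P ⌊b⌋₊
  obtain ⟨F, hF, hcard, hsep⟩ := hmax
  have hb0 : (K : ℝ) ≤ b := by
    by_contra hlt
    obtain ⟨x, hx, y, hy, hne, hxy⟩ := hcon F hF (by rw [hcard]; exact not_le.1 hlt)
    obtain ⟨i, hi, hd⟩ := hsep x hx y hy hne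
    exact absurd (hxy i hi) (not_le.2 hd)
  refine hb ⟨F.image fun y => {x | ∀ i ≤ n, dist (g^[i] x) (g^[i] y) ≤ δ / 2}, ?_, ?_, ?_⟩
  · refine le_trans ?_ hb0
    exact_mod_cast Finset.card_image_le.trans hcard.le
  · intro B hB
    obtain ⟨z, hz, rfl⟩ := Finset.mem_image.1 hB
    intro x hx y hy i hi
    have h1 := hx i hi
    have h2 := hy i hi
    have := dist_triangle_right (g^[i] x) (g^[i] y) (g^[i] z)
    linarith
  · intro x hx
    by_contra! hno
    have hnew : ∀ y ∈ F, ∃ i ≤ n, δ / 2 < dist (g^[i] x) (g^[i] y) := by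
      intro y hy
      have := hno _ (Finset.mem_image.2 ⟨y, hy, rfl⟩)
      simpa using this
    have hxF : x ∉ F := by
      intro hxF
      obtain ⟨i, hi, hd⟩ := hnew x hxF
      rw [dist_self] at hd
      linarith
    have hP : P (K + 1) := by
      refine ⟨insert x F, ?_, by rw [Finset.card_insert_of_notMem hxF, hcard], ?_⟩
      · rw [Finset.coe_insert]
        exact insert_subset hx hF
      · intro y hy z hz hyz
        rcases Finset.mem_insert.1 hy with rfl | hy
        · rcases Finset.mem_insert.1 hz with rfl | hz
          · exact absurd rfl hyz
          · exact hnew z hz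
        · rcases Finset.mem_insert.1 hz with rfl | hz
          · obtain ⟨i, hi, hd⟩ := hnew y ‹_›
            exact ⟨i, hi, by rwa [dist_comm]⟩
          · exact hsep y hy z hz hyz
    have := Nat.le_findGreatest (hbd _ hP) hP
    omega

end Cov

open Dynamics Filter in
/-- Positive entropy forces many orbit segments at some fixed scale. -/
theorem exists_not_cov_of_lt_coverEntropy {X : Type*} [PseudoMetricSpace X] {M : Set X} {G : X → X}
    (hGM : MapsTo G M M) {h : ℝ}
    (hh : (h : EReal) < coverEntropy (MapsTo.restrict G M M hGM) univ) :
    ∃ δ > 0, ∀ n₀, ∃ n ≥ n₀, ¬ Cov G δ n M (Real.exp (h * n)) := by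
  by_contra! hcon
  refine absurd hh (not_lt.2 ?_)
  refine iSup₂_le fun U hU => ?_
  obtain ⟨δ, hδ, hδU⟩ := Metric.mem_uniformity_dist.1 hU
  obtain ⟨n₀, hn₀⟩ := hcon (δ / 2) (by positivity)
  refine _root_.Eventually.expGrowthSup_le ?_
  filter_upwards [eventually_ge_atTop n₀] with n hn
  classical
  obtain ⟨C, h1, h2, h3⟩ := hn₀ n hn
  have hit : ∀ (k : ℕ) (x : M), ((MapsTo.restrict G M M hGM)^[k] x : X) = G^[k] x := by
    intro k
    induction k with
    | zero => intro x; rfl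
    | succ k ih => intro x; rw [Function.iterate_succ_apply, ih, Function.iterate_succ_apply]; rfl
  let pt : Set X → Option M := fun B =>
    if hB : ∃ x : M, (x : X) ∈ B then some hB.choose else none
  have hcov : IsDynCoverOf (MapsTo.restrict G M M hGM) univ U n
      ((C.biUnion fun B => (pt B).toFinset : Finset M) : Set M) := by
    intro x _
    obtain ⟨B, hB, hxB⟩ := h3 x x.2
    have hex : ∃ x : M, (x : X) ∈ B := ⟨x, hxB⟩
    refine ⟨hex.choose, ?_, ?_⟩
    · simp only [Finset.coe_biUnion, mem_iUnion]
      refine ⟨B, hB, ?_⟩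
      have : pt B = some hex.choose := dif_pos hex
      simp [this]
    · refine mem_dynEntourage.2 fun k hk => hδU ?_
      have := h2 B hB x hxB _ hex.choose_spec k hk.le
      rw [Subtype.dist_eq, hit, hit]
      linarith
  have hle := hcov.coverMincard_le_card
  have hcard : ((C.biUnion fun B => (pt B).toFinset).card : ℝ) ≤ Real.exp (h * n) := by
    refine le_trans ?_ h1
    have : (C.biUnion fun B => (pt B).toFinset).card ≤ C.card * 1 := by
      refine Finset.card_biUnion_le_card_mul _ _ _ fun B _ => ?_
      cases pt B <;> simp
    exact_mod_cast this.trans (by simp)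
  have hexp : ((h : EReal) * (n : EReal)).exp = ENNReal.ofReal (Real.exp (h * n)) := by
    rw [← EReal.exp_coe, EReal.coe_mul, EReal.coe_natCast]
  rw [hexp]
  calc ((coverMincard (MapsTo.restrict G M M hGM) univ U n : ℕ∞) : ℝ≥0∞)
      ≤ (((C.biUnion fun B => (pt B).toFinset).card : ℕ∞) : ℝ≥0∞) := by exact_mod_cast hle
    _ ≤ ENNReal.ofReal (Real.exp (h * n)) := by
      rw [ENat.toENNReal_coe, ← ENNReal.ofReal_natCast]
      exact ENNReal.ofReal_le_ofReal hcard

section LoopErasure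

variable {X : Type*} [PseudoMetricSpace X] {g : X → X} {δ : ℝ} {p : ℕ}

theorem cov_image_of_forall_piece {Z ι : Type*} {n : ℕ} {S : Set Z} {b : ℝ} (φ : Z → X)
    (I : Finset ι) (P : ι → Set Z) (hS : ∀ x ∈ S, ∃ i ∈ I, x ∈ P i)
    (h : ∀ i ∈ I, Cov g δ n (φ '' (S ∩ P i)) b) : Cov g δ n (φ '' S) (I.card * b) := by
  have := cov_biUnion I (fun i => φ '' (S ∩ P i)) (fun _ => b) h
  rw [Finset.sum_const, nsmul_eq_mul] at this
  refine this.mono ?_ le_rfl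
  rintro _ ⟨x, hx, rfl⟩
  obtain ⟨i, hi, hxi⟩ := hS x hx
  simp only [mem_iUnion]
  exact ⟨i, hi, x, ⟨hx, hxi⟩, rfl⟩

/-- Coverings of orbit segments between the times `p * s` and `p * t`. -/
def StepCov (g : X → X) (δ : ℝ) (p s t : ℕ) (S : Set X) (b : ℝ) : Prop :=
  Cov g δ (p * (t - s)) (g^[p * s] '' S) b

theorem StepCov.mono {s t : ℕ} {S S' : Set X} {b b' : ℝ} (h : StepCov g δ p s t S b) (hS : S' ⊆ S)
    (hb : b ≤ b') : StepCov g δ p s t S' b' :=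
  Cov.mono h (image_mono hS) hb

theorem StepCov.mul {s t u : ℕ} {S : Set X} {b b' : ℝ} (h : StepCov g δ p s t S b)
    (h' : StepCov g δ p t u S b') (hst : s ≤ t) (htu : t ≤ u) : StepCov g δ p s u S (b * b') := by
  unfold StepCov at *
  have him : g^[p * (t - s)] '' (g^[p * s] '' S) = g^[p * t] '' S := by
    rw [← image_comp, ← Function.iterate_add, ← mul_add, Nat.sub_add_cancel hst]
  have := Cov.mul (k := p * (t - s)) (m := p * (u - t)) h (by rw [him]; exact h') (Nat.le_succ _)
  rwa [← mul_add, show t - s + (u - t) = u - s by omega] at this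

theorem prod_le_prod_of_subset_of_forall_one_le {ι : Type*} {e : ι → ℝ} (he : ∀ i, 1 ≤ e i)
    {s t : Finset ι} (hst : s ⊆ t) : ∏ i ∈ s, e i ≤ ∏ i ∈ t, e i := by
  classical
  rw [← Finset.prod_sdiff hst]
  refine le_mul_of_one_le_left (Finset.prod_nonneg fun i _ => zero_le_one.trans (he i)) ?_
  exact Finset.prod_induction _ (fun z => 1 ≤ z) (fun a b => one_le_mul_of_one_le_of_one_le) le_rfl
    fun i _ => he i

variable {M S : Set X} {Y : ℝ} {e : ℕ → ℝ} {κ : Type*} [Fintype κ] {L : ℕ} {I : Finset ℕ}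
  {cls : X → ℕ → κ} {C₁ h : ℝ}

theorem stepCov_of_bad (hg : MapsTo g M M) (hSM : S ⊆ M) (hY : Cov g δ p M Y)
    (he : ∀ i < L, i ∉ I → StepCov g δ p i (i + 1) S (e i)) {s t : ℕ} (hst : s ≤ t) (ht : t ≤ L)
    (hbad : ∀ i, s ≤ i → i < t → i ∉ I) :
    StepCov g δ p s t S (Y * ∏ i ∈ Finset.Ico s t \ I, e i) := by
  induction t, hst using Nat.le_induction with
  | base =>
    unfold StepCov
    simp only [Nat.sub_self, Nat.mul_zero, Finset.Ico_self, Finset.empty_sdiff, Finset.prod_empty, mul_one]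
    exact (hY.of_le (Nat.zero_le _)).mono
      ((image_mono hSM).trans (hg.iterate _).image_subset) le_rfl
  | succ t hst ih =>
    have h1 := ih (by omega) fun i hi hit => hbad i hi (by omega)
    have h2 := h1.mul (he t (by omega) (hbad t hst (by omega))) hst (Nat.le_succ t)
    have hset : Finset.Ico s (t + 1) \ I = insert t (Finset.Ico s t \ I) := by
      ext i
      simp only [Finset.mem_sdiff, Finset.mem_Ico, Finset.mem_insert]
      constructor
      · rintro ⟨⟨h1, h2⟩, h3⟩
        by_cases hit : i = t
        · exact Or.inl hit
        · exact Or.inr ⟨⟨h1, by omega⟩, h3⟩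
      · rintro (rfl | ⟨⟨h1, h2⟩, h3⟩)
        · exact ⟨⟨hst, by omega⟩, hbad i hst (by omega)⟩
        · exact ⟨⟨h1, by omega⟩, h3⟩
    rwa [hset, Finset.prod_insert (by simp), mul_comm (e t), ← mul_assoc]

/-- Orbit segments whose good times carry one of finitely many classes are covered economically,
as soon as loops from a class to itself are. -/
theorem stepCov_of_loops_aux (hg : MapsTo g M M) (hY1 : 1 ≤ Y) (hY : Cov g δ p M Y)
    (he1 : ∀ i, 1 ≤ e i) (hC1 : 1 ≤ C₁) (hh : 0 ≤ h)
    (hSM : S ⊆ M)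
    (he : ∀ i < L, i ∉ I → StepCov g δ p i (i + 1) S (e i))
    (hloop : ∀ a b q, a ∈ I → b ∈ I → a ≤ b → b < L →
      StepCov g δ p a b {x ∈ S | cls x a = q ∧ cls x b = q} (C₁ * Real.exp (h * (b - a : ℕ))))
    (k : ℕ) : ∀ (s : ℕ) (T : Set X) (Z : Finset κ), s ≤ L → T ⊆ S → Z.card = k →
      (∀ x ∈ T, ∀ i ∈ I, s ≤ i → i < L → cls x i ∈ Z) →
      StepCov g δ p s L T (Y * ((Fintype.card κ * L + 1 : ℕ) * (Y ^ 2 * C₁)) ^ k *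
        Real.exp (h * (L - s : ℕ)) * ∏ i ∈ Finset.Ico s L \ I, e i) := by
  classical
  have hprod1 : ∀ F : Finset ℕ, 1 ≤ ∏ i ∈ F, e i := fun F =>
    Finset.prod_induction _ (fun z => 1 ≤ z) (fun a b => one_le_mul_of_one_le_of_one_le) le_rfl
      fun i _ => he1 i
  induction k with
  | zero =>
    intro s T Z hs hT hZ hcls
    rw [Finset.card_eq_zero] at hZ
    subst hZ
    rcases T.eq_empty_or_nonempty with rfl | ⟨x, hx⟩
    · refine Cov.mono (cov_empty le_rfl) (by simp) ?_
      have := hprod1 (Finset.Ico s L \ I)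
      positivity
    · have := (stepCov_of_bad hg hSM hY he hs le_rfl (fun i hi hiL hiI => by
        simpa using hcls x hx i hiI hi hiL)).mono hT le_rfl
      refine this.mono subset_rfl ?_
      rw [pow_zero, mul_one]
      have h1 := hprod1 (Finset.Ico s L \ I)
      have h2 : 1 ≤ Real.exp (h * (L - s : ℕ)) := Real.one_le_exp (by positivity)
      have h3 : Y ≤ Y * Real.exp (h * (L - s : ℕ)) := le_mul_of_one_le_right (by linarith) h2
      exact mul_le_mul_of_nonneg_right h3 (by linarith)
  | succ k ih =>
    intro s T Z hs hT hZ hcls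
    set W : ℝ := (Fintype.card κ * L + 1 : ℕ) * (Y ^ 2 * C₁) with hW
    have hW1 : 1 ≤ W := by
      refine one_le_mul_of_one_le_of_one_le (by exact_mod_cast Nat.le_add_left _ _) ?_
      exact one_le_mul_of_one_le_of_one_le (one_le_pow₀ hY1) hC1
    by_cases hex : ∃ a, a ∈ I ∧ s ≤ a ∧ a < L ∧ T.Nonempty
    swap
    · rcases T.eq_empty_or_nonempty with rfl | hTne
      · refine Cov.mono (cov_empty le_rfl) (by simp) ?_
        have := hprod1 (Finset.Ico s L \ I)
        positivity
      · have := (stepCov_of_bad hg hSM hY he hs le_rfl (fun i hi hiL hiI =>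
          hex ⟨i, hiI, hi, hiL, hTne⟩)).mono hT le_rfl
        refine this.mono subset_rfl ?_
        have h1 := hprod1 (Finset.Ico s L \ I)
        have h2 : 1 ≤ Real.exp (h * (L - s : ℕ)) := Real.one_le_exp (by positivity)
        have h3 : 1 ≤ W ^ (k + 1) := one_le_pow₀ hW1
        refine mul_le_mul_of_nonneg_right ?_ (by linarith)
        rw [mul_assoc]
        exact le_mul_of_one_le_right (by linarith) (one_le_mul_of_one_le_of_one_le h3 h2)
    obtain ⟨ha, hsa, haL, hTne⟩ := Nat.find_spec hex
    have hmin : ∀ i, s ≤ i → i < Nat.find hex → i ∉ I := fun i hi hlt hiI =>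
      Nat.find_min hex hlt ⟨hiI, hi, by omega, hTne⟩
    generalize Nat.find hex = a at ha hsa haL hmin
    have hκ : (Finset.univ ×ˢ Finset.range L : Finset (κ × ℕ)).card = Fintype.card κ * L := by
      rw [Finset.card_product, Finset.card_univ, Finset.card_range]
    have hpieces := cov_image_of_forall_piece (g := g) (δ := δ) (n := p * (L - s)) (S := T)
      (b := Y ^ 2 * C₁ * (Y * W ^ k * Real.exp (h * (L - s : ℕ)) * ∏ i ∈ Finset.Ico s L \ I, e i))
      (g^[p * s]) (Finset.univ ×ˢ Finset.range L : Finset (κ × ℕ))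
      (fun z => {x | z.2 ∈ I ∧ a ≤ z.2 ∧ cls x a = z.1 ∧ cls x z.2 = z.1 ∧
        ∀ i ∈ I, z.2 < i → i < L → cls x i ≠ z.1}) ?_ ?_
    · refine StepCov.mono hpieces subset_rfl ?_
      have h1 := hprod1 (Finset.Ico s L \ I)
      rw [hκ]
      calc _ ≤ ((Fintype.card κ * L + 1 : ℕ) : ℝ) * (Y ^ 2 * C₁ * (Y * W ^ k *
            Real.exp (h * (L - s : ℕ)) * ∏ i ∈ Finset.Ico s L \ I, e i)) := by
            refine mul_le_mul_of_nonneg_right (by exact_mod_cast Nat.le_succ _) (by positivity)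
        _ = _ := by rw [hW]; ring
    · intro x hx
      let F := (Finset.range L).filter fun b => b ∈ I ∧ cls x b = cls x a
      have haF : a ∈ F := by simp [F, haL, ha]
      have hb := F.max'_mem ⟨a, haF⟩
      have hmax := fun i hi => F.le_max' i hi
      have hab := F.le_max' a haF
      generalize hbdef : F.max' ⟨a, haF⟩ = b at hb hmax hab
      simp only [F, Finset.mem_filter, Finset.mem_range] at hb
      refine ⟨(cls x a, b), by simp [hb.1], hb.2.1, hab, rfl, hb.2.2, ?_⟩
      intro i hi hbi hiL hc
      exact absurd (hmax i (by simp [F, hi, hiL, hc])) (not_le.2 (hbdef ▸ hbi))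
    · rintro ⟨q, b⟩ hqb
      simp only [Finset.mem_product, Finset.mem_univ, Finset.mem_range, true_and] at hqb
      have hWpos : 0 ≤ W := by positivity
      rcases (T ∩ {x | b ∈ I ∧ a ≤ b ∧ cls x a = q ∧ cls x b = q ∧
        ∀ i ∈ I, b < i → i < L → cls x i ≠ q}).eq_empty_or_nonempty with hem | ⟨x₀, hx₀T, hbI, hab, hx₀a, -, -⟩
      · simp only [hem, image_empty]
        have := hprod1 (Finset.Ico s L \ I)
        exact cov_empty (by positivity)
      set T' := T ∩ {x | b ∈ I ∧ a ≤ b ∧ cls x a = q ∧ cls x b = q ∧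
        ∀ i ∈ I, b < i → i < L → cls x i ≠ q} with hT'
      have hqZ : q ∈ Z := hx₀a ▸ hcls x₀ hx₀T a ha hsa haL
      have hT'S : T' ⊆ S := inter_subset_left.trans hT
      have h1 : StepCov g δ p s a T' (Y * ∏ i ∈ Finset.Ico s a \ I, e i) :=
        (stepCov_of_bad hg hSM hY he hsa haL.le hmin).mono hT'S le_rfl
      have h2 : StepCov g δ p a b T' (C₁ * Real.exp (h * (b - a : ℕ))) :=
        (hloop a b q ha hbI hab hqb).mono (fun x hx => ⟨hT'S hx, hx.2.2.2.1, hx.2.2.2.2.1⟩) le_rfl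
      have h3 : StepCov g δ p b (b + 1) T' Y := by
        unfold StepCov
        rw [Nat.add_sub_cancel_left, mul_one]
        exact hY.mono ((image_mono (hT'S.trans hSM)).trans (hg.iterate _).image_subset) le_rfl
      have h4 := ih (b + 1) T' (Z.erase q) (by omega) hT'S
        (by rw [Finset.card_erase_of_mem hqZ]; omega)
        (fun x hx i hi hbi hiL => Finset.mem_erase.2
          ⟨hx.2.2.2.2.2 i hi (by omega) hiL, hcls x hx.1 i hi (by omega) hiL⟩)
      have h5 := ((h1.mul h2 hsa hab).mul h3 (by omega) (by omega)).mul h4 (by omega) (by omega)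
      refine StepCov.mono h5 subset_rfl ?_
      have hp : (∏ i ∈ Finset.Ico s a \ I, e i) * ∏ i ∈ Finset.Ico (b + 1) L \ I, e i ≤
          ∏ i ∈ Finset.Ico s L \ I, e i := by
        rw [← Finset.prod_union]
        · refine prod_le_prod_of_subset_of_forall_one_le he1 ?_
          intro i hi
          simp only [Finset.mem_union, Finset.mem_sdiff, Finset.mem_Ico] at hi ⊢
          rcases hi with hi | hi
          · exact ⟨⟨hi.1.1, by omega⟩, hi.2⟩
          · exact ⟨⟨by omega, hi.1.2⟩, hi.2⟩
        · rw [Finset.disjoint_left]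
          intro i hi hi'
          simp only [Finset.mem_sdiff, Finset.mem_Ico] at hi hi'
          omega
      have hexp : Real.exp (h * (b - a : ℕ)) * Real.exp (h * (L - (b + 1) : ℕ)) ≤
          Real.exp (h * (L - s : ℕ)) := by
        rw [← Real.exp_add, ← mul_add, ← Nat.cast_add]
        refine Real.exp_le_exp.2 (mul_le_mul_of_nonneg_left ?_ hh)
        exact_mod_cast (by omega : b - a + (L - (b + 1)) ≤ L - s)
      calc _ = Y ^ 2 * C₁ * (Y * W ^ k * (Real.exp (h * (b - a : ℕ)) *
            Real.exp (h * (L - (b + 1) : ℕ))) * ((∏ i ∈ Finset.Ico s a \ I, e i) *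
            ∏ i ∈ Finset.Ico (b + 1) L \ I, e i)) := by ring
        _ ≤ _ := by
          have := hprod1 (Finset.Ico s a \ I)
          have := hprod1 (Finset.Ico (b + 1) L \ I)
          gcongr

theorem stepCov_of_loops (hg : MapsTo g M M) (hY1 : 1 ≤ Y) (hY : Cov g δ p M Y)
    (he1 : ∀ i, 1 ≤ e i) (hC1 : 1 ≤ C₁) (hh : 0 ≤ h)
    (hSM : S ⊆ M)
    (he : ∀ i < L, i ∉ I → StepCov g δ p i (i + 1) S (e i))
    (hloop : ∀ a b q, a ∈ I → b ∈ I → a ≤ b → b < L →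
      StepCov g δ p a b {x ∈ S | cls x a = q ∧ cls x b = q} (C₁ * Real.exp (h * (b - a : ℕ)))) :
    Cov g δ (p * L) S (Y * ((Fintype.card κ * L + 1 : ℕ) * (Y ^ 2 * C₁)) ^ Fintype.card κ *
        Real.exp (h * L) * ∏ i ∈ Finset.range L \ I, e i) := by
  have := stepCov_of_loops_aux hg hY1 hY he1 hC1 hh hSM he hloop (Fintype.card κ) 0 S Finset.univ
    (Nat.zero_le _) subset_rfl Finset.card_univ (fun x _ i _ _ _ => Finset.mem_univ _)
  simpa [StepCov, ← Finset.range_eq_Ico] using this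

end LoopErasure

section Scales

variable {X : Type*} [PseudoMetricSpace X] {g : X → X} {δ : ℝ} {M : Set X} {Y : ℝ}

/-- If points with small defect are covered economically, then so are the points whose defect is
small on average along the orbit. -/
theorem cov_of_average_le (hg : MapsTo g M M) (hY1 : 1 ≤ Y) (hY : Cov g δ 0 M Y) {n : ℕ}
    {D : X → ℝ} (hD : ∀ x ∈ M, 0 ≤ D x) {θ h b : ℝ} (hθ : 0 < θ) (hn : 1 ≤ n) (hh : 0 ≤ h)
    (hcov : Cov g δ n {x ∈ M | D x ≤ θ} (Real.exp (h * n))) (R : ℕ) :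
    Cov g δ (n * R) {x ∈ M | ∑ j ∈ Finset.range R, D (g^[n * j] x) ≤ b}
      (2 ^ R * (Y ^ (n + 1) * Real.exp (h * (n * R)) * Real.exp (2 * n * Real.log Y * (b / θ)))) := by
  classical
  have hYn := cov_pow hY hg n
  have hlogY : 0 ≤ Real.log Y := Real.log_nonneg hY1
  have := cov_of_forall_piece (g := g) (δ := δ) (n := n * R)
    (S := {x ∈ M | ∑ j ∈ Finset.range R, D (g^[n * j] x) ≤ b})
    (b := Y ^ (n + 1) * Real.exp (h * (n * R)) * Real.exp (2 * n * Real.log Y * (b / θ)))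
    (Finset.range R).powerset
    (fun B => {x | B = (Finset.range R).filter fun j => θ < D (g^[n * j] x)}) ?_ ?_
  · simpa [Finset.card_powerset] using this
  · intro x hx
    exact ⟨_, Finset.mem_powerset.2 (Finset.filter_subset _ _), rfl⟩
  · intro B hB
    set S := {x ∈ M | ∑ j ∈ Finset.range R, D (g^[n * j] x) ≤ b} ∩
      {x | B = (Finset.range R).filter fun j => θ < D (g^[n * j] x)} with hS
    rcases S.eq_empty_or_nonempty with hem | ⟨x₀, hx₀⟩
    · rw [hem]; exact cov_empty (by positivity)
    have hcard : (B.card : ℝ) ≤ b / θ := by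
      rw [le_div_iff₀ hθ]
      refine le_trans ?_ hx₀.1.2
      have h1 : ∑ j ∈ B, θ ≤ ∑ j ∈ B, D (g^[n * j] x₀) := Finset.sum_le_sum fun j hj => by
        rw [hx₀.2] at hj
        exact (Finset.mem_filter.1 hj).2.le
      rw [Finset.sum_const, nsmul_eq_mul] at h1
      exact h1.trans (Finset.sum_le_sum_of_subset_of_nonneg (Finset.mem_powerset.1 hB)
        fun j _ _ => hD _ (hg.iterate _ hx₀.1.1))
    have hSM : S ⊆ M := fun x hx => hx.1.1
    let e : ℕ → ℝ := fun i => Real.exp (h * n) * if i ∈ B then Y ^ (n + 1) else 1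
    have key := stepCov_of_bad (g := g) (δ := δ) (p := n) (M := M) (S := S) (Y := Y ^ (n + 1))
      (e := e) (L := R) (I := ∅) hg hSM hYn ?_ (Nat.zero_le R) le_rfl (by simp)
    · unfold StepCov at key
      simp only [Nat.sub_zero, mul_zero, Function.iterate_zero, image_id, Finset.sdiff_empty] at key
      refine key.mono subset_rfl ?_
      rw [mul_assoc]
      refine mul_le_mul_of_nonneg_left ?_ (by positivity)
      rw [Finset.prod_mul_distrib]
      have h1 : ∏ i ∈ Finset.Ico 0 R, Real.exp (h * n) = Real.exp (h * (n * R)) := by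
        rw [Finset.prod_const, ← Real.exp_nat_mul]
        congr 1
        simp; ring
      rw [h1]
      refine mul_le_mul_of_nonneg_left ?_ (by positivity)
      rw [Finset.prod_ite, Finset.prod_const_one, mul_one, Finset.prod_const, ← pow_mul]
      have h2 : ({x ∈ Finset.Ico 0 R | x ∈ B} : Finset ℕ).card ≤ B.card :=
        Finset.card_le_card fun i hi => (Finset.mem_filter.1 hi).2
      calc Y ^ ((n + 1) * _) ≤ Y ^ (2 * n * B.card) := by
            refine pow_le_pow_right₀ hY1 (Nat.mul_le_mul (by omega) h2)
        _ = Real.exp (2 * n * Real.log Y * B.card) := by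
            rw [show 2 * (n : ℝ) * Real.log Y * B.card = (2 * n * B.card : ℕ) * Real.log Y by
              push_cast; ring, Real.exp_nat_mul, Real.exp_log (by linarith)]
        _ ≤ _ := Real.exp_le_exp.2 (mul_le_mul_of_nonneg_left hcard (by positivity))
    · intro i hi _
      unfold StepCov
      rw [Nat.add_sub_cancel_left, mul_one]
      have hexp : 1 ≤ Real.exp (h * n) := Real.one_le_exp (by positivity)
      by_cases hiB : i ∈ B
      · simp only [e, hiB, if_true]
        exact hYn.mono ((image_mono hSM).trans (hg.iterate _).image_subset)
          (le_mul_of_one_le_left (by positivity) hexp)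
      · simp only [e, hiB, if_false, mul_one]
        refine hcov.mono ?_ le_rfl
        rintro _ ⟨x, hx, rfl⟩
        refine ⟨hg.iterate _ (hSM hx), ?_⟩
        by_contra hlt
        refine hiB ?_
        rw [hx.2]
        exact Finset.mem_filter.2 ⟨Finset.mem_range.2 hi, not_le.1 hlt⟩

theorem sum_range_mul_eq (f : ℕ → ℝ) (R q : ℕ) :
    ∑ j ∈ Finset.range (R * q), f j = ∑ j ∈ Finset.range R, ∑ i ∈ Finset.range q, f (j * q + i) := by
  induction R with
  | zero => simp
  | succ R ih => rw [Nat.succ_mul, Finset.sum_range_add, ih, Finset.sum_range_succ]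

/-- A subadditive cocycle is almost additive at a suitable scale along most of any orbit;
so it suffices to cover almost additive orbit segments. -/
theorem cov_of_almost_additive (hg : MapsTo g M M) (hY1 : 1 ≤ Y) (hY : Cov g δ 0 M Y)
    {V : ℕ → X → ℝ} {A θ h h₀ : ℝ} (hV0 : ∀ n, ∀ x ∈ M, 0 ≤ V n x)
    (hVA : ∀ n, ∀ x ∈ M, V n x ≤ A * n)
    (hsub : ∀ q n, ∀ x ∈ M, V (n * q) x ≤ ∑ i ∈ Finset.range q, V n (g^[n * i] x))
    (hA : 0 < A) (hθ : 0 < θ) (hh : 0 ≤ h) (hh₀ : h < h₀) {m₀ : ℕ} (hm₀ : 1 ≤ m₀)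
    (H : ∀ m ≥ m₀, ∀ q₀, ∃ q ≥ q₀, Cov g δ (m * q)
      {x ∈ M | ∑ i ∈ Finset.range q, V m (g^[m * i] x) - V (m * q) x ≤ θ * (m * q : ℕ)}
      (Real.exp (h * (m * q : ℕ)))) :
    ∃ N₀, ∀ N ≥ N₀, Cov g δ N M (Real.exp (h₀ * N)) := by
  classical
  have hlogY : 0 ≤ Real.log Y := Real.log_nonneg hY1
  set d := (h₀ - h) / 4 with hd
  have hdpos : 0 < d := by simp only [hd]; linarith
  obtain ⟨l, hl⟩ := exists_nat_gt (Real.log 2 / d)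
  obtain ⟨K, hK⟩ := exists_nat_gt (2 * Real.log Y * A / (θ * d))
  have hlog2 : 0 < Real.log 2 := Real.log_pos (by norm_num)
  have hKpos : 0 < K := by
    have : (0 : ℝ) < K := lt_of_le_of_lt (by positivity) hK
    exact_mod_cast this
  have hKr : (0 : ℝ) < K := by exact_mod_cast hKpos
  have hH' : ∀ m, ∃ q, 1 ≤ q ∧ (m₀ ≤ m → l ≤ q ∧ Cov g δ (m * q)
      {x ∈ M | ∑ i ∈ Finset.range q, V m (g^[m * i] x) - V (m * q) x ≤ θ * (m * q : ℕ)}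
      (Real.exp (h * (m * q : ℕ)))) := by
    intro m
    by_cases hm : m₀ ≤ m
    · obtain ⟨q, hq, hc⟩ := H m hm (max 1 l)
      exact ⟨q, (le_max_left _ _).trans hq, fun _ => ⟨(le_max_right _ _).trans hq, hc⟩⟩
    · exact ⟨1, le_rfl, fun h => absurd h hm⟩
  choose q hq1 hq using hH'
  let m : ℕ → ℕ := fun k => Nat.rec m₀ (fun _ a => a * q a) k
  have hms : ∀ k, m (k + 1) = m k * q (m k) := fun k => rfl
  have hmz : m 0 = m₀ := rfl
  clear_value m
  have hm1 : ∀ k, m₀ ≤ m k := by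
    intro k
    induction k with
    | zero => exact hmz.ge
    | succ k ih => rw [hms]; exact ih.trans (Nat.le_mul_of_pos_right _ (hq1 _))
  have hmpos : ∀ k, 1 ≤ m k := fun k => hm₀.trans (hm1 k)
  have hml : ∀ k, l ≤ m (k + 1) := fun k => by
    rw [hms]; exact ((hq _ (hm1 k)).1).trans (Nat.le_mul_of_pos_left _ (hmpos k))
  have hdvd : ∀ k j, m k ∣ m (k + j) := by
    intro k j
    induction j with
    | zero => exact dvd_rfl
    | succ j ih => exact ih.trans ⟨_, hms _⟩
  set Pd := m K with hPd
  have hdvd' : ∀ k ≤ K, m k ∣ Pd := fun k hk => by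
    obtain ⟨j, rfl⟩ := Nat.exists_eq_add_of_le hk
    exact hdvd k j
  -- the bound for multiples of `Pd`
  have main : ∀ R : ℕ, Cov g δ (Pd * R) M
      (K * (Y ^ (Pd + 1) * Real.exp ((h + 2 * d) * (Pd * R : ℕ)))) := by
    intro R
    let Rk : ℕ → ℕ := fun k => Pd / m k * R
    have hRk : ∀ k ≤ K, m k * Rk k = Pd * R := fun k hk => by
      simp only [Rk]; rw [← mul_assoc, Nat.mul_div_cancel' (hdvd' k hk)]
    have hRkq : ∀ k < K, Rk k = Rk (k + 1) * q (m k) := by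
      intro k hk
      have h1 := hRk k hk.le
      have h2 := hRk (k + 1) hk
      rw [hms, mul_assoc, ← h1] at h2
      have := Nat.eq_of_mul_eq_mul_left (hmpos k) h2
      rw [← this, mul_comm]
    let W : ℕ → X → ℝ := fun k x => ∑ j ∈ Finset.range (Rk k), V (m k) (g^[m k * j] x)
    let D : ℕ → X → ℝ := fun k x =>
      ∑ i ∈ Finset.range (q (m k)), V (m k) (g^[m k * i] x) - V (m k * q (m k)) x
    have hWD : ∀ k < K, ∀ x, ∑ j ∈ Finset.range (Rk (k + 1)), D k (g^[m (k + 1) * j] x) =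
        W k x - W (k + 1) x := by
      intro k hk x
      simp only [D, W]
      rw [Finset.sum_sub_distrib, hRkq k hk,
        sum_range_mul_eq (fun j => V (m k) (g^[m k * j] x)) (Rk (k + 1)) (q (m k))]
      congr 1
      swap
      · rw [hms]
      refine Finset.sum_congr rfl fun j _ => Finset.sum_congr rfl fun i _ => ?_
      rw [← Function.iterate_add_apply, hms]
      congr 2
      ring
    have hpieces := cov_of_forall_piece (g := g) (δ := δ) (n := Pd * R) (S := M)
      (b := Y ^ (Pd + 1) * Real.exp ((h + 2 * d) * (Pd * R : ℕ))) (Finset.range K)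
      (fun k => {x | W k x - W (k + 1) x ≤ A / K * (Pd * R : ℕ)}) ?_ ?_
    · simpa using hpieces
    · intro x hx
      by_contra! hcon
      have h1 : ∑ k ∈ Finset.range K, A / K * (Pd * R : ℕ) <
          ∑ k ∈ Finset.range K, (W k x - W (k + 1) x) :=
        Finset.sum_lt_sum_of_nonempty (by simpa using hKpos.ne') fun k hk => by
          exact not_le.1 fun h => absurd (hcon k hk) (not_not.2 h)
      rw [Finset.sum_range_sub', Finset.sum_const, nsmul_eq_mul, Finset.card_range] at h1
      have h2 : W 0 x ≤ A * (Pd * R : ℕ) := by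
        have : W 0 x ≤ Rk 0 * (A * (Nat.cast (m 0) : ℝ)) := by
          have := Finset.sum_le_card_nsmul (Finset.range (Rk 0)) (fun j => V (m 0) (g^[m 0 * j] x))
            (A * (Nat.cast (m 0) : ℝ)) fun j _ => hVA (m 0) (g^[m 0 * j] x) (hg.iterate _ hx)
          rwa [nsmul_eq_mul, Finset.card_range] at this
        refine this.trans (le_of_eq ?_)
        rw [← hRk 0 (Nat.zero_le _)]
        push_cast; ring
      have h3 : 0 ≤ W K x := Finset.sum_nonneg fun j _ => hV0 _ _ (hg.iterate _ hx)
      have h4 : (K : ℝ) * (A / K * (Pd * R : ℕ)) = A * (Pd * R : ℕ) := by field_simp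
      linarith
    · intro k hk
      have hk := Finset.mem_range.1 hk
      have hmp : (0 : ℝ) < m (k + 1) := by exact_mod_cast hmpos (k + 1)
      have hc := cov_of_average_le (n := m (k + 1)) (D := D k) (θ := θ * m (k + 1)) (h := h)
        (b := A / K * (Pd * R : ℕ)) hg hY1 hY ?_ (by positivity) (hmpos (k + 1)) hh
        (by
          have := (hq (m k) (hm1 k)).2
          rw [hms]; exact this) (Rk (k + 1))
      · have hn := hRk (k + 1) hk
        rw [hn] at hc
        refine hc.mono ?_ ?_
        · rintro x ⟨hx, hx2⟩
          exact ⟨hx, by rw [hWD k hk]; exact hx2⟩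
        · have hn' : (m (k + 1) : ℝ) * Rk (k + 1) = (Pd * R : ℕ) := by exact_mod_cast hn
          have e1 : (2 : ℝ) ^ Rk (k + 1) ≤ Real.exp (d * (Pd * R : ℕ)) := by
            rw [← Real.rpow_natCast, Real.rpow_def_of_pos (by norm_num)]
            refine Real.exp_le_exp.2 ?_
            rw [← hn']
            have hl1 : (l : ℝ) ≤ m (k + 1) := by exact_mod_cast hml k
            have : Real.log 2 ≤ d * m (k + 1) := by
              rw [div_lt_iff₀ hdpos] at hl
              nlinarith
            calc Real.log 2 * Rk (k + 1) ≤ d * m (k + 1) * Rk (k + 1) :=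
                  mul_le_mul_of_nonneg_right this (by positivity)
              _ = _ := by ring
          have e2 : Real.exp (2 * m (k + 1) * Real.log Y * (A / K * (Pd * R : ℕ) / (θ * m (k + 1))))
              ≤ Real.exp (d * (Pd * R : ℕ)) := by
            refine Real.exp_le_exp.2 ?_
            have : 2 * m (k + 1) * Real.log Y * (A / K * (Pd * R : ℕ) / (θ * m (k + 1))) =
              (2 * Real.log Y * A / θ / K) * (Pd * R : ℕ) := by field_simp
            rw [this]
            refine mul_le_mul_of_nonneg_right ?_ (by positivity)
            rw [div_lt_iff₀ (by positivity)] at hK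
            rw [div_div, div_le_iff₀ (by positivity)]
            linarith [mul_comm θ d]
          have e3 : Y ^ (m (k + 1) + 1) ≤ Y ^ (Pd + 1) := pow_le_pow_right₀ hY1
            (Nat.succ_le_succ (Nat.le_of_dvd (hmpos K) (hdvd' _ hk)))
          rw [hn']
          have e4 : Real.exp ((h + 2 * d) * (Pd * R : ℕ)) = Real.exp (d * (Pd * R : ℕ)) *
              (Real.exp (h * (Pd * R : ℕ)) * Real.exp (d * (Pd * R : ℕ))) := by
            rw [← Real.exp_add, ← Real.exp_add]; congr 1; ring
          rw [e4]
          calc _ ≤ Real.exp (d * (Pd * R : ℕ)) * (Y ^ (Pd + 1) * Real.exp (h * (Pd * R : ℕ)) *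
                Real.exp (d * (Pd * R : ℕ))) := by gcongr
            _ = _ := by ring
      · intro x hx
        have := hsub (q (m k)) (m k) x hx
        simp only [D]; linarith
  obtain ⟨N₀, hN₀⟩ := exists_nat_gt (Real.log (Y * K * Y ^ (Pd + 1) * Y ^ (Pd + 1)) / (2 * d))
  refine ⟨N₀, fun N hN => ?_⟩
  have hNd := Nat.div_add_mod N Pd
  have hmod := Nat.mod_lt N (hmpos K)
  have hc := (main (N / Pd)).mul (k := Pd * (N / Pd)) (m := N % Pd)
    (((cov_pow hY hg Pd).of_le hmod.le).mono (hg.iterate _).image_subset le_rfl) (Nat.le_succ _)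
  rw [hNd] at hc
  refine hc.mono subset_rfl ?_
  have hYp : (0 : ℝ) < Y := by linarith
  have hB : (0:ℝ) < Y * K * Y ^ (Pd + 1) * Y ^ (Pd + 1) := by positivity
  have h1 : Y * K * Y ^ (Pd + 1) * Y ^ (Pd + 1) ≤ Real.exp (2 * d * N) := by
    rw [← Real.log_le_iff_le_exp hB]
    rw [div_lt_iff₀ (by positivity)] at hN₀
    have : (N₀ : ℝ) ≤ N := by exact_mod_cast hN
    nlinarith
  have h2 : Real.exp ((h + 2 * d) * (Pd * (N / Pd) : ℕ)) ≤ Real.exp ((h + 2 * d) * N) := by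
    refine Real.exp_le_exp.2 (mul_le_mul_of_nonneg_left ?_ (by positivity))
    exact_mod_cast Nat.mul_div_le N Pd
  have h3 : Real.exp (h₀ * N) = Real.exp (2 * d * N) * Real.exp ((h + 2 * d) * N) := by
    rw [← Real.exp_add]; congr 1; simp only [hd]; ring
  rw [h3]
  calc _ ≤ 1 * (K * (Y ^ (Pd + 1) * Real.exp ((h + 2 * d) * N))) * Y ^ (Pd + 1) := by
        rw [one_mul]; gcongr
    _ ≤ Y * (K * (Y ^ (Pd + 1) * Real.exp ((h + 2 * d) * N))) * Y ^ (Pd + 1) := by gcongr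
    _ = (Y * K * Y ^ (Pd + 1) * Y ^ (Pd + 1)) * Real.exp ((h + 2 * d) * N) := by ring
    _ ≤ _ := mul_le_mul_of_nonneg_right h1 (by positivity)

end Scales

/-- A parametrization of `M` around `x` with quantitative bounds: it is defined on a disk of radius
`r`, covers the points of `M` at distance at most `ρ` from `x`, and is controlled by `K`. -/
def HasChart {N : ℕ} (M : Set (EuclideanSpace ℝ (Fin N))) (r ρ K : ℝ)
    (x : EuclideanSpace ℝ (Fin N)) : Prop :=
  ∃ (φ : EuclideanSpace ℝ (Fin 2) → EuclideanSpace ℝ (Fin N)) (u : EuclideanSpace ℝ (Fin 2)),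
    φ u = x ∧ (∀ v ∈ Metric.ball u r, φ v ∈ M) ∧
    (∀ y ∈ M, ‖y - x‖ ≤ ρ → ∃ v ∈ Metric.ball u r, φ v = y) ∧
    (∀ v ∈ Metric.ball u r, HasFDerivAt φ (fderiv ℝ φ v) v) ∧
    (∀ v ∈ Metric.ball u r, ‖fderiv ℝ φ v‖ ≤ K) ∧
    (∀ v ∈ Metric.ball u r, ∀ ξ, ‖ξ‖ ≤ K * ‖fderiv ℝ φ v ξ‖) ∧
    (∀ v ∈ Metric.ball u r, ∀ w ∈ Metric.ball u r, ‖fderiv ℝ φ v - fderiv ℝ φ w‖ ≤ K * ‖v - w‖) ∧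
    ∀ v ∈ Metric.ball u r, ∀ w ∈ Metric.ball u r, ‖v - w‖ ≤ K * ‖φ v - φ w‖

section Charts

variable {N : ℕ} {M : Set (EuclideanSpace ℝ (Fin N))} {r ρ K : ℝ} {x : EuclideanSpace ℝ (Fin N)}

theorem HasChart.mono (h : HasChart M r ρ K x) {r' ρ' K' : ℝ} (hr : r' ≤ r) (hρ : ρ' ≤ ρ)
    (hK0 : 0 ≤ K) (hK : K ≤ K') (hr0 : 0 < r') (hlt : K' * ρ' < r') : HasChart M r' ρ' K' x := by
  obtain ⟨φ, u, h1, h2, h3, h4, h5, h6, h7, h8⟩ := h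
  have hsub : Metric.ball u r' ⊆ Metric.ball u r := Metric.ball_subset_ball hr
  refine ⟨φ, u, h1, fun v hv => h2 v (hsub hv), ?_, fun v hv => h4 v (hsub hv),
    fun v hv => (h5 v (hsub hv)).trans hK,
    fun v hv ξ => (h6 v (hsub hv) ξ).trans (mul_le_mul_of_nonneg_right hK (norm_nonneg _)),
    fun v hv w hw => (h7 v (hsub hv) w (hsub hw)).trans
      (mul_le_mul_of_nonneg_right hK (norm_nonneg _)),
    fun v hv w hw => (h8 v (hsub hv) w (hsub hw)).trans
      (mul_le_mul_of_nonneg_right hK (norm_nonneg _))⟩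
  intro y hy hyx
  obtain ⟨v, hv, hvy⟩ := h3 y hy (hyx.trans hρ)
  refine ⟨v, ?_, hvy⟩
  have hu : u ∈ Metric.ball u r := Metric.mem_ball_self (hr0.trans_le hr)
  rw [mem_ball_iff_norm]
  calc ‖v - u‖ ≤ K * ‖φ v - φ u‖ := h8 v hv u hu
    _ ≤ K' * ρ' := by
      rw [hvy, h1]
      exact mul_le_mul hK hyx (norm_nonneg _) (hK0.trans hK)
    _ < r' := hlt

theorem exists_hasChart_nhds (hM : IsSmoothSubmanifold 2 M) {x₀ : EuclideanSpace ℝ (Fin N)}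
    (hx₀ : x₀ ∈ M) : ∃ r > 0, ∃ ρ > 0, ∃ K > 0, ∃ η > 0, ∀ x ∈ M, ‖x - x₀‖ < η →
      HasChart M r ρ K x := by
  obtain ⟨U, V, φ, ψ, hU, hV, hxV, hφ, hinj, hbij, hψ, hψφ⟩ := hM x₀ hx₀
  obtain ⟨u₀, hu₀, rfl⟩ := hbij.surjOn ⟨hx₀, hxV⟩
  have hψ' : ∀ y ∈ M ∩ V, ψ y ∈ U ∧ φ (ψ y) = y := by
    intro y hy
    obtain ⟨u, hu, rfl⟩ := hbij.surjOn hy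
    rw [hψφ u hu]
    exact ⟨hu, rfl⟩
  have hat : ContDiffAt ℝ 2 φ u₀ := (hφ.contDiffAt (hU.mem_nhds hu₀)).of_le
    (WithTop.coe_le_coe.2 (le_top : (2 : ℕ∞) ≤ ⊤))
  have hdiff : ∀ v ∈ U, HasFDerivAt φ (fderiv ℝ φ v) v := fun v hv =>
    ((hφ.contDiffAt (hU.mem_nhds hv)).differentiableAt (by simp)).hasFDerivAt
  have hinj₀ : Function.Injective (fderiv ℝ φ u₀) := by
    have := hinj u₀ hu₀
    rwa [fderivWithin_of_isOpen hU hu₀] at this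
  obtain ⟨K₁, s, hs, hlip⟩ :=
    (hat.fderiv_right (m := 1) (by norm_num)).exists_lipschitzOnWith
  obtain ⟨K₂, hK₂, hanti⟩ := (fderiv ℝ φ u₀).toLinearMap.exists_antilipschitzWith
    (LinearMap.ker_eq_bot.2 hinj₀)
  have hanti' : ∀ ξ, ‖ξ‖ ≤ K₂ * ‖fderiv ℝ φ u₀ ξ‖ := fun ξ => by
    simpa using hanti.le_mul_dist ξ 0
  have hK₂' : (0 : ℝ) < K₂ := hK₂
  set c : ℝ := 1 / (2 * K₂) with hc
  have hcpos : 0 < c := by positivity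
  obtain ⟨R₀, hR₀, hball⟩ := Metric.mem_nhds_iff.1 (Filter.inter_mem hs (hU.mem_nhds hu₀))
  set R := min R₀ (c / (K₁ + 1)) with hR
  have hRpos : 0 < R := by positivity
  have hsubs : Metric.ball u₀ R ⊆ s ∩ U := (Metric.ball_subset_ball (min_le_left _ _)).trans hball
  have hu₀R : u₀ ∈ Metric.ball u₀ R := Metric.mem_ball_self hRpos
  have hclose : ∀ v ∈ Metric.ball u₀ R, ‖fderiv ℝ φ v - fderiv ℝ φ u₀‖ ≤ c := by
    intro v hv
    have h1 := hlip.norm_sub_le (hsubs hv).1 (hsubs hu₀R).1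
    rw [mem_ball_iff_norm] at hv
    have h2 : (K₁ : ℝ) * ‖v - u₀‖ ≤ (K₁ + 1) * (c / (K₁ + 1)) := by
      refine mul_le_mul (by linarith) (hv.le.trans (min_le_right _ _)) (norm_nonneg _) (by positivity)
    rw [mul_div_cancel₀ _ (by positivity : (K₁ : ℝ) + 1 ≠ 0)] at h2
    linarith
  have hlow : ∀ v ∈ Metric.ball u₀ R, ∀ ξ, ‖ξ‖ ≤ 2 * K₂ * ‖fderiv ℝ φ v ξ‖ := by
    intro v hv ξ
    have h1 := (fderiv ℝ φ v - fderiv ℝ φ u₀).le_of_opNorm_le (hclose v hv) ξ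
    have h2 := hanti' ξ
    have h3 : ‖fderiv ℝ φ u₀ ξ‖ ≤ ‖fderiv ℝ φ v ξ‖ + c * ‖ξ‖ := by
      rw [sub_apply] at h1
      calc ‖fderiv ℝ φ u₀ ξ‖ = ‖fderiv ℝ φ v ξ - (fderiv ℝ φ v ξ - fderiv ℝ φ u₀ ξ)‖ := by abel_nf
        _ ≤ _ := (norm_sub_le _ _).trans (by linarith)
    have h4 : K₂ * ‖fderiv ℝ φ u₀ ξ‖ ≤ K₂ * (‖fderiv ℝ φ v ξ‖ + c * ‖ξ‖) :=
      mul_le_mul_of_nonneg_left h3 hK₂'.le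
    have h5 : K₂ * (c * ‖ξ‖) = ‖ξ‖ / 2 := by rw [hc]; field_simp
    linarith
  have hsep : ∀ v ∈ Metric.ball u₀ R, ∀ w ∈ Metric.ball u₀ R,
      ‖v - w‖ ≤ 2 * K₂ * ‖φ v - φ w‖ := by
    intro v hv w hw
    have h1 := (convex_ball u₀ R).norm_image_sub_le_of_norm_hasFDerivWithin_le'
      (fun z hz => (hdiff z (hsubs hz).2).hasFDerivWithinAt) hclose hw hv
    have h2 := hanti' (v - w)
    have h3 : ‖fderiv ℝ φ u₀ (v - w)‖ ≤ ‖φ v - φ w‖ + c * ‖v - w‖ := by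
      calc ‖fderiv ℝ φ u₀ (v - w)‖
          = ‖(φ v - φ w) - (φ v - φ w - fderiv ℝ φ u₀ (v - w))‖ := by abel_nf
        _ ≤ _ := (norm_sub_le _ _).trans (by linarith)
    have h4 := mul_le_mul_of_nonneg_left h3 hK₂'.le
    have h5 : K₂ * (c * ‖v - w‖) = ‖v - w‖ / 2 := by rw [hc]; field_simp
    linarith
  have hcont := hψ (φ u₀) ⟨hx₀, hxV⟩
  rw [ContinuousWithinAt, hψφ u₀ hu₀] at hcont
  have hev := (hcont.eventually (Metric.ball_mem_nhds u₀ (by positivity : 0 < R / 4)))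
  rw [eventually_nhdsWithin_iff] at hev
  obtain ⟨η, hη, hηball⟩ := Metric.mem_nhds_iff.1 (Filter.inter_mem hev (hV.mem_nhds hxV))
  have hnear : ∀ y ∈ M, ‖y - φ u₀‖ < η → ψ y ∈ Metric.ball u₀ (R / 4) ∧ φ (ψ y) = y := by
    intro y hy hyη
    have h1 := hηball (mem_ball_iff_norm.2 hyη)
    exact ⟨h1.1 ⟨hy, h1.2⟩, (hψ' y ⟨hy, h1.2⟩).2⟩
  refine ⟨R / 2, by positivity, η / 2, by positivity, max (max (‖fderiv ℝ φ u₀‖ + c) K₁) (2 * K₂),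
    by positivity, η / 2, by positivity, ?_⟩
  intro x hx hxη
  obtain ⟨hxb, hxe⟩ := hnear x hx (by linarith)
  have hsub' : Metric.ball (ψ x) (R / 2) ⊆ Metric.ball u₀ R := by
    intro v hv
    rw [Metric.mem_ball] at *
    linarith [dist_triangle v (ψ x) u₀]
  refine ⟨φ, ψ x, hxe, fun v hv => (hbij.mapsTo (hsubs (hsub' hv)).2).1, ?_,
    fun v hv => hdiff v (hsubs (hsub' hv)).2, ?_, ?_, ?_, ?_⟩
  · intro y hy hyx
    have : ‖y - φ u₀‖ < η := by
      linarith [norm_sub_le_norm_sub_add_norm_sub y x (φ u₀)]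
    obtain ⟨hyb, hye⟩ := hnear y hy this
    refine ⟨ψ y, ?_, hye⟩
    rw [Metric.mem_ball] at *
    linarith [dist_triangle_right (ψ y) (ψ x) u₀]
  · intro v hv
    refine le_trans ?_ ((le_max_left _ _).trans (le_max_left _ _))
    have := norm_sub_norm_le (fderiv ℝ φ v) (fderiv ℝ φ u₀)
    linarith [hclose v (hsub' hv)]
  · intro v hv ξ
    exact (hlow v (hsub' hv) ξ).trans (mul_le_mul_of_nonneg_right (le_max_right _ _) (norm_nonneg _))
  · intro v hv w hw
    exact (hlip.norm_sub_le (hsubs (hsub' hv)).1 (hsubs (hsub' hw)).1).trans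
      (mul_le_mul_of_nonneg_right ((le_max_right _ _).trans (le_max_left _ _)) (norm_nonneg _))
  · intro v hv w hw
    exact (hsep v (hsub' hv) w (hsub' hw)).trans
      (mul_le_mul_of_nonneg_right (le_max_right _ _) (norm_nonneg _))

theorem exists_uniform_hasChart (hMc : IsCompact M) (hM : IsSmoothSubmanifold 2 M) :
    ∃ r > 0, ∃ ρ > 0, ∃ K ≥ 1, ∀ x ∈ M, HasChart M r ρ K x := by
  suffices ∃ r > 0, ∃ ρ > 0, ∃ K ≥ 1, ∀ x ∈ M ∩ M, HasChart M r ρ K x by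
    simpa only [inter_self] using this
  refine hMc.induction_on (p := fun S => ∃ r > 0, ∃ ρ > 0, ∃ K ≥ (1 : ℝ), ∀ x ∈ S ∩ M, HasChart M r ρ K x)
    ⟨1, one_pos, 1, one_pos, 1, le_rfl, by simp⟩ ?_ ?_ ?_
  · rintro s t hst ⟨r, hr, ρ, hρ, K, hK, h⟩
    exact ⟨r, hr, ρ, hρ, K, hK, fun x hx => h x ⟨hst hx.1, hx.2⟩⟩
  · rintro s t ⟨r, hr, ρ, hρ, K, hK, h⟩ ⟨r', hr', ρ', hρ', K', hK', h'⟩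
    have hlt : max K K' * min (min ρ ρ') (min r r' / (2 * max K K')) < min r r' := by
      have hp : 0 < max K K' := by positivity
      calc max K K' * min (min ρ ρ') (min r r' / (2 * max K K'))
          ≤ max K K' * (min r r' / (2 * max K K')) :=
            mul_le_mul_of_nonneg_left (min_le_right _ _) hp.le
        _ = min r r' / 2 := by field_simp
        _ < min r r' := half_lt_self (by positivity)
    refine ⟨min r r', by positivity, min (min ρ ρ') (min r r' / (2 * max K K')), by positivity,
      max K K', le_max_of_le_left hK, ?_⟩
    rintro x ⟨hx | hx, hxM⟩
    · exact (h x ⟨hx, hxM⟩).mono (min_le_left _ _) ((min_le_left _ _).trans (min_le_left _ _))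
        (by linarith) (le_max_left _ _) (by positivity) hlt
    · exact (h' x ⟨hx, hxM⟩).mono (min_le_right _ _) ((min_le_left _ _).trans (min_le_right _ _))
        (by linarith) (le_max_right _ _) (by positivity) hlt
  · intro x hx
    obtain ⟨r, hr, ρ, hρ, K, hK, η, hη, h⟩ := exists_hasChart_nhds hM hx
    refine ⟨Metric.ball x η, mem_nhdsWithin_of_mem_nhds (Metric.ball_mem_nhds x hη), r, hr,
      min ρ (r / (2 * max K 1)), by positivity, max K 1, le_max_right _ _, ?_⟩
    rintro y ⟨hy, hyM⟩
    refine (h y hyM (mem_ball_iff_norm.1 hy)).mono le_rfl (min_le_left _ _) hK.le (le_max_left _ _) hr ?_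
    calc max K 1 * min ρ (r / (2 * max K 1)) ≤ max K 1 * (r / (2 * max K 1)) :=
          mul_le_mul_of_nonneg_left (min_le_right _ _) (by positivity)
      _ = r / 2 := by field_simp
      _ < r := half_lt_self hr

end Charts

/-- The tangent space of `M` at `x`, as a linear subspace. -/
def Tan {N : ℕ} (M : Set (EuclideanSpace ℝ (Fin N))) (x : EuclideanSpace ℝ (Fin N)) :
    Submodule ℝ (EuclideanSpace ℝ (Fin N)) :=
  Submodule.span ℝ (TangentAt M x)

section Tangent

variable {N : ℕ} {M : Set (EuclideanSpace ℝ (Fin N))} {r ρ K : ℝ} {x : EuclideanSpace ℝ (Fin N)}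
  {G G' F : EuclideanSpace ℝ (Fin N) → EuclideanSpace ℝ (Fin N)}

theorem fderiv_mem_tangentAt (hG : DifferentiableAt ℝ G x) (hGM : MapsTo G M M)
    {w : EuclideanSpace ℝ (Fin N)} (hw : w ∈ TangentAt M x) :
    fderiv ℝ G x w ∈ TangentAt M (G x) := by
  obtain ⟨c, hc, rfl, hd⟩ := hw
  exact ⟨G ∘ c, fun t => hGM (hc t), rfl, hG.hasFDerivAt.comp_hasDerivAt 0 hd⟩

theorem fderiv_mem_tan (hG : DifferentiableAt ℝ G x) (hGM : MapsTo G M M)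
    {w : EuclideanSpace ℝ (Fin N)} (hw : w ∈ Tan M x) : fderiv ℝ G x w ∈ Tan M (G x) := by
  have : Tan M x ≤ (Tan M (G x)).comap (fderiv ℝ G x).toLinearMap :=
    Submodule.span_le.2 fun w hw => Submodule.subset_span (fderiv_mem_tangentAt hG hGM hw)
  exact this hw

theorem fderiv_fderiv_of_inverse (hG : DifferentiableAt ℝ G x) (hG' : DifferentiableAt ℝ G' (G x))
    (hinv : ∀ y ∈ M, G' (G y) = y) {w : EuclideanSpace ℝ (Fin N)} (hw : w ∈ Tan M x) :
    fderiv ℝ G' (G x) (fderiv ℝ G x w) = w := by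
  have : Tan M x ≤ LinearMap.eqLocus
      ((fderiv ℝ G' (G x)).comp (fderiv ℝ G x)).toLinearMap LinearMap.id := by
    refine Submodule.span_le.2 fun w hw => ?_
    obtain ⟨c, hc, rfl, hd⟩ := hw
    have h1 := hG.hasFDerivAt.comp_hasDerivAt 0 hd
    have h2 := HasFDerivAt.comp_hasDerivAt (f := G ∘ c) 0 hG'.hasFDerivAt h1
    have h3 : G' ∘ (G ∘ c) = c := funext fun t => hinv _ (hc t)
    rw [h3] at h2
    exact h2.unique hd
  exact this hw

theorem chart_mem_tangentAt {φ : EuclideanSpace ℝ (Fin 2) → EuclideanSpace ℝ (Fin N)}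
    {u v : EuclideanSpace ℝ (Fin 2)} (hφ : ∀ v ∈ Metric.ball u r, φ v ∈ M)
    (hv : v ∈ Metric.ball u r) (hd : DifferentiableAt ℝ φ v) (ξ : EuclideanSpace ℝ (Fin 2)) :
    fderiv ℝ φ v ξ ∈ TangentAt M (φ v) := by
  classical
  refine ⟨fun t => if v + t • ξ ∈ Metric.ball u r then φ (v + t • ξ) else φ v, fun t => ?_, ?_, ?_⟩
  · dsimp only
    split_ifs with h
    exacts [hφ _ h, hφ _ hv]
  · simp [hv]
  · have h1 : HasDerivAt (fun t : ℝ => v + t • ξ) ξ 0 := by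
      simpa using ((hasDerivAt_id (0 : ℝ)).smul_const ξ).const_add v
    have h2 : HasDerivAt (fun t : ℝ => φ (v + t • ξ)) (fderiv ℝ φ v ξ) 0 :=
      HasFDerivAt.comp_hasDerivAt_of_eq (x := (0 : ℝ)) hd.hasFDerivAt h1 (by simp)
    refine h2.congr_of_eventuallyEq ?_
    have hc : Filter.Tendsto (fun t : ℝ => v + t • ξ) (nhds 0) (nhds v) := by
      simpa using h1.continuousAt.tendsto
    filter_upwards [hc.eventually (Metric.isOpen_ball.mem_nhds hv)] with t ht
    exact if_pos ht

/-- In a chart, the tangent space is the image of the derivative. -/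
theorem tan_eq_range {φ : EuclideanSpace ℝ (Fin 2) → EuclideanSpace ℝ (Fin N)}
    {u : EuclideanSpace ℝ (Fin 2)} (hr : 0 < r) (hρ : 0 < ρ)
    (h2 : ∀ v ∈ Metric.ball u r, φ v ∈ M)
    (h3 : ∀ y ∈ M, ‖y - φ u‖ ≤ ρ → ∃ v ∈ Metric.ball u r, φ v = y)
    (h4 : HasFDerivAt φ (fderiv ℝ φ u) u)
    (h8 : ∀ v ∈ Metric.ball u r, ∀ w ∈ Metric.ball u r, ‖v - w‖ ≤ K * ‖φ v - φ w‖) :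
    Tan M (φ u) = LinearMap.range (fderiv ℝ φ u).toLinearMap := by
  have hu : u ∈ Metric.ball u r := Metric.mem_ball_self hr
  refine le_antisymm (Submodule.span_le.2 ?_) ?_
  · rintro w ⟨c, hc, hc0, hd⟩
    have hclosed : IsClosed ((LinearMap.range (fderiv ℝ φ u).toLinearMap : Submodule ℝ _) :
      Set (EuclideanSpace ℝ (Fin N))) := Submodule.closed_of_finiteDimensional _
    have hnear : ∀ᶠ t in nhds (0 : ℝ), ‖c t - φ u‖ ≤ ρ := by
      have : Filter.Tendsto (fun t => ‖c t - φ u‖) (nhds 0) (nhds 0) := by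
        have := (hd.continuousAt.tendsto.sub_const (φ u)).norm
        rwa [hc0, sub_self, norm_zero] at this
      filter_upwards [this.eventually (Iio_mem_nhds hρ)] with t ht using le_of_lt ht
    have hex : ∀ t, ∃ v, ‖c t - φ u‖ ≤ ρ → v ∈ Metric.ball u r ∧ φ v = c t := by
      intro t
      by_cases h : ‖c t - φ u‖ ≤ ρ
      · obtain ⟨v, hv, hvc⟩ := h3 _ (hc t) h
        exact ⟨v, fun _ => ⟨hv, hvc⟩⟩
      · exact ⟨u, fun h' => absurd h' h⟩
    choose a ha using hex
    have hab : ∀ᶠ t in nhds (0 : ℝ), ‖a t - u‖ ≤ K * ‖c t - φ u‖ := by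
      filter_upwards [hnear] with t ht
      have := h8 _ (ha t ht).1 _ hu
      rwa [(ha t ht).2] at this
    have hO : (fun t => a t - u) =O[nhds 0] fun t => c t - φ u := Asymptotics.IsBigO.of_bound K hab
    have hO2 : (fun t => c t - φ u) =O[nhds 0] fun t : ℝ => t := by
      have := hd.isBigO_sub
      simpa [hc0] using this
    have hta : Filter.Tendsto a (nhds 0) (nhds u) := by
      rw [← tendsto_sub_nhds_zero_iff]
      exact (hO.trans hO2).trans_tendsto Filter.tendsto_id
    have ho : (fun t => φ (a t) - φ u - fderiv ℝ φ u (a t - u)) =o[nhds 0] fun t : ℝ => t :=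
      (h4.isLittleO.comp_tendsto hta).trans_isBigO (hO.trans hO2)
    have ho' : (fun t => c t - φ u - t • w) =o[nhds 0] fun t : ℝ => t := by
      have := hd.isLittleO
      simpa [hc0] using this
    have hdiff : (fun t => fderiv ℝ φ u (a t - u) - t • w) =o[nhds 0] fun t : ℝ => t := by
      refine (ho'.sub ho).congr' ?_ Filter.EventuallyEq.rfl
      filter_upwards [hnear] with t ht
      rw [(ha t ht).2]
      abel
    have hlim : Filter.Tendsto (fun t : ℝ => t⁻¹ • (fderiv ℝ φ u (a t - u) - t • w))
        (nhdsWithin 0 {0}ᶜ) (nhds 0) := by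
      have h1 := hdiff.tendsto_inv_smul_nhds_zero
      exact h1.mono_left nhdsWithin_le_nhds
    have hlim' : Filter.Tendsto (fun t : ℝ => fderiv ℝ φ u (t⁻¹ • (a t - u)))
        (nhdsWithin 0 {0}ᶜ) (nhds w) := by
      have h1 := hlim.add_const w
      rw [zero_add] at h1
      refine h1.congr' ?_
      filter_upwards [self_mem_nhdsWithin] with t ht
      have ht : t ≠ 0 := ht
      rw [smul_sub, smul_smul, inv_mul_cancel₀ ht, one_smul, sub_add_cancel, map_smul]
    exact hclosed.mem_of_tendsto hlim' (Filter.Eventually.of_forall fun t => ⟨_, rfl⟩)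
  · rintro _ ⟨ξ, rfl⟩
    exact Submodule.subset_span (chart_mem_tangentAt h2 hu h4.differentiableAt ξ)

theorem HasChart.finrank_tan (h : HasChart M r ρ K x) (hr : 0 < r) (hρ : 0 < ρ) :
    Module.finrank ℝ (Tan M x) = 2 := by
  obtain ⟨φ, u, rfl, h2, h3, h4, h5, h6, h7, h8⟩ := h
  have hu : u ∈ Metric.ball u r := Metric.mem_ball_self hr
  rw [tan_eq_range hr hρ h2 h3 (h4 u hu) h8, LinearMap.finrank_range_of_inj, finrank_euclideanSpace,
    Fintype.card_fin]
  refine (injective_iff_map_eq_zero _).2 fun ξ hξ => ?_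
  have := h6 u hu ξ
  have hξ' : fderiv ℝ φ u ξ = 0 := hξ
  rw [hξ', norm_zero, mul_zero] at this
  exact norm_le_zero_iff.1 this

/-- First order expansion along `M`, uniformly. -/
theorem HasChart.exists_tan_approx (h : HasChart M r ρ K x) (hr : 0 < r) (hρ : 0 < ρ) (hK : 1 ≤ K)
    (hF : Differentiable ℝ F) {α C B : ℝ} (hα : 0 < α) (hα1 : α ≤ 1) (hC : 0 ≤ C)
    (hFC : ∀ y ∈ M, ∀ z ∈ M, ‖fderiv ℝ F y - fderiv ℝ F z‖ ≤ C * ‖y - z‖ ^ α)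
    (hFB : ∀ y ∈ M, ‖fderiv ℝ F y‖ ≤ B) {δ : ℝ} (hδ : δ ≤ ρ) (hδ1 : δ ≤ 1)
    {y z : EuclideanSpace ℝ (Fin N)} (hy : y ∈ M) (hz : z ∈ M) (hyx : ‖y - x‖ ≤ δ)
    (hzx : ‖z - x‖ ≤ δ) :
    ∃ w ∈ Tan M x, ‖y - z - w‖ ≤ ((C + 1) * (B + 1) * K ^ 4) * δ ^ α * ‖y - z‖ ∧
      ‖F y - F z - fderiv ℝ F x w‖ ≤ ((C + 1) * (B + 1) * K ^ 4) * δ ^ α * ‖y - z‖ := by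
  obtain ⟨φ, u, rfl, h2, h3, h4, h5, h6, h7, h8⟩ := h
  have hu : u ∈ Metric.ball u r := Metric.mem_ball_self hr
  have hxM : φ u ∈ M := h2 u hu
  obtain ⟨a, ha, rfl⟩ := h3 y hy (hyx.trans hδ)
  obtain ⟨b, hb, rfl⟩ := h3 z hz (hzx.trans hδ)
  have hδ0 : 0 ≤ δ := (norm_nonneg _).trans hyx
  have hB0 : 0 ≤ B := (norm_nonneg _).trans (hFB _ hxM)
  have hδα : δ ≤ δ ^ α := by
    rcases hδ0.eq_or_lt with h | h
    · rw [← h]; exact Real.rpow_nonneg le_rfl _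
    · calc δ = δ ^ (1 : ℝ) := (Real.rpow_one δ).symm
        _ ≤ δ ^ α := Real.rpow_le_rpow_of_exponent_ge h hδ1 hα1
  have hδα0 : 0 ≤ δ ^ α := Real.rpow_nonneg hδ0 _
  -- the segment from `b` to `a` stays close to `u`
  let s := Metric.ball u r ∩ Metric.closedBall u (K * δ)
  have hs : Convex ℝ s := (convex_ball _ _).inter (convex_closedBall _ _)
  have has : a ∈ s := ⟨ha, by
    rw [mem_closedBall_iff_norm]
    exact (h8 a ha u hu).trans (mul_le_mul_of_nonneg_left hyx (by linarith))⟩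
  have hbs : b ∈ s := ⟨hb, by
    rw [mem_closedBall_iff_norm]
    exact (h8 b hb u hu).trans (mul_le_mul_of_nonneg_left hzx (by linarith))⟩
  have hφd : ∀ v ∈ s, ‖fderiv ℝ φ v - fderiv ℝ φ u‖ ≤ K ^ 2 * δ := fun v hv => by
    refine (h7 v hv.1 u hu).trans ?_
    have := mem_closedBall_iff_norm.1 hv.2
    calc K * ‖v - u‖ ≤ K * (K * δ) := mul_le_mul_of_nonneg_left this (by linarith)
      _ = _ := by ring
  have hφl : ∀ v ∈ s, ‖φ v - φ u‖ ≤ K ^ 2 * δ := fun v hv => by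
    have h1 := (convex_ball u r).norm_image_sub_le_of_norm_hasFDerivWithin_le
      (fun z hz => (h4 z hz).hasFDerivWithinAt) h5 hu hv.1
    have := mem_closedBall_iff_norm.1 hv.2
    calc ‖φ v - φ u‖ ≤ K * ‖v - u‖ := h1
      _ ≤ K * (K * δ) := mul_le_mul_of_nonneg_left this (by linarith)
      _ = _ := by ring
  have hab := h8 a ha b hb
  have hK0 : 0 ≤ K := by linarith
  have e1 := hs.norm_image_sub_le_of_norm_hasFDerivWithin_le'
    (fun z hz => (h4 z hz.1).hasFDerivWithinAt) hφd hbs has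
  have hKpow : K ^ 3 ≤ K ^ 4 := pow_le_pow_right₀ hK (by norm_num)
  have hCB : 1 ≤ (C + 1) * (B + 1) := by nlinarith
  refine ⟨fderiv ℝ φ u (a - b), ?_, ?_, ?_⟩
  · rw [tan_eq_range hr hρ h2 h3 (h4 u hu) h8]
    exact ⟨_, rfl⟩
  · refine e1.trans ?_
    calc K ^ 2 * δ * ‖a - b‖ ≤ K ^ 2 * δ ^ α * (K * ‖φ a - φ b‖) := by gcongr
      _ = 1 * K ^ 3 * δ ^ α * ‖φ a - φ b‖ := by ring
      _ ≤ _ := by gcongr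
  · have hcomp : ∀ v ∈ s, HasFDerivWithinAt (F ∘ φ) ((fderiv ℝ F (φ v)).comp (fderiv ℝ φ v)) s v :=
      fun v hv => ((hF (φ v)).hasFDerivAt.comp v (h4 v hv.1)).hasFDerivWithinAt
    have hbound : ∀ v ∈ s, ‖(fderiv ℝ F (φ v)).comp (fderiv ℝ φ v) -
        (fderiv ℝ F (φ u)).comp (fderiv ℝ φ u)‖ ≤ (C + B) * K ^ 3 * δ ^ α := by
      intro v hv
      have hsplit : (fderiv ℝ F (φ v)).comp (fderiv ℝ φ v) - (fderiv ℝ F (φ u)).comp (fderiv ℝ φ u) =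
          (fderiv ℝ F (φ v) - fderiv ℝ F (φ u)).comp (fderiv ℝ φ v) +
          (fderiv ℝ F (φ u)).comp (fderiv ℝ φ v - fderiv ℝ φ u) := by
        ext ξ; simp
      rw [hsplit]
      have p1 : ‖φ v - φ u‖ ^ α ≤ K ^ 2 * δ ^ α := by
        calc ‖φ v - φ u‖ ^ α ≤ (K ^ 2 * δ) ^ α :=
              Real.rpow_le_rpow (norm_nonneg _) (hφl v hv) hα.le
          _ = (K ^ 2) ^ α * δ ^ α := Real.mul_rpow (by positivity) hδ0
          _ ≤ (K ^ 2) ^ (1 : ℝ) * δ ^ α := by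
              refine mul_le_mul_of_nonneg_right ?_ hδα0
              exact Real.rpow_le_rpow_of_exponent_le (one_le_pow₀ hK) hα1
          _ = _ := by rw [Real.rpow_one]
      have p2 := hFC _ (h2 v hv.1) _ hxM
      calc _ ≤ ‖fderiv ℝ F (φ v) - fderiv ℝ F (φ u)‖ * ‖fderiv ℝ φ v‖ +
            ‖fderiv ℝ F (φ u)‖ * ‖fderiv ℝ φ v - fderiv ℝ φ u‖ :=
            (norm_add_le _ _).trans (add_le_add (ContinuousLinearMap.opNorm_comp_le _ _)
              (ContinuousLinearMap.opNorm_comp_le _ _))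
        _ ≤ C * (K ^ 2 * δ ^ α) * K + B * (K ^ 2 * δ ^ α) := by
            refine add_le_add ?_ ?_
            · exact mul_le_mul (p2.trans (mul_le_mul_of_nonneg_left p1 hC)) (h5 v hv.1)
                (norm_nonneg _) (by positivity)
            · exact mul_le_mul (hFB _ hxM) ((hφd v hv).trans (by gcongr)) (norm_nonneg _) hB0
        _ ≤ C * (K ^ 2 * δ ^ α) * K + B * (K ^ 2 * δ ^ α) * K := by
            have : 0 ≤ B * (K ^ 2 * δ ^ α) := by positivity
            linarith [le_mul_of_one_le_right this hK]
        _ = _ := by ring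
    have e2 := hs.norm_image_sub_le_of_norm_hasFDerivWithin_le' hcomp hbound hbs has
    refine e2.trans ?_
    calc (C + B) * K ^ 3 * δ ^ α * ‖a - b‖ ≤ (C + B) * K ^ 3 * δ ^ α * (K * ‖φ a - φ b‖) := by gcongr
      _ = (C + B) * K ^ 4 * δ ^ α * ‖φ a - φ b‖ := by ring
      _ ≤ _ := by
        have : C + B ≤ (C + 1) * (B + 1) := by nlinarith
        gcongr

/-- Through each point of `M`, in each direction, there is a curve that is almost straight. -/
theorem HasChart.exists_curve (h : HasChart M r ρ K x) (hr : 0 < r) (hρ : 0 < ρ) (hK : 1 ≤ K)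
    {f : EuclideanSpace ℝ (Fin N)} (hf : f ∈ Tan M x) (hf1 : ‖f‖ = 1) {d : ℝ} (hd : K * d < r) :
    ∃ c : ℝ → EuclideanSpace ℝ (Fin N), c 0 = x ∧
      (∀ s, |s| ≤ d → c s ∈ M ∧ ∃ v ∈ TangentAt M (c s), HasDerivAt c v s) ∧
      ∀ s t, |s| ≤ d → |t| ≤ d →
        ‖c s - c t - (s - t) • f‖ ≤ K ^ 3 * d * |s - t| := by
  obtain ⟨φ, u, rfl, h2, h3, h4, h5, h6, h7, h8⟩ := h
  have hu : u ∈ Metric.ball u r := Metric.mem_ball_self hr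
  rw [tan_eq_range hr hρ h2 h3 (h4 u hu) h8] at hf
  obtain ⟨ξ, rfl⟩ := hf
  have hξ : ‖ξ‖ ≤ K := by
    have := h6 u hu ξ
    have hf1' : ‖fderiv ℝ φ u ξ‖ = 1 := hf1
    rwa [hf1', mul_one] at this
  have hin : ∀ s, |s| ≤ d → ‖u + s • ξ - u‖ ≤ K * d := by
    intro s hs
    rw [add_sub_cancel_left, norm_smul, Real.norm_eq_abs, mul_comm]
    exact mul_le_mul hξ hs (abs_nonneg _) (by linarith)
  have hball : ∀ s, |s| ≤ d → u + s • ξ ∈ Metric.ball u r := fun s hs =>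
    mem_ball_iff_norm.2 ((hin s hs).trans_lt hd)
  refine ⟨fun s => φ (u + s • ξ), by simp, fun s hs => ⟨h2 _ (hball s hs), _,
    chart_mem_tangentAt h2 (hball s hs) (h4 _ (hball s hs)).differentiableAt ξ, ?_⟩, ?_⟩
  · have h1 : HasDerivAt (fun t : ℝ => u + t • ξ) ξ s := by
      simpa using ((hasDerivAt_id s).smul_const ξ).const_add u
    exact (h4 _ (hball s hs)).comp_hasDerivAt s h1
  · intro s t hs ht
    have hd0 : 0 ≤ d := (abs_nonneg _).trans hs
    have hφd : ∀ v ∈ Metric.closedBall u (K * d), ‖fderiv ℝ φ v - fderiv ℝ φ u‖ ≤ K * (K * d) := by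
      intro v hv
      rw [mem_closedBall_iff_norm] at hv
      exact (h7 v (mem_ball_iff_norm.2 (hv.trans_lt hd)) u hu).trans
        (mul_le_mul_of_nonneg_left hv (by linarith))
    have e := (convex_closedBall u (K * d)).norm_image_sub_le_of_norm_hasFDerivWithin_le'
      (fun v hv => (h4 v (mem_ball_iff_norm.2
        ((mem_closedBall_iff_norm.1 hv).trans_lt hd))).hasFDerivWithinAt) hφd
      (mem_closedBall_iff_norm.2 (hin t ht)) (mem_closedBall_iff_norm.2 (hin s hs))
    have hsub : u + s • ξ - (u + t • ξ) = (s - t) • ξ := by rw [sub_smul]; abel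
    rw [hsub, map_smul, norm_smul, Real.norm_eq_abs] at e
    refine e.trans ?_
    calc K * (K * d) * (|s - t| * ‖ξ‖) ≤ K * (K * d) * (|s - t| * K) := by gcongr
      _ = _ := by ring

end Tangent

/-- A map `G`, inverted on `M` by `G'`, both differentiable with `α`-Hölder bounded derivative
on `M`. -/
structure HolderDiffeo {N : ℕ} (M : Set (EuclideanSpace ℝ (Fin N)))
    (G G' : EuclideanSpace ℝ (Fin N) → EuclideanSpace ℝ (Fin N)) (α C B : ℝ) : Prop where
  diff : Differentiable ℝ G
  diff' : Differentiable ℝ G'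
  maps : MapsTo G M M
  maps' : MapsTo G' M M
  inv : ∀ x ∈ M, G' (G x) = x
  inv' : ∀ x ∈ M, G (G' x) = x
  holder : ∀ y ∈ M, ∀ z ∈ M, ‖fderiv ℝ G y - fderiv ℝ G z‖ ≤ C * ‖y - z‖ ^ α
  holder' : ∀ y ∈ M, ∀ z ∈ M, ‖fderiv ℝ G' y - fderiv ℝ G' z‖ ≤ C * ‖y - z‖ ^ α
  bound : ∀ y ∈ M, ‖fderiv ℝ G y‖ ≤ B
  bound' : ∀ y ∈ M, ‖fderiv ℝ G' y‖ ≤ B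
  lip : ∀ y ∈ M, ∀ z ∈ M, ‖G y - G z‖ ≤ B * ‖y - z‖
  lip' : ∀ y ∈ M, ∀ z ∈ M, ‖G' y - G' z‖ ≤ B * ‖y - z‖
  pos : 0 < α
  le_one : α ≤ 1
  nonneg : 0 ≤ C
  one_le : 1 ≤ B

namespace HolderDiffeo

variable {N : ℕ} {M : Set (EuclideanSpace ℝ (Fin N))}
  {G G' G₁ G₁' : EuclideanSpace ℝ (Fin N) → EuclideanSpace ℝ (Fin N)} {α C B C₁ B₁ : ℝ}

theorem symm (h : HolderDiffeo M G G' α C B) : HolderDiffeo M G' G α C B :=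
  ⟨h.diff', h.diff, h.maps', h.maps, h.inv', h.inv, h.holder', h.holder, h.bound', h.bound,
    h.lip', h.lip, h.pos, h.le_one, h.nonneg, h.one_le⟩

theorem comp_holder {F F₁ : EuclideanSpace ℝ (Fin N) → EuclideanSpace ℝ (Fin N)} {C B C₁ B₁ : ℝ}
    (hα : 0 < α) (hα1 : α ≤ 1) (hC : 0 ≤ C) (hB : 1 ≤ B) (hB₁ : 1 ≤ B₁)
    (hd : Differentiable ℝ F) (hd₁ : Differentiable ℝ F₁) (hm₁ : MapsTo F₁ M M)
    (hh : ∀ y ∈ M, ∀ z ∈ M, ‖fderiv ℝ F y - fderiv ℝ F z‖ ≤ C * ‖y - z‖ ^ α)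
    (hh₁ : ∀ y ∈ M, ∀ z ∈ M, ‖fderiv ℝ F₁ y - fderiv ℝ F₁ z‖ ≤ C₁ * ‖y - z‖ ^ α)
    (hb : ∀ y ∈ M, ‖fderiv ℝ F y‖ ≤ B) (hb₁ : ∀ y ∈ M, ‖fderiv ℝ F₁ y‖ ≤ B₁)
    (hl₁ : ∀ y ∈ M, ∀ z ∈ M, ‖F₁ y - F₁ z‖ ≤ B₁ * ‖y - z‖) :
    ∀ y ∈ M, ∀ z ∈ M, ‖fderiv ℝ (F ∘ F₁) y - fderiv ℝ (F ∘ F₁) z‖ ≤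
      (C * B₁ ^ 2 + B * C₁) * ‖y - z‖ ^ α := by
  intro y hy z hz
  rw [fderiv_comp _ (hd _) (hd₁ _), fderiv_comp _ (hd _) (hd₁ _)]
  have hsplit : (fderiv ℝ F (F₁ y)).comp (fderiv ℝ F₁ y) - (fderiv ℝ F (F₁ z)).comp (fderiv ℝ F₁ z) =
      (fderiv ℝ F (F₁ y) - fderiv ℝ F (F₁ z)).comp (fderiv ℝ F₁ y) +
        (fderiv ℝ F (F₁ z)).comp (fderiv ℝ F₁ y - fderiv ℝ F₁ z) := by
    ext ξ; simp
  rw [hsplit]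
  have p1 : ‖F₁ y - F₁ z‖ ^ α ≤ B₁ * ‖y - z‖ ^ α := by
    calc ‖F₁ y - F₁ z‖ ^ α ≤ (B₁ * ‖y - z‖) ^ α :=
          Real.rpow_le_rpow (norm_nonneg _) (hl₁ y hy z hz) hα.le
      _ = B₁ ^ α * ‖y - z‖ ^ α := Real.mul_rpow (by positivity) (norm_nonneg _)
      _ ≤ B₁ ^ (1 : ℝ) * ‖y - z‖ ^ α := by
          refine mul_le_mul_of_nonneg_right ?_ (by positivity)
          exact Real.rpow_le_rpow_of_exponent_le hB₁ hα1
      _ = _ := by rw [Real.rpow_one]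
  have p2 := (hh _ (hm₁ hy) _ (hm₁ hz)).trans (mul_le_mul_of_nonneg_left p1 hC)
  calc _ ≤ ‖fderiv ℝ F (F₁ y) - fderiv ℝ F (F₁ z)‖ * ‖fderiv ℝ F₁ y‖ +
        ‖fderiv ℝ F (F₁ z)‖ * ‖fderiv ℝ F₁ y - fderiv ℝ F₁ z‖ :=
        (norm_add_le _ _).trans (add_le_add (ContinuousLinearMap.opNorm_comp_le _ _)
          (ContinuousLinearMap.opNorm_comp_le _ _))
    _ ≤ C * (B₁ * ‖y - z‖ ^ α) * B₁ + B * (C₁ * ‖y - z‖ ^ α) := by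
        refine add_le_add ?_ ?_
        · exact mul_le_mul p2 (hb₁ y hy) (norm_nonneg _) (by positivity)
        · exact mul_le_mul (hb _ (hm₁ hz)) (hh₁ y hy z hz) (norm_nonneg _) (by linarith)
    _ = _ := by ring

theorem comp (h : HolderDiffeo M G G' α C B) (h₁ : HolderDiffeo M G₁ G₁' α C₁ B₁) :
    HolderDiffeo M (G ∘ G₁) (G₁' ∘ G') α
      (C * B₁ ^ 2 + B * C₁ + (C₁ * B ^ 2 + B₁ * C)) (B * B₁) where
  diff := h.diff.comp h₁.diff
  diff' := h₁.diff'.comp h.diff'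
  maps := h.maps.comp h₁.maps
  maps' := h₁.maps'.comp h.maps'
  inv x hx := by simp [h.inv _ (h₁.maps hx), h₁.inv x hx]
  inv' x hx := by simp [h₁.inv' _ (h.maps' hx), h.inv' x hx]
  holder y hy z hz := by
    refine (comp_holder h.pos h.le_one h.nonneg h.one_le h₁.one_le h.diff h₁.diff h₁.maps h.holder
      h₁.holder h.bound h₁.bound h₁.lip y hy z hz).trans ?_
    have := h.nonneg; have := h₁.nonneg; have := h.one_le; have := h₁.one_le
    have : 0 ≤ C₁ * B ^ 2 + B₁ * C := by positivity
    exact mul_le_mul_of_nonneg_right (by linarith) (by positivity)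
  holder' y hy z hz := by
    refine (comp_holder h.pos h.le_one h₁.nonneg h₁.one_le h.one_le h₁.diff' h.diff' h.maps'
      h₁.holder' h.holder' h₁.bound' h.bound' h.lip' y hy z hz).trans ?_
    have := h.nonneg; have := h₁.nonneg; have := h.one_le; have := h₁.one_le
    have : 0 ≤ C * B₁ ^ 2 + B * C₁ := by positivity
    exact mul_le_mul_of_nonneg_right (by linarith) (by positivity)
  bound y hy := by
    rw [fderiv_comp _ (h.diff _) (h₁.diff _)]
    exact (ContinuousLinearMap.opNorm_comp_le _ _).trans (mul_le_mul (h.bound _ (h₁.maps hy))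
      (h₁.bound y hy) (norm_nonneg _) (by linarith [h.one_le]))
  bound' y hy := by
    rw [fderiv_comp _ (h₁.diff' _) (h.diff' _), mul_comm]
    exact (ContinuousLinearMap.opNorm_comp_le _ _).trans (mul_le_mul (h₁.bound' _ (h.maps' hy))
      (h.bound' y hy) (norm_nonneg _) (by linarith [h₁.one_le]))
  lip y hy z hz := by
    have := h.one_le
    calc _ ≤ B * ‖G₁ y - G₁ z‖ := h.lip _ (h₁.maps hy) _ (h₁.maps hz)
      _ ≤ B * (B₁ * ‖y - z‖) := by gcongr; exact h₁.lip y hy z hz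
      _ = _ := by ring
  lip' y hy z hz := by
    have := h₁.one_le
    calc _ ≤ B₁ * ‖G' y - G' z‖ := h₁.lip' _ (h.maps' hy) _ (h.maps' hz)
      _ ≤ B₁ * (B * ‖y - z‖) := by gcongr; exact h.lip' y hy z hz
      _ = _ := by ring
  pos := h.pos
  le_one := h.le_one
  nonneg := by
    have := h.nonneg; have := h₁.nonneg; have := h.one_le; have := h₁.one_le
    positivity
  one_le := one_le_mul_of_one_le_of_one_le h.one_le h₁.one_le

theorem iterate (h : HolderDiffeo M G G' α C B) (p : ℕ) :
    ∃ C', HolderDiffeo M (G^[p]) (G'^[p]) α C' (B ^ p) := by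
  induction p with
  | zero =>
    refine ⟨0, ⟨differentiable_id, differentiable_id, fun x hx => hx, fun x hx => hx,
      fun x hx => rfl, fun x hx => rfl, ?_, ?_, ?_, ?_, ?_, ?_, h.pos, h.le_one, le_rfl, by simp⟩⟩
    all_goals simp [Function.iterate_zero, ContinuousLinearMap.norm_id_le]
  | succ p ih =>
    obtain ⟨C', hC'⟩ := ih
    have := hC'.comp h
    rw [← Function.iterate_succ, ← Function.iterate_succ', ← pow_succ] at this
    exact ⟨_, this⟩

theorem of_contDiff (hMc : IsCompact M) (hGM : MapsTo G M M) (hG'M : MapsTo G' M M)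
    (hGinv : ∀ x ∈ M, G' (G x) = x) (hGinv' : ∀ x ∈ M, G (G' x) = x)
    (hG : ContDiff ℝ 1 G) (hG' : ContDiff ℝ 1 G') {ε : ℝ≥0} (hε : 0 < ε) {Cg Cg' : ℝ≥0}
    (hGH : HolderOnWith Cg ε (fderiv ℝ G) M) (hGH' : HolderOnWith Cg' ε (fderiv ℝ G') M) :
    ∃ α C B, HolderDiffeo M G G' α C B := by
  obtain ⟨R, hR⟩ := hMc.isBounded.subset_closedBall (0 : EuclideanSpace ℝ (Fin N))
  have key : ∀ F : EuclideanSpace ℝ (Fin N) → EuclideanSpace ℝ (Fin N), ContDiff ℝ 1 F →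
      ∃ B, ∀ y ∈ Metric.closedBall (0 : EuclideanSpace ℝ (Fin N)) R, ‖fderiv ℝ F y‖ ≤ B := fun F hF =>
    (isCompact_closedBall _ _).exists_bound_of_continuousOn (hF.continuous_fderiv one_ne_zero).continuousOn
  obtain ⟨B₁, hB₁⟩ := key G hG
  obtain ⟨B₂, hB₂⟩ := key G' hG'
  have lip : ∀ (F : EuclideanSpace ℝ (Fin N) → EuclideanSpace ℝ (Fin N)) (b : ℝ), ContDiff ℝ 1 F →
      (∀ y ∈ Metric.closedBall (0 : EuclideanSpace ℝ (Fin N)) R, ‖fderiv ℝ F y‖ ≤ b) →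
      ∀ y ∈ M, ∀ z ∈ M, ‖F y - F z‖ ≤ b * ‖y - z‖ := fun F b hF hb y hy z hz =>
    (convex_closedBall _ _).norm_image_sub_le_of_norm_fderiv_le
      (fun v _ => (hF.differentiable one_ne_zero) v) hb (hR hz) (hR hy)
  have hol : ∀ (F : EuclideanSpace ℝ (Fin N) → EuclideanSpace ℝ (Fin N)) (b : ℝ) (c : ℝ≥0), 0 ≤ b →
      (∀ y ∈ Metric.closedBall (0 : EuclideanSpace ℝ (Fin N)) R, ‖fderiv ℝ F y‖ ≤ b) →
      HolderOnWith c ε (fderiv ℝ F) M →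
      ∀ y ∈ M, ∀ z ∈ M, ‖fderiv ℝ F y - fderiv ℝ F z‖ ≤
        (c + 2 * b) * ‖y - z‖ ^ (min (ε : ℝ) 1) := by
    intro F b c hb0 hb hH y hy z hz
    rw [add_mul]
    have hp : (0:ℝ) ≤ c * ‖y - z‖ ^ (min (ε : ℝ) 1) := by positivity
    have hp' : (0:ℝ) ≤ 2 * b * ‖y - z‖ ^ (min (ε : ℝ) 1) := by positivity
    have hm : 0 < min (ε : ℝ) 1 := lt_min (by exact_mod_cast hε) one_pos
    rcases le_total ‖y - z‖ 1 with h1 | h1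
    · have := hH.dist_le hy hz
      rw [dist_eq_norm, dist_eq_norm] at this
      have h2 : ‖y - z‖ ^ (ε : ℝ) ≤ ‖y - z‖ ^ (min (ε : ℝ) 1) := by
        rcases (norm_nonneg (y - z)).eq_or_lt with h0 | h0
        · rw [← h0, Real.zero_rpow (by exact_mod_cast hε.ne'), Real.zero_rpow hm.ne']
        · exact Real.rpow_le_rpow_of_exponent_ge h0 h1 (min_le_left _ _)
      have h3 : (c : ℝ) * ‖y - z‖ ^ (ε : ℝ) ≤ c * ‖y - z‖ ^ (min (ε : ℝ) 1) :=
        mul_le_mul_of_nonneg_left h2 c.2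
      linarith
    · have h2 : 1 ≤ ‖y - z‖ ^ (min (ε : ℝ) 1) := Real.one_le_rpow h1 hm.le
      have h3 := norm_sub_le (fderiv ℝ F y) (fderiv ℝ F z)
      have h4 := hb y (hR hy)
      have h5 := hb z (hR hz)
      have h6 : 2 * b * 1 ≤ 2 * b * ‖y - z‖ ^ (min (ε : ℝ) 1) := by gcongr
      linarith
  obtain ⟨B, hB1, hBB₁, hBB₂⟩ : ∃ B, 1 ≤ B ∧ B₁ ≤ B ∧ B₂ ≤ B :=
    ⟨max 1 (max B₁ B₂), le_max_left _ _, (le_max_left _ _).trans (le_max_right _ _),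
      (le_max_right _ _).trans (le_max_right _ _)⟩
  have b₁ := fun y hy => (hB₁ y hy).trans hBB₁
  have b₂ := fun y hy => (hB₂ y hy).trans hBB₂
  refine ⟨min (ε : ℝ) 1, Cg + 2 * B + (Cg' + 2 * B), B,
    ⟨hG.differentiable one_ne_zero, hG'.differentiable one_ne_zero, hGM, hG'M, hGinv, hGinv',
      fun y hy z hz => (hol G B Cg (by linarith) b₁ hGH y hy z hz).trans ?_,
      fun y hy z hz => (hol G' B Cg' (by linarith) b₂ hGH' y hy z hz).trans ?_,
      fun y hy => b₁ y (hR hy), fun y hy => b₂ y (hR hy), lip G B hG b₁, lip G' B hG' b₂,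
      lt_min (by exact_mod_cast hε) one_pos, min_le_right _ _, by positivity, hB1⟩⟩
  all_goals
    have : (0:ℝ) ≤ Cg := Cg.2
    have : (0:ℝ) ≤ Cg' := Cg'.2
    exact mul_le_mul_of_nonneg_right (by linarith) (by positivity)

theorem dist_iterate_le (h : HolderDiffeo M G G' α C B) (i : ℕ) {y z : EuclideanSpace ℝ (Fin N)}
    (hy : y ∈ M) (hz : z ∈ M) : dist (G^[i] y) (G^[i] z) ≤ B ^ i * dist y z := by
  obtain ⟨C', hC'⟩ := h.iterate i
  rw [dist_eq_norm, dist_eq_norm]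
  exact hC'.lip y hy z hz

end HolderDiffeo

theorem exists_cov_zero {N : ℕ} {M : Set (EuclideanSpace ℝ (Fin N))} (hM : IsCompact M)
    (G : EuclideanSpace ℝ (Fin N) → EuclideanSpace ℝ (Fin N)) {δ : ℝ} (hδ : 0 < δ) :
    ∃ Y, 1 ≤ Y ∧ Cov G δ 0 M Y := by
  obtain ⟨t, -, htf, ht⟩ := hM.finite_cover_balls (half_pos hδ)
  refine ⟨htf.toFinset.card * 1 + 1, by simp, ?_⟩
  refine (cov_of_forall_piece htf.toFinset (fun c => Metric.ball c (δ / 2)) (b := 1) ?_ ?_).mono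
    subset_rfl (by linarith)
  · intro x hx
    obtain ⟨c, hc, hxc⟩ := mem_iUnion₂.1 (ht hx)
    exact ⟨c, by simpa using hc, hxc⟩
  · intro c hc
    refine ⟨{M ∩ Metric.ball c (δ / 2)}, by simp, ?_, fun x hx => ⟨_, by simp, hx⟩⟩
    intro B hB x hx y hy i hi
    obtain rfl := Finset.mem_singleton.1 hB
    obtain rfl : i = 0 := by omega
    have h1 := Metric.mem_ball.1 hx.2
    have h2 := Metric.mem_ball'.1 hy.2
    have h3 := dist_triangle x c y
    simp only [Function.iterate_zero, id]
    linarith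

/-- The positive part of the logarithm of the norm of the derivative of `F` along `M`. -/
def logNorm {N : ℕ} (M : Set (EuclideanSpace ℝ (Fin N)))
    (F : EuclideanSpace ℝ (Fin N) → EuclideanSpace ℝ (Fin N)) (x : EuclideanSpace ℝ (Fin N)) : ℝ :=
  Real.posLog ‖(fderiv ℝ F x).comp (Tan M x).subtypeL‖

section LogNorm

variable {N : ℕ} {M : Set (EuclideanSpace ℝ (Fin N))}
  {F F₁ : EuclideanSpace ℝ (Fin N) → EuclideanSpace ℝ (Fin N)} {x w : EuclideanSpace ℝ (Fin N)}

theorem logNorm_nonneg : 0 ≤ logNorm M F x := Real.posLog_nonneg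

theorem norm_fderiv_le_exp_logNorm (hw : w ∈ Tan M x) :
    ‖fderiv ℝ F x w‖ ≤ Real.exp (logNorm M F x) * ‖w‖ := by
  have h1 := ((fderiv ℝ F x).comp (Tan M x).subtypeL).le_opNorm ⟨w, hw⟩
  refine h1.trans (mul_le_mul_of_nonneg_right ?_ (norm_nonneg _))
  rcases (norm_nonneg ((fderiv ℝ F x).comp (Tan M x).subtypeL)).eq_or_lt with h | h
  · rw [← h]; exact (Real.exp_pos _).le
  · rw [← Real.log_le_iff_le_exp h]
    exact le_max_right _ _

theorem logNorm_le_of_forall {b : ℝ} (hb : 0 ≤ b)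
    (h : ∀ w ∈ Tan M x, ‖fderiv ℝ F x w‖ ≤ Real.exp b * ‖w‖) : logNorm M F x ≤ b := by
  have h1 : ‖(fderiv ℝ F x).comp (Tan M x).subtypeL‖ ≤ Real.exp b :=
    ContinuousLinearMap.opNorm_le_bound _ (Real.exp_pos _).le fun w => h w w.2
  rcases (norm_nonneg ((fderiv ℝ F x).comp (Tan M x).subtypeL)).eq_or_lt with h0 | h0
  · rw [logNorm, ← h0, Real.posLog_zero]; exact hb
  · exact max_le hb ((Real.log_le_iff_le_exp h0).2 h1)

theorem logNorm_comp_le (hF : DifferentiableAt ℝ F (F₁ x)) (hF₁ : DifferentiableAt ℝ F₁ x)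
    (hm : MapsTo F₁ M M) : logNorm M (F ∘ F₁) x ≤ logNorm M F (F₁ x) + logNorm M F₁ x := by
  refine logNorm_le_of_forall (add_nonneg logNorm_nonneg logNorm_nonneg) fun w hw => ?_
  rw [fderiv_comp _ hF hF₁, Real.exp_add, mul_assoc]
  refine (norm_fderiv_le_exp_logNorm (fderiv_mem_tan hF₁ hm hw)).trans ?_
  exact mul_le_mul_of_nonneg_left (norm_fderiv_le_exp_logNorm hw) (Real.exp_pos _).le

end LogNorm

section Ruelle

variable {N : ℕ} {M : Set (EuclideanSpace ℝ (Fin N))}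
  {G G' : EuclideanSpace ℝ (Fin N) → EuclideanSpace ℝ (Fin N)} {α C B r ρ K : ℝ}

/-- The cell of the cubical grid of mesh `a` that contains `x`. -/
def gridCell (a : ℝ) (x : EuclideanSpace ℝ (Fin N)) (k : Fin N) : ℤ := ⌊x k / a⌋

theorem norm_sub_le_of_gridCell_eq {a : ℝ} (ha : 0 < a) {x y : EuclideanSpace ℝ (Fin N)}
    (h : gridCell a x = gridCell a y) : ‖x - y‖ ≤ √N * a := by
  have hk : ∀ k, ‖(x - y) k‖ ^ 2 ≤ a ^ 2 := fun k => by
    have h1 : ⌊x k / a⌋ = ⌊y k / a⌋ := congrFun h k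
    have h2 := Int.abs_sub_lt_one_of_floor_eq_floor h1
    rw [← sub_div, abs_div, abs_of_pos ha, div_lt_one ha] at h2
    rw [PiLp.sub_apply, Real.norm_eq_abs, sq_abs]
    exact sq_le_sq' (by linarith [(abs_lt.1 h2).1]) (abs_lt.1 h2).2.le
  rw [EuclideanSpace.norm_eq]
  calc √(∑ k, ‖(x - y) k‖ ^ 2) ≤ √(∑ _k : Fin N, a ^ 2) :=
        Real.sqrt_le_sqrt (Finset.sum_le_sum fun k _ => hk k)
    _ = √N * a := by
        rw [Finset.sum_const, Finset.card_univ, Fintype.card_fin, nsmul_eq_mul,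
          Real.sqrt_mul (Nat.cast_nonneg _), Real.sqrt_sq ha.le]

theorem exists_gridCells_ball {a R : ℝ} (ha : 0 < a) (hR : 0 ≤ R) (z : EuclideanSpace ℝ (Fin N)) :
    ∃ I : Finset (Fin N → ℤ), (I.card : ℝ) ≤ (2 * R / a + 2) ^ N ∧
      ∀ y, ‖y - z‖ ≤ R → gridCell a y ∈ I := by
  refine ⟨Fintype.piFinset fun k => Finset.Icc ⌊(z k - R) / a⌋ ⌊(z k + R) / a⌋, ?_, fun y hy => ?_⟩
  · rw [Fintype.card_piFinset, Nat.cast_prod]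
    refine (Finset.prod_le_prod (fun _ _ => Nat.cast_nonneg _)
      (g := fun _ => 2 * R / a + 2) fun k _ => ?_).trans (by simp)
    rw [Int.card_Icc]
    have h1 := Int.floor_le ((z k + R) / a)
    have h2 := Int.lt_floor_add_one ((z k - R) / a)
    have h3 : ((z k + R) / a) = ((z k - R) / a) + 2 * R / a := by ring
    have h4 : ⌊(z k - R) / a⌋ ≤ ⌊(z k + R) / a⌋ := by
      apply Int.floor_le_floor; gcongr; linarith
    have h5 : (((⌊(z k + R) / a⌋ + 1 - ⌊(z k - R) / a⌋).toNat : ℤ) : ℝ) =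
        ⌊(z k + R) / a⌋ + 1 - ⌊(z k - R) / a⌋ := by
      rw [Int.toNat_of_nonneg (by omega)]; push_cast; ring
    rw [← Int.cast_natCast, h5]
    linarith
  · rw [Fintype.mem_piFinset]
    intro k
    have h1 : |y k - z k| ≤ R := by
      have := PiLp.norm_apply_le (y - z) k
      rw [PiLp.sub_apply, Real.norm_eq_abs] at this
      exact this.trans hy
    have h2 := abs_le.1 h1
    rw [Finset.mem_Icc]
    constructor <;> apply Int.floor_le_floor <;> gcongr <;> linarith

/-- At small scales, `F` expands by at most twice its derivative. -/
theorem HolderDiffeo.exists_local_lip (h : HolderDiffeo M G G' α C B) (hr : 0 < r) (hρ : 0 < ρ)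
    (hK : 1 ≤ K) (hM : ∀ x ∈ M, HasChart M r ρ K x) : ∃ δ₀ > 0, ∀ x ∈ M, ∀ y ∈ M, ‖y - x‖ ≤ δ₀ →
      ‖G y - G x‖ ≤ 2 * Real.exp (logNorm M G x) * ‖y - x‖ := by
  obtain ⟨δ₀, hδ₀, hδ1, hδρ, hδ⟩ : ∃ δ₀ > 0, δ₀ ≤ 1 ∧ δ₀ ≤ ρ ∧
      ((C + 1) * (B + 1) * K ^ 4) * δ₀ ^ α ≤ 1 / 2 := by
    have ht : Filter.Tendsto (fun d : ℝ => ((C + 1) * (B + 1) * K ^ 4) * d ^ α)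
        (nhdsWithin 0 (Ioi 0)) (nhds 0) := by
      have := (Real.continuousAt_rpow_const 0 α (Or.inr h.pos.le)).tendsto.const_mul
        ((C + 1) * (B + 1) * K ^ 4)
      rw [Real.zero_rpow h.pos.ne', mul_zero] at this
      exact this.mono_left nhdsWithin_le_nhds
    have h1 := ht.eventually (Iio_mem_nhds (show (0:ℝ) < 1 / 2 by norm_num))
    have h2 : ∀ᶠ d : ℝ in nhdsWithin 0 (Ioi 0), d < 1 :=
      nhdsWithin_le_nhds (Iio_mem_nhds one_pos)
    have h3 : ∀ᶠ d : ℝ in nhdsWithin 0 (Ioi 0), d < ρ :=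
      nhdsWithin_le_nhds (Iio_mem_nhds hρ)
    obtain ⟨d, ⟨⟨hd1, hd2⟩, hd3⟩, hd4⟩ :=
      (((h1.and h2).and h3).and self_mem_nhdsWithin).exists
    exact ⟨d, hd4, hd2.le, hd3.le, le_of_lt hd1⟩
  refine ⟨δ₀, hδ₀, fun x hx y hy hyx => ?_⟩
  obtain ⟨w, hw, h1, h2⟩ := (hM x hx).exists_tan_approx hr hρ hK h.diff h.pos h.le_one h.nonneg
    h.holder h.bound hδρ hδ1 hy hx hyx (by simpa using hδ₀.le)
  have h1' := h1.trans (mul_le_mul_of_nonneg_right hδ (norm_nonneg _))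
  have h2' := h2.trans (mul_le_mul_of_nonneg_right hδ (norm_nonneg _))
  have h3 := norm_fderiv_le_exp_logNorm (F := G) hw
  have h4 : 1 ≤ Real.exp (logNorm M G x) := Real.one_le_exp logNorm_nonneg
  have h5 : ‖w‖ ≤ 3 / 2 * ‖y - x‖ := by
    have := norm_sub_norm_le w (y - x)
    rw [norm_sub_rev w] at this
    linarith
  have h6 : ‖G y - G x‖ ≤ ‖fderiv ℝ G x w‖ + ‖G y - G x - fderiv ℝ G x w‖ := by
    have := norm_add_le (fderiv ℝ G x w) (G y - G x - fderiv ℝ G x w)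
    rwa [add_sub_cancel] at this
  calc ‖G y - G x‖ ≤ Real.exp (logNorm M G x) * (3 / 2 * ‖y - x‖) + 1 * (1 / 2 * ‖y - x‖) := by
        have := mul_le_mul_of_nonneg_left h5 (Real.exp_pos (logNorm M G x)).le
        linarith
    _ ≤ Real.exp (logNorm M G x) * (3 / 2 * ‖y - x‖) +
        Real.exp (logNorm M G x) * (1 / 2 * ‖y - x‖) := by gcongr
    _ = _ := by ring

/-- Ruelle's inequality at finite scale. -/
theorem HolderDiffeo.exists_cov_of_sum_logNorm_le (h : HolderDiffeo M G G' α C B)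
    (hMc : IsCompact M) (hr : 0 < r) (hρ : 0 < ρ)
    (hK : 1 ≤ K) (hM : ∀ x ∈ M, HasChart M r ρ K x) {δ : ℝ} (hδ : 0 < δ) (m : ℕ) :
    ∃ Q : ℝ, 1 ≤ Q ∧ ∀ (T : ℕ) (s : ℝ),
      Cov G δ (m * T) {x ∈ M | ∑ i ∈ Finset.range T, logNorm M (G^[m]) (G^[m * i] x) ≤ s}
        (Q * (((4 * √N + 6) * 2) ^ N) ^ T * Real.exp (N * s)) := by
  obtain ⟨C', hF⟩ := h.iterate m
  obtain ⟨δ₁, hδ₁, hloc⟩ := hF.exists_local_lip hr hρ hK hM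
  set U : EuclideanSpace ℝ (Fin N) → ℝ := logNorm M (G^[m]) with hU
  have hU0 : ∀ x, 0 ≤ U x := fun x => logNorm_nonneg
  have hBm : 1 ≤ B ^ m := one_le_pow₀ h.one_le
  obtain ⟨d, hd, hdδ₁, hdδ⟩ : ∃ d > 0, d ≤ δ₁ ∧ B ^ m * d ≤ δ :=
    ⟨min δ₁ (δ / B ^ m), lt_min hδ₁ (by positivity), min_le_left _ _, by
      have := min_le_right δ₁ (δ / B ^ m)
      rwa [le_div_iff₀' (by positivity)] at this⟩
  set a : ℝ := d / (√N + 1) with ha_def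
  have hsN : 0 ≤ √(N : ℝ) := Real.sqrt_nonneg _
  have ha : 0 < a := by positivity
  have hcell : ∀ x y : EuclideanSpace ℝ (Fin N), gridCell a x = gridCell a y → ‖x - y‖ ≤ d := by
    intro x y hxy
    refine (norm_sub_le_of_gridCell_eq ha hxy).trans ?_
    have : (√N + 1) * a = d := by rw [ha_def]; field_simp
    linarith
  have hsmall : ∀ S ⊆ M, (∀ x ∈ S, ∀ y ∈ S, gridCell a x = gridCell a y) → Cov G δ m S 1 := by
    intro S hS hc
    refine ⟨{S}, by simp, ?_, fun x hx => ⟨S, by simp, hx⟩⟩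
    intro P hP x hx y hy i hi
    obtain rfl := Finset.mem_singleton.1 hP
    refine (h.dist_iterate_le i (hS hx) (hS hy)).trans (le_trans ?_ hdδ)
    rw [dist_eq_norm]
    exact mul_le_mul (pow_le_pow_right₀ h.one_le hi) (hcell x y (hc x hx y hy)) (norm_nonneg _)
      (by positivity)
  set D : ℝ := ((4 * √N + 6) * 2) ^ N with hD
  have key : ∀ (T : ℕ) (s : ℝ), ∀ S ⊆ M, (∀ x ∈ S, ∀ y ∈ S, gridCell a x = gridCell a y) →
      (∀ x ∈ S, ∑ i ∈ Finset.range T, U (G^[m * i] x) ≤ s) →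
      Cov G δ (m * T) S (D ^ T * Real.exp (N * s)) := by
    intro T
    induction T with
    | zero =>
      intro s S hS hc hs
      rcases S.eq_empty_or_nonempty with rfl | ⟨x, hx⟩
      · exact cov_empty (by positivity)
      · refine ((hsmall S hS hc).of_le (by simp)).mono subset_rfl ?_
        have := hs x hx
        simp only [Finset.range_zero, Finset.sum_empty] at this
        rw [pow_zero, one_mul]
        exact Real.one_le_exp (by positivity)
    | succ T ih =>
      intro s S hS hc hs
      rcases S.eq_empty_or_nonempty with rfl | hne
      · exact cov_empty (by positivity)
      have hbdd : BddBelow (U '' S) := ⟨0, by rintro _ ⟨x, -, rfl⟩; exact hU0 x⟩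
      obtain ⟨_, ⟨x₀, hx₀, rfl⟩, hx₀'⟩ := exists_lt_of_csInf_lt (hne.image U)
        (show sInf (U '' S) < sInf (U '' S) + Real.log 2 by
          linarith [Real.log_pos (show (1:ℝ) < 2 by norm_num)])
      have hinf : ∀ x ∈ S, U x₀ - Real.log 2 ≤ U x := fun x hx => by
        have := csInf_le hbdd (mem_image_of_mem U hx)
        linarith
      have hball : ∀ x ∈ S, ‖G^[m] x - G^[m] x₀‖ ≤ 2 * Real.exp (U x₀) * d := fun x hx => by
        have h1 := hcell x x₀ (hc x hx x₀ hx₀)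
        refine (hloc x₀ (hS hx₀) x (hS hx) (h1.trans hdδ₁)).trans ?_
        gcongr
      obtain ⟨I, hI, hIc⟩ := exists_gridCells_ball ha
        (show 0 ≤ 2 * Real.exp (U x₀) * d by positivity) (G^[m] x₀)
      have hIcard : (I.card : ℝ) ≤ (4 * √N + 6) ^ N * Real.exp (N * U x₀) := by
        refine hI.trans ?_
        rw [Real.exp_nat_mul, ← mul_pow]
        have h1 : 2 * (2 * Real.exp (U x₀) * d) / a = 4 * (√N + 1) * Real.exp (U x₀) := by
          rw [ha_def]; field_simp; ring
        have h2 : 1 ≤ Real.exp (U x₀) := Real.one_le_exp (hU0 _)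
        refine pow_le_pow_left₀ (by positivity) ?_ N
        rw [h1]
        linarith
      refine (cov_of_forall_piece I (fun c => {x | gridCell a (G^[m] x) = c})
        (b := D ^ T * Real.exp (N * (s - U x₀ + Real.log 2))) (fun x hx => ⟨_, hIc _ (hball x hx), rfl⟩)
        fun c hcI => ?_).mono subset_rfl ?_
      · have h1 : Cov G δ m (S ∩ {x | gridCell a (G^[m] x) = c}) 1 :=
          (hsmall S hS hc).mono inter_subset_left le_rfl
        have h2 := ih (s - U x₀ + Real.log 2) (G^[m] '' (S ∩ {x | gridCell a (G^[m] x) = c})) ?_ ?_ ?_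
        · have := h1.mul h2 (Nat.le_succ m)
          rw [one_mul] at this
          convert this using 1
          ring
        · rintro _ ⟨x, hx, rfl⟩
          exact hF.maps (hS hx.1)
        · rintro _ ⟨x, hx, rfl⟩ _ ⟨y, hy, rfl⟩
          have hx2 : gridCell a (G^[m] x) = c := hx.2
          have hy2 : gridCell a (G^[m] y) = c := hy.2
          rw [hx2, hy2]
        · rintro _ ⟨x, hx, rfl⟩
          have h3 := hs x hx.1
          have h4 := hinf x hx.1
          rw [Finset.sum_range_succ'] at h3
          simp only [mul_zero, Function.iterate_zero, id] at h3
          have h5 : ∀ i, G^[m * i] (G^[m] x) = G^[m * (i + 1)] x := fun i => by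
            rw [← Function.iterate_add_apply]; congr 2
          simp only [h5]
          linarith
      · have hN : Real.exp (N * (s - U x₀ + Real.log 2)) =
            Real.exp (N * s) * (Real.exp (N * U x₀))⁻¹ * 2 ^ N := by
          rw [← Real.exp_neg, ← Real.exp_add, show (N : ℝ) * (s - U x₀ + Real.log 2) =
            N * s + -(N * U x₀) + N * Real.log 2 by ring, Real.exp_add, Real.exp_nat_mul (Real.log 2),
            Real.exp_log (by norm_num)]
        calc (I.card : ℝ) * (D ^ T * Real.exp (N * (s - U x₀ + Real.log 2)))
            ≤ ((4 * √N + 6) ^ N * Real.exp (N * U x₀)) *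
              (D ^ T * Real.exp (N * (s - U x₀ + Real.log 2))) := by gcongr
          _ = _ := by
              rw [hN, pow_succ D T, hD, mul_pow]
              field_simp
  obtain ⟨R, hR0, hR⟩ := hMc.isBounded.subset_closedBall_lt 0 (0 : EuclideanSpace ℝ (Fin N))
  obtain ⟨I, hI, hIc⟩ := exists_gridCells_ball ha hR0.le (0 : EuclideanSpace ℝ (Fin N))
  refine ⟨(2 * R / a + 2) ^ N, one_le_pow₀ (by
    have : 0 ≤ 2 * R / a := by positivity
    linarith), fun T s => ?_⟩
  refine (cov_of_forall_piece I (fun c => {x | gridCell a x = c}) (b := D ^ T * Real.exp (N * s))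
    (fun x hx => ⟨_, hIc _ (mem_closedBall_iff_norm.1 (hR hx.1)), rfl⟩) fun c _ => ?_).mono
      subset_rfl ?_
  · refine key T s _ (fun x hx => hx.1.1) (fun x hx y hy => ?_) fun x hx => hx.1.2
    have hx2 : gridCell a x = c := hx.2
    have hy2 : gridCell a y = c := hy.2
    rw [hx2, hy2]
  · rw [mul_assoc]
    gcongr

/-- Ruelle's inequality at finite scale, for the inverse. -/
theorem HolderDiffeo.exists_cov_of_sum_logNorm_inverse_le (h : HolderDiffeo M G G' α C B)
    (hMc : IsCompact M) (hr : 0 < r) (hρ : 0 < ρ)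
    (hK : 1 ≤ K) (hM : ∀ x ∈ M, HasChart M r ρ K x) {δ : ℝ} (hδ : 0 < δ) (m : ℕ) :
    ∃ Q : ℝ, 1 ≤ Q ∧ ∀ (T : ℕ) (s : ℝ),
      Cov G δ (m * T) {x ∈ M | ∑ i ∈ Finset.range T,
        logNorm M (G'^[m]) (G^[m] (G^[m * i] x)) ≤ s}
        (Q * (((4 * √N + 6) * 2) ^ N) ^ T * Real.exp (N * s)) := by
  obtain ⟨Q, hQ, H⟩ := h.symm.exists_cov_of_sum_logNorm_le hMc hr hρ hK hM hδ m
  refine ⟨Q, hQ, fun T s => Cov.reverse h.maps h.inv (fun x hx => hx.1)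
    ((H T s).mono ?_ le_rfl)⟩
  rintro _ ⟨x, ⟨hx, hxs⟩, rfl⟩
  refine ⟨h.maps.iterate _ hx, le_trans (le_of_eq ?_) hxs⟩
  rw [← Finset.sum_range_reflect]
  refine Finset.sum_congr rfl fun i hi => ?_
  have hi := Finset.mem_range.1 hi
  have hpow : ∀ k, ∀ y ∈ M, G'^[k] (G^[k] y) = y := fun k y hy => by
    obtain ⟨C', hC'⟩ := h.iterate k
    exact hC'.inv y hy
  congr 1
  have h1 : m * T = m * (T - 1 - i) + (m + m * i) := by
    obtain ⟨j, rfl⟩ : ∃ j, T = i + j + 1 := ⟨T - 1 - i, by omega⟩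
    rw [show i + j + 1 - 1 - i = j by omega]; ring
  rw [h1, Function.iterate_add_apply, hpow _ _ (h.maps.iterate _ hx), Function.iterate_add_apply]

end Ruelle

set_option linter.unusedSectionVars false

section PlaneFrame

variable {E : Type*} [NormedAddCommGroup E] [InnerProductSpace ℝ E]

/-- The vector representing, on the plane spanned by the unit vectors `e` and `f`, the coordinate
along `e`. -/
def coordVec (e f : E) : E := (1 - inner ℝ e f ^ 2)⁻¹ • (e - inner ℝ e f • f)

theorem coordVec_mem {T : Submodule ℝ E} {e f : E} (he : e ∈ T) (hf : f ∈ T) : coordVec e f ∈ T :=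
  T.smul_mem _ (T.sub_mem he (T.smul_mem _ hf))

theorem inner_sq_lt_one {e f : E} (he : ‖e‖ = 1) (hf : ‖f‖ = 1) (h1 : e ≠ f) (h2 : e ≠ -f) :
    inner ℝ e f ^ 2 < 1 := by
  rw [sq_lt_one_iff_abs_lt_one, abs_lt]
  constructor
  · have h3 := (inner_lt_one_iff_real_of_norm_eq_one he (by rwa [norm_neg] : ‖-f‖ = 1)).2 h2
    rw [inner_neg_right] at h3
    linarith
  · exact (inner_lt_one_iff_real_of_norm_eq_one he hf).2 h1

variable {e f : E} (he : ‖e‖ = 1) (hf : ‖f‖ = 1) (hc : inner ℝ e f ^ 2 < 1)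
include he hf hc

theorem inner_coordVec_left : inner ℝ (coordVec e f) e = 1 := by
  have hee : inner ℝ e e = (1:ℝ) := by rw [real_inner_self_eq_norm_sq, he]; norm_num
  have h0 : 1 - inner ℝ e f ^ 2 ≠ 0 := by linarith
  rw [coordVec, real_inner_smul_left, inner_sub_left, real_inner_smul_left, hee,
    real_inner_comm e f]
  field_simp

theorem inner_coordVec_right : inner ℝ (coordVec e f) f = 0 := by
  have hff : inner ℝ f f = (1:ℝ) := by rw [real_inner_self_eq_norm_sq, hf]; norm_num
  rw [coordVec, real_inner_smul_left, inner_sub_left, real_inner_smul_left, hff]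
  ring

theorem norm_coordVec_sq : ‖coordVec e f‖ ^ 2 = (1 - inner ℝ e f ^ 2)⁻¹ := by
  rw [← real_inner_self_eq_norm_sq]
  nth_rw 2 [coordVec]
  rw [real_inner_smul_right, inner_sub_right, real_inner_smul_right,
    inner_coordVec_left he hf hc, inner_coordVec_right he hf hc]
  ring

theorem norm_coordVec_comm : ‖coordVec e f‖ = ‖coordVec f e‖ := by
  have hc' : inner ℝ f e ^ 2 < 1 := by rwa [real_inner_comm]
  rw [← sq_eq_sq₀ (norm_nonneg _) (norm_nonneg _), norm_coordVec_sq he hf hc,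
    norm_coordVec_sq hf he hc', real_inner_comm]

theorem one_le_norm_coordVec : 1 ≤ ‖coordVec e f‖ := by
  have h1 := real_inner_le_norm (coordVec e f) e
  rw [inner_coordVec_left he hf hc, he] at h1
  linarith

theorem eq_coord_add_coord {T : Submodule ℝ E} (hT : Module.finrank ℝ T = 2) (heT : e ∈ T)
    (hfT : f ∈ T) {w : E} (hw : w ∈ T) :
    w = inner ℝ (coordVec e f) w • e + inner ℝ (coordVec f e) w • f := by
  have hc' : inner ℝ f e ^ 2 < 1 := by rwa [real_inner_comm]
  have hfin : FiniteDimensional ℝ T := Module.finite_of_finrank_eq_succ hT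
  have hli : LinearIndependent ℝ ![e, f] := by
    refine LinearIndependent.pair_iff.2 fun s t hst => ?_
    have h1 := congrArg (inner ℝ (coordVec e f)) hst
    have h2 := congrArg (inner ℝ (coordVec f e)) hst
    rw [inner_add_right, real_inner_smul_right, real_inner_smul_right, inner_zero_right,
      inner_coordVec_left he hf hc, inner_coordVec_right he hf hc] at h1
    rw [inner_add_right, real_inner_smul_right, real_inner_smul_right, inner_zero_right,
      inner_coordVec_left hf he hc', inner_coordVec_right hf he hc'] at h2
    exact ⟨by linarith, by linarith⟩
  have hspan : Submodule.span ℝ (range ![e, f]) = T := by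
    refine Submodule.eq_of_le_of_finrank_eq (Submodule.span_le.2 ?_) ?_
    · rintro _ ⟨i, rfl⟩
      fin_cases i
      exacts [heT, hfT]
    · rw [finrank_span_eq_card hli, hT, Fintype.card_fin]
  rw [← hspan, Matrix.range_cons, Matrix.range_cons, Matrix.range_empty, union_empty,
    singleton_union, Submodule.mem_span_pair] at hw
  obtain ⟨a, b, rfl⟩ := hw
  simp only [inner_add_right, real_inner_smul_right, inner_coordVec_left he hf hc,
    inner_coordVec_right he hf hc, inner_coordVec_left hf he hc', inner_coordVec_right hf he hc',
    mul_one, mul_zero, add_zero, zero_add]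

theorem norm_le_abs_coord_add_abs_coord {T : Submodule ℝ E} (hT : Module.finrank ℝ T = 2)
    (heT : e ∈ T) (hfT : f ∈ T) {w : E} (hw : w ∈ T) :
    ‖w‖ ≤ |inner ℝ (coordVec e f) w| + |inner ℝ (coordVec f e) w| := by
  calc ‖w‖ = ‖inner ℝ (coordVec e f) w • e + inner ℝ (coordVec f e) w • f‖ :=
        congrArg norm (eq_coord_add_coord he hf hc hT heT hfT hw)
    _ ≤ _ := by
        refine (norm_add_le _ _).trans ?_
        rw [norm_smul, norm_smul, he, hf, mul_one, mul_one, Real.norm_eq_abs, Real.norm_eq_abs]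

/-- If a linear map stretches `f` and contracts `e`, the angle between them is not too small. -/
theorem norm_coordVec_le {A : E →L[ℝ] E} {P : ℝ} {T : Submodule ℝ E} (heT : e ∈ T) (hfT : f ∈ T)
    (hA : ∀ w ∈ T, ‖A w‖ ≤ Real.exp P * ‖w‖) (h : 1 ≤ ‖A f‖ - ‖A e‖) :
    ‖coordVec e f‖ ≤ 2 * Real.exp P := by
  have hP := Real.exp_pos P
  have hee : inner ℝ e e = (1:ℝ) := by rw [real_inner_self_eq_norm_sq, he]; norm_num
  have hff : inner ℝ f f = (1:ℝ) := by rw [real_inner_self_eq_norm_sq, hf]; norm_num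
  have h1 : 1 ≤ Real.exp P * ‖f - e‖ := by
    have h2 := hA _ (T.sub_mem hfT heT)
    rw [map_sub] at h2
    linarith [norm_sub_norm_le (A f) (A e)]
  have h2 : 1 ≤ Real.exp P * ‖f + e‖ := by
    have h2 := hA _ (T.add_mem hfT heT)
    rw [map_add] at h2
    have h3 := norm_sub_norm_le (A f) (-A e)
    rw [norm_neg, sub_neg_eq_add] at h3
    linarith
  have e1 : ‖f - e‖ ^ 2 = 2 - 2 * inner ℝ e f := by
    rw [norm_sub_sq_real, he, hf, real_inner_comm]; ring
  have e2 : ‖f + e‖ ^ 2 = 2 + 2 * inner ℝ e f := by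
    rw [norm_add_sq_real, he, hf, real_inner_comm]; ring
  have h1' : 1 ≤ Real.exp P ^ 2 * (2 - 2 * inner ℝ e f) := by
    rw [← e1, ← mul_pow]; exact one_le_pow₀ h1
  have h2' : 1 ≤ Real.exp P ^ 2 * (2 + 2 * inner ℝ e f) := by
    rw [← e2, ← mul_pow]; exact one_le_pow₀ h2
  have h3 : 1 ≤ 2 * Real.exp P ^ 2 * (1 - inner ℝ e f ^ 2) := by
    generalize (inner ℝ e f : ℝ) = c at *
    have hE : 0 < Real.exp P ^ 2 := by positivity
    generalize Real.exp P ^ 2 = X at *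
    have hc1 := abs_lt.1 (sq_lt_one_iff_abs_lt_one c |>.1 hc)
    rcases le_total 0 c with h0 | h0
    · have : 2 * X * (1 - c ^ 2) = X * (2 - 2 * c) * (1 + c) := by ring
      rw [this]
      exact one_le_mul_of_one_le_of_one_le h1' (by linarith)
    · have : 2 * X * (1 - c ^ 2) = X * (2 + 2 * c) * (1 - c) := by ring
      rw [this]
      exact one_le_mul_of_one_le_of_one_le h2' (by linarith)
  have h4 : (1 - inner ℝ e f ^ 2)⁻¹ ≤ 2 * Real.exp P ^ 2 := by
    rw [inv_le_iff_one_le_mul₀ (by linarith)]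
    linarith
  refine le_of_sq_le_sq ?_ (by positivity)
  rw [norm_coordVec_sq he hf hc]
  nlinarith [sq_nonneg (Real.exp P)]

end PlaneFrame

section Frames

variable {N : ℕ} {M : Set (EuclideanSpace ℝ (Fin N))}
  {G G' : EuclideanSpace ℝ (Fin N) → EuclideanSpace ℝ (Fin N)} {α C B r ρ K : ℝ}
  {x : EuclideanSpace ℝ (Fin N)}

theorem exists_norm_fderiv_eq {F : EuclideanSpace ℝ (Fin N) → EuclideanSpace ℝ (Fin N)}
    (hT : Module.finrank ℝ (Tan M x) = 2) (h : 0 < logNorm M F x) :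
    ∃ w ∈ Tan M x, ‖w‖ = 1 ∧ ‖fderiv ℝ F x w‖ = Real.exp (logNorm M F x) := by
  have : Nontrivial (Tan M x) := Module.nontrivial_of_finrank_pos (R := ℝ) (by omega)
  set A := (fderiv ℝ F x).comp (Tan M x).subtypeL with hA
  have hne : (Metric.sphere (0 : Tan M x) 1).Nonempty := (NormedSpace.sphere_nonempty).2 zero_le_one
  obtain ⟨w, hw, hmax⟩ := (isCompact_sphere (0 : Tan M x) 1).exists_isMaxOn hne
    (A.continuous.norm.continuousOn)
  have hw1 : ‖w‖ = 1 := by simpa using hw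
  have h1 : ‖A‖ = ‖A w‖ := by
    refine le_antisymm (A.opNorm_le_of_unit_norm (norm_nonneg _) fun z hz => hmax (by simpa using hz)) ?_
    have := A.le_opNorm w
    rwa [hw1, mul_one] at this
  refine ⟨w, w.2, hw1, ?_⟩
  have h2 : ‖fderiv ℝ F x w‖ = ‖A w‖ := rfl
  rw [h2, ← h1]
  have h3 : logNorm M F x = Real.log ‖A‖ := by
    rw [logNorm, Real.posLog_apply, max_eq_right]
    by_contra! h4
    rw [logNorm, Real.posLog_apply, max_eq_left h4.le] at h
    exact lt_irrefl _ h
  have h4 : 0 < ‖A‖ := by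
    rcases (norm_nonneg A).eq_or_lt with h4 | h4
    · rw [h3, ← h4, Real.log_zero] at h
      exact absurd h (lt_irrefl _)
    · exact h4
  rw [h3, Real.exp_log h4]

namespace HolderDiffeo

variable (h : HolderDiffeo M G G' α C B)
include h

theorem differentiable_iterate (i : ℕ) : Differentiable ℝ (G^[i]) := by
  obtain ⟨C', hC'⟩ := h.iterate i
  exact hC'.diff

theorem iterate_mem (hx : x ∈ M) (i : ℕ) : G^[i] x ∈ M := h.maps.iterate i hx

theorem fderiv_iterate_succ (i : ℕ) (w : EuclideanSpace ℝ (Fin N)) :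
    fderiv ℝ (G^[i + 1]) x w = fderiv ℝ G (G^[i] x) (fderiv ℝ (G^[i]) x w) := by
  rw [Function.iterate_succ', fderiv_comp _ (h.diff _) (h.differentiable_iterate i _)]
  rfl

theorem fderiv_inverse {w : EuclideanSpace ℝ (Fin N)} (hw : w ∈ Tan M x) :
    fderiv ℝ G' (G x) (fderiv ℝ G x w) = w :=
  fderiv_fderiv_of_inverse (h.diff _) (h.diff' _) h.inv hw

theorem fderiv_inverse' (hx : x ∈ M) {w : EuclideanSpace ℝ (Fin N)} (hw : w ∈ Tan M (G x)) :
    fderiv ℝ G x (fderiv ℝ G' (G x) w) = w := by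
  have := h.symm.fderiv_inverse hw
  rwa [h.inv x hx] at this

theorem logNorm_iterate_le (q : ℕ) :
    logNorm M (G^[q]) x ≤ ∑ i ∈ Finset.range q, logNorm M G (G^[i] x) := by
  induction q with
  | zero =>
    rw [Finset.range_zero, Finset.sum_empty]
    exact logNorm_le_of_forall le_rfl fun w _ => by simp
  | succ q ih =>
    rw [Finset.sum_range_succ, Function.iterate_succ', add_comm]
    exact (logNorm_comp_le (h.diff _) (h.differentiable_iterate q _)
      (h.maps.iterate q)).trans (by gcongr)

theorem inverse_iterate (hx : x ∈ M) (q : ℕ) : G'^[q] (G^[q] x) = x := by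
  obtain ⟨C', hC'⟩ := h.iterate q
  exact hC'.inv x hx

theorem logNorm_inverse_iterate_le (hx : x ∈ M) (q : ℕ) :
    logNorm M (G'^[q]) (G^[q] x) ≤ ∑ i ∈ Finset.range q, logNorm M G' (G^[i + 1] x) := by
  refine (h.symm.logNorm_iterate_le q).trans (le_of_eq ?_)
  rw [← Finset.sum_range_reflect]
  refine Finset.sum_congr rfl fun i hi => ?_
  have hi := Finset.mem_range.1 hi
  congr 1
  have h1 : q = (q - 1 - i) + (i + 1) := by omega
  conv_lhs => rw [show G^[q] x = G^[q - 1 - i] (G^[i + 1] x) by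
    rw [← Function.iterate_add_apply, ← h1]]
  exact h.inverse_iterate (h.iterate_mem hx _) _

/-- Push forward of a tangent vector along an orbit, normalized. -/
theorem exists_unit_push {w : EuclideanSpace ℝ (Fin N)} (hw : w ∈ Tan M x)
    (hw1 : ‖w‖ = 1) : ∃ (e : ℕ → EuclideanSpace ℝ (Fin N)) (ℓ : ℕ → ℝ),
      (∀ i, e i ∈ Tan M (G^[i] x)) ∧ (∀ i, ‖e i‖ = 1) ∧
      (∀ i, fderiv ℝ G (G^[i] x) (e i) = Real.exp (ℓ i) • e (i + 1)) ∧
      (∀ q, ∑ i ∈ Finset.range q, ℓ i = Real.log ‖fderiv ℝ (G^[q]) x w‖) ∧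
      ∀ i, ∃ c : ℝ, c • fderiv ℝ (G'^[i]) (G^[i] x) (e i) = w := by
  let W : ℕ → EuclideanSpace ℝ (Fin N) := fun i => fderiv ℝ (G^[i]) x w
  have hWT : ∀ i, W i ∈ Tan M (G^[i] x) := fun i =>
    fderiv_mem_tan (h.differentiable_iterate i _) (h.maps.iterate i) hw
  have hWinv : ∀ i, fderiv ℝ (G'^[i]) (G^[i] x) (W i) = w := fun i => by
    obtain ⟨C', hC'⟩ := h.iterate i
    exact hC'.fderiv_inverse hw
  have hW0 : ∀ i, 0 < ‖W i‖ := fun i => by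
    rw [norm_pos_iff]
    intro h0
    have := hWinv i
    rw [h0, map_zero] at this
    rw [← this, norm_zero] at hw1
    exact zero_ne_one hw1
  have hWs : ∀ i, fderiv ℝ G (G^[i] x) (W i) = W (i + 1) := fun i =>
    (h.fderiv_iterate_succ i w).symm
  refine ⟨fun i => ‖W i‖⁻¹ • W i, fun i => Real.log ‖W (i + 1)‖ - Real.log ‖W i‖,
    fun i => (Tan M _).smul_mem _ (hWT i), fun i => ?_, fun i => ?_, fun q => ?_,
    fun i => ⟨‖W i‖, ?_⟩⟩
  · rw [norm_smul, norm_inv, norm_norm, inv_mul_cancel₀ (hW0 i).ne']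
  · rw [map_smul, hWs, Real.exp_sub, Real.exp_log (hW0 _), Real.exp_log (hW0 _), smul_smul]
    congr 1
    have := (hW0 (i + 1)).ne'
    have := (hW0 i).ne'
    field_simp
  · have h1 := Finset.sum_range_sub (fun i => Real.log ‖W i‖) q
    have h2 : W 0 = w := by simp [W]
    rw [h2, hw1, Real.log_one, sub_zero] at h1
    exact h1
  · rw [map_smul, hWinv, smul_smul, mul_inv_cancel₀ (hW0 i).ne', one_smul]

end HolderDiffeo

/-- Vectors representing, along the orbit of `x`, the coordinates with respect to a contracted
direction (`u`) and an expanded direction (`v`). -/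
structure DualFrame (M : Set (EuclideanSpace ℝ (Fin N)))
    (G : EuclideanSpace ℝ (Fin N) → EuclideanSpace ℝ (Fin N)) (x : EuclideanSpace ℝ (Fin N)) (L : ℕ)
    (P Q a b : ℕ → ℝ) (u v : ℕ → EuclideanSpace ℝ (Fin N)) : Prop where
  decomp : ∀ i, ∀ w ∈ Tan M (G^[i] x), ‖w‖ ≤ |inner ℝ (u i) w| + |inner ℝ (v i) w|
  step_u : ∀ i, ∀ w ∈ Tan M (G^[i] x),
    inner ℝ (u (i + 1)) (fderiv ℝ G (G^[i] x) w) = Real.exp (-b i) * inner ℝ (u i) w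
  step_v : ∀ i, ∀ w ∈ Tan M (G^[i] x),
    inner ℝ (v (i + 1)) (fderiv ℝ G (G^[i] x) w) = Real.exp (a i) * inner ℝ (v i) w
  dir : ∀ i, ∃ φ ∈ Tan M (G^[i] x), ‖φ‖ = 1 ∧ inner ℝ (u i) φ = (0:ℝ) ∧ inner ℝ (v i) φ = (1:ℝ)
  norm_eq : ∀ i, ‖v i‖ = ‖u i‖
  one_le : ∀ i, 1 ≤ ‖u i‖
  a_le : ∀ i < L, a i ≤ P i
  b_le : ∀ i < L, b i ≤ Q i
  norm_succ_le : ∀ i < L, ‖u (i + 1)‖ ≤ Real.exp (P i + Q i - a i - b i) * ‖u i‖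
  norm_le_succ : ∀ i < L, ‖u i‖ ≤ Real.exp (P i + Q i - a i - b i) * ‖u (i + 1)‖
  angle : ∀ i < L, Real.log 2 ≤ a i → 0 ≤ b i → ‖u i‖ ≤ 2 * Real.exp (P i)

theorem HolderDiffeo.exists_dualFrame_of_push (h : HolderDiffeo M G G' α C B)
    (hT : ∀ y ∈ M, Module.finrank ℝ (Tan M y) = 2) (hx : x ∈ M) {L : ℕ} {P Q a b : ℕ → ℝ}
    (hP : ∀ i < L, logNorm M G (G^[i] x) ≤ P i) (hQ : ∀ i < L, logNorm M G' (G^[i + 1] x) ≤ Q i)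
    {e f : ℕ → EuclideanSpace ℝ (Fin N)} (heT : ∀ i, e i ∈ Tan M (G^[i] x)) (he : ∀ i, ‖e i‖ = 1)
    (hes : ∀ i, fderiv ℝ G (G^[i] x) (e i) = Real.exp (-b i) • e (i + 1))
    (hfT : ∀ i, f i ∈ Tan M (G^[i] x)) (hf : ∀ i, ‖f i‖ = 1)
    (hfs : ∀ i, fderiv ℝ G (G^[i] x) (f i) = Real.exp (a i) • f (i + 1))
    (hc : ∀ i, inner ℝ (e i) (f i) ^ 2 < 1) :
    DualFrame M G x L P Q a b (fun i => coordVec (e i) (f i)) (fun i => coordVec (f i) (e i)) := by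
  have hc' : ∀ i, inner ℝ (f i) (e i) ^ 2 < 1 := fun i => by rw [real_inner_comm]; exact hc i
  have hstep : ∀ i, ∀ w ∈ Tan M (G^[i] x), fderiv ℝ G (G^[i] x) w =
      (inner ℝ (coordVec (e i) (f i)) w * Real.exp (-b i)) • e (i + 1) +
        (inner ℝ (coordVec (f i) (e i)) w * Real.exp (a i)) • f (i + 1) := fun i w hw => by
    conv_lhs => rw [eq_coord_add_coord (he i) (hf i) (hc i) (hT _ (h.iterate_mem hx i)) (heT i)
      (hfT i) hw]
    rw [map_add, map_smul, map_smul, hes, hfs, smul_smul, smul_smul]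
  have hsu : ∀ i, ∀ w ∈ Tan M (G^[i] x), inner ℝ (coordVec (e (i + 1)) (f (i + 1)))
      (fderiv ℝ G (G^[i] x) w) = Real.exp (-b i) * inner ℝ (coordVec (e i) (f i)) w := by
    intro i w hw
    rw [hstep i w hw, inner_add_right, real_inner_smul_right, real_inner_smul_right,
      inner_coordVec_left (he _) (hf _) (hc _), inner_coordVec_right (he _) (hf _) (hc _)]
    ring
  have hsv : ∀ i, ∀ w ∈ Tan M (G^[i] x), inner ℝ (coordVec (f (i + 1)) (e (i + 1)))
      (fderiv ℝ G (G^[i] x) w) = Real.exp (a i) * inner ℝ (coordVec (f i) (e i)) w := by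
    intro i w hw
    rw [hstep i w hw, inner_add_right, real_inner_smul_right, real_inner_smul_right,
      inner_coordVec_left (hf _) (he _) (hc' _), inner_coordVec_right (hf _) (he _) (hc' _)]
    ring
  have hne : ∀ i, ‖coordVec (f i) (e i)‖ = ‖coordVec (e i) (f i)‖ := fun i =>
    norm_coordVec_comm (hf i) (he i) (hc' i)
  have hone : ∀ i, 1 ≤ ‖coordVec (e i) (f i)‖ := fun i => one_le_norm_coordVec (he i) (hf i) (hc i)
  have hb0 : ∀ i < L, ∀ w ∈ Tan M (G^[i] x), ‖fderiv ℝ G (G^[i] x) w‖ ≤ Real.exp (P i) * ‖w‖ :=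
    fun i hi w hw => (norm_fderiv_le_exp_logNorm hw).trans
      (mul_le_mul_of_nonneg_right (Real.exp_le_exp.2 (hP i hi)) (norm_nonneg _))
  have hb1 : ∀ i < L, ∀ w ∈ Tan M (G^[i + 1] x),
      ‖fderiv ℝ G' (G^[i + 1] x) w‖ ≤ Real.exp (Q i) * ‖w‖ :=
    fun i hi w hw => (norm_fderiv_le_exp_logNorm hw).trans
      (mul_le_mul_of_nonneg_right (Real.exp_le_exp.2 (hQ i hi)) (norm_nonneg _))
  have hsx : ∀ i, G^[i + 1] x = G (G^[i] x) := fun i => Function.iterate_succ_apply' _ _ _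
  have hale : ∀ i < L, a i ≤ P i := fun i hi => by
    have := hb0 i hi _ (hfT i)
    rw [hfs, norm_smul, hf, hf, mul_one, mul_one, Real.norm_eq_abs, abs_of_pos (Real.exp_pos _)] at this
    exact Real.exp_le_exp.1 this
  have hble : ∀ i < L, b i ≤ Q i := fun i hi => by
    have h1 := hb1 i hi _ (by rw [hsx]; exact fderiv_mem_tan (h.diff _) h.maps (heT i))
    conv at h1 => lhs; rw [hsx, h.fderiv_inverse (heT i)]
    rw [hes, norm_smul, he, he, mul_one, Real.norm_eq_abs, abs_of_pos (Real.exp_pos _),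
      ← Real.exp_add] at h1
    have := Real.one_le_exp_iff.1 h1
    linarith
  refine ⟨fun i w hw => norm_le_abs_coord_add_abs_coord (he i) (hf i) (hc i)
      (hT _ (h.iterate_mem hx i)) (heT i) (hfT i) hw, hsu, hsv, fun i => ⟨f i, hfT i, hf i,
      inner_coordVec_right (he i) (hf i) (hc i), inner_coordVec_left (hf i) (he i) (hc' i)⟩, hne,
      hone, hale, hble, fun i hi => ?_, fun i hi => ?_, fun i hi ha hb => ?_⟩
  · set z := coordVec (e (i + 1)) (f (i + 1)) with hz
    have hzT : z ∈ Tan M (G^[i + 1] x) := coordVec_mem (heT _) (hfT _)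
    have hzT' : z ∈ Tan M (G (G^[i] x)) := by rw [← hsx]; exact hzT
    have hwT := fderiv_mem_tan (h.diff' _) h.maps' hzT'
    rw [h.inv _ (h.iterate_mem hx i)] at hwT
    have h1 := hsu i _ hwT
    rw [h.fderiv_inverse' (h.iterate_mem hx i) hzT', ← hz, real_inner_self_eq_norm_sq] at h1
    have h2 := real_inner_le_norm (coordVec (e i) (f i)) (fderiv ℝ G' (G (G^[i] x)) z)
    have h3 := hb1 i hi z hzT
    rw [hsx] at h3
    have hz0 : 0 < ‖z‖ := one_pos.trans_le (hone _)
    have h4 : ‖z‖ * ‖z‖ ≤ (Real.exp (Q i - b i) * ‖coordVec (e i) (f i)‖) * ‖z‖ := by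
      calc ‖z‖ * ‖z‖ = ‖z‖ ^ 2 := by ring
        _ ≤ Real.exp (-b i) * (‖coordVec (e i) (f i)‖ * (Real.exp (Q i) * ‖z‖)) := by
            rw [h1]; gcongr; exact h2.trans (by gcongr)
        _ = _ := by rw [sub_eq_add_neg, Real.exp_add]; ring
    refine (le_of_mul_le_mul_right h4 hz0).trans ?_
    gcongr
    linarith [hale i hi]
  · set z := coordVec (f i) (e i) with hz
    have hzT : z ∈ Tan M (G^[i] x) := coordVec_mem (hfT _) (heT _)
    have h1 := hsv i _ hzT
    rw [← hz, real_inner_self_eq_norm_sq] at h1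
    have h2 := real_inner_le_norm (coordVec (f (i + 1)) (e (i + 1))) (fderiv ℝ G (G^[i] x) z)
    rw [h1, hne (i + 1)] at h2
    have h3 := hb0 i hi z hzT
    have hz0 : 0 < ‖z‖ := by rw [hz, hne]; exact one_pos.trans_le (hone _)
    have h4 : ‖z‖ * ‖z‖ ≤ (Real.exp (P i - a i) * ‖coordVec (e (i + 1)) (f (i + 1))‖) * ‖z‖ := by
      have h5 : ‖z‖ ^ 2 = Real.exp (-a i) * (Real.exp (a i) * ‖z‖ ^ 2) := by
        rw [← mul_assoc, ← Real.exp_add]; simp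
      calc ‖z‖ * ‖z‖ = ‖z‖ ^ 2 := by ring
        _ ≤ Real.exp (-a i) * (‖coordVec (e (i + 1)) (f (i + 1))‖ * (Real.exp (P i) * ‖z‖)) := by
            rw [h5]; exact mul_le_mul_of_nonneg_left (h2.trans (mul_le_mul_of_nonneg_left h3 (norm_nonneg _))) (Real.exp_pos _).le
        _ = _ := by rw [sub_eq_add_neg, Real.exp_add]; ring
    rw [← hne i]
    refine (le_of_mul_le_mul_right h4 hz0).trans ?_
    exact mul_le_mul_of_nonneg_right (Real.exp_le_exp.2 (by linarith [hble i hi])) (norm_nonneg _)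
  · refine norm_coordVec_le (he i) (hf i) (hc i) (heT i) (hfT i) (hb0 i hi) ?_
    rw [hes, hfs, norm_smul, norm_smul, he, hf, mul_one, mul_one, Real.norm_eq_abs,
      Real.norm_eq_abs, abs_of_pos (Real.exp_pos _), abs_of_pos (Real.exp_pos _)]
    have h1 : 2 ≤ Real.exp (a i) := by
      rw [← Real.log_le_iff_le_exp (by norm_num)]; exact ha
    have h2 : Real.exp (-b i) ≤ 1 := Real.exp_le_one_iff.2 (by linarith)
    linarith

/-- An almost additive orbit segment carries a dual frame, unless one of the two directions is
not expanded at all. -/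
theorem HolderDiffeo.exists_dualFrame (h : HolderDiffeo M G G' α C B)
    (hT : ∀ y ∈ M, Module.finrank ℝ (Tan M y) = 2) (hx : x ∈ M) {L : ℕ} {P Q : ℕ → ℝ}
    (hP : ∀ i < L, logNorm M G (G^[i] x) ≤ P i) (hQ : ∀ i < L, logNorm M G' (G^[i + 1] x) ≤ Q i)
    {Θ : ℝ} (hΘ : ∑ i ∈ Finset.range L, (P i + Q i) ≤
      logNorm M (G^[L]) x + logNorm M (G'^[L]) (G^[L] x) + Θ) :
    ∑ i ∈ Finset.range L, min (P i) (Q i) ≤ Θ ∨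
      ∃ a b u v, DualFrame M G x L P Q a b u v ∧
        ∑ i ∈ Finset.range L, (P i + Q i - a i - b i) ≤ Θ := by
  rw [Finset.sum_add_distrib] at hΘ
  obtain ⟨C', hL⟩ := h.iterate L
  rcases (logNorm_nonneg (M := M) (F := G^[L]) (x := x)).eq_or_lt with hp | hp
  · left
    have h1 := h.logNorm_inverse_iterate_le hx L
    have h2 : ∑ i ∈ Finset.range L, logNorm M G' (G^[i + 1] x) ≤ ∑ i ∈ Finset.range L, Q i :=
      Finset.sum_le_sum fun i hi => hQ i (Finset.mem_range.1 hi)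
    have h3 : ∑ i ∈ Finset.range L, min (P i) (Q i) ≤ ∑ i ∈ Finset.range L, P i :=
      Finset.sum_le_sum fun i hi => min_le_left _ _
    linarith
  rcases (logNorm_nonneg (M := M) (F := G'^[L]) (x := G^[L] x)).eq_or_lt with hq | hq
  · left
    have h1 := h.logNorm_iterate_le (x := x) L
    have h2 : ∑ i ∈ Finset.range L, logNorm M G (G^[i] x) ≤ ∑ i ∈ Finset.range L, P i :=
      Finset.sum_le_sum fun i hi => hP i (Finset.mem_range.1 hi)
    have h3 : ∑ i ∈ Finset.range L, min (P i) (Q i) ≤ ∑ i ∈ Finset.range L, Q i :=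
      Finset.sum_le_sum fun i hi => min_le_right _ _
    linarith
  right
  obtain ⟨f₀, hf₀T, hf₀, hf₀'⟩ := exists_norm_fderiv_eq (hT x hx) hp
  obtain ⟨g, hgT, hg, hg'⟩ := exists_norm_fderiv_eq (hT _ (h.iterate_mem hx L)) hq
  set β := logNorm M (G'^[L]) (G^[L] x) with hβ
  have hgT' : fderiv ℝ (G'^[L]) (G^[L] x) g ∈ Tan M x := by
    have := fderiv_mem_tan (hL.diff' _) hL.maps' hgT
    rwa [hL.inv x hx] at this
  set e₀ := Real.exp (-β) • fderiv ℝ (G'^[L]) (G^[L] x) g with he₀_def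
  have he₀T : e₀ ∈ Tan M x := (Tan M x).smul_mem _ hgT'
  have he₀ : ‖e₀‖ = 1 := by
    rw [he₀_def, norm_smul, hg', Real.norm_eq_abs, abs_of_pos (Real.exp_pos _), ← Real.exp_add]
    simp
  have he₀' : ‖fderiv ℝ (G^[L]) x e₀‖ = Real.exp (-β) := by
    rw [he₀_def, map_smul, hL.fderiv_inverse' hx hgT, norm_smul, hg, mul_one, Real.norm_eq_abs,
      abs_of_pos (Real.exp_pos _)]
  obtain ⟨e, ℓe, heT, he, hes, hesum, hec⟩ := h.exists_unit_push he₀T he₀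
  obtain ⟨f, ℓf, hfT, hf, hfs, hfsum, hfc⟩ := h.exists_unit_push hf₀T hf₀
  have hpar : ∀ i, ∀ σ : ℝ, e i ≠ σ • f i := by
    intro i σ hσ
    obtain ⟨c, hc⟩ := hec i
    obtain ⟨c', hc'⟩ := hfc i
    have hcol : ∃ τ : ℝ, τ • e₀ = f₀ ∨ τ • f₀ = e₀ := by
      by_cases hc'0 : c' = 0
      · rw [hc'0, zero_smul] at hc'
        rw [← hc', norm_zero] at hf₀
        exact absurd hf₀ zero_ne_one
      refine ⟨c * σ / c', Or.inr ?_⟩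
      rw [← hc, ← hc', hσ, map_smul, smul_smul, smul_smul]
      congr 1
      field_simp
    obtain ⟨τ, hτ | hτ⟩ := hcol
    · have h1 : |τ| = 1 := by
        have := congrArg norm hτ
        rwa [norm_smul, he₀, hf₀, mul_one] at this
      have h2 := congrArg (fun w => ‖fderiv ℝ (G^[L]) x w‖) hτ
      simp only [map_smul, norm_smul, Real.norm_eq_abs, h1, one_mul] at h2
      rw [he₀', hf₀', Real.exp_eq_exp] at h2
      linarith
    · have h1 : |τ| = 1 := by
        have := congrArg norm hτ
        rwa [norm_smul, he₀, hf₀, mul_one] at this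
      have h2 := congrArg (fun w => ‖fderiv ℝ (G^[L]) x w‖) hτ
      simp only [map_smul, norm_smul, Real.norm_eq_abs, h1, one_mul] at h2
      rw [he₀', hf₀', Real.exp_eq_exp] at h2
      linarith
  have hc : ∀ i, inner ℝ (e i) (f i) ^ 2 < 1 := fun i => inner_sq_lt_one (he i) (hf i)
    (fun h1 => hpar i 1 (by rw [one_smul]; exact h1))
    (fun h1 => hpar i (-1) (by rw [neg_one_smul]; exact h1))
  refine ⟨ℓf, fun i => -ℓe i, _, _, h.exists_dualFrame_of_push hT hx hP hQ heT he
    (fun i => by rw [neg_neg]; exact hes i) hfT hf hfs hc, ?_⟩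
  simp only [Finset.sum_add_distrib, Finset.sum_sub_distrib, Finset.sum_neg_distrib]
  rw [hesum, hfsum, he₀', hf₀', Real.log_exp, Real.log_exp]
  linarith

end Frames

section Strings

variable {N : ℕ} {M : Set (EuclideanSpace ℝ (Fin N))}
  {G G' : EuclideanSpace ℝ (Fin N) → EuclideanSpace ℝ (Fin N)} {α C B : ℝ}
  {x : EuclideanSpace ℝ (Fin N)}

/-- An orbit segment of length `l` with a dual frame, contracting and expanding at rate `χ` from
both ends, the angle of the frame being tempered with rate `κ`. -/
structure GoodString (M : Set (EuclideanSpace ℝ (Fin N)))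
    (G : EuclideanSpace ℝ (Fin N) → EuclideanSpace ℝ (Fin N)) (χ κ A H : ℝ) (l : ℕ)
    (z : EuclideanSpace ℝ (Fin N)) (u v : ℕ → EuclideanSpace ℝ (Fin N)) (a b D : ℕ → ℝ) :
    Prop where
  decomp : ∀ i, ∀ w ∈ Tan M (G^[i] z), ‖w‖ ≤ |inner ℝ (u i) w| + |inner ℝ (v i) w|
  step_u : ∀ i < l, ∀ w ∈ Tan M (G^[i] z),
    inner ℝ (u (i + 1)) (fderiv ℝ G (G^[i] z) w) = Real.exp (-b i) * inner ℝ (u i) w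
  step_v : ∀ i < l, ∀ w ∈ Tan M (G^[i] z),
    inner ℝ (v (i + 1)) (fderiv ℝ G (G^[i] z) w) = Real.exp (a i) * inner ℝ (v i) w
  dir : ∃ φ ∈ Tan M z, ‖φ‖ = 1 ∧ inner ℝ (u 0) φ = (0:ℝ) ∧ inner ℝ (v 0) φ = (1:ℝ)
  norm_u : ∀ i ≤ l, ‖u i‖ ≤ H * Real.exp (κ + κ * min (i : ℝ) (l - i))
  norm_v : ∀ i ≤ l, ‖v i‖ ≤ H * Real.exp (κ + κ * min (i : ℝ) (l - i))
  norm_u_zero : ‖u 0‖ ≤ H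
  norm_v_zero : ‖v 0‖ ≤ H
  neg_le_a : ∀ i, -D i ≤ a i
  neg_le_b : ∀ i, -D i ≤ b i
  nonneg : ∀ i, 0 ≤ D i
  a_le : ∀ i, a i ≤ A
  b_le : ∀ i, b i ≤ A
  sum_b : ∀ j ≤ l, χ * j ≤ ∑ i ∈ Finset.range j, b i
  sum_a : ∀ j ≤ l, χ * (l - j) - A ≤ ∑ i ∈ Finset.range l, a i - ∑ i ∈ Finset.range j, a i
  sum_D : ∀ j ≤ l, ∑ i ∈ Finset.range j, D i ≤ κ * j
  sum_D' : ∀ j ≤ l, ∑ i ∈ Finset.range l, D i - ∑ i ∈ Finset.range j, D i ≤ κ * (l - j) + κ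

theorem DualFrame.norm_add_le {L : ℕ} {P Q a b : ℕ → ℝ} {u v : ℕ → EuclideanSpace ℝ (Fin N)}
    (hd : DualFrame M G x L P Q a b u v) (s j : ℕ) (hs : s + j ≤ L) :
    ‖u (s + j)‖ ≤ Real.exp (∑ k ∈ Finset.Ico s (s + j), (P k + Q k - a k - b k)) * ‖u s‖ := by
  induction j with
  | zero => simp
  | succ j ih =>
    rw [← add_assoc, Finset.sum_Ico_succ_top (by omega), add_comm _ (P (s + j) + _ - _ - _),
      Real.exp_add, mul_assoc]
    exact (hd.norm_succ_le (s + j) (by omega)).trans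
      (mul_le_mul_of_nonneg_left (ih (by omega)) (Real.exp_pos _).le)

theorem DualFrame.norm_le_add {L : ℕ} {P Q a b : ℕ → ℝ} {u v : ℕ → EuclideanSpace ℝ (Fin N)}
    (hd : DualFrame M G x L P Q a b u v) (s j : ℕ) (hs : s + j ≤ L) :
    ‖u s‖ ≤ Real.exp (∑ k ∈ Finset.Ico s (s + j), (P k + Q k - a k - b k)) * ‖u (s + j)‖ := by
  induction j with
  | zero => simp
  | succ j ih =>
    rw [← add_assoc, Finset.sum_Ico_succ_top (by omega), Real.exp_add, mul_assoc]
    exact (ih (by omega)).trans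
      (mul_le_mul_of_nonneg_left (hd.norm_le_succ (s + j) (by omega)) (Real.exp_pos _).le)

/-- Between two good steps a dual frame is a good string. -/
theorem DualFrame.goodString {L : ℕ} {P Q a b : ℕ → ℝ} {u v : ℕ → EuclideanSpace ℝ (Fin N)}
    (hd : DualFrame M G x L P Q a b u v) {A K χ : ℝ} (hK : 1 ≤ K) (hA : 0 ≤ A) (hχ : Real.log 2 ≤ χ)
    (hP0 : ∀ i, 0 ≤ P i) (hQ0 : ∀ i, 0 ≤ Q i) (hPA : ∀ i, P i ≤ A) (hQA : ∀ i, Q i ≤ A)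
    {s e : ℕ} (hse : s ≤ e) (he : e < L)
    (hs1 : FwdGood (fun i => min (P i) (Q i) - K * (P i + Q i - a i - b i)) χ L s)
    (he0 : FwdGood (fun i => min (P i) (Q i) - K * (P i + Q i - a i - b i)) χ L e)
    (he1 : BwdGood (fun i => min (P i) (Q i) - K * (P i + Q i - a i - b i)) χ e) :
    ∃ a' b' D', GoodString M G χ (A / K) A (2 * Real.exp A) (e - s) (G^[s] x)
      (fun i => u (s + i)) (fun i => v (s + i)) a' b' D' := by
  have hK0 : 0 < K := by linarith
  have hχ0 : 0 ≤ χ := (Real.log_nonneg (by norm_num)).trans hχ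
  set D : ℕ → ℝ := fun i => P i + Q i - a i - b i with hD
  have hD0 : ∀ i < L, 0 ≤ D i := fun i hi => by
    have h1 := hd.a_le i hi
    have h2 := hd.b_le i hi
    simp only [hD]; linarith
  set c : ℕ → ℝ := fun i => min (P i) (Q i) - K * D i with hc
  have hca : ∀ i < L, c i ≤ a i := fun i hi => by
    have h1 := hd.b_le i hi
    have h2 := min_le_left (P i) (Q i)
    have h3 := mul_le_mul_of_nonneg_right hK (hD0 i hi)
    have h4 : D i = P i + Q i - a i - b i := rfl
    simp only [hc]; linarith
  have hcb : ∀ i < L, c i ≤ b i := fun i hi => by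
    have h1 := hd.a_le i hi
    have h2 := min_le_right (P i) (Q i)
    have h3 := mul_le_mul_of_nonneg_right hK (hD0 i hi)
    have h4 : D i = P i + Q i - a i - b i := rfl
    simp only [hc]; linarith
  have hgood : ∀ i < L, FwdGood c χ L i → ‖u i‖ ≤ 2 * Real.exp A := by
    intro i hi hg
    have h1 := hg (i + 1) (by omega) (by omega)
    rw [Nat.Ico_succ_singleton, Finset.sum_singleton] at h1
    push_cast at h1
    have h2 : χ ≤ c i := by linarith
    refine (hd.angle i hi (by linarith [hca i hi]) (by linarith [hcb i hi])).trans ?_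
    have := Real.exp_le_exp.2 (hPA i)
    linarith
  have hcD : ∀ i, K * D i + c i ≤ A := fun i => by
    have h2 := (min_le_left (P i) (Q i)).trans (hPA i)
    simp only [hc]; linarith
  have hcA : ∀ i < L, c i ≤ A := fun i hi => by
    have := hcD i
    have := mul_nonneg hK0.le (hD0 i hi)
    linarith
  -- sums over intervals
  have hsumD : ∀ p q, K * ∑ i ∈ Finset.Ico p q, D i + ∑ i ∈ Finset.Ico p q, c i ≤ A * (q - p : ℕ) := by
    intro p q
    rw [Finset.mul_sum, ← Finset.sum_add_distrib]
    refine (Finset.sum_le_sum fun i _ => hcD i).trans (le_of_eq ?_)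
    rw [Finset.sum_const, Nat.card_Ico, nsmul_eq_mul, mul_comm]
  have hκ : ∀ r : ℝ, A / K * r = A * r / K := fun r => by ring
  have hfD : ∀ j, j ≤ e - s → ∑ i ∈ Finset.Ico s (s + j), D i ≤ A / K * j := by
    intro j hj
    have h1 := hs1 (s + j) (by omega) (by omega)
    have h2 := hsumD s (s + j)
    rw [show s + j - s = j by omega] at h2
    push_cast at h1
    have h3 : 0 ≤ χ * ((s:ℝ) + j - s) := by
      apply mul_nonneg hχ0
      have : (0:ℝ) ≤ j := Nat.cast_nonneg j
      linarith
    rw [hκ, le_div_iff₀ hK0]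
    linarith
  have hbc : ∀ j, j ≤ e - s → χ * ((e - s : ℕ) - j) - A ≤ ∑ i ∈ Finset.Ico (s + j) e, c i := by
    intro j hj
    have h1 := he1 (s + j) (by omega)
    rw [Finset.sum_Ico_succ_top (by omega)] at h1
    have h2 := hcA e he
    rw [Nat.cast_sub hse]
    push_cast at h1
    have h3 : χ * ((e:ℝ) + 1 - (s + j)) = χ * ((e:ℝ) - s - j) + χ := by ring
    have h4 : ∑ i ∈ Finset.Ico (s + j) e, (min (P i) (Q i) - K * (P i + Q i - a i - b i)) =
      ∑ i ∈ Finset.Ico (s + j) e, c i := rfl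
    have h5 : min (P e) (Q e) - K * (P e + Q e - a e - b e) = c e := rfl
    linarith
  have hbD : ∀ j, j ≤ e - s →
      ∑ i ∈ Finset.Ico (s + j) e, D i ≤ A / K * ((e - s : ℕ) - j) + A / K := by
    intro j hj
    have h1 := hbc j hj
    have h2 := hsumD (s + j) e
    have h3 : ((e - (s + j) : ℕ) : ℝ) = ((e - s : ℕ) : ℝ) - j := by
      rw [← Nat.cast_sub hj]; congr 1; omega
    rw [h3] at h2
    have h5 : (0:ℝ) ≤ ((e - s : ℕ) : ℝ) - j := by rw [← Nat.cast_sub hj]; exact Nat.cast_nonneg _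
    have h4 := mul_nonneg hχ0 h5
    have h6 : A / K * (((e - s : ℕ) : ℝ) - j) + A / K = (A * (((e - s : ℕ) : ℝ) - j) + A) / K := by
      ring
    rw [h6, le_div_iff₀ hK0]
    linarith
  have hnorm : ∀ i ≤ e - s, ‖u (s + i)‖ ≤
      2 * Real.exp A * Real.exp (A / K + A / K * min (i : ℝ) ((e - s : ℕ) - i)) := by
    intro i hi
    have hκ0 : 0 ≤ A / K := by positivity
    rcases le_total (i : ℝ) (((e - s : ℕ) : ℝ) - i) with h | h
    · rw [min_eq_left h]
      refine (hd.norm_add_le s i (by omega)).trans ?_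
      rw [mul_comm]
      refine mul_le_mul (hgood s (by omega) hs1) (Real.exp_le_exp.2 ?_) (Real.exp_pos _).le
        (by positivity)
      exact (hfD i hi).trans (by linarith)
    · rw [min_eq_right h]
      have h1 := hd.norm_le_add (s + i) (e - (s + i)) (by omega)
      rw [show s + i + (e - (s + i)) = e by omega] at h1
      refine h1.trans ?_
      rw [mul_comm]
      refine mul_le_mul (hgood e (by omega) he0) (Real.exp_le_exp.2 ?_) (Real.exp_pos _).le
        (by positivity)
      exact (hbD i hi).trans (by linarith)
  have hit : ∀ i, G^[i] (G^[s] x) = G^[s + i] x := fun i => by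
    rw [← Function.iterate_add_apply, add_comm]
  have hsum : ∀ (w : ℕ → ℝ) j, j ≤ e - s →
      ∑ i ∈ Finset.range j, (if i < e - s then w (s + i) else 0) = ∑ i ∈ Finset.Ico s (s + j), w i := by
    intro w j hj
    rw [Finset.sum_Ico_eq_sum_range, show s + j - s = j by omega]
    refine Finset.sum_congr rfl fun i hi => if_pos ?_
    have := Finset.mem_range.1 hi
    omega
  have hsum' : ∀ (w : ℕ → ℝ) j, j ≤ e - s →
      ∑ i ∈ Finset.range (e - s), (if i < e - s then w (s + i) else 0) -
        ∑ i ∈ Finset.range j, (if i < e - s then w (s + i) else 0) = ∑ i ∈ Finset.Ico (s + j) e, w i := by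
    intro w j hj
    rw [hsum w _ le_rfl, hsum w j hj, show s + (e - s) = e by omega, sub_eq_iff_eq_add,
      add_comm, Finset.sum_Ico_consecutive _ (by omega) (by omega)]
  refine ⟨fun i => if i < e - s then a (s + i) else 0, fun i => if i < e - s then b (s + i) else 0,
    fun i => if i < e - s then D (s + i) else 0, ?_⟩
  refine ⟨?_, ?_, ?_, ?_, hnorm, ?_, hgood s (by omega) hs1, ?_, ?_, ?_, ?_, ?_, ?_, ?_, ?_, ?_, ?_⟩
  · intro i w hw
    rw [hit] at hw
    exact hd.decomp _ w hw
  · intro i hi w hw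
    rw [hit] at hw ⊢
    simp only [if_pos hi]
    exact hd.step_u _ w hw
  · intro i hi w hw
    rw [hit] at hw ⊢
    simp only [if_pos hi]
    exact hd.step_v _ w hw
  · exact hd.dir s
  · intro i hi
    rw [hd.norm_eq]; exact hnorm i hi
  · have := hgood s (by omega) hs1
    simp only [add_zero]
    rwa [hd.norm_eq]
  · intro i
    split_ifs with hi
    · have := hd.b_le (s + i) (by omega)
      have := hP0 (s + i)
      simp only [hD]; linarith
    · simp
  · intro i
    split_ifs with hi
    · have := hd.a_le (s + i) (by omega)
      have := hQ0 (s + i)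
      simp only [hD]; linarith
    · simp
  · intro i
    split_ifs with hi
    · exact hD0 _ (by omega)
    · exact le_rfl
  · intro i
    split_ifs with hi
    · exact (hd.a_le _ (by omega)).trans (hPA _)
    · exact hA
  · intro i
    split_ifs with hi
    · exact (hd.b_le _ (by omega)).trans (hQA _)
    · exact hA
  · intro j hj
    rw [hsum b j hj]
    have h1 := hs1 (s + j) (by omega) (by omega)
    have h2 : ∑ i ∈ Finset.Ico s (s + j), c i ≤ ∑ i ∈ Finset.Ico s (s + j), b i :=
      Finset.sum_le_sum fun i hi => hcb i (by have := Finset.mem_Ico.1 hi; omega)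
    push_cast at h1
    rw [add_sub_cancel_left] at h1
    exact h1.trans h2
  · intro j hj
    rw [hsum' a j hj]
    exact (hbc j hj).trans
      (Finset.sum_le_sum fun i hi => hca i (by have := Finset.mem_Ico.1 hi; omega))
  · intro j hj
    rw [hsum D j hj]
    exact hfD j hj
  · intro j hj
    rw [hsum' D j hj]
    exact hbD j hj

/-- An almost additive orbit segment consists of good strings between good times, and of further
times which contribute little. -/
theorem HolderDiffeo.exists_goodStrings (h : HolderDiffeo M G G' α C B)
    (hT : ∀ y ∈ M, Module.finrank ℝ (Tan M y) = 2) (hx : x ∈ M) {L : ℕ} {P Q : ℕ → ℝ}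
    {A K χ Θ : ℝ} (hK : 1 ≤ K) (hA : 0 ≤ A) (hχ : Real.log 2 ≤ χ) (hΘ0 : 0 ≤ Θ)
    (hP0 : ∀ i, 0 ≤ P i) (hQ0 : ∀ i, 0 ≤ Q i) (hPA : ∀ i, P i ≤ A) (hQA : ∀ i, Q i ≤ A)
    (hP : ∀ i < L, logNorm M G (G^[i] x) ≤ P i) (hQ : ∀ i < L, logNorm M G' (G^[i + 1] x) ≤ Q i)
    (hΘ : ∑ i ∈ Finset.range L, (P i + Q i) ≤
      logNorm M (G^[L]) x + logNorm M (G'^[L]) (G^[L] x) + Θ) :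
    ∃ (I : Finset ℕ) (u v : ℕ → EuclideanSpace ℝ (Fin N)), I ⊆ Finset.range L ∧
      (∀ s ∈ I, ∀ e ∈ I, s ≤ e → ∃ a b D, GoodString M G χ (A / K) A (2 * Real.exp A) (e - s)
        (G^[s] x) (fun i => u (s + i)) (fun i => v (s + i)) a b D) ∧
      ∑ i ∈ Finset.range L \ I, min (P i) (Q i) ≤ 2 * χ * L + 2 * K * Θ := by
  have hχ0 : 0 ≤ χ := (Real.log_nonneg (by norm_num)).trans hχ
  have h0 : 0 ≤ 2 * χ * L := by positivity
  have h1 : Θ ≤ 2 * K * Θ := by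
    have := mul_le_mul_of_nonneg_right hK hΘ0
    linarith
  rcases h.exists_dualFrame hT hx hP hQ hΘ with hm | ⟨a, b, u, v, hd, hs⟩
  · refine ⟨∅, fun _ => 0, fun _ => 0, Finset.empty_subset _, by simp, ?_⟩
    rw [Finset.sdiff_empty]
    linarith
  · classical
    set D : ℕ → ℝ := fun i => P i + Q i - a i - b i with hD
    have hmem : ∀ i, i ∈ goodSteps (fun i => min (P i) (Q i) - K * (P i + Q i - a i - b i)) χ L ↔
        i < L ∧ FwdGood (fun i => min (P i) (Q i) - K * (P i + Q i - a i - b i)) χ L i ∧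
          BwdGood (fun i => min (P i) (Q i) - K * (P i + Q i - a i - b i)) χ i := fun i => by
      simp [goodSteps]
    refine ⟨goodSteps (fun i => min (P i) (Q i) - K * (P i + Q i - a i - b i)) χ L, u, v,
      Finset.filter_subset _ _, ?_, ?_⟩
    · intro s hs e he hse
      have h2 := (hmem s).1 hs
      have h3 := (hmem e).1 he
      exact hd.goodString hK hA hχ hP0 hQ0 hPA hQA hse h3.1 h2.2.1 h3.2.1 h3.2.2
    · set D' : ℕ → ℝ := fun i => if i < L then D i else 0 with hD'
      have hD'0 : ∀ i, 0 ≤ D' i := fun i => by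
        simp only [hD', hD]
        split_ifs with hi
        · have h1 := hd.a_le i hi
          have h2 := hd.b_le i hi
          linarith
        · exact le_rfl
      have hI : goodSteps (fun i => min (P i) (Q i) - K * (P i + Q i - a i - b i)) χ L =
          goodSteps (fun i => min (P i) (Q i) - K * D' i) χ L := by
        refine Finset.filter_congr fun i hi => ?_
        have hi := Finset.mem_range.1 hi
        refine and_congr (forall_congr' fun j => forall_congr' fun h1 => forall_congr' fun h2 => ?_)
          (forall_congr' fun j => forall_congr' fun h1 => ?_)
        · rw [Finset.sum_congr rfl fun k hk => ?_]
          have := Finset.mem_Ico.1 hk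
          simp only [hD', hD, if_pos (show k < L by omega)]
        · rw [Finset.sum_congr rfl fun k hk => ?_]
          have := Finset.mem_Ico.1 hk
          simp only [hD', hD, if_pos (show k < L by omega)]
      have h3 := sum_not_goodSteps_le (fun i => min (P i) (Q i)) D' hχ0 (by linarith : (0:ℝ) ≤ K) L
        (fun i => le_min (hP0 i) (hQ0 i)) hD'0
      rw [hI]
      have h4 : ∑ i ∈ Finset.range L, D' i = ∑ i ∈ Finset.range L, D i :=
        Finset.sum_congr rfl fun i hi => if_pos (Finset.mem_range.1 hi)
      rw [h4] at h3
      have h5 := mul_le_mul_of_nonneg_left hs (by linarith : (0:ℝ) ≤ 2 * K)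
      linarith

end Strings

section BoxTube

variable {E : Type*} [NormedAddCommGroup E] [InnerProductSpace ℝ E]

/-- The box in `M` around `x` of half-widths `ρu`, `ρv` in the coordinates `u`, `v`. -/
def boxTube (M : Set E) (x u v : E) (ρu ρv : ℝ) : Tube E where
  D := {y | y ∈ M ∧ ‖y - x‖ ≤ 2 * (ρu + ρv) ∧ |inner ℝ u (y - x)| ≤ ρu ∧ |inner ℝ v (y - x)| ≤ ρv}
  U y := inner ℝ u (y - x) / ρu
  V y := inner ℝ v (y - x) / ρv
  cont := by fun_prop
  le_one y hy := by
    have h0 : 0 ≤ ρv := (abs_nonneg _).trans hy.2.2.2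
    rw [abs_div, abs_of_nonneg h0]
    exact div_le_one_of_le₀ hy.2.2.2 h0

theorem link_boxTube {M : Set E} {f : E → E} {x x' u v u' v' : E} {ρu ρv ρu' ρv' s t Er ζ : ℝ}
    (hf : MapsTo f M M) (hx : x ∈ M) (hρu : 0 < ρu) (hρv : 0 < ρv) (hρu' : 0 < ρu')
    (hρv' : 0 < ρv') (hζ : 0 < ζ) (hEr : 0 ≤ Er)
    (hu : ∀ y ∈ M, ∀ z ∈ M, ‖y - x‖ ≤ 2 * (ρu + ρv) → ‖z - x‖ ≤ 2 * (ρu + ρv) →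
      |inner ℝ u' (f y - f z) - s * inner ℝ u (y - z)| ≤ Er * ‖y - z‖)
    (hv : ∀ y ∈ M, ∀ z ∈ M, ‖y - x‖ ≤ 2 * (ρu + ρv) → ‖z - x‖ ≤ 2 * (ρu + ρv) →
      |inner ℝ v' (f y - f z) - t * inner ℝ v (y - z)| ≤ Er * ‖y - z‖)
    (hn : ∀ y ∈ M, ∀ z ∈ M, ‖y - x‖ ≤ 2 * (ρu + ρv) → ‖z - x‖ ≤ 2 * (ρu + ρv) →
      ‖y - z‖ ≤ 2 * (|inner ℝ u (y - z)| + |inner ℝ v (y - z)|))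
    (hn' : ∀ y ∈ M, ‖y - x‖ ≤ 2 * (ρu + ρv) →
      ‖f y - x'‖ ≤ 2 * (|inner ℝ u' (f y - x')| + |inner ℝ v' (f y - x')|))
    (hcu : |inner ℝ u' (f x - x')| ≤ ζ * ρu') (hcv : |inner ℝ v' (f x - x')| ≤ ζ * ρv')
    (hs0 : 0 ≤ s) (hs : s * ρu ≤ (1 - 2 * ζ) * ρu') (ht : (1 + 2 * ζ) * ρv' ≤ t * ρv)
    (hEu : 2 * Er * (ρu + ρv) ≤ ζ * ρu') (hEv : 2 * Er * (ρu + ρv) ≤ ζ * ρv') :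
    Link f (1 + ζ) (boxTube M x u v ρu ρv) (boxTube M x' u' v' ρu' ρv') := by
  have key : ∀ y ∈ M, ∀ z ∈ M, ‖y - x‖ ≤ 2 * (ρu + ρv) → ‖z - x‖ ≤ 2 * (ρu + ρv) →
      ∀ d : ℝ, 0 ≤ d → |inner ℝ u (y - z)| ≤ d * ρu → |inner ℝ v (y - z)| ≤ d * ρv →
      |inner ℝ u' (f y - f z) - s * inner ℝ u (y - z)| ≤ d * (ζ * ρu') ∧
      |inner ℝ v' (f y - f z) - t * inner ℝ v (y - z)| ≤ d * (ζ * ρv') := by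
    intro y hy z hz hyx hzx d hd h1 h2
    have h3 : Er * ‖y - z‖ ≤ d * (2 * Er * (ρu + ρv)) := by
      calc Er * ‖y - z‖ ≤ Er * (2 * (d * ρu + d * ρv)) :=
            mul_le_mul_of_nonneg_left ((hn y hy z hz hyx hzx).trans (by linarith)) hEr
        _ = _ := by ring
    exact ⟨(hu y hy z hz hyx hzx).trans (h3.trans (mul_le_mul_of_nonneg_left hEu hd)),
      (hv y hy z hz hyx hzx).trans (h3.trans (mul_le_mul_of_nonneg_left hEv hd))⟩
  have hxx : ‖x - x‖ ≤ 2 * (ρu + ρv) := by rw [sub_self, norm_zero]; positivity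
  have hsplit : ∀ (a : E) y, inner ℝ a (f y - x') = inner ℝ a (f y - f x) + inner ℝ a (f x - x') := by
    intro a y
    rw [← inner_add_right, sub_add_sub_cancel]
  refine ⟨?_, ?_, ?_, ?_⟩
  · rintro y ⟨hy, hyx, h1, h2⟩ h3
    obtain ⟨h4, -⟩ := key y hy x hx hyx hxx 1 zero_le_one (by rwa [one_mul]) (by rwa [one_mul])
    have h5 : |inner ℝ u' (f y - x')| ≤ ρu' := by
      rw [hsplit]
      rw [abs_le] at h1 h4 hcu ⊢
      have h6 : s * inner ℝ u (y - x) ≤ s * ρu := mul_le_mul_of_nonneg_left h1.2 hs0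
      have h7 : s * -ρu ≤ s * inner ℝ u (y - x) := mul_le_mul_of_nonneg_left h1.1 hs0
      constructor <;> linarith [hcu.1, hcu.2, h4.1, h4.2]
    have h6 : |inner ℝ v' (f y - x')| ≤ ρv' := by
      simp only [boxTube, abs_div, abs_of_pos hρv'] at h3
      rwa [div_le_one hρv'] at h3
    refine ⟨hf hy, (hn' y hy hyx).trans ?_, h5, h6⟩
    linarith
  · rintro y ⟨hy, hyx, h1, h2⟩ h3
    obtain ⟨-, h4⟩ := key y hy x hx hyx hxx 1 zero_le_one (by rwa [one_mul]) (by rwa [one_mul])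
    simp only [boxTube] at h3 ⊢
    rw [div_eq_one_iff_eq hρv.ne'] at h3
    rw [one_le_div hρv', hsplit]
    rw [h3] at h4
    have h5 := (abs_le.1 h4).1
    have h6 := (abs_le.1 hcv).1
    linarith
  · rintro y ⟨hy, hyx, h1, h2⟩ h3
    obtain ⟨-, h4⟩ := key y hy x hx hyx hxx 1 zero_le_one (by rwa [one_mul]) (by rwa [one_mul])
    simp only [boxTube] at h3 ⊢
    rw [div_eq_iff hρv.ne'] at h3
    rw [div_le_iff₀ hρv', hsplit]
    rw [h3] at h4
    have h5 := (abs_le.1 h4).2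
    have h6 := (abs_le.1 hcv).2
    linarith
  · rintro y ⟨hy, hyx, -, -⟩ z ⟨hz, hzx, -, -⟩ h1
    simp only [boxTube, ← sub_div, ← inner_sub_right, sub_sub_sub_cancel_right] at h1 ⊢
    set d := inner ℝ v (y - z) / ρv with hd
    have hd0 : 0 ≤ d := (abs_nonneg _).trans h1
    have hdv : inner ℝ v (y - z) = d * ρv := by rw [hd]; field_simp
    rw [abs_div, abs_of_pos hρu, div_le_iff₀ hρu] at h1
    obtain ⟨h2, h3⟩ := key y hy z hz hyx hzx d hd0 h1 (by
      rw [hdv, abs_of_nonneg (by positivity)])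
    have h4 : (1 + ζ) * d ≤ inner ℝ v' (f y - f z) / ρv' := by
      rw [le_div_iff₀ hρv']
      have h5 := (abs_le.1 h3).1
      rw [hdv] at h5
      have h6 := mul_le_mul_of_nonneg_left ht hd0
      linarith
    refine ⟨?_, h4⟩
    refine le_trans ?_ ((le_mul_of_one_le_left hd0 (by linarith)).trans h4)
    rw [abs_div, abs_of_pos hρu', div_le_iff₀ hρu']
    have h5 : |s * inner ℝ u (y - z)| ≤ d * (s * ρu) := by
      rw [abs_mul, abs_of_nonneg hs0]
      calc _ ≤ s * (d * ρu) := mul_le_mul_of_nonneg_left h1 hs0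
        _ = _ := by ring
    have h6 := mul_le_mul_of_nonneg_left hs hd0
    have h8 : 0 ≤ d * (ζ * ρu') := by positivity
    rw [abs_le] at h2 h5 ⊢
    constructor <;> linarith [h2.1, h2.2, h5.1, h5.2]

end BoxTube

section Chain

variable {N : ℕ} {M : Set (EuclideanSpace ℝ (Fin N))}
  {G G' : EuclideanSpace ℝ (Fin N) → EuclideanSpace ℝ (Fin N)} {α C B : ℝ}
  {x : EuclideanSpace ℝ (Fin N)}

/-- Near each point, differences of points of `M` are almost tangent, and `G` acts on them almost
by its derivative. -/
def TanApprox (M : Set (EuclideanSpace ℝ (Fin N)))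
    (G : EuclideanSpace ℝ (Fin N) → EuclideanSpace ℝ (Fin N)) (K₁ ρ₀ α : ℝ) : Prop :=
  ∀ x ∈ M, ∀ y ∈ M, ∀ z ∈ M, ∀ δ ≤ ρ₀, ‖y - x‖ ≤ δ → ‖z - x‖ ≤ δ →
    ∃ w ∈ Tan M x, ‖y - z - w‖ ≤ K₁ * δ ^ α * ‖y - z‖ ∧
      ‖G y - G z - fderiv ℝ G x w‖ ≤ K₁ * δ ^ α * ‖y - z‖

theorem HolderDiffeo.exists_tanApprox (h : HolderDiffeo M G G' α C B) {r ρ K : ℝ} (hr : 0 < r)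
    (hρ : 0 < ρ) (hK : 1 ≤ K) (hM : ∀ x ∈ M, HasChart M r ρ K x) :
    ∃ K₁ ρ₀, 0 < K₁ ∧ 0 < ρ₀ ∧ TanApprox M G K₁ ρ₀ α := by
  have := h.nonneg
  have := h.one_le
  refine ⟨(C + 1) * (B + 1) * K ^ 4, min ρ 1, by positivity, lt_min hρ one_pos, ?_⟩
  intro x hx y hy z hz δ hδ hyx hzx
  exact (hM x hx).exists_tan_approx hr hρ hK h.diff h.pos h.le_one h.nonneg h.holder h.bound
    (hδ.trans (min_le_left _ _)) (hδ.trans (min_le_right _ _)) hy hz hyx hzx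

theorem abs_inner_le_of_norm_le {E : Type*} [NormedAddCommGroup E] [InnerProductSpace ℝ E]
    {u w : E} {H e : ℝ} (hu : ‖u‖ ≤ H) (hw : ‖w‖ ≤ e) : |inner ℝ u w| ≤ H * e :=
  (abs_real_inner_le_norm u w).trans
    (mul_le_mul hu hw (norm_nonneg _) ((norm_nonneg _).trans hu))

theorem TanApprox.norm_sub_le {K₁ ρ₀ : ℝ} (hT : TanApprox M G K₁ ρ₀ α) (hx : x ∈ M)
    {u v uh vh : EuclideanSpace ℝ (Fin N)}
    (hd : ∀ w ∈ Tan M x, ‖w‖ ≤ |inner ℝ u w| + |inner ℝ v w|) {H η δ : ℝ} (hu : ‖u‖ ≤ H)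
    (hv : ‖v‖ ≤ H) (huh : ‖uh - u‖ ≤ η) (hvh : ‖vh - v‖ ≤ η) (hδ : δ ≤ ρ₀)
    (hs : (2 * H + 1) * (K₁ * δ ^ α) + 2 * η ≤ 1 / 2) {y z : EuclideanSpace ℝ (Fin N)}
    (hy : y ∈ M) (hz : z ∈ M) (hyx : ‖y - x‖ ≤ δ) (hzx : ‖z - x‖ ≤ δ) :
    ‖y - z‖ ≤ 2 * (|inner ℝ uh (y - z)| + |inner ℝ vh (y - z)|) := by
  obtain ⟨w, hw, h1, -⟩ := hT x hx y hy z hz δ hδ hyx hzx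
  set e := K₁ * δ ^ α * ‖y - z‖ with he
  have key : ∀ u uh : EuclideanSpace ℝ (Fin N), ‖u‖ ≤ H → ‖uh - u‖ ≤ η →
      |inner ℝ u w| ≤ |inner ℝ uh (y - z)| + (H * e + η * ‖y - z‖) := by
    intro u uh hu huh
    have h2 := abs_inner_le_of_norm_le hu h1
    have h3 := abs_inner_le_of_norm_le huh (le_refl ‖y - z‖)
    have h4 : inner ℝ u w = inner ℝ uh (y - z) - inner ℝ (uh - u) (y - z) - inner ℝ u (y - z - w) := by
      simp only [inner_sub_left, inner_sub_right]; ring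
    rw [h4]
    refine (abs_sub _ _).trans ?_
    have := abs_sub (inner ℝ uh (y - z)) (inner ℝ (uh - u) (y - z))
    linarith
  have h2 := key u uh hu huh
  have h3 := key v vh hv hvh
  have h4 := hd w hw
  have h5 : ‖y - z‖ ≤ ‖y - z - w‖ + ‖w‖ := by
    have := norm_add_le (y - z - w) w
    rwa [sub_add_cancel] at this
  have h6 := mul_le_mul_of_nonneg_right hs (norm_nonneg (y - z))
  have h7 : ((2 * H + 1) * (K₁ * δ ^ α) + 2 * η) * ‖y - z‖ = 2 * H * e + e + 2 * (η * ‖y - z‖) := by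
    rw [he]; ring
  linarith

theorem TanApprox.abs_inner_sub_le {K₁ ρ₀ : ℝ} (hT : TanApprox M G K₁ ρ₀ α) (hx : x ∈ M)
    (hlip : ∀ y ∈ M, ∀ z ∈ M, ‖G y - G z‖ ≤ B * ‖y - z‖)
    {u u' uh uh' : EuclideanSpace ℝ (Fin N)} {s H η η' δ σ : ℝ}
    (hstep : ∀ w ∈ Tan M x, inner ℝ u' (fderiv ℝ G x w) = s * inner ℝ u w) (hs0 : 0 ≤ s)
    (hs : s ≤ σ) (hK₁ : 0 ≤ K₁) (hu : ‖u‖ ≤ H) (hu' : ‖u'‖ ≤ H) (huh : ‖uh - u‖ ≤ η)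
    (huh' : ‖uh' - u'‖ ≤ η') (hδ : δ ≤ ρ₀) {y z : EuclideanSpace ℝ (Fin N)}
    (hy : y ∈ M) (hz : z ∈ M) (hyx : ‖y - x‖ ≤ δ) (hzx : ‖z - x‖ ≤ δ) :
    |inner ℝ uh' (G y - G z) - s * inner ℝ uh (y - z)| ≤
      ((H + σ * H) * (K₁ * δ ^ α) + η' * B + σ * η) * ‖y - z‖ := by
  obtain ⟨w, hw, h1, h1'⟩ := hT x hx y hy z hz δ hδ hyx hzx
  have hδ0 : 0 ≤ δ := (norm_nonneg _).trans hyx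
  set e := K₁ * δ ^ α * ‖y - z‖ with he
  have he0 : 0 ≤ e := by positivity
  have h2 := abs_inner_le_of_norm_le hu h1
  have h2' := abs_inner_le_of_norm_le hu' h1'
  have h3 := abs_inner_le_of_norm_le huh (le_refl ‖y - z‖)
  have h3' := abs_inner_le_of_norm_le huh' (hlip y hy z hz)
  have h4 : inner ℝ uh' (G y - G z) - s * inner ℝ uh (y - z) =
      inner ℝ (uh' - u') (G y - G z) + inner ℝ u' (G y - G z - fderiv ℝ G x w) -
        s * (inner ℝ (uh - u) (y - z) + inner ℝ u (y - z - w)) := by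
    have := hstep w hw
    simp only [inner_sub_left, inner_sub_right] at this ⊢
    rw [this]; ring
  have hH : 0 ≤ H := (norm_nonneg _).trans hu
  have hη : 0 ≤ η := (norm_nonneg _).trans huh
  rw [h4]
  refine (abs_sub _ _).trans ?_
  rw [abs_mul, abs_of_nonneg hs0]
  have h5 := abs_add_le (inner ℝ (uh' - u') (G y - G z)) (inner ℝ u' (G y - G z - fderiv ℝ G x w))
  have h6 := abs_add_le (inner ℝ (uh - u) (y - z)) (inner ℝ u (y - z - w))
  have h7 : s * |inner ℝ (uh - u) (y - z) + inner ℝ u (y - z - w)| ≤ σ * (η * ‖y - z‖ + H * e) :=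
    mul_le_mul hs (by linarith) (abs_nonneg _) (hs0.trans hs)
  have h8 : ((H + σ * H) * (K₁ * δ ^ α) + η' * B + σ * η) * ‖y - z‖ =
      H * e + η' * (B * ‖y - z‖) + σ * (η * ‖y - z‖ + H * e) := by rw [he]; ring
  linarith

/-- A link between two boxes placed near a point and near its image. -/
theorem HolderDiffeo.link_boxTube (h : HolderDiffeo M G G' α C B) {K₁ ρ₀ : ℝ} (hK₁ : 0 ≤ K₁)
    (hT : TanApprox M G K₁ ρ₀ α) (hx : x ∈ M)
    {u v u' v' xh uh vh xh' uh' vh' : EuclideanSpace ℝ (Fin N)}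
    {s t H η η' δ δ₀ σ ζ ρu ρv ρu' ρv' : ℝ}
    (hxhM : xh ∈ M) (hxhM' : xh' ∈ M)
    (hd : ∀ w ∈ Tan M x, ‖w‖ ≤ |inner ℝ u w| + |inner ℝ v w|)
    (hd' : ∀ w ∈ Tan M (G x), ‖w‖ ≤ |inner ℝ u' w| + |inner ℝ v' w|)
    (hstepu : ∀ w ∈ Tan M x, inner ℝ u' (fderiv ℝ G x w) = s * inner ℝ u w)
    (hstepv : ∀ w ∈ Tan M x, inner ℝ v' (fderiv ℝ G x w) = t * inner ℝ v w)
    (hs0 : 0 ≤ s) (ht0 : 0 ≤ t) (hsσ : s ≤ σ) (htσ : t ≤ σ)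
    (hu : ‖u‖ ≤ H) (hv : ‖v‖ ≤ H) (hu' : ‖u'‖ ≤ H) (hv' : ‖v'‖ ≤ H)
    (hxh : ‖xh - x‖ ≤ η) (huh : ‖uh - u‖ ≤ η) (hvh : ‖vh - v‖ ≤ η)
    (hxh' : ‖xh' - G x‖ ≤ η') (huh' : ‖uh' - u'‖ ≤ η') (hvh' : ‖vh' - v'‖ ≤ η')
    (hδ₀ : 2 * (ρu + ρv) + η ≤ δ₀) (hδ : B * δ₀ ≤ δ) (hη'δ : η' ≤ δ) (hδρ : δ ≤ ρ₀)
    (hhalf : (2 * H + 1) * (K₁ * δ ^ α) + 2 * η ≤ 1 / 2)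
    (hhalf' : (2 * H + 1) * (K₁ * δ ^ α) + 2 * η' ≤ 1 / 2)
    (hρu : 0 < ρu) (hρv : 0 < ρv) (hρu' : 0 < ρu') (hρv' : 0 < ρv') (hζ : 0 < ζ)
    (hEu : 2 * ((H + σ * H) * (K₁ * δ ^ α) + η' * B + σ * η) * (ρu + ρv) ≤ ζ * ρu')
    (hEv : 2 * ((H + σ * H) * (K₁ * δ ^ α) + η' * B + σ * η) * (ρu + ρv) ≤ ζ * ρv')
    (hcu : (H + η') * (B * η + η') ≤ ζ * ρu') (hcv : (H + η') * (B * η + η') ≤ ζ * ρv')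
    (hs : s * ρu ≤ (1 - 2 * ζ) * ρu') (ht : (1 + 2 * ζ) * ρv' ≤ t * ρv) :
    Link G (1 + ζ) (boxTube M xh uh vh ρu ρv) (boxTube M xh' uh' vh' ρu' ρv') := by
  have hH : 0 ≤ H := (norm_nonneg _).trans hu
  have hη : 0 ≤ η := (norm_nonneg _).trans huh
  have hη' : 0 ≤ η' := (norm_nonneg _).trans huh'
  have hB : 0 ≤ B := zero_le_one.trans h.one_le
  have hσ : 0 ≤ σ := hs0.trans hsσ
  have hδ₀0 : 0 ≤ δ₀ := by linarith
  have hδ₀δ : δ₀ ≤ δ := (le_mul_of_one_le_left hδ₀0 h.one_le).trans hδ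
  have hδ0 : 0 ≤ δ := hδ₀0.trans hδ₀δ
  have hclose : ∀ y, ‖y - xh‖ ≤ 2 * (ρu + ρv) → ‖y - x‖ ≤ δ₀ := by
    intro y hy
    have := norm_sub_le_norm_sub_add_norm_sub y xh x
    linarith
  have hcen : ∀ w v' : EuclideanSpace ℝ (Fin N), ‖v'‖ ≤ H → ‖w - v'‖ ≤ η' →
      |inner ℝ w (G xh - xh')| ≤ (H + η') * (B * η + η') := by
    intro w v' hv' hw
    refine abs_inner_le_of_norm_le ?_ ?_
    · have := norm_add_le (w - v') v'
      rw [sub_add_cancel] at this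
      linarith
    · have h1 := norm_sub_le_norm_sub_add_norm_sub (G xh) (G x) xh'
      have h2 := h.lip xh hxhM x hx
      have h3 := mul_le_mul_of_nonneg_left hxh hB
      rw [norm_sub_rev (G x)] at h1
      linarith
  refine _root_.link_boxTube (s := s) (t := t)
    (Er := (H + σ * H) * (K₁ * δ ^ α) + η' * B + σ * η) h.maps hxhM hρu hρv hρu' hρv' hζ
    (by positivity) ?_ ?_ ?_ ?_ ((hcen uh' u' hu' huh').trans hcu) ((hcen vh' v' hv' hvh').trans hcv)
    hs0 hs ht hEu hEv
  · intro y hy z hz hyx hzx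
    exact hT.abs_inner_sub_le hx h.lip hstepu hs0 hsσ hK₁ hu hu' huh huh' hδρ hy hz
      ((hclose y hyx).trans hδ₀δ) ((hclose z hzx).trans hδ₀δ)
  · intro y hy z hz hyx hzx
    exact hT.abs_inner_sub_le hx h.lip hstepv ht0 htσ hK₁ hv hv' hvh hvh' hδρ hy hz
      ((hclose y hyx).trans hδ₀δ) ((hclose z hzx).trans hδ₀δ)
  · intro y hy z hz hyx hzx
    exact hT.norm_sub_le hx hd hu hv huh hvh hδρ hhalf hy hz
      ((hclose y hyx).trans hδ₀δ) ((hclose z hzx).trans hδ₀δ)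
  · intro y hy hyx
    refine hT.norm_sub_le (h.maps hx) hd' hu' hv' huh' hvh' hδρ hhalf' (h.maps hy) hxhM' ?_
      (hxh'.trans hη'δ)
    exact ((h.lip y hy x hx).trans (mul_le_mul_of_nonneg_left (hclose y hyx) hB)).trans hδ

end Chain

section Chain

variable {N : ℕ} {M : Set (EuclideanSpace ℝ (Fin N))}
  {G G' : EuclideanSpace ℝ (Fin N) → EuclideanSpace ℝ (Fin N)} {α C B : ℝ}

theorem chain_error_le {H K₁ A κ ζ r X mx mn m e e' p q α B : ℝ} (hH : 0 ≤ H) (hK : 0 ≤ K₁)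
    (hX : 0 ≤ X) (hr : 0 ≤ r) (hA : 0 ≤ A) (hκ : 0 ≤ κ) (hm : 0 ≤ m) (hB : 0 ≤ B)
    (he : 0 ≤ e) (he' : 0 ≤ e')
    (hmain : α * mx + 2 * κ * m + (mx - mn) ≤ 8 * A)
    (hrX : 8 * H * K₁ * Real.exp (9 * A + 3 * κ) * X ≤ ζ / 2)
    (hpert : 4 * (e' * B + Real.exp (A + κ + κ * m) * e) * Real.exp mx ≤ ζ / 2 * Real.exp mn)
    (hp : p ≤ mx) (hq : q ≤ mx) :
    2 * ((H * Real.exp (2 * κ + κ * m) +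
        Real.exp (A + κ + κ * m) * (H * Real.exp (2 * κ + κ * m))) *
          (K₁ * (X * Real.exp (α * mx))) + e' * B + Real.exp (A + κ + κ * m) * e) *
      (r * Real.exp p + r * Real.exp q) ≤ ζ * (r * Real.exp mn) := by
  have h1 : r * Real.exp p + r * Real.exp q ≤ 2 * r * Real.exp mx := by
    have := mul_le_mul_of_nonneg_left (Real.exp_le_exp.2 hp) hr
    have := mul_le_mul_of_nonneg_left (Real.exp_le_exp.2 hq) hr
    linarith
  have h2 : H * Real.exp (2 * κ + κ * m) +
      Real.exp (A + κ + κ * m) * (H * Real.exp (2 * κ + κ * m)) ≤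
      2 * H * Real.exp (A + 3 * κ + 2 * κ * m) := by
    have h3 : (1:ℝ) ≤ Real.exp (A + κ + κ * m) := Real.one_le_exp (by positivity)
    have h4 := mul_le_mul_of_nonneg_right h3
      (show 0 ≤ H * Real.exp (2 * κ + κ * m) by positivity)
    have h5 : Real.exp (A + 3 * κ + 2 * κ * m) =
        Real.exp (A + κ + κ * m) * Real.exp (2 * κ + κ * m) := by
      rw [← Real.exp_add]; ring_nf
    rw [h5]
    linarith
  have h3 : 0 ≤ K₁ * (X * Real.exp (α * mx)) := by positivity
  have h4 := mul_le_mul_of_nonneg_right h2 h3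
  have h0 : 0 ≤ Real.exp (A + κ + κ * m) * e := by positivity
  have h0' : 0 ≤ e' * B := by positivity
  have h0'' : 0 ≤ (H * Real.exp (2 * κ + κ * m) +
        Real.exp (A + κ + κ * m) * (H * Real.exp (2 * κ + κ * m))) *
          (K₁ * (X * Real.exp (α * mx))) := by positivity
  have h5 : 8 * H * K₁ * X * Real.exp (A + 3 * κ + 2 * κ * m) * Real.exp (α * mx) * Real.exp mx ≤
      ζ / 2 * Real.exp mn := by
    have h6 : Real.exp (A + 3 * κ + 2 * κ * m) * Real.exp (α * mx) * Real.exp mx ≤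
        Real.exp (9 * A + 3 * κ) * Real.exp mn := by
      rw [← Real.exp_add, ← Real.exp_add, ← Real.exp_add]
      exact Real.exp_le_exp.2 (by linarith)
    have h7 := mul_le_mul_of_nonneg_left h6 (show 0 ≤ 8 * H * K₁ * X by positivity)
    have h8 := mul_le_mul_of_nonneg_right hrX (Real.exp_pos mn).le
    linarith
  calc _ ≤ 2 * (2 * H * Real.exp (A + 3 * κ + 2 * κ * m) * (K₁ * (X * Real.exp (α * mx))) +
        e' * B + Real.exp (A + κ + κ * m) * e) * (2 * r * Real.exp mx) :=
        mul_le_mul (by linarith) h1 (by positivity) (by linarith)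
    _ = r * (8 * H * K₁ * X * Real.exp (A + 3 * κ + 2 * κ * m) * Real.exp (α * mx) * Real.exp mx +
        4 * (e' * B + Real.exp (A + κ + κ * m) * e) * Real.exp mx) := by ring
    _ ≤ r * (ζ / 2 * Real.exp mn + ζ / 2 * Real.exp mn) :=
        mul_le_mul_of_nonneg_left (add_le_add h5 hpert) hr
    _ = _ := by ring

theorem exists_pos_rpow_mul_le {B α X : ℝ} (hB : 0 < B) (hα : 0 < α) (hX : 0 < X) :
    ∃ r₀ > 0, ∀ r, 0 < r → r ≤ r₀ → (B * r) ^ α ≤ X := by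
  refine ⟨X ^ α⁻¹ / B, by positivity, fun r hr hr0 => ?_⟩
  rw [le_div_iff₀ hB, mul_comm] at hr0
  calc (B * r) ^ α ≤ (X ^ α⁻¹) ^ α := Real.rpow_le_rpow (by positivity) hr0 hα.le
    _ = X := Real.rpow_inv_rpow hX.le hα.ne'

/-- A long good string whose two ends are close to each other in phase space carries a chain of
linked boxes which starts and ends with the same box. -/
theorem HolderDiffeo.exists_chain (h : HolderDiffeo M G G' α C B) {K₁ ρ₀ χ κ A H d₀ : ℝ}
    (hK₁ : 0 < K₁) (hρ₀ : 0 < ρ₀) (hT : TanApprox M G K₁ ρ₀ α) (hκ : 0 < κ) (hχ : 0 < χ)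
    (hχA : χ ≤ A) (hκχ : 2 * κ + 2 * (4 * (2 * κ) * A / χ) ≤ α * χ / 2) (hH : 1 ≤ H)
    (hd₀ : 0 < d₀) :
    ∃ r η c, 0 < r ∧ r ≤ d₀ ∧ 0 < η ∧ 1 < c ∧
      ∀ xb ∈ M, ∀ ub vb : EuclideanSpace ℝ (Fin N), ∀ (l : ℕ) z u v a b D,
        A ≤ (χ - 2 * κ) * l → z ∈ M → GoodString M G χ κ A H l z u v a b D →
        ‖xb - z‖ ≤ η → ‖ub - u 0‖ ≤ η → ‖vb - v 0‖ ≤ η →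
        ‖xb - G^[l] z‖ ≤ η → ‖ub - u l‖ ≤ η → ‖vb - v l‖ ≤ η →
        ∃ τ : ℕ → Tube (EuclideanSpace ℝ (Fin N)),
          τ 0 = boxTube M xb ub vb r (r * Real.exp (-A)) ∧
          τ l = boxTube M xb ub vb r (r * Real.exp (-A)) ∧
          (∀ i < l, Link G c (τ i) (τ (i + 1))) ∧
          ∀ i ≤ l, ∀ y ∈ (τ i).D, ‖y - G^[i] z‖ ≤ d₀ := by
  have hA : 0 < A := hχ.trans_le hχA
  have hB := h.one_le
  have hB0 : 0 < B := by linarith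
  have hα := h.pos
  have hα1 := h.le_one
  obtain ⟨ζ, hζ⟩ : ∃ ζ : ℝ, ζ = (1 - Real.exp (-κ)) / 2 := ⟨_, rfl⟩
  have hexp1 : Real.exp (-κ) < 1 := by rw [Real.exp_lt_one_iff]; linarith
  have hζ0 : 0 < ζ := by rw [hζ]; linarith
  have hζ1 : ζ ≤ 1 / 2 := by rw [hζ]; linarith [Real.exp_pos (-κ)]
  obtain ⟨r₀, hr₀, hr₀'⟩ := exists_pos_rpow_mul_le (B := 5 * B) (by positivity) hα
    (show 0 < ζ / 2 / (8 * H * K₁ * Real.exp (9 * A + 3 * κ)) by positivity)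
  obtain ⟨r, hr⟩ : ∃ r, r = min r₀ (min d₀ (min ρ₀ d₀ / (5 * B * Real.exp (2 * A + 2 * κ)))) :=
    ⟨_, rfl⟩
  have hr0 : 0 < r := by rw [hr]; positivity
  have hrd : r ≤ d₀ := by rw [hr]; exact (min_le_right _ _).trans (min_le_left _ _)
  have hr2 : 5 * B * r * Real.exp (2 * A + 2 * κ) ≤ min ρ₀ d₀ := by
    have : r ≤ min ρ₀ d₀ / (5 * B * Real.exp (2 * A + 2 * κ)) := by
      rw [hr]; exact (min_le_right _ _).trans (min_le_right _ _)
    rw [le_div_iff₀ (by positivity)] at this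
    linarith
  have hrX : 8 * H * K₁ * Real.exp (9 * A + 3 * κ) * (5 * B * r) ^ α ≤ ζ / 2 := by
    have := hr₀' r hr0 (by rw [hr]; exact min_le_left _ _)
    rw [le_div_iff₀ (by positivity)] at this
    linarith
  obtain ⟨X, hX⟩ : ∃ X, X = (5 * B * r) ^ α := ⟨_, rfl⟩
  have hX0 : 0 ≤ X := by rw [hX]; positivity
  rw [← hX] at hrX
  obtain ⟨η, hη0, hη1, hη2, hη3, hη4, hη5⟩ : ∃ η > 0, η ≤ 1 / 8 ∧ η ≤ H ∧
      η ≤ r * Real.exp (-(2 * A)) ∧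
      4 * (B + Real.exp (A + 2 * κ)) * Real.exp (10 * A) * η ≤ ζ / 2 ∧
      2 * (H * Real.exp (3 * κ)) * (B + 1) * η ≤ ζ * (r * Real.exp (-(12 * A))) := by
    refine ⟨min (1 / 8) (min H (min (r * Real.exp (-(2 * A)))
      (min (ζ / 2 / (4 * (B + Real.exp (A + 2 * κ)) * Real.exp (10 * A)))
        (ζ * (r * Real.exp (-(12 * A))) / (2 * (H * Real.exp (3 * κ)) * (B + 1)))))), by positivity,
      min_le_left _ _, ?_, ?_, ?_, ?_⟩
    · exact (min_le_right _ _).trans (min_le_left _ _)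
    · exact (min_le_right _ _).trans ((min_le_right _ _).trans (min_le_left _ _))
    · rw [mul_comm, ← le_div_iff₀ (by positivity)]
      exact (min_le_right _ _).trans ((min_le_right _ _).trans ((min_le_right _ _).trans
        (min_le_left _ _)))
    · rw [mul_comm, ← le_div_iff₀ (by positivity)]
      exact (min_le_right _ _).trans ((min_le_right _ _).trans ((min_le_right _ _).trans
        (min_le_right _ _)))
  refine ⟨r, η, 1 + ζ, hr0, hrd, hη0, by linarith, ?_⟩
  intro xb hxb ub vb l z u v a b D hl hz hs hx0 hu0 hv0 hxl hul hvl
  obtain ⟨p, q, hp0, hq0, hpl, hql, hp, hq, hmain, hmain', hmx⟩ :=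
    exists_log_widths (by positivity) hχ hA.le hα hα1 hκχ hχA hl hs.neg_le_a hs.neg_le_b hs.nonneg
      hs.a_le hs.b_le hs.sum_b hs.sum_a
      (fun j hj => (hs.sum_D j hj).trans (by
        have : (0:ℝ) ≤ κ * j := by positivity
        linarith))
      (fun j hj => (hs.sum_D' j hj).trans (by
        have : (0:ℝ) ≤ κ * (l - j) := mul_nonneg hκ.le (sub_nonneg.2 (by exact_mod_cast hj))
        linarith))
  have hl0 : 0 < l := by
    rcases Nat.eq_zero_or_pos l with rfl | h0
    · simp only [Nat.cast_zero, mul_zero] at hl; linarith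
    · exact h0
  let P : ℕ → Prop := fun i => i = 0 ∨ i = l
  classical
  let xh : ℕ → EuclideanSpace ℝ (Fin N) := fun i => if P i then xb else G^[i] z
  let uh : ℕ → EuclideanSpace ℝ (Fin N) := fun i => if P i then ub else u i
  let vh : ℕ → EuclideanSpace ℝ (Fin N) := fun i => if P i then vb else v i
  let e : ℕ → ℝ := fun i => if P i then η else 0
  have he0 : ∀ i, 0 ≤ e i := fun i => by
    by_cases hi : P i <;> simp [e, hi, hη0.le]
  have heη : ∀ i, e i ≤ η := fun i => by
    by_cases hi : P i <;> simp [e, hi, hη0.le]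
  have hxhM : ∀ i, xh i ∈ M := fun i => by
    by_cases hi : P i
    · simp [xh, hi, hxb]
    · simp [xh, hi, h.iterate_mem hz i]
  have hxh : ∀ i, ‖xh i - G^[i] z‖ ≤ e i := fun i => by
    by_cases hi : P i
    · simp only [xh, e, hi, if_true]
      rcases hi with rfl | rfl <;> assumption
    · simp [xh, e, hi]
  have huh : ∀ i, ‖uh i - u i‖ ≤ e i := fun i => by
    by_cases hi : P i
    · simp only [uh, e, hi, if_true]
      rcases hi with rfl | rfl <;> assumption
    · simp [uh, e, hi]
  have hvh : ∀ i, ‖vh i - v i‖ ≤ e i := fun i => by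
    by_cases hi : P i
    · simp only [vh, e, hi, if_true]
      rcases hi with rfl | rfl <;> assumption
    · simp [vh, e, hi]
  have hm0 : ∀ i ≤ l, 0 ≤ min (i:ℝ) (l - i) := fun i hi =>
    le_min (Nat.cast_nonneg i) (sub_nonneg.2 (by exact_mod_cast hi))
  have hclose : ∀ i ≤ l, 2 * (r * Real.exp (p i) + r * Real.exp (q i)) + e i ≤
      5 * r * Real.exp (max (p i) (q i)) := by
    intro i hi
    have h1 := mul_le_mul_of_nonneg_left (Real.exp_le_exp.2 (le_max_left (p i) (q i))) hr0.le
    have h2 := mul_le_mul_of_nonneg_left (Real.exp_le_exp.2 (le_max_right (p i) (q i))) hr0.le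
    have h3 : e i ≤ r * Real.exp (max (p i) (q i)) := by
      by_cases hP : P i
      · have h4 : 0 ≤ max (p i) (q i) := by
          rcases hP with rfl | rfl
          · exact hp0.ge.trans (le_max_left _ _)
          · exact hpl.ge.trans (le_max_left _ _)
        have h5 : Real.exp (-(2 * A)) ≤ Real.exp (max (p i) (q i)) :=
          Real.exp_le_exp.2 (by linarith)
        exact (heη i).trans (hη3.trans (mul_le_mul_of_nonneg_left h5 hr0.le))
      · simp only [e, hP, if_false]; positivity
    linarith
  have hmxr : ∀ i ≤ l, 5 * B * r * Real.exp (max (p i) (q i)) ≤ min ρ₀ d₀ := fun i hi =>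
    (mul_le_mul_of_nonneg_left (Real.exp_le_exp.2 (hmx i hi)) (by positivity)).trans hr2
  refine ⟨fun i => boxTube M (xh i) (uh i) (vh i) (r * Real.exp (p i)) (r * Real.exp (q i)),
    ?_, ?_, ?_, ?_⟩
  · simp [xh, uh, vh, P, hp0, hq0]
  · simp [xh, uh, vh, P, hpl, hql]
  · intro i hi
    obtain ⟨m, hm⟩ : ∃ m, m = min (i:ℝ) (l - i) := ⟨_, rfl⟩
    obtain ⟨mx, hmxe⟩ : ∃ mx, mx = max (p i) (q i) := ⟨_, rfl⟩
    obtain ⟨mn, hmn⟩ : ∃ mn, mn = min (p (i + 1)) (q (i + 1)) := ⟨_, rfl⟩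
    have hm0' : 0 ≤ m := hm ▸ hm0 i hi.le
    have hmain1 := hmain i hi
    have hmain2 := hmain' i hi.le
    have hmxi := hmx i hi.le
    have hcl := hclose i hi.le
    have hmr := hmxr i hi.le
    rw [← hm, ← hmxe, ← hmn] at hmain1
    rw [← hm, ← hmxe] at hmain2
    rw [← hmxe] at hmxi hcl hmr
    have hpm : p i ≤ mx := hmxe ▸ le_max_left _ _
    have hqm : q i ≤ mx := hmxe ▸ le_max_right _ _
    have hpn : mn ≤ p (i + 1) := hmn ▸ min_le_left _ _
    have hqn : mn ≤ q (i + 1) := hmn ▸ min_le_right _ _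
    have hmend : P i ∨ P (i + 1) → -(2 * A) ≤ mx ∧ m ≤ 1 := by
      intro hP
      have hcase : i = 0 ∨ i + 1 = l := by
        rcases hP with (h1 | h1) | (h1 | h1)
        · exact Or.inl h1
        · omega
        · omega
        · exact Or.inr h1
      rcases hcase with h1 | h1
      · constructor
        · have : p i = 0 := by rw [h1, hp0]
          linarith
        · rw [hm, h1]; exact (min_le_left _ _).trans (by simp)
      · constructor
        · have h2 := hq i hi
          have h3 := hs.a_le i
          rw [h1, hql] at h2
          linarith
        · rw [hm, ← h1]; exact (min_le_right _ _).trans (by push_cast; linarith)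
    have hmn12 : P i ∨ P (i + 1) → mx - mn ≤ 10 * A := by
      intro hP
      have h1 := (hmend hP).1
      have h2 : α * mx ≥ -(2 * A) := by
        rcases le_total 0 mx with h3 | h3
        · have : 0 ≤ α * mx := by positivity
          linarith
        · have := mul_le_mul_of_nonpos_right hα1 h3
          linarith
      have : 0 ≤ 2 * κ * m := by positivity
      linarith
    have hDi : D i ≤ κ + κ * m := by
      have h1 : D i ≤ κ * (i + 1) := by
        have h2 := hs.sum_D (i + 1) hi
        rw [Finset.sum_range_succ] at h2
        have h3 : 0 ≤ ∑ k ∈ Finset.range i, D k := Finset.sum_nonneg fun k _ => hs.nonneg k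
        push_cast at h2
        linarith
      have h2 : D i ≤ κ * (l - i) + κ := by
        have h2 := hs.sum_D' i hi.le
        rw [← Finset.sum_Ico_eq_sub _ hi.le] at h2
        exact (Finset.single_le_sum (fun k _ => hs.nonneg k)
          (Finset.mem_Ico.2 ⟨le_rfl, hi⟩)).trans h2
      rw [hm]
      rcases min_cases (i:ℝ) (l - i) with ⟨h3, -⟩ | ⟨h3, -⟩ <;> rw [h3] <;> linarith
    have hnorm : ∀ w : ℕ → EuclideanSpace ℝ (Fin N),
        (∀ i ≤ l, ‖w i‖ ≤ H * Real.exp (κ + κ * min (i : ℝ) (l - i))) →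
        ‖w i‖ ≤ H * Real.exp (2 * κ + κ * m) ∧ ‖w (i + 1)‖ ≤ H * Real.exp (2 * κ + κ * m) := by
      intro w hw
      constructor
      · refine (hw i hi.le).trans (mul_le_mul_of_nonneg_left (Real.exp_le_exp.2 ?_) (by linarith))
        rw [← hm]; linarith
      · refine (hw (i + 1) hi).trans (mul_le_mul_of_nonneg_left (Real.exp_le_exp.2 ?_) (by linarith))
        have h1 : min ((i + 1 : ℕ) : ℝ) (l - (i + 1 : ℕ)) ≤ m + 1 := by
          push_cast
          rw [hm]
          rcases min_cases (i:ℝ) (l - i) with ⟨h3, -⟩ | ⟨h3, -⟩ <;> rw [h3]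
          · exact min_le_left _ _
          · exact (min_le_right _ _).trans (by linarith)
        have := mul_le_mul_of_nonneg_left h1 hκ.le
        linarith
    have hpert : 4 * (e (i + 1) * B + Real.exp (A + κ + κ * m) * e i) * Real.exp mx ≤
        ζ / 2 * Real.exp mn := by
      by_cases hP : P i ∨ P (i + 1)
      · obtain ⟨h1, h2⟩ := hmend hP
        have h3 : Real.exp mx ≤ Real.exp (10 * A) * Real.exp mn := by
          rw [← Real.exp_add]; exact Real.exp_le_exp.2 (by linarith [hmn12 hP])
        have h4 : Real.exp (A + κ + κ * m) * e i ≤ Real.exp (A + 2 * κ) * η :=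
          mul_le_mul (Real.exp_le_exp.2 (by linarith [mul_le_mul_of_nonneg_left h2 hκ.le]))
            (heη i) (he0 i) (Real.exp_pos _).le
        have h5 := mul_le_mul_of_nonneg_right (heη (i + 1)) hB0.le
        have h6 := mul_le_mul_of_nonneg_right hη4 (Real.exp_pos mn).le
        calc _ ≤ 4 * (η * B + Real.exp (A + 2 * κ) * η) * (Real.exp (10 * A) * Real.exp mn) :=
              mul_le_mul (by linarith) h3 (Real.exp_pos _).le (by positivity)
          _ = 4 * (B + Real.exp (A + 2 * κ)) * Real.exp (10 * A) * η * Real.exp mn := by ring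
          _ ≤ _ := h6
      · push Not at hP
        simp only [e, hP.1, hP.2, if_false]
        rw [zero_mul, mul_zero, add_zero, mul_zero, zero_mul]
        positivity
    have hcen : (H * Real.exp (2 * κ + κ * m) + e (i + 1)) * (B * e i + e (i + 1)) ≤
        ζ * (r * Real.exp mn) := by
      by_cases hP : P i ∨ P (i + 1)
      · obtain ⟨h1, h2⟩ := hmend hP
        have h3 : Real.exp (-(12 * A)) ≤ Real.exp mn :=
          Real.exp_le_exp.2 (by linarith [hmn12 hP])
        have h4 : H * Real.exp (2 * κ + κ * m) ≤ H * Real.exp (3 * κ) :=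
          mul_le_mul_of_nonneg_left (Real.exp_le_exp.2
            (by linarith [mul_le_mul_of_nonneg_left h2 hκ.le])) (by linarith)
        have h5 : e (i + 1) ≤ H * Real.exp (3 * κ) :=
          (heη _).trans (hη2.trans (le_mul_of_one_le_right (by linarith)
            (Real.one_le_exp (by positivity))))
        have h6 := mul_le_mul_of_nonneg_left (heη i) hB0.le
        calc _ ≤ (2 * (H * Real.exp (3 * κ))) * ((B + 1) * η) :=
              mul_le_mul (by linarith) (by linarith [heη (i + 1)])
                (add_nonneg (mul_nonneg hB0.le (he0 i)) (he0 _)) (by positivity)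
          _ = 2 * (H * Real.exp (3 * κ)) * (B + 1) * η := by ring
          _ ≤ _ := hη5.trans (mul_le_mul_of_nonneg_left
              (mul_le_mul_of_nonneg_left h3 hr0.le) hζ0.le)
      · push Not at hP
        simp only [e, hP.1, hP.2, if_false]
        rw [mul_zero, add_zero, add_zero, mul_zero]
        positivity
    have hδα : (5 * B * r * Real.exp mx) ^ α = X * Real.exp (α * mx) := by
      rw [Real.mul_rpow (by positivity) (Real.exp_pos _).le, ← Real.exp_mul, mul_comm mx, hX]
    have hhalf : ∀ j, (2 * (H * Real.exp (2 * κ + κ * m)) + 1) *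
        (K₁ * (5 * B * r * Real.exp mx) ^ α) + 2 * e j ≤ 1 / 2 := by
      intro j
      rw [hδα]
      have h1 : (1:ℝ) ≤ H * Real.exp (2 * κ + κ * m) :=
        one_le_mul_of_one_le_of_one_le hH (Real.one_le_exp (by positivity))
      have h2 : (2 * (H * Real.exp (2 * κ + κ * m)) + 1) * (K₁ * (X * Real.exp (α * mx))) ≤
          3 * (H * Real.exp (2 * κ + κ * m)) * (K₁ * (X * Real.exp (α * mx))) :=
        mul_le_mul_of_nonneg_right (by linarith) (by positivity)
      have h3 : Real.exp (2 * κ + κ * m) * Real.exp (α * mx) ≤ Real.exp (9 * A + 3 * κ) := by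
        rw [← Real.exp_add]
        have : 0 ≤ κ * m := by positivity
        exact Real.exp_le_exp.2 (by linarith)
      have h4 := mul_le_mul_of_nonneg_left h3 (show 0 ≤ 3 * H * K₁ * X by positivity)
      have h5 := heη j
      have h6 : 0 ≤ H * K₁ * Real.exp (9 * A + 3 * κ) * X := by positivity
      linarith
    have herr := fun p' (hp' : mn ≤ p') => (chain_error_le (α := α) (show 0 ≤ H by linarith) hK₁.le hX0
      hr0.le hA.le hκ.le hm0' hB0.le (he0 i) (he0 (i + 1)) (by linarith) hrX hpert hpm hqm).trans
      (mul_le_mul_of_nonneg_left (mul_le_mul_of_nonneg_left (Real.exp_le_exp.2 hp') hr0.le)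
        hζ0.le)
    have hce := fun p' (hp' : mn ≤ p') => hcen.trans
      (mul_le_mul_of_nonneg_left (mul_le_mul_of_nonneg_left (Real.exp_le_exp.2 hp') hr0.le)
        hζ0.le)
    rw [← hδα] at herr
    have hG1 : G^[i + 1] z = G (G^[i] z) := Function.iterate_succ_apply' G i z
    have hstepu := hs.step_u i hi
    have hstepv := hs.step_v i hi
    have hdd := hs.decomp (i + 1)
    have hxh1 := hxh (i + 1)
    rw [hG1] at hdd hxh1
    refine h.link_boxTube hK₁.le hT (h.iterate_mem hz i) (s := Real.exp (-b i))
      (t := Real.exp (a i)) (σ := Real.exp (A + κ + κ * m)) (η := e i) (η' := e (i + 1))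
      (δ₀ := 5 * r * Real.exp mx) (δ := 5 * B * r * Real.exp mx)
      (H := H * Real.exp (2 * κ + κ * m)) (hxhM i) (hxhM (i + 1)) (hs.decomp i) hdd hstepu hstepv
      (Real.exp_pos _).le (Real.exp_pos _).le (Real.exp_le_exp.2 ?_) (Real.exp_le_exp.2 ?_)
      (hnorm u hs.norm_u).1 (hnorm v hs.norm_v).1 (hnorm u hs.norm_u).2 (hnorm v hs.norm_v).2
      (hxh i) (huh i) (hvh i) hxh1 (huh (i + 1)) (hvh (i + 1)) hcl (le_of_eq (by ring)) ?_
      (hmr.trans (min_le_left _ _)) (hhalf i) (hhalf (i + 1)) (by positivity) (by positivity)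
      (by positivity) (by positivity) hζ0 (herr _ hpn) (herr _ hqn) (hce _ hpn) (hce _ hqn) ?_ ?_
    · have := hs.neg_le_b i
      linarith
    · have := hs.a_le i
      have : 0 ≤ κ * m := by positivity
      linarith
    · by_cases hP : P (i + 1)
      · have h1 := (hmend (Or.inr hP)).1
        have h2 := mul_le_mul_of_nonneg_left (Real.exp_le_exp.2 h1) hr0.le
        have h3 : r * Real.exp mx ≤ 5 * B * (r * Real.exp mx) :=
          le_mul_of_one_le_left (by positivity) (by linarith)
        have h4 := heη (i + 1)
        linarith
      · simp only [e, hP, if_false]; positivity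
    · have h1 : 1 - 2 * ζ = Real.exp (-κ) := by rw [hζ]; ring
      rw [h1, mul_left_comm, mul_left_comm (Real.exp (-κ)), ← Real.exp_add, ← Real.exp_add]
      refine mul_le_mul_of_nonneg_left (Real.exp_le_exp.2 ?_) hr0.le
      have := hp i hi
      linarith
    · have h1 : 1 + 2 * ζ ≤ Real.exp κ := by
        have := Real.add_one_le_exp κ
        have := Real.add_one_le_exp (-κ)
        rw [hζ]; linarith
      refine (mul_le_mul_of_nonneg_right h1 (by positivity)).trans ?_
      rw [mul_left_comm, mul_left_comm (Real.exp (a i)), ← Real.exp_add, ← Real.exp_add]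
      refine mul_le_mul_of_nonneg_left (Real.exp_le_exp.2 ?_) hr0.le
      have := hq i hi
      linarith
  · intro i hi y hy
    have h1 : ‖y - xh i‖ ≤ 2 * (r * Real.exp (p i) + r * Real.exp (q i)) := hy.2.1
    have h2 := norm_sub_le_norm_sub_add_norm_sub y (xh i) (G^[i] z)
    have h3 := hxh i
    have h4 := hclose i hi
    have h5 := (hmxr i hi).trans (min_le_right _ _)
    have h6 : 5 * r * Real.exp (max (p i) (q i)) ≤ B * (5 * r * Real.exp (max (p i) (q i))) :=
      le_mul_of_one_le_left (by positivity) hB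
    linarith

end Chain

section Curves

variable {E : Type*} [NormedAddCommGroup E] [InnerProductSpace ℝ E] {M : Set E}

theorem abs_inner_sub_smul_le {u g φ : E} {H e t : ℝ} (hu : ‖u‖ ≤ H) (hg : ‖g - t • φ‖ ≤ e) :
    |inner ℝ u g - t * inner ℝ u φ| ≤ H * e := by
  have h := abs_inner_le_of_norm_le hu hg
  rwa [inner_sub_right, inner_smul_right] at h

/-- A curve with nearly constant velocity along the unstable direction spans the box. -/
theorem boxTube_coneSpans {x u v φ : E} {ρu ρv H ε : ℝ} {σ : ℝ → E} (hρv : 0 < ρv)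
    (hρ : ρv ≤ ρu) (hH : 1 ≤ H) (hu : ‖u‖ ≤ H) (hv : ‖v‖ ≤ H) (hφ : ‖φ‖ = 1)
    (huφ : inner ℝ u φ = (0 : ℝ)) (hvφ : inner ℝ v φ = (1 : ℝ)) (hε0 : 0 ≤ ε)
    (hε : H * ε ≤ 1 / 4) (h0 : σ 0 = x) (hM : ∀ s, |s| ≤ 2 * ρv → σ s ∈ M)
    (hσ : ∀ s t, |s| ≤ 2 * ρv → |t| ≤ 2 * ρv → ‖σ s - σ t - (s - t) • φ‖ ≤ ε * |s - t|) :
    ∃ p q, -(2 * ρv) ≤ p ∧ q ≤ 2 * ρv ∧ ConeSpans (boxTube M x u v ρu ρv) σ p q ∧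
      ∀ t ∈ Ioo p q, ‖σ t - x‖ < 2 * (ρu + ρv) ∧ |inner ℝ u (σ t - x)| < ρu ∧
        |inner ℝ v (σ t - x)| < ρv := by
  have hρu : 0 < ρu := hρv.trans_le hρ
  have hε1 : ε ≤ 1 / 4 := (le_mul_of_one_le_left hε0 hH).trans hε
  have hu1 : ∀ s t, |s| ≤ 2 * ρv → |t| ≤ 2 * ρv →
      |inner ℝ u (σ s - σ t)| ≤ 1 / 4 * |s - t| := by
    intro s t hs ht
    have h := abs_inner_sub_smul_le hu (hσ s t hs ht)
    rw [huφ, mul_zero, sub_zero, ← mul_assoc] at h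
    exact h.trans (mul_le_mul_of_nonneg_right hε (abs_nonneg _))
  have hv1 : ∀ s t, |s| ≤ 2 * ρv → |t| ≤ 2 * ρv → s ≤ t →
      3 / 4 * (t - s) ≤ inner ℝ v (σ t - σ s) := by
    intro s t hs ht hst
    have h := abs_inner_sub_smul_le hv (hσ t s ht hs)
    rw [hvφ, mul_one, ← mul_assoc, abs_of_nonneg (sub_nonneg.2 hst)] at h
    have h2 := (abs_le.1 h).1
    have h3 := mul_le_mul_of_nonneg_right hε (sub_nonneg.2 hst)
    linarith
  have hn1 : ∀ s t, |s| ≤ 2 * ρv → |t| ≤ 2 * ρv → ‖σ s - σ t‖ ≤ 5 / 4 * |s - t| := by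
    intro s t hs ht
    have h := norm_add_le (σ s - σ t - (s - t) • φ) ((s - t) • φ)
    rw [sub_add_cancel, norm_smul, hφ, mul_one, Real.norm_eq_abs] at h
    have h2 := hσ s t hs ht
    have h3 := mul_le_mul_of_nonneg_right hε1 (abs_nonneg (s - t))
    linarith
  have h00 : |(0:ℝ)| ≤ 2 * ρv := by rw [abs_zero]; positivity
  have hcont : ContinuousOn σ (Icc (-(2 * ρv)) (2 * ρv)) := by
    have hL : LipschitzOnWith (5 / 4) σ (Icc (-(2 * ρv)) (2 * ρv)) := by
      refine LipschitzOnWith.of_dist_le_mul fun s hs t ht => ?_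
      rw [dist_eq_norm, Real.dist_eq]
      exact (hn1 s t (abs_le.2 hs) (abs_le.2 ht)).trans (by norm_num)
    exact hL.continuousOn
  set V : ℝ → ℝ := fun s => inner ℝ v (σ s - x) with hV
  have hVc : ContinuousOn V (Icc (-(2 * ρv)) (2 * ρv)) := by
    have : Continuous fun y : E => inner ℝ v (y - x) := by fun_prop
    exact this.comp_continuousOn hcont
  have hVd : ∀ s t, |s| ≤ 2 * ρv → |t| ≤ 2 * ρv → s ≤ t → 3 / 4 * (t - s) ≤ V t - V s := by
    intro s t hs ht hst
    have := hv1 s t hs ht hst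
    simp only [hV, ← inner_sub_right, sub_sub_sub_cancel_right]
    exact this
  have hV0 : V 0 = 0 := by simp [hV, h0]
  have hneg : |-(2 * ρv)| ≤ 2 * ρv := by rw [abs_neg, abs_of_pos (by positivity)]
  have hpos : |2 * ρv| ≤ 2 * ρv := by rw [abs_of_pos (by positivity)]
  obtain ⟨p, hp, hVp⟩ : ∃ p ∈ Icc (-(2 * ρv)) 0, V p = -ρv := by
    have h1 := hVd (-(2 * ρv)) 0 hneg h00 (by linarith)
    exact intermediate_value_Icc (by linarith) (hVc.mono (Icc_subset_Icc le_rfl (by linarith)))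
      ⟨by linarith, by linarith⟩
  obtain ⟨q, hq, hVq⟩ : ∃ q ∈ Icc 0 (2 * ρv), V q = ρv := by
    have h1 := hVd 0 (2 * ρv) h00 hpos (by linarith)
    exact intermediate_value_Icc (by linarith) (hVc.mono (Icc_subset_Icc (by linarith) le_rfl))
      ⟨by linarith, by linarith⟩
  have habs : ∀ t ∈ Icc p q, |t| ≤ 2 * ρv := fun t ht =>
    abs_le.2 ⟨hp.1.trans ht.1, ht.2.trans hq.2⟩
  have hpq : p ≤ q := hp.2.trans hq.1
  have hp' := habs p ⟨le_rfl, hpq⟩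
  have hq' := habs q ⟨hpq, le_rfl⟩
  have hux : ∀ t ∈ Icc p q, |inner ℝ u (σ t - x)| < ρu := by
    intro t ht
    have h1 := hu1 t 0 (habs t ht) h00
    rw [h0, sub_zero] at h1
    have := habs t ht
    linarith
  have hnx : ∀ t ∈ Icc p q, ‖σ t - x‖ < 2 * (ρu + ρv) := by
    intro t ht
    have h1 := hn1 t 0 (habs t ht) h00
    rw [h0, sub_zero] at h1
    have := habs t ht
    linarith
  have hVt : ∀ t ∈ Icc p q, |V t| ≤ ρv := by
    intro t ht
    have h1 := hVd p t hp' (habs t ht) ht.1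
    have h2 := hVd t q (habs t ht) hq' ht.2
    exact abs_le.2 ⟨by linarith [ht.1], by linarith [ht.2]⟩
  refine ⟨p, q, hp.1, hq.2, ⟨⟨hpq, hcont.mono (Icc_subset_Icc hp.1 hq.2), fun t ht =>
    ⟨hM t (habs t ht), (hnx t ht).le, (hux t ht).le, hVt t ht⟩, ?_, ?_⟩, ?_⟩, fun t ht =>
    ⟨hnx t (Ioo_subset_Icc_self ht), hux t (Ioo_subset_Icc_self ht), ?_⟩⟩
  · change V p / ρv = -1
    rw [hVp, neg_div, div_self hρv.ne']
  · change V q / ρv = 1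
    rw [hVq, div_self hρv.ne']
  · intro s hs t ht hst
    simp only [boxTube, ← sub_div, ← inner_sub_right, sub_sub_sub_cancel_right]
    have h1 := hu1 t s (habs t ht) (habs s hs)
    have h2 := hv1 s t (habs s hs) (habs t ht) hst
    have h3 := sub_nonneg.2 hst
    rw [abs_of_nonneg h3] at h1
    rw [abs_div, abs_of_pos hρu]
    exact div_le_div₀ (by linarith) (by linarith) hρv hρ
  · have h1 := hVd p t hp' (habs t (Ioo_subset_Icc_self ht)) ht.1.le
    have h2 := hVd t q (habs t (Ioo_subset_Icc_self ht)) hq' ht.2.le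
    exact abs_lt.2 ⟨by linarith [ht.1], by linarith [ht.2]⟩

/-- A curve in `M` with velocity at one point in the unstable cone contains an arc of the box
issued from this point. -/
theorem boxTube_halfArc {x u v w : E} {ρu ρv H c t₀ : ℝ} {γ : ℝ → E} (hρv : 0 < ρv)
    (hρ : ρv ≤ ρu) (hH : 1 ≤ H) (hu : ‖u‖ ≤ H) (hv : ‖v‖ ≤ H)
    (huw : |inner ℝ u w| ≤ 1 / 4) (hvw : 3 / 4 ≤ inner ℝ v w)
    (hγ : ∀ t ∈ Icc (0:ℝ) 1, γ t ∈ M) (hγc : ContinuousOn γ (Icc 0 1)) (ht₀ : t₀ ∈ Icc (0:ℝ) 1)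
    (hd : HasDerivWithinAt γ (c • w) (Icc 0 1) t₀) (hc : c ≠ 0)
    (h1 : ‖γ t₀ - x‖ < 2 * (ρu + ρv)) (h2 : |inner ℝ u (γ t₀ - x)| < ρu)
    (h3 : |inner ℝ v (γ t₀ - x)| < ρv) :
    ∃ s q d : ℝ, 0 < d ∧ (∀ t ∈ Icc 0 q, t₀ + s * t ∈ Icc (0:ℝ) 1) ∧
      (HalfArc (boxTube M x u v ρu ρv) d (fun t => γ (t₀ + s * t)) 0 q ∨
        HalfArc (boxTube M x u v ρu ρv).flip d (fun t => γ (t₀ + s * t)) 0 q) := by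
  have hρu : 0 < ρu := hρv.trans_le hρ
  have hc0 : 0 < |c| := abs_pos.2 hc
  have hev : ∀ᶠ t in nhdsWithin t₀ (Icc (0:ℝ) 1),
      ‖γ t - γ t₀ - (t - t₀) • c • w‖ ≤ |c| / (8 * H) * ‖t - t₀‖ ∧ ‖γ t - x‖ < 2 * (ρu + ρv) ∧
        |inner ℝ u (γ t - x)| < ρu ∧ |inner ℝ v (γ t - x)| < ρv := by
    have hcw := hγc t₀ ht₀
    have hcx : ContinuousWithinAt (fun t => γ t - x) (Icc 0 1) t₀ := hcw.sub continuousWithinAt_const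
    have hin : ∀ w' : E,
        ContinuousWithinAt (fun t => (inner ℝ w' (γ t - x) : ℝ)) (Icc 0 1) t₀ := fun w' =>
      (show Continuous fun y : E => (inner ℝ w' y : ℝ) by
        fun_prop).continuousAt.comp_continuousWithinAt hcx
    refine (hd.isLittleO.def (show 0 < |c| / (8 * H) by positivity)).and
      ((hcx.norm.eventually_lt continuousWithinAt_const h1).and
      (((hin u).abs.eventually_lt continuousWithinAt_const h2).and
      ((hin v).abs.eventually_lt continuousWithinAt_const h3)))
  obtain ⟨ε, hε, hball⟩ := Metric.mem_nhdsWithin_iff.1 hev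
  obtain ⟨s, q, hs, hq0, hqε, hq⟩ : ∃ s q : ℝ, |s| = 1 ∧ 0 < q ∧ q < ε ∧
      ∀ t ∈ Icc 0 q, t₀ + s * t ∈ Icc (0:ℝ) 1 := by
    rcases lt_or_ge t₀ 1 with h4 | h4
    · refine ⟨1, min (ε / 2) (1 - t₀), by simp, lt_min (by linarith) (by linarith),
        (min_le_left _ _).trans_lt (by linarith), fun t ht => ⟨by linarith [ht₀.1, ht.1], ?_⟩⟩
      have := ht.2.trans (min_le_right _ _)
      linarith
    · refine ⟨-1, min (ε / 2) 1, by simp, lt_min (by linarith) (by linarith),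
        (min_le_left _ _).trans_lt (by linarith), fun t ht => ⟨?_, by linarith [ht₀.2, ht.1]⟩⟩
      have := ht.2.trans (min_le_right _ _)
      linarith
  have hall : ∀ t ∈ Icc 0 q,
      ‖γ (t₀ + s * t) - γ t₀ - (t * (s * c)) • w‖ ≤ |c| / (8 * H) * t ∧
        γ (t₀ + s * t) ∈ (boxTube M x u v ρu ρv).D := by
    intro t ht
    have h5 : t₀ + s * t ∈ Metric.ball t₀ ε := by
      rw [Metric.mem_ball, Real.dist_eq, add_sub_cancel_left, abs_mul, hs, one_mul,
        abs_of_nonneg ht.1]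
      exact ht.2.trans_lt hqε
    obtain ⟨h6, h7, h8, h9⟩ := hball ⟨h5, hq t ht⟩
    rw [add_sub_cancel_left, smul_smul, Real.norm_eq_abs, abs_mul, hs, one_mul,
      abs_of_nonneg ht.1] at h6
    refine ⟨?_, hγ _ (hq t ht), h7.le, h8.le, h9.le⟩
    convert h6 using 4
    ring
  have hH8 : H * (|c| / (8 * H)) = |c| / 8 := by field_simp
  have hU : ∀ t ∈ Icc 0 q, |inner ℝ u (γ (t₀ + s * t) - γ t₀)| ≤ 3 / 8 * |c| * t := by
    intro t ht
    have h5 := abs_inner_sub_smul_le hu (hall t ht).1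
    rw [← mul_assoc H, hH8] at h5
    have h6 : |t * (s * c) * inner ℝ u w| ≤ t * |c| * (1 / 4) := by
      rw [abs_mul, abs_mul, abs_mul, hs, one_mul, abs_of_nonneg ht.1]
      exact mul_le_mul_of_nonneg_left huw (mul_nonneg ht.1 (abs_nonneg _))
    have h7 := abs_add_le (inner ℝ u (γ (t₀ + s * t) - γ t₀) - t * (s * c) * inner ℝ u w)
      (t * (s * c) * inner ℝ u w)
    rw [sub_add_cancel] at h7
    linarith
  have hcont : ContinuousOn (fun t => γ (t₀ + s * t)) (Icc 0 q) :=
    hγc.comp (by fun_prop) fun t ht => hq t ht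
  have hVabs : ∀ t ∈ Icc 0 q,
      |inner ℝ v (γ (t₀ + s * t) - γ t₀) - t * (s * c) * inner ℝ v w| ≤ |c| / 8 * t := by
    intro t ht
    have h5 := abs_inner_sub_smul_le hv (hall t ht).1
    rwa [← mul_assoc H, hH8] at h5
  have h0 : γ (t₀ + s * 0) = γ t₀ := by simp
  have hfrac : ∀ t ∈ Icc 0 q, 3 / 8 * |c| * t / ρu ≤ 5 / 8 * |c| * t / ρv := by
    intro t ht
    have : 0 ≤ |c| * t := mul_nonneg (abs_nonneg _) ht.1
    exact div_le_div₀ (by linarith) (by linarith) hρv hρ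
  have hUt : ∀ t ∈ Icc 0 q, |(boxTube M x u v ρu ρv).U (γ (t₀ + s * t)) -
      (boxTube M x u v ρu ρv).U (γ (t₀ + s * 0))| ≤ 3 / 8 * |c| * t / ρu := by
    intro t ht
    rw [h0]
    simp only [boxTube, ← sub_div, ← inner_sub_right, sub_sub_sub_cancel_right]
    rw [abs_div, abs_of_pos hρu]
    exact div_le_div_of_nonneg_right (hU t ht) hρu.le
  have hd0 : 0 < 5 / 8 * |c| * q / ρv := by positivity
  have hvs : (boxTube M x u v ρu ρv).V = fun y => inner ℝ v (y - x) / ρv := rfl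
  have hVdiff : ∀ t, (boxTube M x u v ρu ρv).V (γ (t₀ + s * t)) -
      (boxTube M x u v ρu ρv).V (γ (t₀ + s * 0)) = inner ℝ v (γ (t₀ + s * t) - γ t₀) / ρv := by
    intro t
    rw [h0]
    simp only [boxTube, ← sub_div, ← inner_sub_right, sub_sub_sub_cancel_right]
  have hqq : q ∈ Icc 0 q := ⟨hq0.le, le_rfl⟩
  refine ⟨s, q, 5 / 8 * |c| * q / ρv, hd0, hq, ?_⟩
  have hsc : |s * c| = |c| := by rw [abs_mul, hs, one_mul]
  rcases le_total 0 (s * c) with h5 | h5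
  · left
    rw [abs_of_nonneg h5] at hsc
    have hV : ∀ t ∈ Icc 0 q, 5 / 8 * |c| * t / ρv ≤
        (boxTube M x u v ρu ρv).V (γ (t₀ + s * t)) -
        (boxTube M x u v ρu ρv).V (γ (t₀ + s * 0)) := by
      intro t ht
      rw [hVdiff]
      refine div_le_div_of_nonneg_right ?_ hρv.le
      have h6 := (abs_le.1 (hVabs t ht)).1
      have h7 := mul_le_mul_of_nonneg_left hvw (mul_nonneg ht.1 h5)
      rw [hsc] at h6 h7
      linarith
    exact ⟨hq0.le, hcont, fun t ht => (hall t ht).2, fun t ht =>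
      (hUt t ht).trans ((hfrac t ht).trans (hV t ht)), Or.inr (hV q hqq)⟩
  · right
    rw [abs_of_nonpos h5] at hsc
    have hsc' : s * c = -|c| := by linarith
    have hV : ∀ t ∈ Icc 0 q, 5 / 8 * |c| * t / ρv ≤
        (boxTube M x u v ρu ρv).flip.V (γ (t₀ + s * t)) -
        (boxTube M x u v ρu ρv).flip.V (γ (t₀ + s * 0)) := by
      intro t ht
      have h8 : (boxTube M x u v ρu ρv).flip.V (γ (t₀ + s * t)) -
        (boxTube M x u v ρu ρv).flip.V (γ (t₀ + s * 0)) =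
          -inner ℝ v (γ (t₀ + s * t) - γ t₀) / ρv := by
        rw [neg_div, ← hVdiff]
        simp only [Tube.flip]
        ring
      rw [h8]
      refine div_le_div_of_nonneg_right ?_ hρv.le
      have h6 := (abs_le.1 (hVabs t ht)).2
      have h7 := mul_le_mul_of_nonneg_left hvw (mul_nonneg ht.1 (abs_nonneg c))
      rw [hsc'] at h6
      linarith
    exact ⟨hq0.le, hcont, fun t ht => (hall t ht).2, fun t ht =>
      (hUt t ht).trans ((hfrac t ht).trans (hV t ht)), Or.inr (hV q hqq)⟩

end Curves

section Growth

variable {N : ℕ} {M : Set (EuclideanSpace ℝ (Fin N))}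
  {G G' : EuclideanSpace ℝ (Fin N) → EuclideanSpace ℝ (Fin N)} {α C B : ℝ}

/-- A horseshoe over a small enough box makes some curve of a very ample family grow. -/
theorem Horseshoe.exists_growth {f : EuclideanSpace ℝ (Fin N) → EuclideanSpace ℝ (Fin N)}
    {c : ℝ} {l : ℕ} {x u v φ : EuclideanSpace ℝ (Fin N)} {ρu ρv H r ρ K : ℝ} {ι : Type*}
    {J : Finset ι} {τ : ι → ℕ → Tube (EuclideanSpace ℝ (Fin N))}
    (h : Horseshoe f c (boxTube M x u v ρu ρv) l J τ) (hJ : 3 ≤ J.card)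
    (hρv : 0 < ρv) (hρuv : ρv ≤ ρu) (hH : 1 ≤ H) (hu : ‖u‖ ≤ H) (hv : ‖v‖ ≤ H)
    (hφT : φ ∈ Tan M x) (hφ : ‖φ‖ = 1) (huφ : inner ℝ u φ = (0 : ℝ)) (hvφ : inner ℝ v φ = (1 : ℝ))
    (hr : 0 < r) (hρ : 0 < ρ) (hK : 1 ≤ K) (hx : HasChart M r ρ K x) (hKr : K * (2 * ρv) < r)
    (hHK : H * (K ^ 3 * (2 * ρv)) ≤ 1 / 4) {Γ : Set (ℝ → EuclideanSpace ℝ (Fin N))}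
    (hΓ : IsVeryAmpleFamily M Γ) :
    ∃ γ ∈ Γ, ∃ n₀ : ℕ, ∀ k : ℕ, (J.card : ℝ≥0∞) ^ k * ENNReal.ofReal (2 * ρv / H) ≤
      eVariationOn (f^[(n₀ + k) * l] ∘ γ) (Icc 0 1) := by
  obtain ⟨σ, hσ0, hσ1, hσ2⟩ := hx.exists_curve hr hρ hK hφT hφ hKr
  have hε0 : 0 ≤ K ^ 3 * (2 * ρv) := by positivity
  obtain ⟨p, q, hp, hq, hspan, hnorms⟩ := boxTube_coneSpans hρv hρuv hH hu hv hφ huφ hvφ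
    hε0 hHK hσ0 (fun s hs => (hσ1 s hs).1) hσ2
  obtain ⟨t, ht, hmid⟩ := h.exists_isMiddle hJ hspan
  obtain ⟨h1, h2, h3⟩ := hnorms t ht
  have htd : |t| < 2 * ρv := abs_lt.2 ⟨hp.trans_lt ht.1, ht.2.trans_le hq⟩
  obtain ⟨htM, w, hwT, hw⟩ := hσ1 t htd.le
  have hwφ : ‖w - φ‖ ≤ K ^ 3 * (2 * ρv) := by
    have hd : HasDerivAt (fun s => σ s - s • φ) (w - (1:ℝ) • φ) t :=
      hw.sub ((hasDerivAt_id t).smul_const φ)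
    rw [one_smul] at hd
    refine hd.le_of_lip' hε0 ?_
    have hnear : ∀ᶠ s in nhds t, |s| < 2 * ρv := continuous_abs.continuousAt.eventually_lt
      continuousAt_const htd
    filter_upwards [hnear] with s hs
    have := hσ2 s t hs.le htd.le
    rw [Real.norm_eq_abs]
    rwa [show σ s - s • φ - (σ t - t • φ) = σ s - σ t - (s - t) • φ by rw [sub_smul]; abel]
  have hwφ' : ‖w - (1:ℝ) • φ‖ ≤ K ^ 3 * (2 * ρv) := by rwa [one_smul]
  have huw := abs_inner_sub_smul_le hu hwφ'
  have hvw := abs_inner_sub_smul_le hv hwφ'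
  rw [huφ, mul_zero, sub_zero] at huw
  rw [hvφ, mul_one] at hvw
  have hvw' : 3 / 4 ≤ inner ℝ v w := by linarith [(abs_le.1 hvw).1]
  have hw0 : w ≠ 0 := by
    rintro rfl
    rw [inner_zero_right] at hvw'
    linarith
  obtain ⟨hΓ1, hΓ2⟩ := hΓ
  obtain ⟨γ, hγ, t₀, ht₀, hγt, hder, c', hc'⟩ := hΓ2 _ htM w hwT hw0
  have hc0 : c' ≠ 0 := by
    rintro rfl
    rw [zero_smul] at hc'
    exact hder hc'
  obtain ⟨hγM, hγC⟩ := hΓ1 γ hγ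
  have hγd : HasDerivWithinAt γ (c' • w) (Icc 0 1) t₀ := by
    rw [← hc']
    exact ((hγC.differentiableOn one_ne_zero) t₀ ht₀).hasDerivWithinAt
  rw [← hγt] at h1 h2 h3
  obtain ⟨s, q', d, hd, hmaps, harc⟩ := boxTube_halfArc hρv hρuv hH hu hv (huw.trans hHK) hvw' hγM
    hγC.continuousOn ht₀ hγd hc0 h1 h2 h3
  have hP : IsMiddle f l J τ (γ (t₀ + s * 0)) := by
    rw [mul_zero, add_zero, hγt]; exact hmid
  have hdist : ∀ y z, (boxTube M x u v ρu ρv).V y = -1 → (boxTube M x u v ρu ρv).V z = 1 →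
      ENNReal.ofReal (2 * ρv / H) ≤ edist y z := by
    intro y z hy hz
    simp only [boxTube] at hy hz
    rw [div_eq_iff hρv.ne'] at hy hz
    rw [edist_comm, edist_dist, dist_eq_norm]
    refine ENNReal.ofReal_le_ofReal ?_
    rw [div_le_iff₀ (by linarith), mul_comm ‖_‖]
    have h4 := abs_inner_le_of_norm_le hv (le_refl ‖z - y‖)
    have h5 : inner ℝ v (z - y) = 2 * ρv := by
      rw [← sub_sub_sub_cancel_right z y x, inner_sub_right, hy, hz]; ring
    rw [h5] at h4
    exact (le_abs_self _).trans h4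
  have hcomp : ∀ n : ℕ, eVariationOn (fun t => f^[n] (γ (t₀ + s * t))) (Icc 0 q') ≤
      eVariationOn (f^[n] ∘ γ) (Icc 0 1) := by
    intro n
    rcases le_total 0 s with hs | hs
    · exact eVariationOn.comp_le_of_monotoneOn (f^[n] ∘ γ) (fun t => t₀ + s * t)
        (fun a _ b _ hab => by
          have := mul_le_mul_of_nonneg_left hab hs
          simp only; linarith) hmaps
    · exact eVariationOn.comp_le_of_antitoneOn (f^[n] ∘ γ) (fun t => t₀ + s * t)
        (fun a _ b _ hab => by
          have := mul_le_mul_of_nonpos_left hab hs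
          simp only; linarith) hmaps
  refine ⟨γ, hγ, ?_⟩
  rcases harc with harc | harc
  · obtain ⟨n₀, hn₀⟩ := h.halfArc_growth hdist hd harc hP
    exact ⟨n₀, fun k => (hn₀ k).trans (hcomp _)⟩
  · obtain ⟨n₀, hn₀⟩ := h.flip.halfArc_growth (δ := ENNReal.ofReal (2 * ρv / H))
      (fun y z hy hz => by
        rw [edist_comm]
        simp only [Tube.flip] at hy hz
        exact hdist z y (by linarith) (by linarith)) hd harc hP.flip
    exact ⟨n₀, fun k => (hn₀ k).trans (hcomp _)⟩

/-- Exponential growth along an arithmetic progression of times implies exponential growth. -/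
theorem HolderDiffeo.growth_of_subsequence (h : HolderDiffeo M G G' α C B) {γ : ℝ → EuclideanSpace ℝ (Fin N)}
    (hγ : ∀ t ∈ Icc (0:ℝ) 1, γ t ∈ M) {d n₀ : ℕ} (hd : 0 < d) {J δ h₁ : ℝ} (hδ : 0 < δ) (hh : 0 ≤ h₁)
    (hJ : Real.exp (h₁ * d) ≤ J)
    (hg : ∀ k : ℕ, ENNReal.ofReal J ^ k * ENNReal.ofReal δ ≤
      eVariationOn (G^[d * (n₀ + k)] ∘ γ) (Icc 0 1)) :
    ∃ c > 0, ∀ n : ℕ, ENNReal.ofReal (c * Real.exp (h₁ * n)) ≤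
      eVariationOn (G^[n] ∘ γ) (Icc 0 1) := by
  have hB := h.one_le
  have hB0 : 0 < B := by linarith
  refine ⟨δ / B ^ (d * (n₀ + 1)), by positivity, fun n => ?_⟩
  obtain ⟨k, hk⟩ : ∃ k, k = n / d + 1 := ⟨_, rfl⟩
  have hkn : n ≤ d * k := by
    rw [hk]; exact (Nat.lt_mul_div_succ n hd).le
  have hkn' : d * k ≤ n + d := by
    rw [hk, mul_add, mul_one]
    exact Nat.add_le_add_right (Nat.mul_div_le n d) d
  obtain ⟨j, hj⟩ : ∃ j, d * (n₀ + k) = j + n := ⟨d * (n₀ + k) - n, by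
    rw [mul_add]; omega⟩
  have hjle : j ≤ d * (n₀ + 1) := by
    rw [mul_add] at hj ⊢
    omega
  have h1 := hg k
  rw [hj, Function.iterate_add, Function.comp_assoc] at h1
  have hL : LipschitzOnWith (Real.toNNReal (B ^ j)) (G^[j]) M := by
    refine LipschitzOnWith.of_dist_le_mul fun y hy z hz => ?_
    rw [Real.coe_toNNReal _ (by positivity)]
    exact h.dist_iterate_le j hy hz
  have h2 := h1.trans (hL.comp_eVariationOn_le (g := G^[n] ∘ γ) (s := Icc 0 1)
    fun t ht => h.iterate_mem (hγ t ht) n)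
  have h3 : ENNReal.ofReal (Real.exp (h₁ * n) * δ) ≤
      ENNReal.ofReal (B ^ (d * (n₀ + 1))) * eVariationOn (G^[n] ∘ γ) (Icc 0 1) := by
    refine le_trans ?_ (h2.trans (mul_le_mul_left ?_ _))
    · have hJ0 : 0 ≤ J := (Real.exp_pos _).le.trans hJ
      rw [← ENNReal.ofReal_pow hJ0, ← ENNReal.ofReal_mul (by positivity)]
      refine ENNReal.ofReal_le_ofReal (mul_le_mul_of_nonneg_right ?_ hδ.le)
      refine le_trans ?_ (pow_le_pow_left₀ (Real.exp_pos _).le hJ k)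
      rw [← Real.exp_nat_mul]
      refine Real.exp_le_exp.2 ?_
      have : (n:ℝ) ≤ d * k := by exact_mod_cast hkn
      have := mul_le_mul_of_nonneg_left this hh
      linarith
    · exact ENNReal.ofReal_le_ofReal (pow_le_pow_right₀ hB hjle)
  have hb : (0:ℝ) < B ^ (d * (n₀ + 1)) := by positivity
  rw [div_mul_eq_mul_div, ENNReal.ofReal_div_of_pos hb, mul_comm δ]
  exact ENNReal.div_le_of_le_mul' h3

end Growth

section SeparatedStrings

variable {N : ℕ} {M : Set (EuclideanSpace ℝ (Fin N))}
  {G G' : EuclideanSpace ℝ (Fin N) → EuclideanSpace ℝ (Fin N)} {α C B : ℝ}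

/-- Many separated hyperbolic strings which start and end almost at the same place with almost the
same coframes form a horseshoe, and hence make some curve of a very ample family grow. -/
theorem HolderDiffeo.growth_of_separated_strings (h : HolderDiffeo M G G' α C B) {p : ℕ}
    (hp : 0 < p) {C' B' : ℝ} (hF : HolderDiffeo M G^[p] G'^[p] α C' B') {r ρ K : ℝ} (hr : 0 < r)
    (hρ : 0 < ρ) (hK : 1 ≤ K) (hM : ∀ x ∈ M, HasChart M r ρ K x)
    {Γ : Set (ℝ → EuclideanSpace ℝ (Fin N))} (hΓ : IsVeryAmpleFamily M Γ) {χ κ A H δ : ℝ}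
    (hκ : 0 < κ) (hχ : 0 < χ) (hχA : χ ≤ A)
    (hκχ : 2 * κ + 2 * (4 * (2 * κ) * A / χ) ≤ α * χ / 2) (hH : 1 ≤ H) (hδ : 0 < δ) :
    ∃ η > 0, ∀ (h₁ : ℝ) (l : ℕ) (F : Finset (EuclideanSpace ℝ (Fin N)))
      (u v : EuclideanSpace ℝ (Fin N) → ℕ → EuclideanSpace ℝ (Fin N)),
      0 ≤ h₁ → A ≤ (χ - 2 * κ) * l → 3 ≤ F.card → Real.exp (h₁ * (p * l : ℕ)) ≤ F.card →
      (∀ z ∈ F, ∀ w ∈ F, z ≠ w → ∃ i ≤ p * l, δ / 2 < dist (G^[i] z) (G^[i] w)) →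
      (∀ z ∈ F, z ∈ M ∧ ∃ a b D, GoodString M G^[p] χ κ A H l z (u z) (v z) a b D) →
      (∀ z ∈ F, ∀ w ∈ F, ‖z - w‖ ≤ η ∧ ‖u z 0 - u w 0‖ ≤ η ∧ ‖v z 0 - v w 0‖ ≤ η ∧
        ‖z - (G^[p])^[l] w‖ ≤ η ∧ ‖u z 0 - u w l‖ ≤ η ∧ ‖v z 0 - v w l‖ ≤ η) →
      ∃ γ ∈ Γ, ∃ c > 0, ∀ n : ℕ, ENNReal.ofReal (c * Real.exp (h₁ * n)) ≤
        eVariationOn (G^[n] ∘ γ) (Icc 0 1) := by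
  classical
  have hA : 0 < A := hχ.trans_le hχA
  have hB := h.one_le
  have hB0 : 0 < B := by linarith
  obtain ⟨d₀, hd₀, hd1, hd2, hd3⟩ : ∃ d₀ : ℝ, 0 < d₀ ∧ d₀ ≤ r / (4 * K) ∧
      d₀ ≤ 1 / (8 * H * K ^ 3) ∧ d₀ ≤ δ / (4 * B ^ p) :=
    ⟨min (r / (4 * K)) (min (1 / (8 * H * K ^ 3)) (δ / (4 * B ^ p))), by positivity,
      min_le_left _ _, (min_le_right _ _).trans (min_le_left _ _),
      (min_le_right _ _).trans (min_le_right _ _)⟩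
  rw [le_div_iff₀ (by positivity)] at hd1 hd2 hd3
  obtain ⟨K₁, ρ₀, hK₁, hρ₀, hT⟩ := hF.exists_tanApprox hr hρ hK hM
  obtain ⟨r₁, η, c, hr₁, hr₁d, hη, hc, hchain⟩ :=
    hF.exists_chain hK₁ hρ₀ hT hκ hχ hχA hκχ hH hd₀
  refine ⟨η, hη, fun h₁ l F u v hh₁ hl hcard hexp hsep hstr hclose => ?_⟩
  have hl0 : 0 < l := by
    rcases Nat.eq_zero_or_pos l with rfl | hl0
    · simp at hl; linarith
    · exact hl0
  obtain ⟨z₀, hz₀⟩ : F.Nonempty := Finset.card_pos.1 (by omega)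
  obtain ⟨hz₀M, a₀, b₀, D₀, hs₀⟩ := hstr z₀ hz₀
  have hτ : ∀ z ∈ F, ∃ τ : ℕ → Tube (EuclideanSpace ℝ (Fin N)),
      τ 0 = boxTube M z₀ (u z₀ 0) (v z₀ 0) r₁ (r₁ * Real.exp (-A)) ∧
      τ l = boxTube M z₀ (u z₀ 0) (v z₀ 0) r₁ (r₁ * Real.exp (-A)) ∧
      (∀ i < l, Link G^[p] c (τ i) (τ (i + 1))) ∧
      ∀ i ≤ l, ∀ y ∈ (τ i).D, ‖y - (G^[p])^[i] z‖ ≤ d₀ := by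
    intro z hz
    obtain ⟨hzM, a, b, D, hs⟩ := hstr z hz
    obtain ⟨h1, h2, h3, h4, h5, h6⟩ := hclose z₀ hz₀ z hz
    exact hchain z₀ hz₀M _ _ l z _ _ a b D hl hzM hs h1 h2 h3 h4 h5 h6
  have hτ' : ∀ z, ∃ τ : ℕ → Tube (EuclideanSpace ℝ (Fin N)), z ∈ F →
      τ 0 = boxTube M z₀ (u z₀ 0) (v z₀ 0) r₁ (r₁ * Real.exp (-A)) ∧
      τ l = boxTube M z₀ (u z₀ 0) (v z₀ 0) r₁ (r₁ * Real.exp (-A)) ∧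
      (∀ i < l, Link G^[p] c (τ i) (τ (i + 1))) ∧
      ∀ i ≤ l, ∀ y ∈ (τ i).D, ‖y - (G^[p])^[i] z‖ ≤ d₀ := by
    intro z
    by_cases hz : z ∈ F
    · obtain ⟨τ, h1⟩ := hτ z hz
      exact ⟨τ, fun _ => h1⟩
    · exact ⟨fun _ => boxTube M z₀ (u z₀ 0) (v z₀ 0) r₁ (r₁ * Real.exp (-A)), fun h => absurd h hz⟩
  choose τ hτ using hτ'
  have hhs : Horseshoe G^[p] c (boxTube M z₀ (u z₀ 0) (v z₀ 0) r₁ (r₁ * Real.exp (-A))) l F τ :=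
    { cont := hF.diff.continuous
      one_lt := hc
      pos := hl0
      start := fun z hz => (hτ z hz).1
      finish := fun z hz => (hτ z hz).2.1
      link := fun z hz => (hτ z hz).2.2.1
      excl := by
        intro z hz w hw y hy hy'
        by_contra hne
        obtain ⟨n, hn, hlt⟩ := hsep z hz w hw hne
        have hkl : n / p ≤ l := Nat.div_le_of_le_mul hn
        have h1 := (hτ z hz).2.2.2 _ hkl _ (hy _ hkl)
        have h2 := (hτ w hw).2.2.2 _ hkl _ (hy' _ hkl)
        have h3 : dist ((G^[p])^[n / p] z) ((G^[p])^[n / p] w) ≤ 2 * d₀ := by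
          refine (dist_triangle_left _ _ ((G^[p])^[n / p] y)).trans ?_
          rw [dist_eq_norm, dist_eq_norm]
          linarith
        have h4 : ∀ x, G^[n] x = G^[n % p] ((G^[p])^[n / p] x) := by
          intro x
          rw [← Function.iterate_mul, ← Function.iterate_add_apply, Nat.mod_add_div]
        have h5 := h.dist_iterate_le (n % p) (hF.iterate_mem (hstr z hz).1 (n / p))
          (hF.iterate_mem (hstr w hw).1 (n / p))
        rw [← h4, ← h4] at h5
        have h6 : B ^ (n % p) ≤ B ^ p := pow_le_pow_right₀ hB (Nat.mod_lt _ hp).le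
        have h7 := mul_le_mul h6 h3 dist_nonneg (by positivity)
        linarith }
  obtain ⟨φ, hφT, hφ, huφ, hvφ⟩ := hs₀.dir
  have hexpA : Real.exp (-A) ≤ 1 := Real.exp_le_one_iff.2 (by linarith)
  have hρr : r₁ * Real.exp (-A) ≤ r₁ := mul_le_of_le_one_right hr₁.le hexpA
  have hρv : 0 < r₁ * Real.exp (-A) := mul_pos hr₁ (Real.exp_pos _)
  have hKd : K * (2 * (r₁ * Real.exp (-A))) ≤ K * (2 * d₀) :=
    mul_le_mul_of_nonneg_left (by linarith) (by linarith)
  have hHK : H * (K ^ 3 * (2 * (r₁ * Real.exp (-A)))) ≤ H * (K ^ 3 * (2 * d₀)) :=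
    mul_le_mul_of_nonneg_left (mul_le_mul_of_nonneg_left (by linarith) (by positivity))
      (by linarith)
  obtain ⟨γ, hγ, n₀, hgrow⟩ := hhs.exists_growth hcard hρv hρr hH hs₀.norm_u_zero hs₀.norm_v_zero
    hφT hφ huφ hvφ hr hρ hK (hM z₀ hz₀M) (by linarith) (by linarith) hΓ
  obtain ⟨c', hc', hfin⟩ := h.growth_of_subsequence (d := p * l) (n₀ := n₀) (J := F.card)
    (hΓ.1 γ hγ).1 (Nat.mul_pos hp hl0)
    (show 0 < 2 * (r₁ * Real.exp (-A)) / H by positivity) hh₁ hexp fun k => by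
      have h1 := hgrow k
      rwa [← Function.iterate_mul, show p * ((n₀ + k) * l) = p * l * (n₀ + k) by ring,
        ← ENNReal.ofReal_natCast] at h1
  exact ⟨γ, hγ, c', hc', hfin⟩

end SeparatedStrings

theorem IsCompact.exists_finite_classes {X : Type*} [PseudoMetricSpace X] {S : Set X}
    (hS : IsCompact S) {η : ℝ} (hη : 0 < η) :
    ∃ (k : ℕ) (cl : X → Fin k), ∀ x ∈ S, ∀ y ∈ S, cl x = cl y → dist x y ≤ η := by
  classical
  obtain ⟨t, -, htf, ht⟩ := hS.finite_cover_balls (half_pos hη)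
  have hex : ∀ x, ∃ o : Option htf.toFinset, x ∈ S → ∃ c, o = some c ∧ dist x c ≤ η / 2 := by
    intro x
    by_cases hx : x ∈ S
    · obtain ⟨c, hc, hxc⟩ := mem_iUnion₂.1 (ht hx)
      exact ⟨some ⟨c, htf.mem_toFinset.2 hc⟩, fun _ => ⟨_, rfl, (Metric.mem_ball.1 hxc).le⟩⟩
    · exact ⟨none, fun h => absurd h hx⟩
  choose o ho using hex
  refine ⟨_, fun x => Fintype.equivFin _ (o x), fun x hx y hy hxy => ?_⟩
  obtain ⟨c, hc, hxc⟩ := ho x hx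
  obtain ⟨c', hc', hyc⟩ := ho y hy
  have h1 := (Fintype.equivFin (Option htf.toFinset)).injective hxy
  rw [hc, hc', Option.some_inj] at h1
  subst h1
  have := dist_triangle_right x y (c : X)
  linarith

section Strings

variable {N : ℕ} {M : Set (EuclideanSpace ℝ (Fin N))}
  {G G' : EuclideanSpace ℝ (Fin N) → EuclideanSpace ℝ (Fin N)} {α C B : ℝ}

/-- If no curve of a very ample family grows, then the hyperbolic strings which start and end
almost at the same place have small covers. -/
theorem HolderDiffeo.exists_cov_strings (h : HolderDiffeo M G G' α C B) (hMc : IsCompact M) {p : ℕ}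
    (hp : 0 < p) {C' B' : ℝ} (hF : HolderDiffeo M G^[p] G'^[p] α C' B') {r ρ K : ℝ} (hr : 0 < r)
    (hρ : 0 < ρ) (hK : 1 ≤ K) (hM : ∀ x ∈ M, HasChart M r ρ K x)
    {Γ : Set (ℝ → EuclideanSpace ℝ (Fin N))} (hΓ : IsVeryAmpleFamily M Γ) {χ κ A H δ h₁ : ℝ}
    (hκ : 0 < κ) (hχ : 0 < χ) (hχA : χ ≤ A)
    (hκχ : 2 * κ + 2 * (4 * (2 * κ) * A / χ) ≤ α * χ / 2) (hH : 1 ≤ H) (hδ : 0 < δ)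
    (hh₁ : 0 ≤ h₁)
    (hno : ¬ ∃ γ ∈ Γ, ∃ c > 0, ∀ n : ℕ, ENNReal.ofReal (c * Real.exp (h₁ * n)) ≤
        eVariationOn (G^[n] ∘ γ) (Icc 0 1)) :
    ∃ η > 0, ∃ C₁ ≥ 1, ∀ (l : ℕ) (Z : Set (EuclideanSpace ℝ (Fin N)))
      (u v : EuclideanSpace ℝ (Fin N) → ℕ → EuclideanSpace ℝ (Fin N)),
      (∀ z ∈ Z, z ∈ M ∧ ∃ a b D, GoodString M G^[p] χ κ A H l z (u z) (v z) a b D) →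
      (∀ z ∈ Z, ∀ w ∈ Z, ‖z - w‖ ≤ η ∧ ‖u z 0 - u w 0‖ ≤ η ∧ ‖v z 0 - v w 0‖ ≤ η ∧
        ‖z - (G^[p])^[l] w‖ ≤ η ∧ ‖u z 0 - u w l‖ ≤ η ∧ ‖v z 0 - v w l‖ ≤ η) →
      Cov G δ (p * l) Z (C₁ * Real.exp (h₁ * (p * l : ℕ))) := by
  have hA : 0 < A := hχ.trans_le hχA
  obtain ⟨η, hη, hgrow⟩ := h.growth_of_separated_strings hp hF hr hρ hK hM hΓ hκ hχ hχA hκχ hH hδ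
  obtain ⟨Y, hY1, hY⟩ := exists_cov_zero hMc G hδ
  have hχκ : 0 < χ - 2 * κ := by
    have h1 : 0 ≤ 2 * (4 * (2 * κ) * A / χ) := by positivity
    have h2 : α * χ ≤ 1 * χ := mul_le_mul_of_nonneg_right h.le_one hχ.le
    linarith
  obtain ⟨l₀, hl₀⟩ := exists_nat_ge (A / (χ - 2 * κ))
  rw [div_le_iff₀ hχκ] at hl₀
  refine ⟨η, hη, max 3 (Y ^ (p * l₀ + 1)), by
    exact (by norm_num : (1:ℝ) ≤ 3).trans (le_max_left _ _), fun l Z u v hZ hclose => ?_⟩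
  have hexp1 : 1 ≤ Real.exp (h₁ * (p * l : ℕ)) := Real.one_le_exp (by positivity)
  rcases lt_or_ge l l₀ with hl | hl
  · refine (cov_pow hY h.maps (p * l)).mono (fun z hz => (hZ z hz).1) ?_
    refine le_trans ?_ (le_mul_of_one_le_right (by positivity) hexp1)
    exact (pow_le_pow_right₀ hY1 (Nat.succ_le_succ (Nat.mul_le_mul_left p hl.le))).trans
      (le_max_right _ _)
  · by_contra hcov
    obtain ⟨F, hFZ, hcard, hsep⟩ := exists_separated_of_not_cov hδ.le hcov
    have h3 : 3 * Real.exp (h₁ * (p * l : ℕ)) < F.card :=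
      (mul_le_mul_of_nonneg_right (le_max_left _ _) (Real.exp_pos _).le).trans_lt hcard
    have h4 : (3:ℝ) ≤ F.card := by linarith
    have h5 : A ≤ (χ - 2 * κ) * l := by
      have : (l₀ : ℝ) ≤ l := by exact_mod_cast hl
      have := mul_le_mul_of_nonneg_right this hχκ.le
      linarith
    exact hno (hgrow h₁ l F u v hh₁ h5 (by exact_mod_cast h4) (by linarith) hsep
      (fun z hz => hZ z (hFZ hz)) fun z hz w hw => hclose z (hFZ hz) w (hFZ hw))

end Strings

section Exponents

variable {N : ℕ} {M : Set (EuclideanSpace ℝ (Fin N))}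
  {G G' : EuclideanSpace ℝ (Fin N) → EuclideanSpace ℝ (Fin N)} {α C B : ℝ}
  {x : EuclideanSpace ℝ (Fin N)}

/-- Total finite-time expansion of a map and of its inverse along an orbit segment. -/
def expo (M : Set (EuclideanSpace ℝ (Fin N)))
    (G G' : EuclideanSpace ℝ (Fin N) → EuclideanSpace ℝ (Fin N)) (n : ℕ)
    (x : EuclideanSpace ℝ (Fin N)) : ℝ :=
  logNorm M (G^[n]) x + logNorm M (G'^[n]) (G^[n] x)

/-- Sum of the forward expansions over `T` consecutive segments of length `m`. -/
def fwdSum (M : Set (EuclideanSpace ℝ (Fin N)))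
    (G : EuclideanSpace ℝ (Fin N) → EuclideanSpace ℝ (Fin N)) (m T : ℕ)
    (x : EuclideanSpace ℝ (Fin N)) : ℝ :=
  ∑ i ∈ Finset.range T, logNorm M (G^[m]) (G^[m * i] x)

/-- Sum of the backward expansions over `T` consecutive segments of length `m`. -/
def bwdSum (M : Set (EuclideanSpace ℝ (Fin N)))
    (G G' : EuclideanSpace ℝ (Fin N) → EuclideanSpace ℝ (Fin N)) (m T : ℕ)
    (x : EuclideanSpace ℝ (Fin N)) : ℝ :=
  ∑ i ∈ Finset.range T, logNorm M (G'^[m]) (G^[m] (G^[m * i] x))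

theorem fwdSum_nonneg (m T : ℕ) : 0 ≤ fwdSum M G m T x :=
  Finset.sum_nonneg fun _ _ => logNorm_nonneg

theorem bwdSum_nonneg (m T : ℕ) : 0 ≤ bwdSum M G G' m T x :=
  Finset.sum_nonneg fun _ _ => logNorm_nonneg

theorem expo_nonneg (n : ℕ) : 0 ≤ expo M G G' n x := add_nonneg logNorm_nonneg logNorm_nonneg

theorem sum_fwdSum_add_bwdSum (m T L : ℕ) :
    ∑ i ∈ Finset.range L, (fwdSum M G m T (G^[m * T * i] x) + bwdSum M G G' m T (G^[m * T * i] x)) =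
      ∑ i ∈ Finset.range (T * L), expo M G G' m (G^[m * i] x) := by
  induction L with
  | zero => simp
  | succ L ih =>
    rw [Finset.sum_range_succ, ih, mul_add, mul_one, Finset.sum_range_add, fwdSum, bwdSum,
      ← Finset.sum_add_distrib]
    refine congrArg _ (Finset.sum_congr rfl fun i _ => ?_)
    rw [expo, ← Function.iterate_add_apply, show m * (T * L + i) = m * i + m * T * L by ring]

namespace HolderDiffeo

theorem logNorm_iterate_le_mul (h : HolderDiffeo M G G' α C B) (hx : x ∈ M) (m : ℕ) :
    logNorm M (G^[m]) x ≤ Real.log B * m := by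
  obtain ⟨C', hm⟩ := h.iterate m
  have hB : 0 < B := by linarith [h.one_le]
  refine logNorm_le_of_forall (mul_nonneg (Real.log_nonneg h.one_le) (Nat.cast_nonneg _))
    fun w _ => ?_
  rw [mul_comm (Real.log B), Real.exp_nat_mul, Real.exp_log hB]
  exact ((fderiv ℝ (G^[m]) x).le_opNorm w).trans
    (mul_le_mul_of_nonneg_right (hm.bound x hx) (norm_nonneg _))

theorem fwdSum_le (h : HolderDiffeo M G G' α C B) (hx : x ∈ M) (m T : ℕ) :
    fwdSum M G m T x ≤ Real.log B * (m * T : ℕ) := by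
  refine (Finset.sum_le_card_nsmul _ _ _ fun i _ =>
    h.logNorm_iterate_le_mul (h.iterate_mem hx (m * i)) m).trans (le_of_eq ?_)
  rw [Finset.card_range, nsmul_eq_mul]
  push_cast
  ring

theorem bwdSum_le (h : HolderDiffeo M G G' α C B) (hx : x ∈ M) (m T : ℕ) :
    bwdSum M G G' m T x ≤ Real.log B * (m * T : ℕ) := by
  refine (Finset.sum_le_card_nsmul _ _ _ fun i _ =>
    h.symm.logNorm_iterate_le_mul (h.iterate_mem (h.iterate_mem hx (m * i)) m) m).trans
    (le_of_eq ?_)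
  rw [Finset.card_range, nsmul_eq_mul]
  push_cast
  ring

theorem expo_le (h : HolderDiffeo M G G' α C B) (hx : x ∈ M) (n : ℕ) :
    expo M G G' n x ≤ 2 * Real.log B * n := by
  have h1 := h.logNorm_iterate_le_mul hx n
  have h2 := h.symm.logNorm_iterate_le_mul (h.iterate_mem hx n) n
  rw [expo]
  linarith

theorem logNorm_le_fwdSum (h : HolderDiffeo M G G' α C B) (m T : ℕ) :
    logNorm M (G^[m * T]) x ≤ fwdSum M G m T x := by
  obtain ⟨C', hm⟩ := h.iterate m
  have h1 := hm.logNorm_iterate_le (x := x) T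
  rw [← Function.iterate_mul] at h1
  refine h1.trans (le_of_eq (Finset.sum_congr rfl fun i _ => ?_))
  rw [← Function.iterate_mul]

theorem logNorm_inverse_le_bwdSum (h : HolderDiffeo M G G' α C B) (hx : x ∈ M) (m T : ℕ) :
    logNorm M (G'^[m * T]) (G^[m * T] x) ≤ bwdSum M G G' m T x := by
  obtain ⟨C', hm⟩ := h.iterate m
  have h1 := hm.logNorm_inverse_iterate_le hx T
  rw [← Function.iterate_mul, ← Function.iterate_mul] at h1
  refine h1.trans (le_of_eq (Finset.sum_congr rfl fun i _ => ?_))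
  rw [Function.iterate_succ_apply', ← Function.iterate_mul]

theorem expo_mul_le (h : HolderDiffeo M G G' α C B) (hx : x ∈ M) (q n : ℕ) :
    expo M G G' (n * q) x ≤ ∑ i ∈ Finset.range q, expo M G G' n (G^[n * i] x) := by
  simp only [expo]
  rw [Finset.sum_add_distrib]
  exact add_le_add (h.logNorm_le_fwdSum n q) (h.logNorm_inverse_le_bwdSum hx n q)

/-- Hyperbolic strings along an orbit segment with almost additive exponents. -/
theorem exists_goodStrings_of_sum_expo_le (h : HolderDiffeo M G G' α C B)
    (hT : ∀ y ∈ M, Module.finrank ℝ (Tan M y) = 2) (hx : x ∈ M) {m T L : ℕ} {A K χ Θ : ℝ}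
    (hK : 1 ≤ K) (hA : Real.log B * (m * T : ℕ) ≤ A) (hχ : Real.log 2 ≤ χ) (hΘ0 : 0 ≤ Θ)
    (hΘ : ∑ i ∈ Finset.range (T * L), expo M G G' m (G^[m * i] x) -
      expo M G G' (m * (T * L)) x ≤ Θ) :
    ∃ (I : Finset ℕ) (u v : ℕ → EuclideanSpace ℝ (Fin N)), I ⊆ Finset.range L ∧
      (∀ s ∈ I, ∀ e ∈ I, s ≤ e → ∃ a b D, GoodString M (G^[m * T]) χ (A / K) A (2 * Real.exp A)
        (e - s) (G^[m * T * s] x) (fun i => u (s + i)) (fun i => v (s + i)) a b D) ∧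
      ∑ i ∈ Finset.range L \ I, min (fwdSum M G m T (G^[m * T * i] x))
        (bwdSum M G G' m T (G^[m * T * i] x)) ≤ 2 * χ * L + 2 * K * Θ := by
  obtain ⟨C', hF⟩ := h.iterate (m * T)
  have hA0 : 0 ≤ A :=
    (mul_nonneg (Real.log_nonneg h.one_le) (Nat.cast_nonneg (m * T))).trans hA
  have hi : ∀ i, (G^[m * T])^[i] = G^[m * T * i] := fun i => (Function.iterate_mul _ _ _).symm
  have hi' : ∀ i, (G'^[m * T])^[i] = G'^[m * T * i] := fun i => (Function.iterate_mul _ _ _).symm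
  have := hF.exists_goodStrings hT hx (L := L) (P := fun i => fwdSum M G m T (G^[m * T * i] x))
    (Q := fun i => bwdSum M G G' m T (G^[m * T * i] x)) hK hA0 hχ hΘ0
    (fun i => fwdSum_nonneg m T) (fun i => bwdSum_nonneg m T)
    (fun i => (h.fwdSum_le (h.iterate_mem hx _) m T).trans hA)
    (fun i => (h.bwdSum_le (h.iterate_mem hx _) m T).trans hA)
    (fun i _ => by rw [hi]; exact h.logNorm_le_fwdSum m T)
    (fun i _ => by
      rw [Function.iterate_succ_apply', hi]
      exact h.logNorm_inverse_le_bwdSum (h.iterate_mem hx _) m T)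
    (by
      rw [sum_fwdSum_add_bwdSum, hi, hi', mul_assoc m T L]
      have : expo M G G' (m * (T * L)) x = logNorm M (G^[m * (T * L)]) x +
        logNorm M (G'^[m * (T * L)]) (G^[m * (T * L)] x) := rfl
      linarith)
  simpa only [hi] using this

end HolderDiffeo

end Exponents

section Counting

variable {N : ℕ} {M : Set (EuclideanSpace ℝ (Fin N))}
  {G G' : EuclideanSpace ℝ (Fin N) → EuclideanSpace ℝ (Fin N)} {α C B : ℝ}

/-- Points whose exponents are almost additive have small covers if no curve grows. -/
theorem HolderDiffeo.exists_cov_of_expo_almost_additive (h : HolderDiffeo M G G' α C B)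
    (hMc : IsCompact M) {m T : ℕ} (hp : 0 < m * T) {r ρ Kc : ℝ} (hr : 0 < r)
    (hρ : 0 < ρ) (hKc : 1 ≤ Kc) (hM : ∀ x ∈ M, HasChart M r ρ Kc x)
    {Γ : Set (ℝ → EuclideanSpace ℝ (Fin N))} (hΓ : IsVeryAmpleFamily M Γ) {χ κ A δ h₁ θ W : ℝ}
    (hκ : 0 < κ) (hκA : κ ≤ A) (hχ : Real.log 2 ≤ χ) (hχA : χ ≤ A)
    (hκχ : 2 * κ + 2 * (4 * (2 * κ) * A / χ) ≤ α * χ / 2)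
    (hA : Real.log B * (m * T : ℕ) ≤ A) (hδ : 0 < δ) (hh₁ : 0 ≤ h₁) (hθ : 0 ≤ θ)
    (hno : ¬ ∃ γ ∈ Γ, ∃ c > 0, ∀ n : ℕ, ENNReal.ofReal (c * Real.exp (h₁ * n)) ≤
        eVariationOn (G^[n] ∘ γ) (Icc 0 1))
    (hW : 1 ≤ W)
    (hWf : ∀ s, Cov G δ (m * T) {y ∈ M | fwdSum M G m T y ≤ s} (W * Real.exp (N * s)))
    (hWb : ∀ s, Cov G δ (m * T) {y ∈ M | bwdSum M G G' m T y ≤ s} (W * Real.exp (N * s))) :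
    ∃ Y C₁ : ℝ, ∃ k : ℕ, 1 ≤ Y ∧ 1 ≤ C₁ ∧ ∀ L : ℕ, Cov G δ (m * T * L)
      {x ∈ M | ∑ i ∈ Finset.range (T * L), expo M G G' m (G^[m * i] x) -
        expo M G G' (m * (T * L)) x ≤ θ * (m * T * L : ℕ)}
      ((4 * (⌊A⌋₊ + 1 : ℕ)) ^ L * (Y * ((k * L + 1 : ℕ) * (Y ^ 2 * C₁)) ^ k *
        Real.exp (h₁ * (m * T : ℕ) * L) * ((W * Real.exp N) ^ L *
          Real.exp (N * (2 * χ * L + 2 * (A / κ) * (θ * (m * T * L : ℕ))))))) := by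
  classical
  have hχ0 : 0 < χ := (Real.log_pos (by norm_num)).trans_le hχ
  have hA0 : 0 < A := hχ0.trans_le hχA
  have hH : 1 ≤ 2 * Real.exp A := by
    have := Real.one_le_exp hA0.le
    linarith
  have hT : ∀ y ∈ M, Module.finrank ℝ (Tan M y) = 2 := fun y hy => (hM y hy).finrank_tan hr hρ
  have hAK : A / (A / κ) = κ := div_div_cancel₀ hA0.ne'
  have hK1 : 1 ≤ A / κ := (one_le_div hκ).2 hκA
  obtain ⟨C', hF⟩ := h.iterate (m * T)
  obtain ⟨η, hη, C₁, hC₁, hstr⟩ :=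
    h.exists_cov_strings hMc hp hF hr hρ hKc hM hΓ hκ hχ0 hχA hκχ hH hδ hh₁ hno
  obtain ⟨Y₀, hY₀, hY₀c⟩ := exists_cov_zero hMc G hδ
  have hYc := cov_pow hY₀c h.maps (m * T)
  have hcpt : IsCompact (M ×ˢ (Metric.closedBall (0 : EuclideanSpace ℝ (Fin N)) (2 * Real.exp A) ×ˢ
      Metric.closedBall (0 : EuclideanSpace ℝ (Fin N)) (2 * Real.exp A))) :=
    hMc.prod ((isCompact_closedBall _ _).prod (isCompact_closedBall _ _))
  obtain ⟨k, cl, hcl⟩ := hcpt.exists_finite_classes hη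
  refine ⟨Y₀ ^ (m * T + 1), C₁, k, one_le_pow₀ hY₀, hC₁, fun L => ?_⟩
  set Θ : ℝ := θ * (m * T * L : ℕ) with hΘ
  have hΘ0 : 0 ≤ Θ := by positivity
  set S := {x ∈ M | ∑ i ∈ Finset.range (T * L), expo M G G' m (G^[m * i] x) -
        expo M G G' (m * (T * L)) x ≤ Θ} with hS
  set P : EuclideanSpace ℝ (Fin N) → ℕ → ℝ := fun x i => fwdSum M G m T (G^[m * T * i] x) with hPdef
  set Q : EuclideanSpace ℝ (Fin N) → ℕ → ℝ := fun x i => bwdSum M G G' m T (G^[m * T * i] x)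
    with hQdef
  have hex : ∀ x, ∃ (I : Finset ℕ) (u v : ℕ → EuclideanSpace ℝ (Fin N)), x ∈ S →
      I ⊆ Finset.range L ∧
      (∀ s ∈ I, ∀ e ∈ I, s ≤ e → ∃ a b D, GoodString M (G^[m * T]) χ κ A (2 * Real.exp A)
        (e - s) (G^[m * T * s] x) (fun i => u (s + i)) (fun i => v (s + i)) a b D) ∧
      ∑ i ∈ Finset.range L \ I, min (P x i) (Q x i) ≤ 2 * χ * L + 2 * (A / κ) * Θ := by
    intro x
    by_cases hx : x ∈ S
    · obtain ⟨I, u, v, h1⟩ := h.exists_goodStrings_of_sum_expo_le hT hx.1 hK1 hA hχ hΘ0 hx.2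
      rw [hAK] at h1
      exact ⟨I, u, v, fun _ => h1⟩
    · exact ⟨∅, fun _ => 0, fun _ => 0, fun h => absurd h hx⟩
  choose I u v hIuv using hex
  have hlab : ∀ x ∈ M, ∀ i, ⌊min (P x i) (Q x i)⌋₊ < ⌊A⌋₊ + 1 := by
    intro x hx i
    refine Nat.lt_succ_of_le (Nat.floor_mono ((min_le_left _ _).trans ?_))
    exact (h.fwdSum_le (h.iterate_mem hx _) m T).trans hA
  set plan : EuclideanSpace ℝ (Fin N) → Fin L → Bool × Bool × Fin (⌊A⌋₊ + 1) := fun x i =>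
    (decide ((i : ℕ) ∈ I x), decide (P x i ≤ Q x i),
      Fin.ofNat (⌊A⌋₊ + 1) ⌊min (P x i) (Q x i)⌋₊) with hplan
  have hcard : ((Finset.univ : Finset (Fin L → Bool × Bool × Fin (⌊A⌋₊ + 1))).card : ℝ) =
      (4 * (⌊A⌋₊ + 1 : ℕ)) ^ L := by
    rw [Finset.card_univ, Fintype.card_fun, Fintype.card_prod, Fintype.card_prod,
      Fintype.card_bool, Fintype.card_fin, Fintype.card_fin]
    push_cast
    congr 1
    ring
  rw [← hcard]
  refine cov_of_forall_piece Finset.univ (fun π => {x | plan x = π})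
    (fun x _ => ⟨plan x, Finset.mem_univ _, rfl⟩) fun π _ => ?_
  rcases (S ∩ {x | plan x = π}).eq_empty_or_nonempty with hemp | ⟨x₀, hx₀S, hx₀⟩
  · rw [hemp]
    exact cov_empty (by positivity)
  obtain ⟨hI₀, -, hsum₀⟩ := hIuv x₀ hx₀S
  have hsame : ∀ x ∈ S ∩ {x | plan x = π}, I x = I x₀ ∧ ∀ i < L,
      ((P x i ≤ Q x i) ↔ (P x₀ i ≤ Q x₀ i)) ∧
        ⌊min (P x i) (Q x i)⌋₊ = ⌊min (P x₀ i) (Q x₀ i)⌋₊ := by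
    intro x hx
    have hpl : ∀ i : Fin L, plan x i = plan x₀ i := fun i => by
      rw [show plan x = π from hx.2, show plan x₀ = π from hx₀]
    have hpl' : ∀ i < L, ((i ∈ I x) ↔ (i ∈ I x₀)) ∧ ((P x i ≤ Q x i) ↔ (P x₀ i ≤ Q x₀ i)) ∧
        ⌊min (P x i) (Q x i)⌋₊ = ⌊min (P x₀ i) (Q x₀ i)⌋₊ := by
      intro i hi
      have h1 := hpl ⟨i, hi⟩
      simp only [hplan, Prod.mk.injEq, decide_eq_decide] at h1
      refine ⟨h1.1, h1.2.1, ?_⟩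
      have h2 := congrArg Fin.val h1.2.2
      simp only [Fin.val_ofNat] at h2
      rwa [Nat.mod_eq_of_lt (hlab x hx.1.1 i), Nat.mod_eq_of_lt (hlab x₀ hx₀S.1 i)] at h2
    refine ⟨Finset.ext fun i => ⟨fun hi => ?_, fun hi => ?_⟩, fun i hi => (hpl' i hi).2⟩
    · exact (hpl' i (Finset.mem_range.1 ((hIuv x hx.1).1 hi))).1.1 hi
    · exact (hpl' i (Finset.mem_range.1 (hI₀ hi))).1.2 hi
  set e : ℕ → ℝ := fun i => W * Real.exp (N * ((⌊min (P x₀ i) (Q x₀ i)⌋₊ : ℝ) + 1)) with he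
  have he1 : ∀ i, 1 ≤ e i := fun i =>
    one_le_mul_of_one_le_of_one_le hW (Real.one_le_exp (by positivity))
  have hstep : ∀ i < L, i ∉ I x₀ → StepCov G δ (m * T) i (i + 1) (S ∩ {x | plan x = π}) (e i) := by
    intro i hi _
    rw [StepCov, Nat.add_sub_cancel_left, mul_one]
    rcases le_or_gt (P x₀ i) (Q x₀ i) with hle | hlt
    · refine (hWf _).mono ?_ le_rfl
      rintro _ ⟨x, hx, rfl⟩
      obtain ⟨-, hx2⟩ := hsame x hx
      refine ⟨h.iterate_mem hx.1.1 _, ?_⟩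
      have h1 := (Nat.lt_floor_add_one (min (P x i) (Q x i))).le
      rw [(hx2 i hi).2, min_eq_left ((hx2 i hi).1.2 hle)] at h1
      exact h1
    · refine (hWb _).mono ?_ le_rfl
      rintro _ ⟨x, hx, rfl⟩
      obtain ⟨-, hx2⟩ := hsame x hx
      refine ⟨h.iterate_mem hx.1.1 _, ?_⟩
      have h0 : Q x i ≤ P x i := by
        by_contra hcon
        exact absurd ((hx2 i hi).1.1 (le_of_lt (not_le.1 hcon))) (not_le.2 hlt)
      have h1 := (Nat.lt_floor_add_one (min (P x i) (Q x i))).le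
      rw [(hx2 i hi).2, min_eq_right h0] at h1
      exact h1
  have hloop : ∀ a b q, a ∈ I x₀ → b ∈ I x₀ → a ≤ b → b < L →
      StepCov G δ (m * T) a b {x ∈ S ∩ {x | plan x = π} |
        cl (G^[m * T * a] x, u x a, v x a) = q ∧ cl (G^[m * T * b] x, u x b, v x b) = q}
        (C₁ * Real.exp (h₁ * (m * T : ℕ) * (b - a : ℕ))) := by
    intro a b q ha hb hab hbL
    have hmem : ∀ x ∈ S ∩ {x | plan x = π}, ∀ i ∈ I x₀, (G^[m * T * i] x, u x i, v x i) ∈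
        M ×ˢ (Metric.closedBall (0 : EuclideanSpace ℝ (Fin N)) (2 * Real.exp A) ×ˢ
          Metric.closedBall (0 : EuclideanSpace ℝ (Fin N)) (2 * Real.exp A)) := by
      intro x hx i hi
      rw [← (hsame x hx).1] at hi
      obtain ⟨a, b, D, hg⟩ := (hIuv x hx.1).2.1 i hi i hi le_rfl
      exact ⟨h.iterate_mem hx.1.1 _, mem_closedBall_zero_iff.2 hg.norm_u_zero,
        mem_closedBall_zero_iff.2 hg.norm_v_zero⟩
    have hclose : ∀ x ∈ S ∩ {x | plan x = π}, ∀ y ∈ S ∩ {x | plan x = π}, ∀ i ∈ I x₀, ∀ j ∈ I x₀,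
        cl (G^[m * T * i] x, u x i, v x i) = cl (G^[m * T * j] y, u y j, v y j) →
        ‖G^[m * T * i] x - G^[m * T * j] y‖ ≤ η ∧ ‖u x i - u y j‖ ≤ η ∧ ‖v x i - v y j‖ ≤ η := by
      intro x hx y hy i hi j hj hxy
      have h1 := hcl _ (hmem x hx i hi) _ (hmem y hy j hj) hxy
      rw [Prod.dist_eq, Prod.dist_eq, max_le_iff, max_le_iff] at h1
      simpa only [dist_eq_norm] using h1
    have hpre : ∀ z, ∃ x, z ∈ G^[m * T * a] '' {x ∈ S ∩ {x | plan x = π} |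
        cl (G^[m * T * a] x, u x a, v x a) = q ∧ cl (G^[m * T * b] x, u x b, v x b) = q} →
        x ∈ S ∩ {x | plan x = π} ∧ cl (G^[m * T * a] x, u x a, v x a) = q ∧
          cl (G^[m * T * b] x, u x b, v x b) = q ∧ G^[m * T * a] x = z := by
      intro z
      by_cases hz : z ∈ G^[m * T * a] '' {x ∈ S ∩ {x | plan x = π} |
        cl (G^[m * T * a] x, u x a, v x a) = q ∧ cl (G^[m * T * b] x, u x b, v x b) = q}
      · obtain ⟨x, ⟨h1, h2, h3⟩, h4⟩ := hz
        exact ⟨x, fun _ => ⟨h1, h2, h3, h4⟩⟩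
      · exact ⟨z, fun h => absurd h hz⟩
    choose g hg using hpre
    have hmain := hstr (b - a) (G^[m * T * a] '' {x ∈ S ∩ {x | plan x = π} |
        cl (G^[m * T * a] x, u x a, v x a) = q ∧ cl (G^[m * T * b] x, u x b, v x b) = q})
      (fun z i => u (g z) (a + i)) (fun z i => v (g z) (a + i)) ?_ ?_
    · rw [StepCov]
      convert hmain using 2
      push_cast
      ring_nf
    · intro z hz
      obtain ⟨h1, -, -, h4⟩ := hg z hz
      refine ⟨h4 ▸ h.iterate_mem h1.1.1 _, ?_⟩
      have hI := (hsame _ h1).1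
      have h5 := (hIuv _ h1.1).2.1 a (hI ▸ ha) b (hI ▸ hb) hab
      rwa [h4] at h5
    · intro z hz w hw
      obtain ⟨h1, h2, -, h4⟩ := hg z hz
      obtain ⟨k1, k2, k3, k4⟩ := hg w hw
      have h5 := hclose _ h1 _ k1 a ha a ha (h2.trans k2.symm)
      have h6 := hclose _ h1 _ k1 a ha b hb (h2.trans k3.symm)
      have h7 : (G^[m * T])^[b - a] w = G^[m * T * b] (g w) := by
        conv_lhs => rw [← Function.iterate_mul, ← k4, ← Function.iterate_add_apply, ← mul_add,
          Nat.sub_add_cancel hab]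
      rw [h4, k4] at h5
      rw [h4, ← h7] at h6
      have h8 : a + (b - a) = b := Nat.add_sub_cancel' hab
      simp only [add_zero, h8]
      exact ⟨h5.1, h5.2.1, h5.2.2, h6.1, h6.2.1, h6.2.2⟩
  have hfin := stepCov_of_loops (cls := fun x i => cl (G^[m * T * i] x, u x i, v x i)) h.maps
    (one_le_pow₀ hY₀) hYc he1 hC₁ (by positivity) (fun x hx => hx.1.1) hstep hloop
  refine hfin.mono subset_rfl ?_
  rw [Fintype.card_fin]
  refine mul_le_mul_of_nonneg_left ?_ (by positivity)
  have hWN : 1 ≤ W * Real.exp N :=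
    one_le_mul_of_one_le_of_one_le hW (Real.one_le_exp (Nat.cast_nonneg _))
  have hprod : ∏ i ∈ Finset.range L \ I x₀, e i ≤ ∏ i ∈ Finset.range L \ I x₀,
      W * Real.exp N * Real.exp (N * min (P x₀ i) (Q x₀ i)) := by
    refine Finset.prod_le_prod (fun i _ => zero_le_one.trans (he1 i)) fun i _ => ?_
    simp only [he]
    rw [mul_assoc, ← Real.exp_add]
    have h1 : (⌊min (P x₀ i) (Q x₀ i)⌋₊ : ℝ) ≤ min (P x₀ i) (Q x₀ i) :=
      Nat.floor_le (le_min (fwdSum_nonneg _ _) (bwdSum_nonneg _ _))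
    have h2 := mul_le_mul_of_nonneg_left h1 (Nat.cast_nonneg (α := ℝ) N)
    exact mul_le_mul_of_nonneg_left (Real.exp_le_exp.2 (by linarith)) (by linarith)
  refine hprod.trans ?_
  rw [Finset.prod_mul_distrib, Finset.prod_const, ← Real.exp_sum, ← Finset.mul_sum]
  refine mul_le_mul (pow_le_pow_right₀ hWN ?_) (Real.exp_le_exp.2
    (mul_le_mul_of_nonneg_left hsum₀ (Nat.cast_nonneg _))) (Real.exp_pos _).le (by positivity)
  exact (Finset.card_le_card Finset.sdiff_subset).trans (Finset.card_range L).le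

end Counting

section Growth

theorem eventually_mul_pow_le_exp {a : ℝ} (ha : 0 < a) (C : ℝ) (k : ℕ) :
    ∀ᶠ n : ℕ in Filter.atTop, C * ((n : ℝ) + 1) ^ k ≤ Real.exp (a * n) := by
  have hr : 1 < Real.exp a := Real.one_lt_exp_iff.2 ha
  have h1 := (Filter.tendsto_add_atTop_iff_nat 1).2 (tendsto_pow_const_div_const_pow_of_one_lt k hr)
  have hpos : 0 < 1 / ((|C| + 1) * Real.exp a) := by positivity
  filter_upwards [h1.eventually_lt_const hpos] with n hn
  have hn1 : (0:ℝ) ≤ ((n : ℝ) + 1) ^ k := by positivity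
  rw [div_lt_div_iff₀ (by positivity) (by positivity), one_mul, pow_succ] at hn
  have h2 : (|C| + 1) * ((n : ℝ) + 1) ^ k * Real.exp a < Real.exp a ^ n * Real.exp a := by
    push_cast at hn
    linarith
  have h3 := lt_of_mul_lt_mul_right h2 (Real.exp_pos a).le
  rw [mul_comm a, Real.exp_nat_mul]
  have h4 := mul_le_mul_of_nonneg_right ((le_abs_self C).trans (le_add_of_nonneg_right zero_le_one))
    hn1
  exact h4.trans h3.le

variable {N : ℕ} {M : Set (EuclideanSpace ℝ (Fin N))}
  {G G' : EuclideanSpace ℝ (Fin N) → EuclideanSpace ℝ (Fin N)} {α C B : ℝ}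

theorem HolderDiffeo.exists_growing_curve (h : HolderDiffeo M G G' α C B) (hMc : IsCompact M)
    {r ρ Kc : ℝ} (hr : 0 < r) (hρ : 0 < ρ) (hKc : 1 ≤ Kc) (hM : ∀ x ∈ M, HasChart M r ρ Kc x)
    {Γ : Set (ℝ → EuclideanSpace ℝ (Fin N))} (hΓ : IsVeryAmpleFamily M Γ) (hGM : MapsTo G M M)
    {h₁ : ℝ} (hh₁ : 0 ≤ h₁)
    (hent : (h₁ : EReal) < Dynamics.coverEntropy (MapsTo.restrict G M M hGM) univ) :
    ∃ γ ∈ Γ, ∃ c > 0, ∀ n : ℕ, ENNReal.ofReal (c * Real.exp (h₁ * n)) ≤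
        eVariationOn (G^[n] ∘ γ) (Icc 0 1) := by
  by_contra hno
  obtain ⟨h₀, h10, h0e⟩ := EReal.lt_iff_exists_real_btwn.1 hent
  replace h10 : h₁ < h₀ := by exact_mod_cast h10
  obtain ⟨δ, hδ, hnot⟩ := exists_not_cov_of_lt_coverEntropy hGM h0e
  obtain ⟨Y, hY1, hY⟩ := exists_cov_zero hMc G hδ
  obtain ⟨g, hg⟩ : ∃ g, g = (h₀ - h₁) / 2 := ⟨_, rfl⟩
  have hg0 : 0 < g := by rw [hg]; linarith
  have hlB := Real.log_nonneg h.one_le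
  obtain ⟨A, hA⟩ : ∃ A, A = Real.log B + 1 := ⟨_, rfl⟩
  have hA0 : 0 < A := by rw [hA]; linarith
  have hN1 : (0:ℝ) < N + 1 := by positivity
  obtain ⟨χ, hχ0, hχA, hχg⟩ : ∃ χ : ℝ, 0 < χ ∧ χ ≤ A ∧ χ ≤ g / (16 * (N + 1)) :=
    ⟨min A (g / (16 * (N + 1))), by positivity, min_le_left _ _, min_le_right _ _⟩
  have hα := h.pos
  obtain ⟨κ, hκ0, hκA, hκχ⟩ : ∃ κ : ℝ, 0 < κ ∧ κ ≤ A ∧ κ ≤ α * χ / 2 / (2 + 16 * A / χ) :=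
    ⟨min A (α * χ / 2 / (2 + 16 * A / χ)), by positivity, min_le_left _ _, min_le_right _ _⟩
  rw [le_div_iff₀ (by positivity)] at hκχ hχg
  obtain ⟨θ, hθ0, hθ⟩ : ∃ θ : ℝ, 0 < θ ∧ 16 * (N + 1) * ((A / κ) * θ) = g :=
    ⟨g / (16 * (N + 1) * (A / κ)), by positivity, by field_simp⟩
  have hexpo : (N:ℝ) * (2 * χ + 2 * (A / κ) * θ) ≤ g / 4 := by
    have h1 : (N:ℝ) * (2 * χ + 2 * (A / κ) * θ) ≤ (N + 1) * (2 * χ + 2 * (A / κ) * θ) :=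
      mul_le_mul_of_nonneg_right (by linarith) (by positivity)
    linarith
  obtain ⟨c₀, hc₀⟩ : ∃ c₀ : ℝ, c₀ = ((4 * √N + 6) * 2) ^ N := ⟨_, rfl⟩
  have hc₀1 : 1 ≤ c₀ := by
    rw [hc₀]
    exact one_le_pow₀ (by linarith [Real.sqrt_nonneg (N:ℝ)])
  obtain ⟨m₀, hm₀⟩ := exists_nat_ge (Real.log c₀ / (g / 8) + 1)
  have hm₀1 : 1 ≤ m₀ := by
    have : 0 ≤ Real.log c₀ / (g / 8) := div_nonneg (Real.log_nonneg hc₀1) (by linarith)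
    exact_mod_cast (show (1:ℝ) ≤ m₀ by linarith)
  have hcov := cov_of_almost_additive (V := expo M G G') (A := 2 * A) (θ := θ) (h := h₁ + g)
    (h₀ := h₀) h.maps hY1 hY (fun n x _ => expo_nonneg n)
    (fun n x hx => (h.expo_le hx n).trans
      (mul_le_mul_of_nonneg_right (by linarith) (Nat.cast_nonneg n)))
    (fun q n x hx => h.expo_mul_le hx q n) (by linarith) hθ0 (by linarith) (by linarith) hm₀1 ?_
  · obtain ⟨N₀, hN₀⟩ := hcov
    obtain ⟨n, hn, hn'⟩ := hnot N₀
    exact hn' (hN₀ n hn)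
  intro m hm q₀
  have hmpos : 0 < m := hm₀1.trans hm
  have hmR : (0:ℝ) < m := by exact_mod_cast hmpos
  have hc₀m : c₀ ≤ Real.exp (g / 8 * m) := by
    rw [← Real.log_le_iff_le_exp (by linarith)]
    have h1 : (m₀:ℝ) ≤ m := by exact_mod_cast hm
    have h2 : Real.log c₀ / (g / 8) ≤ m := by linarith
    rwa [div_le_iff₀ (by linarith), mul_comm] at h2
  obtain ⟨Q₁, hQ₁, hQ₁c⟩ := h.exists_cov_of_sum_logNorm_le hMc hr hρ hKc hM hδ m
  obtain ⟨Q₂, hQ₂, hQ₂c⟩ := h.exists_cov_of_sum_logNorm_inverse_le hMc hr hρ hKc hM hδ m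
  rw [← hc₀] at hQ₁c hQ₂c
  obtain ⟨W, hW⟩ : ∃ W, W = max Q₁ Q₂ := ⟨_, rfl⟩
  have hW1 : 1 ≤ W := by rw [hW]; exact hQ₁.trans (le_max_left _ _)
  obtain ⟨T, hT1, hTχ, hTexp⟩ : ∃ T : ℕ, 1 ≤ T ∧ Real.log 2 ≤ χ * (m * T : ℕ) ∧
      4 * (A * m + 1) * (W * Real.exp N) * ((T:ℝ) + 1) ^ 1 ≤ Real.exp (g / 8 * m * T) := by
    obtain ⟨T₁, hT₁⟩ := exists_nat_ge (Real.log 2 / χ)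
    rw [div_le_iff₀ hχ0] at hT₁
    obtain ⟨T, h1, h2, h3⟩ := ((Filter.eventually_ge_atTop 1).and
      ((Filter.eventually_ge_atTop T₁).and (eventually_mul_pow_le_exp
        (show 0 < g / 8 * m by positivity) (4 * (A * m + 1) * (W * Real.exp N)) 1))).exists
    refine ⟨T, h1, ?_, h3⟩
    have h4 : (T₁:ℝ) ≤ (m * T : ℕ) := by
      exact_mod_cast h2.trans (Nat.le_mul_of_pos_left T hmpos)
    have := mul_le_mul_of_nonneg_right h4 hχ0.le
    linarith
  have hp : 0 < m * T := Nat.mul_pos hmpos hT1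
  obtain ⟨p, hpdef⟩ : ∃ p : ℝ, p = (m * T : ℕ) := ⟨_, rfl⟩
  have hp0 : 0 < p := by rw [hpdef]; exact_mod_cast hp
  have hpmT : p = m * T := by rw [hpdef]; push_cast; ring
  have hWT : 1 ≤ W * c₀ ^ T := one_le_mul_of_one_le_of_one_le hW1 (one_le_pow₀ hc₀1)
  have hWle : ∀ Q ≤ W, ∀ s, Q * c₀ ^ T * Real.exp (N * s) ≤ W * c₀ ^ T * Real.exp (N * s) :=
    fun Q hQ s => mul_le_mul_of_nonneg_right (mul_le_mul_of_nonneg_right hQ (by positivity))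
      (Real.exp_pos _).le
  obtain ⟨Y', C₁, k, hY', hC₁, hfin⟩ := h.exists_cov_of_expo_almost_additive hMc hp hr hρ hKc hM hΓ
    (χ := χ * p) (κ := κ * p) (A := A * p) (δ := δ) (h₁ := h₁) (θ := θ) (W := W * c₀ ^ T)
    (by positivity) (mul_le_mul_of_nonneg_right hκA hp0.le) (by rwa [hpdef])
    (mul_le_mul_of_nonneg_right hχA hp0.le)
    (by
      have h1 : 2 * (κ * p) + 2 * (4 * (2 * (κ * p)) * (A * p) / (χ * p)) =
          κ * (2 + 16 * A / χ) * p := by field_simp; ring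
      rw [h1]
      exact (mul_le_mul_of_nonneg_right hκχ hp0.le).trans (le_of_eq (by ring)))
    (by
      rw [← hpdef]
      exact mul_le_mul_of_nonneg_right (by linarith) hp0.le) hδ hh₁ hθ0.le hno hWT
    (fun s => (hQ₁c T s).mono subset_rfl (hWle _ (hW ▸ le_max_left _ _) s))
    (fun s => (hQ₂c T s).mono subset_rfl (hWle _ (hW ▸ le_max_right _ _) s))
  obtain ⟨L, hLq, hLexp⟩ := ((Filter.eventually_ge_atTop q₀).and (eventually_mul_pow_le_exp
    (show 0 < g / 4 * p by positivity) (Y' * (((k:ℝ) + 1) * (Y' ^ 2 * C₁)) ^ k) k)).exists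
  refine ⟨T * L, hLq.trans (Nat.le_mul_of_pos_left L hT1), ?_⟩
  have hcast : ((m * (T * L) : ℕ) : ℝ) = p * L := by rw [hpmT]; push_cast; ring
  have hcast' : ((m * T * L : ℕ) : ℝ) = p * L := by rw [hpmT]; push_cast; ring
  have hL := hfin L
  rw [hcast', mul_assoc m T L] at hL
  rw [hcast]
  refine hL.mono subset_rfl ?_
  rw [← hpdef, mul_div_mul_right _ _ hp0.ne']
  have e1 : (4 * ((⌊A * p⌋₊ + 1 : ℕ) : ℝ)) * (W * Real.exp N) ≤ Real.exp (g / 8 * p) := by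
    have h1 : ((⌊A * p⌋₊ + 1 : ℕ) : ℝ) ≤ (A * m + 1) * (T + 1) := by
      have h2 : (⌊A * p⌋₊ : ℝ) ≤ A * p := Nat.floor_le (by positivity)
      rw [hpmT] at h2 ⊢
      have h3 : 0 ≤ A * m := by positivity
      push_cast
      linarith [(Nat.cast_nonneg T : (0:ℝ) ≤ T)]
    have h4 : 0 ≤ W * Real.exp N := mul_nonneg (by linarith) (Real.exp_pos _).le
    rw [hpmT, ← mul_assoc (g / 8), ← hpmT]
    refine le_trans ?_ hTexp
    rw [pow_one]
    have h5 := mul_le_mul_of_nonneg_right h1 h4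
    linarith
  have e2 : c₀ ^ T ≤ Real.exp (g / 8 * p) := by
    refine (pow_le_pow_left₀ (by linarith) hc₀m T).trans (le_of_eq ?_)
    rw [← Real.exp_nat_mul, hpmT]
    congr 1
    ring
  have e3 : Y' * (((k * L + 1 : ℕ) : ℝ) * (Y' ^ 2 * C₁)) ^ k ≤ Real.exp (g / 4 * p * L) := by
    refine le_trans ?_ hLexp
    rw [mul_assoc, ← mul_pow]
    have h1 : ((k * L + 1 : ℕ) : ℝ) ≤ (k + 1) * (L + 1) := by
      push_cast
      linarith [(Nat.cast_nonneg k : (0:ℝ) ≤ k), (Nat.cast_nonneg L : (0:ℝ) ≤ L)]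
    have h2 : 0 ≤ Y' ^ 2 * C₁ := by positivity
    have h3 := mul_le_mul_of_nonneg_right h1 h2
    exact mul_le_mul_of_nonneg_left (pow_le_pow_left₀ (by positivity) (by linarith) k)
      (by linarith)
  have e4 : Real.exp (N * (2 * (χ * p) * L + 2 * (A / κ) * (θ * (p * L)))) ≤
      Real.exp (g / 4 * p * L) := by
    refine Real.exp_le_exp.2 ?_
    have h1 := mul_le_mul_of_nonneg_right hexpo (show 0 ≤ p * L by positivity)
    linarith
  calc (4 * ((⌊A * p⌋₊ + 1 : ℕ) : ℝ)) ^ L * (Y' * (((k * L + 1 : ℕ) : ℝ) * (Y' ^ 2 * C₁)) ^ k *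
        Real.exp (h₁ * p * L) * ((W * c₀ ^ T * Real.exp N) ^ L *
          Real.exp (N * (2 * (χ * p) * L + 2 * (A / κ) * (θ * (p * L))))))
      = ((4 * ((⌊A * p⌋₊ + 1 : ℕ) : ℝ)) * (W * Real.exp N)) ^ L * (c₀ ^ T) ^ L *
        (Y' * (((k * L + 1 : ℕ) : ℝ) * (Y' ^ 2 * C₁)) ^ k) * Real.exp (h₁ * p * L) *
          Real.exp (N * (2 * (χ * p) * L + 2 * (A / κ) * (θ * (p * L)))) := by
        simp only [mul_pow]; ring
    _ ≤ Real.exp (g / 8 * p) ^ L * Real.exp (g / 8 * p) ^ L * Real.exp (g / 4 * p * L) *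
        Real.exp (h₁ * p * L) * Real.exp (g / 4 * p * L) := by
        have hW0 : 0 ≤ W := by linarith
        have hc0 : 0 ≤ c₀ := by linarith
        have hY0 : 0 ≤ Y' := by linarith
        have hC0 : 0 ≤ C₁ := by linarith
        refine mul_le_mul ?_ e4 (Real.exp_pos _).le (by positivity)
        refine mul_le_mul_of_nonneg_right ?_ (Real.exp_pos _).le
        refine mul_le_mul ?_ e3 (by positivity) (by positivity)
        exact mul_le_mul (pow_le_pow_left₀ (by positivity) e1 L)
          (pow_le_pow_left₀ (by positivity) e2 L) (by positivity) (by positivity)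
    _ ≤ Real.exp ((h₁ + g) * (p * L)) := by
        rw [← Real.exp_nat_mul, ← Real.exp_add, ← Real.exp_add, ← Real.exp_add, ← Real.exp_add]
        refine Real.exp_le_exp.2 ?_
        have : 0 ≤ g * (p * L) := by positivity
        linarith

end Growth

section Liminf

theorem le_liminf_log_div_of_exp_le {ℓ : ℕ → ℝ≥0∞} {c b h : ℝ} (hc : 0 < c) (hb : b < h)
    (hℓ : ∀ n : ℕ, ENNReal.ofReal (c * Real.exp (h * n)) ≤ ℓ n) :
    (b : EReal) ≤ Filter.liminf (fun n : ℕ => ENNReal.log (ℓ n) / (n : EReal)) Filter.atTop := by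
  obtain ⟨n₀, hn₀⟩ := exists_nat_ge (-Real.log c / (h - b))
  rw [div_le_iff₀ (by linarith)] at hn₀
  refine Filter.le_liminf_of_le (by isBoundedDefault) ?_
  filter_upwards [Filter.eventually_ge_atTop (n₀ + 1)] with n hn
  have hn1 : (n₀ : ℝ) ≤ n := by exact_mod_cast (Nat.le_succ _).trans hn
  rw [EReal.le_div_iff_mul_le (by exact_mod_cast (Nat.succ_pos _).trans_le hn)
    (EReal.natCast_ne_top n)]
  refine le_trans ?_ (ENNReal.log_le_log (hℓ n))
  rw [ENNReal.log_ofReal_of_pos (by positivity), Real.log_mul hc.ne' (Real.exp_pos _).ne',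
    Real.log_exp]
  have h1 := mul_le_mul_of_nonneg_right hn1 (sub_nonneg.2 hb.le)
  have h2 : b * (n : ℝ) ≤ Real.log c + h * n := by linarith
  exact_mod_cast h2

end Liminf

theorem exponential_length_growth_of_very_ample_family
    {N : ℕ} (M : Set (EuclideanSpace ℝ (Fin N)))
    (hMcpt : IsCompact M) (hMsub : IsSmoothSubmanifold 2 M)
    (G G' : EuclideanSpace ℝ (Fin N) → EuclideanSpace ℝ (Fin N))
    (hGM : MapsTo G M M) (hG'M : MapsTo G' M M)
    (hGinv : ∀ x ∈ M, G' (G x) = x) (hGinv' : ∀ x ∈ M, G (G' x) = x)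
    (hG1 : ContDiff ℝ 1 G) (hG'1 : ContDiff ℝ 1 G')
    (ε : ℝ≥0) (hε : 0 < ε) (Cg Cg' : ℝ≥0)
    (hGHolder : HolderOnWith Cg ε (fderiv ℝ G) M)
    (hG'Holder : HolderOnWith Cg' ε (fderiv ℝ G') M)
    (hent : 0 < Dynamics.coverEntropy (MapsTo.restrict G M M hGM) Set.univ)
    (Γ : Set (ℝ → EuclideanSpace ℝ (Fin N))) (hΓ : IsVeryAmpleFamily M Γ) :
    (∀ lam : ℝ, 1 ≤ lam →
      (Real.log lam : EReal) < Dynamics.coverEntropy (MapsTo.restrict G M M hGM) Set.univ →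
      ∃ γ ∈ Γ, ∃ C : ℝ, 0 < C ∧
        ∀ n : ℕ, ENNReal.ofReal (C * lam ^ n) ≤ eVariationOn (G^[n] ∘ γ) (Icc (0 : ℝ) 1)) ∧
    Dynamics.coverEntropy (MapsTo.restrict G M M hGM) Set.univ ≤
      ⨆ γ ∈ Γ, Filter.liminf
        (fun n : ℕ => ENNReal.log (eVariationOn (G^[n] ∘ γ) (Icc (0 : ℝ) 1)) / (n : EReal))
        Filter.atTop := by
  obtain ⟨α, C, B, h⟩ := HolderDiffeo.of_contDiff hMcpt hGM hG'M hGinv hGinv' hG1 hG'1 hε hGHolder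
    hG'Holder
  obtain ⟨r, hr, ρ, hρ, K, hK, hM⟩ := exists_uniform_hasChart hMcpt hMsub
  refine ⟨fun lam hlam hlt => ?_, le_of_forall_lt fun a ha => ?_⟩
  · obtain ⟨γ, hγ, c, hc, hgrow⟩ :=
      h.exists_growing_curve hMcpt hr hρ hK hM hΓ hGM (Real.log_nonneg hlam) hlt
    refine ⟨γ, hγ, c, hc, fun n => ?_⟩
    have h1 := hgrow n
    rwa [mul_comm (Real.log lam), Real.exp_nat_mul, Real.exp_log (zero_lt_one.trans_le hlam)] at h1
  · obtain ⟨b, hab, hb⟩ := EReal.lt_iff_exists_real_btwn.1 (max_lt ha hent)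
    obtain ⟨h₁, hbh, hh₁⟩ := EReal.lt_iff_exists_real_btwn.1 hb
    have hb0 : 0 < b := by exact_mod_cast (le_max_right a 0).trans_lt hab
    have hbh' : b < h₁ := by exact_mod_cast hbh
    obtain ⟨γ, hγ, c, hc, hgrow⟩ :=
      h.exists_growing_curve hMcpt hr hρ hK hM hΓ hGM (hb0.trans hbh').le hh₁
    exact ((le_max_left a 0).trans_lt hab).trans_le
      ((le_liminf_log_div_of_exp_le hc hbh' hgrow).trans (le_iSup₂_of_le γ hγ le_rfl))

end
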